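/- Let ε > 0 be arbitrary. There exists x₀ = x₀(ε) such that for every x > x₀ the interval [x, x + x^ε] contains an even number which can be written as the difference of two primes. -/

import Mathlib

/-- A natural number `m` is a Maillet number if it is the difference of two primes. -/
def IsMaillet (m : ℕ) : Prop :=
  ∃ p q : ℕ, p.Prime ∧ q.Prime ∧ (m : ℤ) = (p : ℤ) - (q : ℤ)

set_option linter.unusedSectionVars false

/-- Comparison of two families of quadratic forms, given in factored form, passes to tensor
products. -/
theorem tensor_form_le {τ α : Type} [hτ : Fintype τ] [DecidableEq τ] [Fintype α]
    {Ω Ω' : τ → Type} [∀ p, Fintype (Ω p)] [∀ p, Fintype (Ω' p)]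
    (μ : ∀ p, Ω p → ℝ) (μ' : ∀ p, Ω' p → ℝ)
    (u : ∀ p, α → Ω p → ℝ) (u' : ∀ p, α → Ω' p → ℝ)
    (hμ : ∀ p x, 0 ≤ μ p x) (hμ' : ∀ p x, 0 ≤ μ' p x)
    (h : ∀ p (f : α → ℝ), ∑ x, μ p x * (∑ a, f a * u p a x) ^ 2 ≤
      ∑ y, μ' p y * (∑ a, f a * u' p a y) ^ 2) (c : (τ → α) → ℝ) :
    ∑ x : (∀ p, Ω p), (∏ p, μ p (x p)) * (∑ U : τ → α, c U * ∏ p, u p (U p) (x p)) ^ 2 ≤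
      ∑ y : (∀ p, Ω' p), (∏ p, μ' p (y p)) *
        (∑ U : τ → α, c U * ∏ p, u' p (U p) (y p)) ^ 2 := by
  classical
  revert Ω Ω' c
  suffices H : ∀ (τ : Type) [hτ : Fintype τ] [DecidableEq τ],
      ∀ {Ω Ω' : τ → Type} [∀ p, Fintype (Ω p)] [∀ p, Fintype (Ω' p)]
      (μ : ∀ p, Ω p → ℝ) (μ' : ∀ p, Ω' p → ℝ)
      (u : ∀ p, α → Ω p → ℝ) (u' : ∀ p, α → Ω' p → ℝ)
      (_ : ∀ p x, 0 ≤ μ p x) (_ : ∀ p x, 0 ≤ μ' p x)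
      (_ : ∀ p (f : α → ℝ), ∑ x, μ p x * (∑ a, f a * u p a x) ^ 2 ≤
        ∑ y, μ' p y * (∑ a, f a * u' p a y) ^ 2) (c : (τ → α) → ℝ),
      ∑ x : (∀ p, Ω p), (∏ p, μ p (x p)) * (∑ U : τ → α, c U * ∏ p, u p (U p) (x p)) ^ 2 ≤
      ∑ y : (∀ p, Ω' p), (∏ p, μ' p (y p)) *
        (∑ U : τ → α, c U * ∏ p, u' p (U p) (y p)) ^ 2 by
    intro Ω Ω' _ _ μ μ' u u' hμ hμ' h c
    exact H τ μ μ' u u' hμ hμ' h c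
  intro τ hτ hd
  refine @Fintype.induction_empty_option (fun τ hτ => ∀ [DecidableEq τ]
      {Ω Ω' : τ → Type} [∀ p, Fintype (Ω p)] [∀ p, Fintype (Ω' p)]
      (μ : ∀ p, Ω p → ℝ) (μ' : ∀ p, Ω' p → ℝ)
      (u : ∀ p, α → Ω p → ℝ) (u' : ∀ p, α → Ω' p → ℝ)
      (_ : ∀ p x, 0 ≤ μ p x) (_ : ∀ p x, 0 ≤ μ' p x)
      (_ : ∀ p (f : α → ℝ), ∑ x, μ p x * (∑ a, f a * u p a x) ^ 2 ≤
        ∑ y, μ' p y * (∑ a, f a * u' p a y) ^ 2) (c : (τ → α) → ℝ),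
      ∑ x : (∀ p, Ω p), (∏ p, μ p (x p)) * (∑ U : τ → α, c U * ∏ p, u p (U p) (x p)) ^ 2 ≤
      ∑ y : (∀ p, Ω' p), (∏ p, μ' p (y p)) *
        (∑ U : τ → α, c U * ∏ p, u' p (U p) (y p)) ^ 2) ?_ ?_ ?_ τ hτ hd
  · intro τ₁ τ₂ _ e ih hd₂ Ω Ω' _ _ μ μ' u u' hμ hμ' h c
    let := Fintype.ofEquiv τ₂ e.symm
    have key := @ih (fun a b => Classical.dec _) (fun p => Ω (e p)) (fun p => Ω' (e p)) _ _ (fun p => μ (e p))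
      (fun p => μ' (e p)) (fun p => u (e p)) (fun p => u' (e p)) (fun p => hμ _)
      (fun p => hμ' _) (fun p => h _) (fun U => c (fun p => U (e.symm p)))
    have hU : ∀ (F : (τ₂ → α) → ℝ), ∑ U : τ₂ → α, F U =
        ∑ U : τ₁ → α, F (fun p => U (e.symm p)) := fun F =>
      (Fintype.sum_equiv (Equiv.arrowCongr e (Equiv.refl α)) _ _ (fun U => by
        rfl)).symm
    have tr : ∀ (Ω : τ₂ → Type) [∀ p, Fintype (Ω p)] (μ : ∀ p, Ω p → ℝ)
        (u : ∀ p, α → Ω p → ℝ),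
        ∑ x : (∀ p, Ω p), (∏ p, μ p (x p)) *
          (∑ U : τ₂ → α, c U * ∏ p, u p (U p) (x p)) ^ 2 =
        ∑ x : (∀ p, Ω (e p)), (∏ p, μ (e p) (x p)) *
          (∑ U : τ₁ → α, c (fun p => U (e.symm p)) * ∏ p, u (e p) (U p) (x p)) ^ 2 := by
      intro Ω _ μ u
      symm
      refine Fintype.sum_equiv (Equiv.piCongrLeft Ω e) _ _ fun x => ?_
      have hx : ∀ p, (Equiv.piCongrLeft Ω e) x (e p) = x p := fun p =>
        Equiv.piCongrLeft_apply_apply Ω e x p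
      rw [hU]
      congr 1
      · rw [← Equiv.prod_comp e (fun p => μ p ((Equiv.piCongrLeft Ω e) x p))]
        exact Finset.prod_congr rfl fun p _ => by rw [hx]
      · congr 1
        refine Finset.sum_congr rfl fun U _ => ?_
        congr 1
        rw [← Equiv.prod_comp e (fun p => u p (U (e.symm p)) ((Equiv.piCongrLeft Ω e) x p))]
        exact Finset.prod_congr rfl fun p _ => by rw [hx]; simp
    have k1 := tr Ω μ u
    have k2 := tr Ω' μ' u'
    calc _ = _ := by convert k1
      _ ≤ _ := by convert key
      _ = _ := by convert k2.symm
  · intro _ Ω Ω' _ _ μ μ' u u' hμ hμ' h c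
    simp
  · intro τ _ ih hd' Ω Ω' _ _ μ μ' u u' hμ hμ' h c
    have hU : ∀ (F : (Option τ → α) → ℝ), ∑ U : Option τ → α, F U =
        ∑ a : α, ∑ U : τ → α, F ((Equiv.piOptionEquivProd (β := fun _ => α)).symm (a, U)) := by
      intro F
      rw [← Fintype.sum_prod_type' (f := fun a U =>
        F ((Equiv.piOptionEquivProd (β := fun _ => α)).symm (a, U)))]
      exact (Fintype.sum_equiv (Equiv.piOptionEquivProd (β := fun _ => α)).symm _ _
        fun _ => rfl).symm
    have tr : ∀ (Ω : Option τ → Type) [∀ p, Fintype (Ω p)] (μ : ∀ p, Ω p → ℝ)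
        (u : ∀ p, α → Ω p → ℝ),
        ∑ x : (∀ p, Ω p), (∏ p, μ p (x p)) *
          (∑ U : Option τ → α, c U * ∏ p, u p (U p) (x p)) ^ 2 =
        ∑ x₀ : Ω none, ∑ x : (∀ p : τ, Ω (some p)), μ none x₀ * ((∏ p, μ (some p) (x p)) *
          (∑ a : α, ∑ U : τ → α,
            c ((Equiv.piOptionEquivProd (β := fun _ => α)).symm (a, U)) * (u none a x₀ *
              ∏ p, u (some p) (U p) (x p))) ^ 2) := by
      intro Ω _ μ u
      rw [← Fintype.sum_prod_type' (f := fun (x₀ : Ω none) (x : ∀ p : τ, Ω (some p)) => μ none x₀ * ((∏ p, μ (some p) (x p)) *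
          (∑ a : α, ∑ U : τ → α,
            c ((Equiv.piOptionEquivProd (β := fun _ => α)).symm (a, U)) * (u none a x₀ *
              ∏ p, u (some p) (U p) (x p))) ^ 2))]
      refine Fintype.sum_equiv (Equiv.piOptionEquivProd (β := Ω)) _ _ fun x => ?_
      rw [hU]
      simp only [Fintype.prod_option, Equiv.piOptionEquivProd]
      simp [mul_assoc]
    rw [tr, tr]
    calc _ ≤ ∑ y₀ : Ω' none, ∑ x : (∀ p : τ, Ω (some p)), μ' none y₀ *
          ((∏ p, μ (some p) (x p)) *
          (∑ a : α, ∑ U : τ → α,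
            c ((Equiv.piOptionEquivProd (β := fun _ => α)).symm (a, U)) * (u' none a y₀ *
              ∏ p, u (some p) (U p) (x p))) ^ 2) := by
          rw [Finset.sum_comm, Finset.sum_comm (s := (Finset.univ : Finset (Ω' none)))]
          refine Finset.sum_le_sum fun x _ => ?_
          have := h none (fun a => ∑ U : τ → α,
            c ((Equiv.piOptionEquivProd (β := fun _ => α)).symm (a, U)) *
              ∏ p, u (some p) (U p) (x p))
          have h2 := mul_le_mul_of_nonneg_left this
            (Finset.prod_nonneg fun p (_ : p ∈ Finset.univ) => hμ (some p) (x p))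
          simp only [Finset.mul_sum, Finset.sum_mul] at h2
          convert h2 using 2 with i _ i _
          · rw [mul_left_comm]; congr 3
            exact Finset.sum_congr rfl fun a _ => Finset.sum_congr rfl fun U _ => by ring
          · rw [mul_left_comm]; congr 3
            exact Finset.sum_congr rfl fun a _ => Finset.sum_congr rfl fun U _ => by ring
      _ ≤ _ := by
          refine Finset.sum_le_sum fun y _ => ?_
          rw [← Finset.mul_sum, ← Finset.mul_sum]
          refine mul_le_mul_of_nonneg_left ?_ (hμ' _ _)
          have := ih (Ω := fun p => Ω (some p)) (Ω' := fun p => Ω' (some p))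
            (fun p => μ (some p)) (fun p => μ' (some p)) (fun p => u (some p))
            (fun p => u' (some p)) (fun p => hμ _) (fun p => hμ' _) (fun p => h _)
            (fun U => ∑ a, c ((Equiv.piOptionEquivProd (β := fun _ => α)).symm (a, U)) *
              u' none a y)
          have e : ∀ g : (τ → α) → ℝ, ∑ U : τ → α, (∑ a,
              c ((Equiv.piOptionEquivProd (β := fun _ => α)).symm (a, U)) * u' none a y) * g U =
              ∑ a : α, ∑ U : τ → α, c ((Equiv.piOptionEquivProd (β := fun _ => α)).symm (a, U)) *
                (u' none a y * g U) := by
            intro g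
            rw [Finset.sum_comm]
            simp only [Finset.sum_mul, mul_assoc]
          simp only [e] at this
          exact this

/-- The centred indicator functions of the residues `r i` used as local sieve weights. -/
noncomputable def locW {Ω ι : Type} [DecidableEq Ω] (p : ℕ) (r : ι → Ω) : Option ι → Ω → ℝ
  | none, _ => 1
  | some i, x => (if x = r i then 1 else 0) - ((p : ℝ) - 1)⁻¹

section Local

variable {Ω ι : Type} [Fintype Ω] [DecidableEq Ω]

theorem sum_indicator_comb (r : ι → Ω) (s : Finset ι) (g : ι → ℝ) :
    ∑ x, ∑ i ∈ s, g i * (if x = r i then 1 else 0) = ∑ i ∈ s, g i := by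
  rw [Finset.sum_comm]
  refine Finset.sum_congr rfl fun i _ => ?_
  simp

theorem sum_indicator_comb_sq (r : ι → Ω) (hr : Function.Injective r) [DecidableEq ι] (s : Finset ι) (g : ι → ℝ) :
    ∑ x, (∑ i ∈ s, g i * (if x = r i then 1 else 0)) ^ 2 = ∑ i ∈ s, g i ^ 2 := by
  have h : ∀ x, (∑ i ∈ s, g i * (if x = r i then (1 : ℝ) else 0)) ^ 2 =
      ∑ i ∈ s, g i ^ 2 * (if x = r i then 1 else 0) := by
    intro x
    by_cases hx : ∃ j ∈ s, x = r j
    · obtain ⟨j, hj, rfl⟩ := hx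
      simp [hr.eq_iff, hj]
    · push Not at hx
      rw [Finset.sum_eq_zero fun i hi => by simp [hx i hi],
        Finset.sum_eq_zero fun i hi => by simp [hx i hi]]
      simp
  simp_rw [h]
  exact sum_indicator_comb r s _

theorem loc_abs_sum_le {p : ℕ} (hp : 3 ≤ p) (hc : Fintype.card Ω = p) (r : ι → Ω)
    (a b : Option ι) (hab : a ≠ none ∨ b ≠ none) :
    ∑ x, |locW p r a x * locW p r b x| ≤ 2 := by
  have hp' : (3 : ℝ) ≤ p := by exact_mod_cast hp
  have hq0 : 0 ≤ ((p : ℝ) - 1)⁻¹ := inv_nonneg.2 (by linarith)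
  have hq1 : ((p : ℝ) - 1)⁻¹ ≤ 1 := inv_le_one_of_one_le₀ (by linarith)
  have hle1 : ∀ (a : Option ι) x, |locW p r a x| ≤ 1 := by
    rintro (_ | i) x
    · simp [locW]
    · simp only [locW]; split_ifs <;> rw [abs_le] <;> constructor <;> linarith
  have hsum : ∀ i : ι, ∑ x, |locW p r (some i) x| ≤ 2 := by
    intro i
    calc ∑ x, |locW p r (some i) x| ≤ ∑ x : Ω, ((if x = r i then 1 - 2 * ((p : ℝ) - 1)⁻¹ else 0) +
          ((p : ℝ) - 1)⁻¹) := by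
          refine Finset.sum_le_sum fun x _ => ?_
          simp only [locW]; split_ifs
          · rw [abs_le]; constructor <;> linarith
          · rw [abs_le]; constructor <;> linarith
      _ = 1 - 2 * ((p : ℝ) - 1)⁻¹ + p * ((p : ℝ) - 1)⁻¹ := by
          rw [Finset.sum_add_distrib]; simp [hc]
      _ ≤ 2 := by
          have : ((p : ℝ) - 1) * ((p : ℝ) - 1)⁻¹ = 1 := mul_inv_cancel₀ (by linarith)
          linarith
  simp only [abs_mul]
  rcases a with _ | i
  · rcases b with _ | j
    · simp at hab
    · refine (Finset.sum_le_sum fun x _ => ?_).trans (hsum j)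
      exact mul_le_of_le_one_left (abs_nonneg _) (hle1 _ _)
  · refine (Finset.sum_le_sum fun x _ => ?_).trans (hsum i)
    exact mul_le_of_le_one_right (abs_nonneg _) (hle1 _ _)

variable [Fintype ι] [DecidableEq ι]

theorem loc_upper {p : ℕ} (hp : 3 ≤ p) (hc : Fintype.card Ω = p) (r : ι → Ω)
    (hr : Function.Injective r) (f : Option ι → ℝ) :
    ∑ x, (p : ℝ)⁻¹ * (∑ a, f a * locW p r a x) ^ 2 ≤
      (1 + ((p : ℝ) * (p - 2))⁻¹) * f none ^ 2 + ∑ i, f (some i) ^ 2 * (p : ℝ)⁻¹ := by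
  have hp' : (3 : ℝ) ≤ p := by exact_mod_cast hp
  set s := ∑ i, f (some i) with hs
  set t := f none - s * ((p : ℝ) - 1)⁻¹ with ht
  have e : ∀ x, ∑ a, f a * locW p r a x =
      t + ∑ i, f (some i) * (if x = r i then 1 else 0) := by
    intro x
    rw [Fintype.sum_option]
    simp only [locW, mul_sub, Finset.sum_sub_distrib, ← Finset.sum_mul, mul_one, ht, ← hs]
    ring
  have e2 : ∑ x, (∑ a, f a * locW p r a x) ^ 2 = p * t ^ 2 + 2 * t * s + ∑ i, f (some i) ^ 2 := by
    simp_rw [e, add_sq, Finset.sum_add_distrib, ← Finset.mul_sum]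
    rw [sum_indicator_comb r Finset.univ (fun i => f (some i)),
      sum_indicator_comb_sq r hr Finset.univ (fun i => f (some i))]
    simp [hc, hs]
  rw [← Finset.mul_sum, e2, ← Finset.sum_mul]
  have key : (1 + ((p : ℝ) * (p - 2))⁻¹) * f none ^ 2 - (p : ℝ)⁻¹ * (p * t ^ 2 + 2 * t * s) =
      (((p : ℝ) * (p - 2)))⁻¹ * (f none + s * (p - 2) * ((p : ℝ) - 1)⁻¹) ^ 2 := by
    have h1 : (p : ℝ) - 1 ≠ 0 := by linarith
    have h2 : (p : ℝ) - 2 ≠ 0 := by linarith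
    have h3 : (p : ℝ) ≠ 0 := by linarith
    rw [ht]; field_simp; ring
  have : 0 ≤ (((p : ℝ) * (p - 2)))⁻¹ * (f none + s * (p - 2) * ((p : ℝ) - 1)⁻¹) ^ 2 := by
    have : (0 : ℝ) ≤ p - 2 := by linarith
    positivity
  nlinarith

theorem loc_lower {p : ℕ} (hp : 3 ≤ p) (hc : Fintype.card Ω = p) (r : ι → Ω)
    (hr : Function.Injective r) (m : ι) (f : Option ι → ℝ) :
    (f none - f (some m) * ((p : ℝ) - 1)⁻¹) ^ 2 + ∑ i ∈ Finset.univ.erase m,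
        f (some i) ^ 2 * ((1 - Fintype.card ι * ((p : ℝ) - 1)⁻¹) * ((p : ℝ) - 1)⁻¹) ≤
    ∑ x, (if x = r m then 0 else ((p : ℝ) - 1)⁻¹) * (∑ a, f a * locW p r a x) ^ 2 := by
  have hp' : (3 : ℝ) ≤ p := by exact_mod_cast hp
  have h1 : (p : ℝ) - 1 ≠ 0 := by linarith
  set q := ((p : ℝ) - 1)⁻¹ with hq
  have hq0 : 0 ≤ q := inv_nonneg.2 (by linarith)
  set s := ∑ i ∈ Finset.univ.erase m, f (some i) with hs
  set t := f none - f (some m) * q - s * q with ht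
  set G : Ω → ℝ := fun x => ∑ i ∈ Finset.univ.erase m, f (some i) * (if x = r i then 1 else 0)
    with hG
  have e : ∀ x, x ≠ r m → ∑ a, f a * locW p r a x = t + G x := by
    intro x hx
    rw [Fintype.sum_option, ← Finset.add_sum_erase _ _ (Finset.mem_univ m)]
    simp only [locW, mul_sub, Finset.sum_sub_distrib, ← Finset.sum_mul, mul_one, ht, ← hs, hG,
      if_neg hx, ← hq]
    ring
  have hGm : G (r m) = 0 := by
    refine Finset.sum_eq_zero fun i hi => ?_
    rw [if_neg fun h => (Finset.ne_of_mem_erase hi) (hr h.symm)]; simp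
  have e2 : ∑ x, (if x = r m then 0 else q) * (∑ a, f a * locW p r a x) ^ 2 =
      q * (((p : ℝ) - 1) * t ^ 2 + 2 * t * s + ∑ i ∈ Finset.univ.erase m, f (some i) ^ 2) := by
    have e3 : ∀ x, (if x = r m then 0 else q) * (∑ a, f a * locW p r a x) ^ 2 =
        q * (t + G x) ^ 2 - q * (if x = r m then t ^ 2 else 0) := by
      intro x
      by_cases hx : x = r m
      · simp [hx, hGm]
      · simp [hx, e x hx]
    simp_rw [e3, Finset.sum_sub_distrib, add_sq, ← Finset.mul_sum, Finset.sum_add_distrib,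
      ← Finset.mul_sum]
    rw [sum_indicator_comb r _ (fun i => f (some i)),
      sum_indicator_comb_sq r hr _ (fun i => f (some i))]
    simp [hc, hs]
    ring
  rw [e2, ← Finset.sum_mul]
  have cs : s ^ 2 ≤ Fintype.card ι * ∑ i ∈ Finset.univ.erase m, f (some i) ^ 2 := by
    calc s ^ 2 ≤ ((Finset.univ.erase m).card : ℝ) * ∑ i ∈ Finset.univ.erase m, f (some i) ^ 2 :=
          sq_sum_le_card_mul_sum_sq
      _ ≤ _ := by
          gcongr
          exact Finset.card_le_univ _
  have hqp : q * ((p : ℝ) - 1) = 1 := inv_mul_cancel₀ h1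
  have : q * (((p : ℝ) - 1) * t ^ 2 + 2 * t * s + ∑ i ∈ Finset.univ.erase m, f (some i) ^ 2) =
      (f none - f (some m) * q) ^ 2 - q ^ 2 * s ^ 2 +
        q * ∑ i ∈ Finset.univ.erase m, f (some i) ^ 2 := by
    rw [mul_add, mul_add, ← mul_assoc, hqp, ht]; ring
  rw [this]
  nlinarith [mul_le_mul_of_nonneg_left cs (sq_nonneg q)]

end Local

section Moment

variable {τ ι : Type} [Fintype τ] [DecidableEq τ]
  {Ω : τ → Type} [∀ p, Fintype (Ω p)] [∀ p, DecidableEq (Ω p)]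

/-- The set of indices where at least one of two colourings is nontrivial. -/
def colSupp [DecidableEq ι] (U V : τ → Option ι) : Finset τ :=
  Finset.univ.filter fun p => U p ≠ none ∨ V p ≠ none

theorem pair_moment [DecidableEq ι] (pr : τ → ℕ) (hpr : ∀ p, 3 ≤ pr p)
    (hc : ∀ p, Fintype.card (Ω p) = pr p)
    (π : ∀ p, ℕ → Ω p) (r : ∀ p, ι → Ω p) (I : Finset ℕ) (w : ℕ → ℝ) (X : ℝ)
    (ν : ∀ p, Ω p → ℝ) (hν : ∀ p, ∑ x, ν p x = 1) (E : Finset τ → ℝ)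
    (hE : ∀ (A : Finset τ) (a : ∀ p, Ω p), |∑ n ∈ I, w n * (if ∀ p ∈ A, π p n = a p then 1 else 0) -
      X * ∏ p ∈ A, ν p (a p)| ≤ E A) (U V : τ → Option ι) :
    |∑ n ∈ I, w n * ∏ p, (locW (pr p) (r p) (U p) (π p n) * locW (pr p) (r p) (V p) (π p n)) -
      X * ∑ x : (∀ p, Ω p), ∏ p, (ν p (x p) *
        (locW (pr p) (r p) (U p) (x p) * locW (pr p) (r p) (V p) (x p)))| ≤
      2 ^ (colSupp U V).card * E (colSupp U V) := by
  set A := colSupp U V with hA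
  set φ : ∀ p, Ω p → ℝ := fun p x => locW (pr p) (r p) (U p) x * locW (pr p) (r p) (V p) x with hφ
  have hφ1 : ∀ p, p ∉ A → ∀ x, φ p x = 1 := by
    intro p hp x
    simp only [hA, colSupp, Finset.mem_filter, Finset.mem_univ, true_and, not_or, not_not] at hp
    simp [hφ, hp.1, hp.2, locW]
  let t : ∀ p, Finset (Ω p) := fun p => if p ∈ A then Finset.univ else {π p 0}
  have claim1 : ∀ n, ∏ p, φ p (π p n) = ∑ x ∈ Fintype.piFinset t,
      (∏ p ∈ A, φ p (x p)) * (if ∀ p ∈ A, π p n = x p then 1 else 0) := by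
    intro n
    rw [Finset.sum_eq_single (fun p => if p ∈ A then π p n else π p 0)]
    · rw [if_pos (fun p hp => by simp [hp]), mul_one]
      rw [← Finset.prod_subset (Finset.subset_univ A) fun p _ hp => hφ1 p hp _]
      exact Finset.prod_congr rfl fun p hp => by simp [hp]
    · intro x hx hne
      rw [if_neg, mul_zero]
      intro hxx
      apply hne
      funext p
      by_cases hp : p ∈ A
      · simp [hp, hxx p hp]
      · have := Fintype.mem_piFinset.1 hx p
        simpa [t, hp] using this
    · intro hx
      exfalso
      apply hx
      rw [Fintype.mem_piFinset]
      intro p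
      by_cases hp : p ∈ A <;> simp [t, hp]
  have gen : ∀ ψ : ∀ p, Ω p → ℝ, ∑ x ∈ Fintype.piFinset t, ∏ p ∈ A, ψ p (x p) =
      ∏ p, if p ∈ A then ∑ x, ψ p x else 1 := by
    intro ψ
    have : ∀ x : (∀ p, Ω p), ∏ p ∈ A, ψ p (x p) = ∏ p, if p ∈ A then ψ p (x p) else 1 := by
      intro x
      rw [Finset.prod_ite_mem, Finset.univ_inter]
    simp_rw [this]
    rw [← Finset.prod_univ_sum t (fun p x => if p ∈ A then ψ p x else 1)]
    refine Finset.prod_congr rfl fun p _ => ?_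
    by_cases hp : p ∈ A <;> simp [t, hp]
  have claim2 : ∑ x : (∀ p, Ω p), ∏ p, (ν p (x p) * φ p (x p)) =
      ∑ x ∈ Fintype.piFinset t, ∏ p ∈ A, (ν p (x p) * φ p (x p)) := by
    rw [gen (fun p x => ν p x * φ p x), ← Fintype.piFinset_univ,
      ← Finset.prod_univ_sum (fun p => (Finset.univ : Finset (Ω p))) (fun p x => ν p x * φ p x)]
    refine Finset.prod_congr rfl fun p _ => ?_
    split_ifs with hp
    · rfl
    · simp [hφ1 p hp, hν]
  have e : ∑ n ∈ I, w n * ∏ p, φ p (π p n) - X * ∑ x : (∀ p, Ω p), ∏ p, (ν p (x p) * φ p (x p)) =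
      ∑ x ∈ Fintype.piFinset t, (∏ p ∈ A, φ p (x p)) *
        (∑ n ∈ I, w n * (if ∀ p ∈ A, π p n = x p then 1 else 0) - X * ∏ p ∈ A, ν p (x p)) := by
    simp_rw [claim2, claim1, mul_sub, Finset.sum_sub_distrib, Finset.mul_sum]
    congr 1
    · rw [Finset.sum_comm]
      exact Finset.sum_congr rfl fun x _ => Finset.sum_congr rfl fun n _ => by ring
    · refine Finset.sum_congr rfl fun x _ => ?_
      rw [Finset.prod_mul_distrib]; ring
  have hE0 : 0 ≤ E A := (abs_nonneg _).trans (hE A fun p => π p 0)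
  calc _ = |∑ x ∈ Fintype.piFinset t, (∏ p ∈ A, φ p (x p)) *
        (∑ n ∈ I, w n * (if ∀ p ∈ A, π p n = x p then 1 else 0) - X * ∏ p ∈ A, ν p (x p))| := by
        rw [← e]
    _ ≤ ∑ x ∈ Fintype.piFinset t, (∏ p ∈ A, |φ p (x p)|) * E A := by
        refine (Finset.abs_sum_le_sum_abs _ _).trans (Finset.sum_le_sum fun x _ => ?_)
        rw [abs_mul, Finset.abs_prod]
        exact mul_le_mul_of_nonneg_left (hE A x) (Finset.prod_nonneg fun _ _ => abs_nonneg _)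
    _ = (∏ p, if p ∈ A then ∑ x, |φ p x| else 1) * E A := by
        rw [← Finset.sum_mul, gen (fun p x => |φ p x|)]
    _ ≤ (∏ p, if p ∈ A then (2 : ℝ) else 1) * E A := by
        refine mul_le_mul_of_nonneg_right (Finset.prod_le_prod ?_ ?_) hE0
        · intro p _; split_ifs
          · exact Finset.sum_nonneg fun _ _ => abs_nonneg _
          · exact zero_le_one
        · intro p _; split_ifs with hp
          · exact loc_abs_sum_le (hpr p) (hc p) (r p) _ _
              (by simpa [hA, colSupp] using hp)
          · exact le_rfl
    _ = _ := by
        rw [Finset.prod_ite_mem, Finset.univ_inter, Finset.prod_const]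

theorem sieve_second_moment [Fintype ι] [DecidableEq ι] (pr : τ → ℕ) (hpr : ∀ p, 3 ≤ pr p)
    (hc : ∀ p, Fintype.card (Ω p) = pr p)
    (π : ∀ p, ℕ → Ω p) (r : ∀ p, ι → Ω p) (I : Finset ℕ) (w : ℕ → ℝ) (X : ℝ)
    (ν : ∀ p, Ω p → ℝ) (hν : ∀ p, ∑ x, ν p x = 1) (E : Finset τ → ℝ)
    (hE : ∀ (A : Finset τ) (a : ∀ p, Ω p), |∑ n ∈ I, w n * (if ∀ p ∈ A, π p n = a p then 1 else 0) -
      X * ∏ p ∈ A, ν p (a p)| ≤ E A) (c : (τ → Option ι) → ℝ) :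
    |∑ n ∈ I, w n * (∑ U, c U * ∏ p, locW (pr p) (r p) (U p) (π p n)) ^ 2 -
      X * ∑ x : (∀ p, Ω p), (∏ p, ν p (x p)) *
        (∑ U, c U * ∏ p, locW (pr p) (r p) (U p) (x p)) ^ 2| ≤
      ∑ U, ∑ V, |c U| * |c V| * (2 ^ (colSupp U V).card * E (colSupp U V)) := by
  have e1 : ∑ n ∈ I, w n * (∑ U, c U * ∏ p, locW (pr p) (r p) (U p) (π p n)) ^ 2 =
      ∑ U, ∑ V, c U * c V * ∑ n ∈ I, w n *
        ∏ p, (locW (pr p) (r p) (U p) (π p n) * locW (pr p) (r p) (V p) (π p n)) := by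
    simp_rw [sq, Finset.sum_mul_sum, Finset.mul_sum]
    rw [Finset.sum_comm]
    refine Finset.sum_congr rfl fun U _ => ?_
    rw [Finset.sum_comm]
    refine Finset.sum_congr rfl fun V _ => Finset.sum_congr rfl fun n _ => ?_
    rw [Finset.prod_mul_distrib]; ring
  have e2 : ∑ x : (∀ p, Ω p), (∏ p, ν p (x p)) *
        (∑ U, c U * ∏ p, locW (pr p) (r p) (U p) (x p)) ^ 2 =
      ∑ U, ∑ V, c U * c V * ∑ x : (∀ p, Ω p), ∏ p, (ν p (x p) *
        (locW (pr p) (r p) (U p) (x p) * locW (pr p) (r p) (V p) (x p))) := by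
    simp_rw [sq, Finset.sum_mul_sum, Finset.mul_sum]
    rw [Finset.sum_comm]
    refine Finset.sum_congr rfl fun U _ => ?_
    rw [Finset.sum_comm]
    refine Finset.sum_congr rfl fun V _ => Finset.sum_congr rfl fun n _ => ?_
    rw [Finset.prod_mul_distrib, Finset.prod_mul_distrib]; ring
  rw [e1, e2, Finset.mul_sum, ← Finset.sum_sub_distrib]
  refine (Finset.abs_sum_le_sum_abs _ _).trans (Finset.sum_le_sum fun U _ => ?_)
  rw [Finset.mul_sum, ← Finset.sum_sub_distrib]
  refine (Finset.abs_sum_le_sum_abs _ _).trans (Finset.sum_le_sum fun V _ => ?_)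
  have := pair_moment pr hpr hc π r I w X ν hν E hE U V
  rw [mul_left_comm, ← mul_sub, abs_mul, abs_mul]
  exact mul_le_mul_of_nonneg_left this (by positivity)

end Moment

section Colour

variable {τ ι : Type} [Fintype τ] [DecidableEq τ] [Fintype ι] [DecidableEq ι]

/-- The product of the primes indexed by `B`. -/
def sz (pr : τ → ℕ) (B : Finset τ) : ℕ := ∏ p ∈ B, pr p

/-- The reciprocal of the totient of `sz pr B`. -/
noncomputable def wt (pr : τ → ℕ) (B : Finset τ) : ℝ := ∏ p ∈ B, ((pr p : ℝ) - 1)⁻¹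

/-- The colour class of `i`. -/
def cls (U : τ → Option ι) (i : ι) : Finset τ := Finset.univ.filter fun p => U p = some i

/-- The set of coloured indices. -/
def csupp (U : τ → Option ι) : Finset τ := Finset.univ.filter fun p => U p ≠ none

theorem prod_csupp {M : Type} [CommMonoid M] (U : τ → Option ι) (f : τ → M) :
    ∏ p ∈ csupp U, f p = ∏ i, ∏ p ∈ cls U i, f p := by
  rw [← Finset.prod_biUnion]
  · refine Finset.prod_congr ?_ fun _ _ => rfl
    ext p
    simp [csupp, cls, Option.ne_none_iff_exists']
  · intro i _ j _ hij
    rw [Function.onFun, Finset.disjoint_left]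
    intro p hp hq
    simp only [cls, Finset.mem_filter, Finset.mem_univ, true_and] at hp hq
    exact hij (Option.some_injective _ (hp.symm.trans hq))

theorem cls_injective : Function.Injective (cls : (τ → Option ι) → ι → Finset τ) := by
  intro U V h
  funext p
  have h2 : ∀ i, U p = some i ↔ V p = some i := fun i => by
    have := congrArg (fun A => p ∈ A i) h
    simpa [cls] using this
  cases hU : U p with
  | none =>
    cases hV : V p with
    | none => rfl
    | some j => rw [← h2, hU] at hV; exact hV
  | some i => exact ((h2 i).1 hU).symm

theorem prod_sum_colour (F : ι → Finset τ → ℝ) :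
    ∏ i, ∑ B, F i B = ∑ A : ι → Finset τ, ∏ i, F i (A i) := by
  rw [Finset.prod_univ_sum (fun _ => (Finset.univ : Finset (Finset τ))) F, Fintype.piFinset_univ]

theorem sum_colour_le (F : ι → Finset τ → ℝ) (hF : ∀ i B, 0 ≤ F i B) :
    ∑ U : τ → Option ι, ∏ i, F i (cls U i) ≤ ∏ i, ∑ B, F i B := by
  rw [prod_sum_colour, ← Finset.sum_image (f := fun A : ι → Finset τ => ∏ i, F i (A i))
    (cls_injective.injOn)]
  exact Finset.sum_le_sum_of_subset_of_nonneg (Finset.subset_univ _)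
    fun A _ _ => Finset.prod_nonneg fun i _ => hF _ _

theorem exists_colour (A : ι → Finset τ) (hA : ∀ i j, i ≠ j → Disjoint (A i) (A j)) :
    ∃ U : τ → Option ι, cls U = A := by
  classical
  refine ⟨fun p => if h : ∃ i, p ∈ A i then some h.choose else none, ?_⟩
  funext i
  ext p
  simp only [cls, Finset.mem_filter, Finset.mem_univ, true_and]
  constructor
  · intro h
    split_ifs at h with hp
    rw [← Option.some_injective _ h]
    exact hp.choose_spec
  · intro h
    have hp : ∃ i, p ∈ A i := ⟨i, h⟩
    rw [dif_pos hp]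
    by_contra hne
    have : hp.choose ≠ i := fun e => hne (by rw [e])
    exact Finset.disjoint_left.1 (hA _ _ this) hp.choose_spec h

theorem sum_prod_mul_le (F G : ι → Finset τ → ℝ) (g : ι → ℝ) (hF : ∀ i B, 0 ≤ F i B)
    (hG : ∀ i B, 0 ≤ G i B)
    (h : ∀ i, ∑ B, F i B * G i B ≤ g i * ∑ B, F i B) :
    ∑ A : ι → Finset τ, (∏ i, F i (A i)) * ∏ i, G i (A i) ≤ (∏ i, g i) * ∏ i, ∑ B, F i B := by
  simp_rw [← Finset.prod_mul_distrib]
  rw [← prod_sum_colour (fun i B => F i B * G i B)]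
  exact Finset.prod_le_prod (fun i _ => Finset.sum_nonneg fun B _ => mul_nonneg (hF _ _) (hG _ _))
    fun i _ => h i

theorem one_sub_sum_le_prod (s : Finset τ) (g : τ → ℝ) (h0 : ∀ p, 0 ≤ g p) (h1 : ∀ p, g p ≤ 1) :
    1 - ∑ p ∈ s, (1 - g p) ≤ ∏ p ∈ s, g p := by
  induction s using Finset.induction_on with
  | empty => simp
  | insert p s hp ih =>
    rw [Finset.sum_insert hp, Finset.prod_insert hp]
    have hle : ∏ p ∈ s, g p ≤ 1 := Finset.prod_le_one (fun p _ => h0 p) fun p _ => h1 p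
    nlinarith [h0 p, h1 p]

/-- Probabilistic lower bound for sums over colourings. -/
theorem le_sum_colour (pr : τ → ℕ) (hpr : ∀ p, 1 ≤ pr p) (F : ι → Finset τ → ℝ)
    (hF : ∀ i B, 0 ≤ F i B) (g κ : τ → ℝ) (h0 : ∀ p, 0 ≤ g p) (h1 : ∀ p, g p ≤ 1)
    (hκ : ∀ i p, ∑ B, F i B * (if p ∈ B then 1 else 0) ≤ κ p * ∑ B, F i B)
    (Λ : ℝ) (hΛ : ∀ i, ∑ B, F i B * Real.log (sz pr B) ≤ Λ * ∑ B, F i B)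
    (Z : ℕ) (hZ : 2 ≤ Z) :
    (1 - Fintype.card ι ^ 2 * ∑ p, κ p ^ 2 - Fintype.card ι * ∑ p, (1 - g p) * κ p -
      Fintype.card ι * Λ / Real.log Z) * ∏ i, ∑ B, F i B ≤
    ∑ U : τ → Option ι, (if sz pr (csupp U) ≤ Z then
      (∏ p ∈ csupp U, g p) * ∏ i, F i (cls U i) else 0) := by
  classical
  have hlZ : 0 < Real.log Z := Real.log_pos (by exact_mod_cast hZ)
  set Tot := ∏ i, ∑ B, F i B with hTot
  set W : (ι → Finset τ) → ℝ := fun A => ∏ i, F i (A i) with hW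
  have hW0 : ∀ A, 0 ≤ W A := fun A => Finset.prod_nonneg fun i _ => hF _ _
  have hWT : ∑ A, W A = Tot := (prod_sum_colour F).symm
  have hlog0 : ∀ B : Finset τ, 0 ≤ Real.log (sz pr B) := fun B => Real.log_natCast_nonneg _
  let ind : τ → Finset τ → ℝ := fun p B => if p ∈ B then 1 else 0
  have hind : ∀ p B, 0 ≤ ind p B := fun p B => by simp only [ind]; split_ifs <;> norm_num
  have single : ∀ (i : ι) (H : Finset τ → ℝ) (v : ℝ), (∀ B, 0 ≤ H B) →
      (∑ B, F i B * H B ≤ v * ∑ B, F i B) → ∑ A, W A * H (A i) ≤ v * Tot := by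
    intro i H v hH hv
    have := sum_prod_mul_le F (fun l B => if l = i then H B else 1)
      (fun l => if l = i then v else 1) hF (fun l B => by split_ifs; exacts [hH _, zero_le_one])
      (fun l => by
        by_cases hl : l = i
        · subst hl; simpa using hv
        · simp [hl])
    simpa using this
  have pair : ∀ (i j : ι) (p : τ), i ≠ j →
      ∑ A, W A * (ind p (A i) * ind p (A j)) ≤ κ p ^ 2 * Tot := by
    intro i j p hij
    have := sum_prod_mul_le F (fun l B => (if l = i then ind p B else 1) *
      (if l = j then ind p B else 1))
      (fun l => (if l = i then κ p else 1) * (if l = j then κ p else 1)) hF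
      (fun l B => by
        refine mul_nonneg ?_ ?_ <;> split_ifs <;> first | exact hind _ _ | exact zero_le_one)
      (fun l => by
        by_cases hl : l = i
        · subst hl; simpa [hij, ind] using hκ l p
        · by_cases hl' : l = j
          · subst hl'; simpa [hl, ind] using hκ l p
          · simp [hl, hl'])
    rw [Finset.prod_mul_distrib] at this
    simp only [Finset.prod_mul_distrib, Finset.prod_ite_eq', Finset.mem_univ, if_true] at this
    rwa [sq]
  let L : (ι → Finset τ) → ℝ := fun A =>
    1 - ∑ i, ∑ j, (if i = j then 0 else ∑ p, ind p (A i) * ind p (A j)) -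
      ∑ i, ∑ p, (1 - g p) * ind p (A i) - (∑ i, Real.log (sz pr (A i))) / Real.log Z
  have hLle : ∀ A, L A ≤ 1 := by
    intro A
    have a1 : 0 ≤ ∑ i, ∑ j, (if i = j then 0 else ∑ p, ind p (A i) * ind p (A j)) :=
      Finset.sum_nonneg fun i _ => Finset.sum_nonneg fun j _ => by
        split_ifs
        · exact le_rfl
        · exact Finset.sum_nonneg fun p _ => mul_nonneg (hind _ _) (hind _ _)
    have a2 : 0 ≤ ∑ i, ∑ p, (1 - g p) * ind p (A i) :=
      Finset.sum_nonneg fun i _ => Finset.sum_nonneg fun p _ =>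
        mul_nonneg (by linarith [h1 p]) (hind _ _)
    have a3 : 0 ≤ (∑ i, Real.log (sz pr (A i))) / Real.log Z :=
      div_nonneg (Finset.sum_nonneg fun i _ => hlog0 _) hlZ.le
    simp only [L]; linarith
  have hLsum : (1 - Fintype.card ι ^ 2 * ∑ p, κ p ^ 2 - Fintype.card ι * ∑ p, (1 - g p) * κ p -
      Fintype.card ι * Λ / Real.log Z) * Tot ≤ ∑ A, W A * L A := by
    have b1 : ∑ A, W A * ∑ i, ∑ j, (if i = j then 0 else ∑ p, ind p (A i) * ind p (A j)) ≤
        Fintype.card ι ^ 2 * (∑ p, κ p ^ 2) * Tot := by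
      simp_rw [Finset.mul_sum]
      rw [Finset.sum_comm]
      calc _ ≤ ∑ i : ι, ∑ j : ι, (∑ p, κ p ^ 2) * Tot := by
            refine Finset.sum_le_sum fun i _ => ?_
            rw [Finset.sum_comm]
            refine Finset.sum_le_sum fun j _ => ?_
            by_cases hij : i = j
            · simp only [hij, if_true, mul_zero, Finset.sum_const_zero]
              exact mul_nonneg (Finset.sum_nonneg fun _ _ => sq_nonneg _)
                (by rw [← hWT]; exact Finset.sum_nonneg fun A _ => hW0 A)
            · simp only [hij, if_false, Finset.mul_sum]
              rw [Finset.sum_comm, Finset.sum_mul]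
              exact Finset.sum_le_sum fun p _ => pair i j p hij
        _ = _ := by
          simp only [Finset.sum_const, Finset.card_univ, nsmul_eq_mul, ← Finset.mul_sum]
          ring
    have b2 : ∑ A, W A * ∑ i, ∑ p, (1 - g p) * ind p (A i) ≤
        Fintype.card ι * (∑ p, (1 - g p) * κ p) * Tot := by
      simp_rw [Finset.mul_sum]
      rw [Finset.sum_comm]
      calc _ ≤ ∑ i : ι, (∑ p, (1 - g p) * κ p) * Tot := by
            refine Finset.sum_le_sum fun i _ => ?_
            rw [Finset.sum_comm, Finset.sum_mul]
            refine Finset.sum_le_sum fun p _ => ?_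
            have := mul_le_mul_of_nonneg_left (single i (ind p) (κ p) (hind p) (hκ i p))
              (by linarith [h1 p] : 0 ≤ 1 - g p)
            rw [Finset.mul_sum] at this
            calc _ = ∑ A, (1 - g p) * (W A * ind p (A i)) :=
                  Finset.sum_congr rfl fun A _ => by ring
              _ ≤ _ := this
              _ = _ := by ring
        _ = _ := by
          simp only [Finset.sum_const, Finset.card_univ, nsmul_eq_mul, ← Finset.mul_sum]
          ring
    have b3 : ∑ A, W A * ((∑ i, Real.log (sz pr (A i))) / Real.log Z) ≤
        Fintype.card ι * Λ / Real.log Z * Tot := by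
      have : ∑ A, W A * ∑ i, Real.log (sz pr (A i)) ≤ Fintype.card ι * Λ * Tot := by
        simp_rw [Finset.mul_sum]
        rw [Finset.sum_comm]
        calc _ ≤ ∑ i : ι, Λ * Tot := Finset.sum_le_sum fun i _ =>
              single i (fun B => Real.log (sz pr B)) Λ hlog0 (hΛ i)
          _ = _ := by
            simp only [Finset.sum_const, Finset.card_univ, nsmul_eq_mul]
            ring
      simp_rw [← mul_div_assoc]
      rw [← Finset.sum_div, div_mul_eq_mul_div]
      exact div_le_div_of_nonneg_right this hlZ.le
    simp only [L, mul_sub, Finset.sum_sub_distrib, mul_one, hWT]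
    linarith
  refine hLsum.trans ?_
  have key : ∀ A, W A * L A ≤ if (∀ i j, i ≠ j → Disjoint (A i) (A j)) ∧ ∏ i, sz pr (A i) ≤ Z then
      (∏ i, ∏ p ∈ A i, g p) * W A else 0 := by
    intro A
    have a1 : ∀ i j, i ≠ j → (0 : ℝ) ≤ ∑ p, ind p (A i) * ind p (A j) := fun i j _ =>
      Finset.sum_nonneg fun p _ => mul_nonneg (hind _ _) (hind _ _)
    have a1' : ∀ i j, (0 : ℝ) ≤ (if i = j then 0 else ∑ p, ind p (A i) * ind p (A j)) := by
      intro i j; split_ifs with h; exacts [le_rfl, a1 i j h]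
    have a1s : 0 ≤ ∑ i, ∑ j, (if i = j then 0 else ∑ p, ind p (A i) * ind p (A j)) :=
      Finset.sum_nonneg fun i _ => Finset.sum_nonneg fun j _ => a1' i j
    have a2 : ∀ i, ∑ p, (1 - g p) * ind p (A i) = ∑ p ∈ A i, (1 - g p) := by
      intro i; simp [ind]
    have a2s : 0 ≤ ∑ i, ∑ p, (1 - g p) * ind p (A i) :=
      Finset.sum_nonneg fun i _ => Finset.sum_nonneg fun p _ =>
        mul_nonneg (by linarith [h1 p]) (hind _ _)
    have a3s : 0 ≤ (∑ i, Real.log (sz pr (A i))) / Real.log Z :=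
      div_nonneg (Finset.sum_nonneg fun i _ => hlog0 _) hlZ.le
    split_ifs with hA
    · rw [mul_comm]
      refine mul_le_mul_of_nonneg_right ?_ (hW0 A)
      have hb : (∏ i, ∏ p ∈ A i, g p) = ∏ p ∈ Finset.univ.biUnion A, g p := by
        rw [Finset.prod_biUnion]; exact fun i _ j _ h => hA.1 i j h
      have hs : ∑ i, ∑ p ∈ A i, (1 - g p) = ∑ p ∈ Finset.univ.biUnion A, (1 - g p) := by
        rw [Finset.sum_biUnion]; exact fun i _ j _ h => hA.1 i j h
      have := one_sub_sum_le_prod (Finset.univ.biUnion A) g h0 h1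
      rw [hb]
      simp only [L, a2, hs] at *
      linarith
    · have hL : L A ≤ 0 := by
        by_cases hd : ∀ i j, i ≠ j → Disjoint (A i) (A j)
        · have hb : (Z : ℝ) ≤ ∏ i, (sz pr (A i) : ℝ) := by
            have : Z < ∏ i, sz pr (A i) := not_le.1 fun h => hA ⟨hd, h⟩
            exact_mod_cast this.le
          have : Real.log Z ≤ ∑ i, Real.log (sz pr (A i)) := by
            rw [← Real.log_prod]
            · exact Real.log_le_log (by positivity) hb
            · intro i _
              have : 0 < sz pr (A i) := Finset.prod_pos fun p _ => hpr p
              positivity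
          have : 1 ≤ (∑ i, Real.log (sz pr (A i))) / Real.log Z := (one_le_div hlZ).2 this
          simp only [L]; linarith
        · push Not at hd
          obtain ⟨i, j, hij, hd⟩ := hd
          obtain ⟨p, hpi, hpj⟩ := Finset.not_disjoint_iff.1 hd
          have c1 : (1 : ℝ) ≤ ∑ p, ind p (A i) * ind p (A j) := by
            have := Finset.single_le_sum (f := fun p => ind p (A i) * ind p (A j))
              (fun p _ => mul_nonneg (hind p (A i)) (hind p (A j))) (Finset.mem_univ p)
            simpa [ind, hpi, hpj] using this
          have c2 := Finset.single_le_sum (f := fun j' => (if i = j' then (0 : ℝ) else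
            ∑ p, ind p (A i) * ind p (A j'))) (fun j _ => a1' i j) (Finset.mem_univ j)
          have c3 := Finset.single_le_sum (f := fun i => ∑ j', (if i = j' then (0 : ℝ) else
            ∑ p, ind p (A i) * ind p (A j'))) (fun i _ => Finset.sum_nonneg fun j _ => a1' i j)
            (Finset.mem_univ i)
          simp only [hij, if_false] at c2 c3
          simp only [L]; linarith
      exact mul_nonpos_of_nonneg_of_nonpos (hW0 A) hL
  refine (Finset.sum_le_sum fun A _ => key A).trans ?_
  rw [← Finset.sum_filter]
  have himg : (Finset.univ.filter fun A : ι → Finset τ =>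
      (∀ i j, i ≠ j → Disjoint (A i) (A j)) ∧ ∏ i, sz pr (A i) ≤ Z) ⊆
      (Finset.univ.filter fun U : τ → Option ι => sz pr (csupp U) ≤ Z).image cls := by
    intro A hA
    simp only [Finset.mem_filter, Finset.mem_univ, true_and] at hA
    obtain ⟨U, rfl⟩ := exists_colour A hA.1
    refine Finset.mem_image_of_mem _ ?_
    simp only [Finset.mem_filter, Finset.mem_univ, true_and]
    rw [sz, prod_csupp]
    exact hA.2
  refine (Finset.sum_le_sum_of_subset_of_nonneg himg fun A _ _ => ?_).trans ?_
  · exact mul_nonneg (Finset.prod_nonneg fun i _ => Finset.prod_nonneg fun p _ => h0 p) (hW0 A)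
  · rw [Finset.sum_image cls_injective.injOn, Finset.sum_filter]
    exact (Finset.sum_congr rfl fun U _ => by simp only [hW, prod_csupp]).le

end Colour

section Diag

variable {τ ι : Type} [Fintype τ] [DecidableEq τ] [Fintype ι] [DecidableEq ι]
  {Ω : τ → Type} [∀ p, Fintype (Ω p)] [∀ p, DecidableEq (Ω p)]

/-- The sieve coefficients attached to a cutoff function `η`. -/
noncomputable def coef (pr : τ → ℕ) (η : ℕ → ℝ) (Z : ℕ) (U : τ → Option ι) : ℝ :=
  (-1) ^ (csupp U).card * (∏ i, η (sz pr (cls U i))) * (if sz pr (csupp U) ≤ Z * Z then 1 else 0)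

theorem sum_mul_prod_eq (c : (τ → Option ι) → ℝ) (y : τ → Option ι) :
    ∑ U, c U * ∏ p, (if U p = y p then (1 : ℝ) else 0) = c y := by
  rw [Finset.sum_eq_single y]
  · simp
  · intro U _ hU
    obtain ⟨p, hp⟩ := Function.ne_iff.1 hU
    rw [Finset.prod_eq_zero (Finset.mem_univ p) (by rw [if_neg hp]), mul_zero]
  · simp

theorem diag_upper (pr : τ → ℕ) (hpr : ∀ p, 3 ≤ pr p)
    (hc : ∀ p, Fintype.card (Ω p) = pr p) (r : ∀ p, ι → Ω p)
    (hr : ∀ p, Function.Injective (r p)) (η : ℕ → ℝ) (Z : ℕ) :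
    ∑ x : (∀ p, Ω p), (∏ p, (pr p : ℝ)⁻¹) *
        (∑ U, coef pr η Z U * ∏ p, locW (pr p) (r p) (U p) (x p)) ^ 2 ≤
      (∏ p, (1 + ((pr p : ℝ) * (pr p - 2))⁻¹)) *
        (∑ B, η (sz pr B) ^ 2 * wt pr B) ^ Fintype.card ι := by
  have hp3 : ∀ p, (3 : ℝ) ≤ pr p := fun p => by exact_mod_cast hpr p
  have hε : ∀ p, 0 ≤ ((pr p : ℝ) * (pr p - 2))⁻¹ := fun p => by
    have := hp3 p
    exact inv_nonneg.2 (mul_nonneg (by linarith) (by linarith))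
  let μ' : ∀ p : τ, Option ι → ℝ := fun p a =>
    a.elim (1 + ((pr p : ℝ) * (pr p - 2))⁻¹) (fun _ => (pr p : ℝ)⁻¹)
  have hμ' : ∀ p a, 0 ≤ μ' p a := by
    rintro p (_ | i)
    · exact add_nonneg zero_le_one (hε p)
    · exact inv_nonneg.2 (by positivity)
  have key := tensor_form_le (Ω := Ω) (Ω' := fun _ => Option ι) (fun p _ => (pr p : ℝ)⁻¹) μ'
    (fun p a x => locW (pr p) (r p) a x) (fun _ a y => if a = y then 1 else 0)
    (fun p _ => inv_nonneg.2 (by positivity)) hμ'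
    (fun p f => by
      refine (loc_upper (hpr p) (hc p) (r p) (hr p) f).trans (le_of_eq ?_)
      simp [Fintype.sum_option, μ', mul_comm]) (coef pr η Z)
  refine key.trans ?_
  simp_rw [sum_mul_prod_eq]
  have h1 : ∀ y : τ → Option ι, (∏ p, μ' p (y p)) * coef pr η Z y ^ 2 ≤
      (∏ p, (1 + ((pr p : ℝ) * (pr p - 2))⁻¹)) *
        ∏ i, (η (sz pr (cls y i)) ^ 2 * wt pr (cls y i)) := by
    intro y
    have a1 : ∏ p, μ' p (y p) ≤ (∏ p, (1 + ((pr p : ℝ) * (pr p - 2))⁻¹)) *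
        ∏ i, wt pr (cls y i) := by
      have : ∏ i, wt pr (cls y i) = ∏ p, if p ∈ csupp y then ((pr p : ℝ) - 1)⁻¹ else 1 := by
        simp only [wt]
        rw [← prod_csupp, Finset.prod_ite_mem, Finset.univ_inter]
      rw [this, ← Finset.prod_mul_distrib]
      refine Finset.prod_le_prod (fun p _ => hμ' _ _) fun p _ => ?_
      cases hy : y p with
      | none => simp [μ', csupp, hy]
      | some i =>
        have : p ∈ csupp y := by simp [csupp, hy]
        rw [if_pos this]
        have h3 := hp3 p
        have : (pr p : ℝ)⁻¹ ≤ ((pr p : ℝ) - 1)⁻¹ := inv_anti₀ (by linarith) (by linarith)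
        have h4 : 0 ≤ ((pr p : ℝ) - 1)⁻¹ := inv_nonneg.2 (by linarith)
        simp only [μ', Option.elim]
        nlinarith [hε p]
    have a2 : coef pr η Z y ^ 2 ≤ ∏ i, η (sz pr (cls y i)) ^ 2 := by
      rw [Finset.prod_pow, coef, mul_pow, mul_pow, ← pow_mul, mul_comm _ 2, pow_mul]
      split_ifs <;> simp [sq_nonneg]
    rw [Finset.prod_mul_distrib, mul_left_comm, mul_comm (∏ p, μ' p (y p))]
    have hw : 0 ≤ (∏ p, (1 + ((pr p : ℝ) * (pr p - 2))⁻¹)) * ∏ i, wt pr (cls y i) :=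
      (Finset.prod_nonneg fun p _ => hμ' p (y p)).trans a1
    exact mul_le_mul a2 a1 (Finset.prod_nonneg fun p _ => hμ' _ _)
      (Finset.prod_nonneg fun _ _ => sq_nonneg _)
  refine (Finset.sum_le_sum fun y _ => h1 y).trans ?_
  rw [← Finset.mul_sum]
  refine mul_le_mul_of_nonneg_left ?_ (Finset.prod_nonneg fun p _ =>
    add_nonneg zero_le_one (hε p))
  refine (sum_colour_le (fun (_ : ι) B => η (sz pr B) ^ 2 * wt pr B) fun _ B =>
    mul_nonneg (sq_nonneg _) (Finset.prod_nonneg fun p _ => ?_)).trans (by simp)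
  exact inv_nonneg.2 (by linarith [hp3 p])

theorem sum_le_sum_compl (pr : τ → ℕ) (hpr : ∀ p, 3 ≤ pr p) (η : ℕ → ℝ)
    (hη : Antitone η) (T : Finset τ) :
    ∑ B, η (sz pr B) * wt pr B ≤ (∏ p ∈ T, (1 + ((pr p : ℝ) - 1)⁻¹)) *
      ∑ A ∈ (Tᶜ).powerset, η (sz pr A) * wt pr A := by
  have hp3 : ∀ p, (3 : ℝ) ≤ pr p := fun p => by exact_mod_cast hpr p
  have hw : ∀ B, 0 ≤ wt pr B := fun B => Finset.prod_nonneg fun p _ =>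
    inv_nonneg.2 (by linarith [hp3 p])
  have e : ∑ B, η (sz pr B) * wt pr B = ∑ x ∈ (Tᶜ).powerset ×ˢ T.powerset,
      η (sz pr (x.1 ∪ x.2)) * wt pr (x.1 ∪ x.2) := by
    symm
    refine Finset.sum_nbij' (fun x => x.1 ∪ x.2) (fun B => (B \ T, B ∩ T)) (by simp) ?_ ?_ ?_ ?_
    · intro B _
      simp only [Finset.mem_product, Finset.mem_powerset]
      refine ⟨fun p hp => ?_, Finset.inter_subset_right⟩
      simp only [Finset.mem_sdiff] at hp
      simpa using hp.2
    · rintro ⟨A, C⟩ h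
      simp only [Finset.mem_product, Finset.mem_powerset] at h
      ext p
      · simp only [Finset.mem_sdiff, Finset.mem_union]
        have h1 := @h.1 p; have h2 := @h.2 p
        simp only [Finset.mem_compl] at h1
        tauto
      · simp only [Finset.mem_inter, Finset.mem_union]
        have h1 := @h.1 p; have h2 := @h.2 p
        simp only [Finset.mem_compl] at h1
        tauto
    · intro B _
      exact Finset.sdiff_union_inter B T
    · intro x _; rfl
  rw [e, Finset.sum_product, Finset.prod_one_add, Finset.sum_mul_sum, Finset.sum_comm]
  refine Finset.sum_le_sum fun C hC => Finset.sum_le_sum fun A hA => ?_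
  rw [Finset.mem_powerset] at hA hC
  have hd : Disjoint A C := by
    rw [Finset.disjoint_left]
    intro p hp hq
    have := hA hp
    simp only [Finset.mem_compl] at this
    exact this (hC hq)
  have h1 : wt pr (A ∪ C) = wt pr A * wt pr C := Finset.prod_union hd
  have h2 : sz pr A ≤ sz pr (A ∪ C) := by
    rw [sz, sz, Finset.prod_union hd]
    exact Nat.le_mul_of_pos_right _ (Finset.prod_pos fun p _ => by linarith [hpr p])
  have h3 : ∏ p ∈ C, ((pr p : ℝ) - 1)⁻¹ = wt pr C := rfl
  rw [h1, h3]
  calc _ ≤ η (sz pr A) * (wt pr A * wt pr C) :=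
        mul_le_mul_of_nonneg_right (hη h2) (mul_nonneg (hw _) (hw _))
    _ = _ := by ring

/-- Evaluation of the inner sums in the dual form. -/
theorem inner_sum_eq (pr : τ → ℕ) (η : ℕ → ℝ) (Z : ℕ)
    (hηZ : ∀ a, Z < a → η a = 0) (m : ι) (y : τ → Option ι) (hym : ∀ p, y p ≠ some m)
    (hyZ : sz pr (csupp y) ≤ Z) :
    ∑ U, coef pr η Z U * ∏ p, ((if U p = y p then (1 : ℝ) else 0) +
      (if U p = some m ∧ y p = none then -((pr p : ℝ) - 1)⁻¹ else 0)) =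
    (-1) ^ (csupp y).card * (∏ i ∈ Finset.univ.erase m, η (sz pr (cls y i))) *
      ∑ A ∈ ((csupp y)ᶜ).powerset, η (sz pr A) * wt pr A := by
  set T := csupp y with hT
  let F : Finset τ → (τ → Option ι) := fun A p => if p ∈ A then some m else y p
  have hnone : ∀ p, p ∉ T ↔ y p = none := fun p => by simp [hT, csupp]
  have hFcls : ∀ A ∈ (Tᶜ).powerset, cls (F A) m = A := by
    intro A _
    ext p
    simp only [cls, F, Finset.mem_filter, Finset.mem_univ, true_and]
    split_ifs with h
    · simp [h]
    · simp [h, hym p]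
  have hinj : Set.InjOn F (Tᶜ).powerset := fun A hA B hB h => by
    rw [← hFcls A hA, ← hFcls B hB, h]
  rw [← Finset.sum_subset (Finset.subset_univ ((Tᶜ).powerset.image F)), Finset.sum_image hinj,
    Finset.mul_sum]
  · refine Finset.sum_congr rfl fun A hA => ?_
    have hA' : ∀ p ∈ A, y p = none := fun p hp => by
      rw [← hnone]; simpa using (Finset.mem_powerset.1 hA) hp
    have hdis : Disjoint T A := by
      rw [Finset.disjoint_left]; exact fun p hp hq => (hnone p).2 (hA' p hq) hp
    have hsupp : csupp (F A) = T ∪ A := by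
      ext p
      simp only [csupp, F, Finset.mem_filter, Finset.mem_univ, true_and, Finset.mem_union, hT]
      split_ifs with h <;> simp [h]
    have hcls : ∀ i ∈ Finset.univ.erase m, cls (F A) i = cls y i := by
      intro i hi
      ext p
      simp only [cls, F, Finset.mem_filter, Finset.mem_univ, true_and]
      split_ifs with h
      · simp [hA' p h, (Finset.ne_of_mem_erase hi).symm]
      · rfl
    have hprod : ∏ p, ((if F A p = y p then (1 : ℝ) else 0) +
        (if F A p = some m ∧ y p = none then -((pr p : ℝ) - 1)⁻¹ else 0)) =
        (-1) ^ A.card * wt pr A := by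
      have : ∀ p, ((if F A p = y p then (1 : ℝ) else 0) +
        (if F A p = some m ∧ y p = none then -((pr p : ℝ) - 1)⁻¹ else 0)) =
        if p ∈ A then -((pr p : ℝ) - 1)⁻¹ else 1 := by
        intro p
        by_cases h : p ∈ A
        · simp [F, h, hA' p h]
        · simp [F, h, hym p]
      simp_rw [this]
      rw [Finset.prod_ite_mem, Finset.univ_inter, wt, ← Finset.prod_const,
        ← Finset.prod_mul_distrib]
      exact Finset.prod_congr rfl fun p _ => by ring
    have hco : coef pr η Z (F A) = (-1) ^ (T.card + A.card) *
        (η (sz pr A) * ∏ i ∈ Finset.univ.erase m, η (sz pr (cls y i))) := by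
      rw [coef, ← Finset.mul_prod_erase _ _ (Finset.mem_univ m), hFcls A hA, hsupp,
        Finset.card_union_of_disjoint hdis, Finset.prod_congr rfl fun i hi => by rw [hcls i hi]]
      by_cases hs : sz pr A ≤ Z
      · rw [if_pos, mul_one]
        rw [sz, Finset.prod_union hdis]
        exact Nat.mul_le_mul hyZ hs
      · simp [hηZ _ (not_le.1 hs)]
    rw [hprod, hco, pow_add]
    have : ((-1 : ℝ) ^ A.card) * (-1) ^ A.card = 1 := by
      rw [← mul_pow]; simp
    linear_combination ((-1) ^ T.card * (∏ i ∈ Finset.univ.erase m, η (sz pr (cls y i))) *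
      (η (sz pr A) * wt pr A)) * this
  · intro U _ hU
    suffices h : ∃ p, ¬ (U p = y p) ∧ ¬ (U p = some m ∧ y p = none) by
      obtain ⟨p, h1, h2⟩ := h
      rw [Finset.prod_eq_zero (Finset.mem_univ p) (by rw [if_neg h1, if_neg h2, add_zero]), mul_zero]
    by_contra hcon
    push Not at hcon
    apply hU
    refine Finset.mem_image.2 ⟨cls U m, ?_, ?_⟩
    · rw [Finset.mem_powerset]
      intro p hp
      simp only [cls, Finset.mem_filter, Finset.mem_univ, true_and] at hp
      rw [Finset.mem_compl, hnone]
      exact (hcon p (by rw [hp]; exact (hym p).symm)).2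
    · funext p
      simp only [F, cls, Finset.mem_filter, Finset.mem_univ, true_and]
      split_ifs with h
      · exact h.symm
      · by_contra hne
        exact h (hcon p fun e => hne e.symm).1

end Diag

section DiagLower

variable {τ ι : Type} [Fintype τ] [DecidableEq τ] [Fintype ι] [DecidableEq ι]
  {Ω : τ → Type} [∀ p, Fintype (Ω p)] [∀ p, DecidableEq (Ω p)]

theorem diag_lower (pr : τ → ℕ) (hpr : ∀ p, 3 ≤ pr p)
    (hk : ∀ p, Fintype.card ι + 1 ≤ pr p)
    (hc : ∀ p, Fintype.card (Ω p) = pr p) (r : ∀ p, ι → Ω p)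
    (hr : ∀ p, Function.Injective (r p)) (η : ℕ → ℝ) (hη : Antitone η) (hη0 : ∀ a, 0 ≤ η a) (Z : ℕ)
    (hηZ : ∀ a, Z < a → η a = 0) (m : ι) :
    (∑ B, η (sz pr B) * wt pr B) ^ 2 *
      (∑ U : τ → Option ι, if sz pr (csupp U) ≤ Z then
        (∏ p ∈ csupp U, ((1 - Fintype.card ι * ((pr p : ℝ) - 1)⁻¹) * ((1 + ((pr p : ℝ) - 1)⁻¹) ^ 2)⁻¹)) *
        ∏ i, (if i = m then (if cls U i = ∅ then 1 else 0) else
          η (sz pr (cls U i)) ^ 2 * wt pr (cls U i)) else 0) ≤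
    ∑ x : (∀ p, Ω p), (∏ p, (if x p = r p m then 0 else ((pr p : ℝ) - 1)⁻¹)) *
        (∑ U, coef pr η Z U * ∏ p, locW (pr p) (r p) (U p) (x p)) ^ 2 := by
  have hp3 : ∀ p, (3 : ℝ) ≤ pr p := fun p => by exact_mod_cast hpr p
  have hq : ∀ p, 0 ≤ ((pr p : ℝ) - 1)⁻¹ := fun p => inv_nonneg.2 (by linarith [hp3 p])
  have hkq : ∀ p, 0 ≤ 1 - Fintype.card ι * ((pr p : ℝ) - 1)⁻¹ := fun p => by
    have h1 := hp3 p
    have h2 : (Fintype.card ι : ℝ) + 1 ≤ pr p := by exact_mod_cast hk p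
    rw [sub_nonneg, ← div_eq_mul_inv, div_le_one (by linarith)]
    linarith
  let μ' : ∀ p : τ, Option ι → ℝ := fun p a =>
    a.elim 1 (fun i => if i = m then 0 else
      (1 - Fintype.card ι * ((pr p : ℝ) - 1)⁻¹) * ((pr p : ℝ) - 1)⁻¹)
  have hμ' : ∀ p a, 0 ≤ μ' p a := by
    rintro p (_ | i)
    · exact zero_le_one
    · simp only [μ', Option.elim]
      split_ifs
      · exact le_rfl
      · exact mul_nonneg (hkq p) (hq p)
  have key := tensor_form_le (Ω' := Ω) (Ω := fun _ => Option ι) μ'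
    (fun p x => if x = r p m then 0 else ((pr p : ℝ) - 1)⁻¹)
    (fun p a y => (if a = y then (1 : ℝ) else 0) +
      (if a = some m ∧ y = none then -((pr p : ℝ) - 1)⁻¹ else 0))
    (fun p a x => locW (pr p) (r p) a x) hμ'
    (fun p x => by split_ifs; exacts [le_rfl, hq p])
    (fun p f => by
      refine le_trans (le_of_eq ?_) (loc_lower (hpr p) (hc p) (r p) (hr p) m f)
      rw [Fintype.sum_option, ← Finset.add_sum_erase _ _ (Finset.mem_univ m)]
      simp only [μ', Option.elim, if_true, zero_mul, zero_add, one_mul]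
      congr 1
      · congr 1
        simp [mul_add, Finset.sum_add_distrib]
        ring
      · refine Finset.sum_congr rfl fun i hi => ?_
        rw [if_neg (Finset.ne_of_mem_erase hi), mul_comm]
        congr 2
        simp) (coef pr η Z)
  refine le_trans ?_ key
  rw [Finset.mul_sum]
  refine Finset.sum_le_sum fun y _ => ?_
  have hR : 0 ≤ (∏ p, μ' p (y p)) * (∑ U, coef pr η Z U * ∏ p, ((if U p = y p then (1 : ℝ) else 0) +
      (if U p = some m ∧ y p = none then -((pr p : ℝ) - 1)⁻¹ else 0))) ^ 2 :=
    mul_nonneg (Finset.prod_nonneg fun p _ => hμ' _ _) (sq_nonneg _)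
  split_ifs with hZ
  swap
  · rw [mul_zero]; exact hR
  by_cases hm : cls y m = ∅
  swap
  · rw [Finset.prod_eq_zero (Finset.mem_univ m) (by rw [if_pos rfl, if_neg hm]), mul_zero, mul_zero]
    exact hR
  have hym : ∀ p, y p ≠ some m := by
    intro p h
    have : p ∈ cls y m := by simp [cls, h]
    simp [hm] at this
  rw [inner_sum_eq pr η Z hηZ m y hym hZ, mul_pow, mul_pow, ← pow_mul, mul_comm _ 2, pow_mul]
  simp only [even_two, Even.neg_pow, one_pow, one_mul]
  rw [← Finset.mul_prod_erase _ _ (Finset.mem_univ m), if_pos rfl, if_pos hm, one_mul]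
  set S := ∑ A ∈ ((csupp y)ᶜ).powerset, η (sz pr A) * wt pr A
  set A1 := ∑ B, η (sz pr B) * wt pr B with hA1
  have hw : ∀ B, 0 ≤ wt pr B := fun B => Finset.prod_nonneg fun p _ => hq p
  have hA0 : 0 ≤ A1 := Finset.sum_nonneg fun B _ => mul_nonneg (hη0 _) (hw _)
  have h1 : A1 ^ 2 ≤ (∏ p ∈ csupp y, (1 + ((pr p : ℝ) - 1)⁻¹)) ^ 2 * S ^ 2 := by
    rw [← mul_pow]
    exact pow_le_pow_left₀ hA0 (sum_le_sum_compl pr hpr η hη (csupp y)) 2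
  have h2 : ∏ i ∈ Finset.univ.erase m, (if i = m then (if cls y i = ∅ then (1 : ℝ) else 0) else
          η (sz pr (cls y i)) ^ 2 * wt pr (cls y i)) =
      (∏ i ∈ Finset.univ.erase m, η (sz pr (cls y i))) ^ 2 *
        ∏ p ∈ csupp y, ((pr p : ℝ) - 1)⁻¹ := by
    rw [prod_csupp, ← Finset.mul_prod_erase _ _ (Finset.mem_univ m), hm, Finset.prod_empty, one_mul,
      ← Finset.prod_pow, ← Finset.prod_mul_distrib]
    refine Finset.prod_congr rfl fun i hi => ?_
    rw [if_neg (Finset.ne_of_mem_erase hi)]; rfl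
  have h3 : ∏ p, μ' p (y p) = ∏ p ∈ csupp y,
      ((1 - Fintype.card ι * ((pr p : ℝ) - 1)⁻¹) * ((pr p : ℝ) - 1)⁻¹) := by
    rw [← Finset.univ_inter (csupp y), ← Finset.prod_ite_mem]
    refine Finset.prod_congr rfl fun p _ => ?_
    cases hy : y p with
    | none => simp [μ', csupp, hy]
    | some i =>
      have : p ∈ csupp y := by simp [csupp, hy]
      have h' : i ≠ m := fun e => hym p (by rw [hy, e])
      simp [μ', this, h']
  rw [h2, h3, Finset.prod_mul_distrib, Finset.prod_mul_distrib, Finset.prod_inv_distrib, Finset.prod_pow]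
  set P := ∏ p ∈ csupp y, (1 + ((pr p : ℝ) - 1)⁻¹)
  have hP : 0 < P := Finset.prod_pos fun p _ => by linarith [hq p]
  set G := ∏ p ∈ csupp y, (1 - Fintype.card ι * ((pr p : ℝ) - 1)⁻¹)
  have hG : 0 ≤ G := Finset.prod_nonneg fun p _ => hkq p
  set Q := ∏ p ∈ csupp y, ((pr p : ℝ) - 1)⁻¹
  have hQ : 0 ≤ Q := Finset.prod_nonneg fun p _ => hq p
  set E := (∏ i ∈ Finset.univ.erase m, η (sz pr (cls y i))) ^ 2
  have hE : 0 ≤ E := sq_nonneg _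
  calc A1 ^ 2 * (G * (P ^ 2)⁻¹ * (E * Q)) = (G * Q * E) * (A1 ^ 2 / P ^ 2) := by ring
    _ ≤ (G * Q * E) * S ^ 2 := by
        refine mul_le_mul_of_nonneg_left ?_ (mul_nonneg (mul_nonneg hG hQ) hE)
        rw [div_le_iff₀ (by positivity)]
        linarith
    _ = _ := by ring

theorem sum_mem_le (pr : τ → ℕ) (hpr : ∀ p, 3 ≤ pr p) (η : ℕ → ℝ)
    (hη : Antitone η) (hη0 : ∀ a, 0 ≤ η a) (p : τ) :
    ∑ B, η (sz pr B) ^ 2 * wt pr B * (if p ∈ B then 1 else 0) ≤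
      ((pr p : ℝ) - 1)⁻¹ * ∑ B, η (sz pr B) ^ 2 * wt pr B := by
  have hq : ∀ p, 0 ≤ ((pr p : ℝ) - 1)⁻¹ := fun p => inv_nonneg.2 (by
    have : (3 : ℝ) ≤ pr p := by exact_mod_cast hpr p
    linarith)
  have hw : ∀ B, 0 ≤ wt pr B := fun B => Finset.prod_nonneg fun p _ => hq p
  simp_rw [mul_ite, mul_one, mul_zero]
  rw [← Finset.sum_filter, Finset.mul_sum]
  have hinj : Set.InjOn (fun B : Finset τ => B.erase p)
      (Finset.univ.filter fun B : Finset τ => p ∈ B : Finset (Finset τ)) := by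
    intro A hA B hB h
    simp only [Finset.coe_filter, Finset.mem_univ, true_and, Set.mem_ofPred_eq] at hA hB
    rw [← Finset.insert_erase hA, ← Finset.insert_erase hB]
    exact congrArg (insert p) h
  refine le_trans ?_ (Finset.sum_le_sum_of_subset_of_nonneg (Finset.subset_univ
    ((Finset.univ.filter fun B => p ∈ B).image fun B : Finset τ => B.erase p))
    fun B _ _ => mul_nonneg (hq p) (mul_nonneg (sq_nonneg _) (hw B)))
  rw [Finset.sum_image hinj]
  refine Finset.sum_le_sum fun B hB => ?_
  have hB : p ∈ B := by simpa using hB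
  have h1 : wt pr B = ((pr p : ℝ) - 1)⁻¹ * wt pr (B.erase p) :=
    (Finset.mul_prod_erase _ _ hB).symm
  have h2 : sz pr (B.erase p) ≤ sz pr B := by
    rw [sz, sz, ← Finset.mul_prod_erase _ _ hB]
    exact Nat.le_mul_of_pos_left _ (by linarith [hpr p])
  rw [h1, mul_left_comm]
  exact mul_le_mul_of_nonneg_left (mul_le_mul_of_nonneg_right
    (pow_le_pow_left₀ (hη0 _) (hη h2) 2) (hw _)) (hq p)

theorem half_le_diag (pr : τ → ℕ) (hpr : ∀ p, 3 ≤ pr p)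
    (hk : ∀ p, Fintype.card ι + 1 ≤ pr p)
    (hc : ∀ p, Fintype.card (Ω p) = pr p) (r : ∀ p, ι → Ω p)
    (hr : ∀ p, Function.Injective (r p)) (η : ℕ → ℝ) (hη : Antitone η) (hη0 : ∀ a, 0 ≤ η a) (Z : ℕ)
    (hZ : 2 ≤ Z) (hηZ : ∀ a, Z < a → η a = 0) (m : ι)
    (hS : 16 * (Fintype.card ι : ℝ) ^ 2 * ∑ p, ((pr p : ℝ) - 1)⁻¹ ^ 2 ≤ 1) (Λ : ℝ) (hΛ0 : 0 ≤ Λ)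
    (hΛ : ∑ B, η (sz pr B) ^ 2 * wt pr B * Real.log (sz pr B) ≤
      Λ * ∑ B, η (sz pr B) ^ 2 * wt pr B) (hΛZ : 4 * Fintype.card ι * Λ ≤ Real.log Z) :
    1 / 2 * (∑ B, η (sz pr B) * wt pr B) ^ 2 *
      (∑ B, η (sz pr B) ^ 2 * wt pr B) ^ (Fintype.card ι - 1) ≤
    ∑ x : (∀ p, Ω p), (∏ p, (if x p = r p m then 0 else ((pr p : ℝ) - 1)⁻¹)) *
        (∑ U, coef pr η Z U * ∏ p, locW (pr p) (r p) (U p) (x p)) ^ 2 := by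
  refine le_trans ?_ (diag_lower pr hpr hk hc r hr η hη hη0 Z hηZ m)
  have hp3 : ∀ p, (3 : ℝ) ≤ pr p := fun p => by exact_mod_cast hpr p
  have hq : ∀ p, 0 ≤ ((pr p : ℝ) - 1)⁻¹ := fun p => inv_nonneg.2 (by linarith [hp3 p])
  have hw : ∀ B, 0 ≤ wt pr B := fun B => Finset.prod_nonneg fun p _ => hq p
  have hkq : ∀ p, 0 ≤ 1 - Fintype.card ι * ((pr p : ℝ) - 1)⁻¹ := fun p => by
    have h1 := hp3 p
    have h2 : (Fintype.card ι : ℝ) + 1 ≤ pr p := by exact_mod_cast hk p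
    rw [sub_nonneg, ← div_eq_mul_inv, div_le_one (by linarith)]
    linarith
  have hk1 : (1 : ℝ) ≤ Fintype.card ι := by exact_mod_cast Fintype.card_pos_iff.2 ⟨m⟩
  set k := (Fintype.card ι : ℝ) with hkdef
  set A2 := ∑ B, η (sz pr B) ^ 2 * wt pr B with hA2
  have hA20 : 0 ≤ A2 := Finset.sum_nonneg fun B _ => mul_nonneg (sq_nonneg _) (hw _)
  let g : τ → ℝ := fun p => (1 - k * ((pr p : ℝ) - 1)⁻¹) * ((1 + ((pr p : ℝ) - 1)⁻¹) ^ 2)⁻¹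
  let F : ι → Finset τ → ℝ := fun i B => if i = m then (if B = ∅ then 1 else 0) else
          η (sz pr B) ^ 2 * wt pr B
  have hF0 : ∀ i B, 0 ≤ F i B := by
    intro i B
    simp only [F]
    split_ifs
    exacts [zero_le_one, le_rfl, mul_nonneg (sq_nonneg _) (hw _)]
  have hFm : ∑ B, F m B = 1 := by simp [F]
  have hFi : ∀ i, i ≠ m → ∑ B, F i B = A2 := by intro i hi; simp [F, hi, hA2]
  have hg0 : ∀ p, 0 ≤ g p := fun p => mul_nonneg (hkq p) (by positivity)
  have hg1 : ∀ p, g p ≤ 1 := fun p => by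
    have := hq p
    refine mul_le_one₀ ?_ (by positivity) ?_
    · nlinarith
    · exact inv_le_one_of_one_le₀ (one_le_pow₀ (by linarith))
  have hglow : ∀ p, 1 - g p ≤ (k + 2) * ((pr p : ℝ) - 1)⁻¹ := fun p => by
    have h1 := hq p
    have h2 := hkq p
    set q := ((pr p : ℝ) - 1)⁻¹
    have : 1 - 2 * q ≤ ((1 + q) ^ 2)⁻¹ := by
      rw [← one_div, le_div_iff₀ (by positivity)]
      nlinarith [mul_nonneg h1 h1, mul_nonneg (mul_nonneg h1 h1) h1]
    have h3 : (1 - k * q) * (1 - 2 * q) ≤ g p := mul_le_mul_of_nonneg_left this h2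
    nlinarith [mul_nonneg (mul_nonneg (zero_le_one.trans hk1) h1) h1]
  have key := le_sum_colour pr (fun p => by linarith [hpr p]) F hF0 g (fun p => ((pr p : ℝ) - 1)⁻¹)
    hg0 hg1 (fun i p => by
      by_cases hi : i = m
      · subst hi
        rw [hFm, mul_one]
        refine le_trans (le_of_eq (Finset.sum_eq_zero fun B _ => ?_)) (hq p)
        by_cases hB : B = ∅ <;> simp [F, hB]
      · rw [hFi i hi]
        simp only [F, if_neg hi]
        exact sum_mem_le pr hpr η hη hη0 p) Λ (fun i => by
      by_cases hi : i = m
      · subst hi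
        rw [hFm, mul_one]
        refine le_trans (le_of_eq (Finset.sum_eq_zero fun B _ => ?_)) hΛ0
        by_cases hB : B = ∅ <;> simp [F, hB, sz]
      · rw [hFi i hi]
        simp only [F, if_neg hi]
        exact hΛ) Z hZ
  have hprod : ∏ i, ∑ B, F i B = A2 ^ (Fintype.card ι - 1) := by
    rw [← Finset.mul_prod_erase _ _ (Finset.mem_univ m), hFm, one_mul,
      Finset.prod_congr rfl fun i hi => hFi i (Finset.ne_of_mem_erase hi), Finset.prod_const,
      Finset.card_erase_of_mem (Finset.mem_univ m), Finset.card_univ]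
  rw [hprod] at key
  have hloss : 1 / 2 ≤ 1 - k ^ 2 * ∑ p, ((pr p : ℝ) - 1)⁻¹ ^ 2 -
      k * ∑ p, (1 - g p) * ((pr p : ℝ) - 1)⁻¹ - k * Λ / Real.log Z := by
    have h1 : ∑ p, (1 - g p) * ((pr p : ℝ) - 1)⁻¹ ≤ (k + 2) * ∑ p, ((pr p : ℝ) - 1)⁻¹ ^ 2 := by
      rw [Finset.mul_sum]
      refine Finset.sum_le_sum fun p _ => ?_
      rw [sq, ← mul_assoc]
      exact mul_le_mul_of_nonneg_right (hglow p) (hq p)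
    have h2 : k * Λ / Real.log Z ≤ 1 / 4 := by
      rw [div_le_iff₀ (Real.log_pos (by exact_mod_cast hZ))]
      linarith
    set s := ∑ p, ((pr p : ℝ) - 1)⁻¹ ^ 2
    have hs : 0 ≤ s := Finset.sum_nonneg fun _ _ => sq_nonneg _
    have h3 : k * ∑ p, (1 - g p) * ((pr p : ℝ) - 1)⁻¹ ≤ k * ((k + 2) * s) :=
      mul_le_mul_of_nonneg_left h1 (by linarith)
    have h4 : k * s ≤ k ^ 2 * s := by
      nlinarith [mul_nonneg (mul_nonneg (zero_le_one.trans hk1) (sub_nonneg.2 hk1)) hs]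
    nlinarith
  rw [mul_comm (1 / 2 : ℝ), mul_assoc]
  exact mul_le_mul_of_nonneg_left ((mul_le_mul_of_nonneg_right hloss (by positivity)).trans key)
    (sq_nonneg _)

end DiagLower

section SquarefreeSums

/-- The product of a finite set of natural numbers. -/
def prd (B : Finset ℕ) : ℕ := ∏ p ∈ B, p

/-- The reciprocal of the totient of `prd B`, for a set of primes `B`. -/
noncomputable def ww (B : Finset ℕ) : ℝ := ∏ p ∈ B, ((p : ℝ) - 1)⁻¹

/-- The sum of reciprocals of totients of squarefree numbers up to `y` composed of primes in `P`. -/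
noncomputable def recipSum (P : Finset ℕ) (y : ℕ) : ℝ :=
  ∑ B ∈ P.powerset, if prd B ≤ y then ww B else 0

theorem sub_one_inv_nonneg (p : ℕ) : 0 ≤ ((p : ℝ) - 1)⁻¹ ∨ p = 0 := by
  rcases Nat.eq_zero_or_pos p with h | h
  · exact Or.inr h
  · left
    have : (1 : ℝ) ≤ p := by exact_mod_cast h
    exact inv_nonneg.2 (by linarith)

theorem ww_nonneg {B : Finset ℕ} (hB : ∀ p ∈ B, p.Prime) : 0 ≤ ww B :=
  Finset.prod_nonneg fun p hp => (sub_one_inv_nonneg p).resolve_right (hB p hp).ne_zero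

theorem prd_pos {B : Finset ℕ} (hB : ∀ p ∈ B, p.Prime) : 0 < prd B :=
  Finset.prod_pos fun p hp => (hB p hp).pos

theorem primeFactors_prd {B : Finset ℕ} (hB : ∀ p ∈ B, p.Prime) : (prd B).primeFactors = B :=
  Nat.primeFactors_prod hB

theorem sum_inv_primeFactors_le {B : Finset ℕ} (hB : ∀ p ∈ B, p.Prime) (y : ℕ) :
    ∑ n ∈ (Finset.Icc 1 y).filter (fun n => n.primeFactors = B), (n : ℝ)⁻¹ ≤ ww B := by
  let f : ℕ →* ℝ := (invMonoidHom : ℝ →* ℝ).comp (Nat.castRingHom ℝ : ℕ →* ℝ)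
  have hf : ∀ n, f n = (n : ℝ)⁻¹ := fun n => rfl
  have h1 := (EulerProduct.summable_and_hasSum_factoredNumbers_prod_filter_prime_geometric
    (f := f) (fun {p} hp => by
      rw [hf, norm_inv, Real.norm_natCast]
      exact inv_lt_one_of_one_lt₀ (by exact_mod_cast hp.one_lt)) B).2
  rw [Finset.filter_true_of_mem hB] at h1
  have hP : 0 < prd B := prd_pos hB
  set S := (Finset.Icc 1 y).filter (fun n => n.primeFactors = B) with hS
  have hdvd : ∀ n ∈ S, prd B ∣ n := by
    intro n hn
    rw [← (Finset.mem_filter.1 hn).2]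
    exact Nat.prod_primeFactors_dvd n
  have hpos : ∀ n ∈ S, n ≠ 0 := fun n hn => by
    have := (Finset.mem_Icc.1 (Finset.mem_filter.1 hn).1).1
    omega
  let T : Finset ℕ := S.image (fun n => n / prd B)
  have hT : ∀ m ∈ T, m ∈ Nat.factoredNumbers B := by
    intro m hm
    obtain ⟨n, hn, rfl⟩ := Finset.mem_image.1 hm
    rw [Nat.mem_factoredNumbers']
    intro p hp hd
    rw [← (Finset.mem_filter.1 hn).2]
    exact Nat.mem_primeFactors.2 ⟨hp, hd.trans (Nat.div_dvd_of_dvd (hdvd n hn)), hpos n hn⟩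
  have h2 : ∑ m ∈ T, (m : ℝ)⁻¹ ≤ ∏ p ∈ B, (1 - (p : ℝ)⁻¹)⁻¹ := by
    have h3 := sum_le_hasSum (T.subtype (fun m => m ∈ Nat.factoredNumbers B))
      (fun m _ => by simp [hf]) h1
    rw [Finset.sum_subtype_of_mem (fun m : ℕ => f m) hT] at h3
    exact h3
  have h3 : ∑ n ∈ S, (n : ℝ)⁻¹ = (prd B : ℝ)⁻¹ * ∑ m ∈ T, (m : ℝ)⁻¹ := by
    rw [Finset.sum_image, Finset.mul_sum]
    · refine Finset.sum_congr rfl fun n hn => ?_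
      rw [← mul_inv, ← Nat.cast_mul, Nat.mul_div_cancel' (hdvd n hn)]
    · intro a ha b hb h
      rw [← Nat.mul_div_cancel' (hdvd a ha), ← Nat.mul_div_cancel' (hdvd b hb)]
      exact congrArg _ h
  rw [h3]
  refine (mul_le_mul_of_nonneg_left h2 (by positivity)).trans (le_of_eq ?_)
  rw [prd, ww, Nat.cast_prod, ← Finset.prod_inv_distrib, ← Finset.prod_mul_distrib]
  refine Finset.prod_congr rfl fun p hp => ?_
  have : (1 : ℝ) < p := by exact_mod_cast (hB p hp).one_lt
  rw [← mul_inv]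
  congr 1
  field_simp

theorem log_le_recipSum {P : Finset ℕ} (hP : ∀ p ∈ P, p.Prime) (y : ℕ)
    (hy : ∀ p : ℕ, p.Prime → p ≤ y → p ∈ P) : Real.log y ≤ recipSum P y := by
  rcases Nat.eq_zero_or_pos y with rfl | hy0
  · simp only [Nat.cast_zero, Real.log_zero]
    refine Finset.sum_nonneg fun B hB => ?_
    split_ifs
    · exact ww_nonneg fun p hp => hP p (Finset.mem_powerset.1 hB hp)
    · exact le_rfl
  have h1 : Real.log y ≤ ∑ n ∈ Finset.Icc 1 y, (n : ℝ)⁻¹ := by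
    have := log_add_one_le_harmonic y
    rw [harmonic_eq_sum_Icc] at this
    push_cast at this
    refine le_trans (Real.log_le_log (by exact_mod_cast hy0) (by linarith)) this
  refine h1.trans ?_
  rw [← Finset.sum_fiberwise_of_maps_to (s := Finset.Icc 1 y) (t := P.powerset)
    (g := fun n => n.primeFactors)]
  · refine Finset.sum_le_sum fun B hB => ?_
    have hB' : ∀ p ∈ B, p.Prime := fun p hp => hP p (Finset.mem_powerset.1 hB hp)
    split_ifs with h
    · exact sum_inv_primeFactors_le hB' y
    · rw [Finset.filter_false_of_mem, Finset.sum_empty]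
      intro n hn he
      apply h
      have h1 := Finset.mem_Icc.1 hn
      rw [← he]
      exact (Nat.le_of_dvd (by omega) (Nat.prod_primeFactors_dvd n)).trans h1.2
  · intro n hn
    have h1 := Finset.mem_Icc.1 hn
    refine Finset.mem_powerset.2 fun p hp => hy p (Nat.prime_of_mem_primeFactors hp) ?_
    exact (Nat.le_of_mem_primeFactors hp).trans h1.2

theorem prod_one_add_inv_mul_le (P : Finset ℕ) (hP : ∀ p ∈ P, 2 ≤ p) :
    ∏ p ∈ P, (1 + ((p : ℝ) * (p - 1))⁻¹) ≤ 3 := by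
  have hnn : ∀ p ∈ P, 0 ≤ ((p : ℝ) * (p - 1))⁻¹ := fun p hp => by
    have : (2 : ℝ) ≤ p := by exact_mod_cast hP p hp
    exact inv_nonneg.2 (mul_nonneg (by linarith) (by linarith))
  have hsum : ∀ n : ℕ, ∑ p ∈ Finset.Ico 2 (n + 2), ((p : ℝ) * (p - 1))⁻¹ = 1 - ((n : ℝ) + 1)⁻¹ := by
    intro n
    induction n with
    | zero => simp
    | succ n ih =>
      rw [Finset.sum_Ico_succ_top (by omega), ih]
      push_cast
      have : (n : ℝ) + 1 ≠ 0 := by positivity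
      have : (n : ℝ) + 2 ≠ 0 := by positivity
      have : (n : ℝ) + 2 - 1 ≠ 0 := by
        rw [show (n : ℝ) + 2 - 1 = n + 1 by ring]; positivity
      field_simp
      ring
  have h1 : ∑ p ∈ P, ((p : ℝ) * (p - 1))⁻¹ ≤ 1 := by
    refine le_trans (Finset.sum_le_sum_of_subset_of_nonneg (t := Finset.Ico 2 (P.sup id + 2))
      (fun p hp => ?_) fun p hp _ => ?_) ((hsum _).trans_le ?_)
    · have := Finset.le_sup (f := id) hp
      simp only [id] at this
      rw [Finset.mem_Ico]; exact ⟨hP p hp, by omega⟩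
    · have : (2 : ℝ) ≤ p := by exact_mod_cast (Finset.mem_Ico.1 hp).1
      exact inv_nonneg.2 (mul_nonneg (by linarith) (by linarith))
    · have : 0 ≤ ((P.sup id : ℕ) + 1 : ℝ)⁻¹ := by positivity
      linarith
  calc _ ≤ ∏ p ∈ P, Real.exp (((p : ℝ) * (p - 1))⁻¹) :=
        Finset.prod_le_prod (fun p hp => add_nonneg zero_le_one (hnn p hp)) fun p _ => by
          rw [add_comm]; exact Real.add_one_le_exp _
    _ = Real.exp (∑ p ∈ P, ((p : ℝ) * (p - 1))⁻¹) := (Real.exp_sum _ _).symm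
    _ ≤ Real.exp 1 := Real.exp_le_exp.2 h1
    _ ≤ 3 := Real.exp_one_lt_three.le

theorem sum_prd_inv_le {P : Finset ℕ} (hP : ∀ p ∈ P, p.Prime) (y : ℕ) :
    ∑ B ∈ P.powerset, (if prd B ≤ y then (prd B : ℝ)⁻¹ else 0) ≤ 1 + Real.log y := by
  have h := harmonic_le_one_add_log y
  rw [harmonic_eq_sum_Icc] at h
  push_cast at h
  refine le_trans ?_ h
  have hB' : ∀ B ∈ P.powerset, ∀ p ∈ B, p.Prime := fun B hB p hp =>
    hP p (Finset.mem_powerset.1 hB hp)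
  rw [← Finset.sum_filter]
  have hinj : Set.InjOn prd (P.powerset.filter fun B => prd B ≤ y : Finset (Finset ℕ)) := by
    intro A hA B hB h
    have hA := (Finset.mem_filter.1 (Finset.mem_coe.1 hA)).1
    have hB := (Finset.mem_filter.1 (Finset.mem_coe.1 hB)).1
    rw [← primeFactors_prd (hB' A hA), ← primeFactors_prd (hB' B hB), h]
  rw [← Finset.sum_image (f := fun n : ℕ => (n : ℝ)⁻¹) hinj]
  refine Finset.sum_le_sum_of_subset_of_nonneg (fun n hn => ?_) fun n _ _ => by positivity
  obtain ⟨B, hB, rfl⟩ := Finset.mem_image.1 hn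
  have hB := Finset.mem_filter.1 hB
  exact Finset.mem_Icc.2 ⟨prd_pos (hB' B hB.1), hB.2⟩

theorem recipSum_le {P : Finset ℕ} (hP : ∀ p ∈ P, p.Prime) (y : ℕ) :
    recipSum P y ≤ 3 * (1 + Real.log y) := by
  have h0 : 0 ≤ 1 + Real.log y := add_nonneg zero_le_one (Real.log_natCast_nonneg y)
  have hB' : ∀ B ∈ P.powerset, ∀ p ∈ B, p.Prime := fun B hB p hp =>
    hP p (Finset.mem_powerset.1 hB hp)
  have e : ∀ B ∈ P.powerset, ww B = ∑ C ∈ B.powerset, (prd B : ℝ)⁻¹ * ww C := by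
    intro B hB
    rw [← Finset.mul_sum]
    simp only [ww]
    rw [← Finset.prod_one_add, prd, Nat.cast_prod, ← Finset.prod_inv_distrib,
      ← Finset.prod_mul_distrib]
    refine Finset.prod_congr rfl fun p hp => ?_
    have : (1 : ℝ) < p := by exact_mod_cast (hB' B hB p hp).one_lt
    have : (p : ℝ) - 1 ≠ 0 := by linarith
    field_simp
    ring
  have hsplit : recipSum P y ≤ ∑ C ∈ P.powerset, ww C * (prd C : ℝ)⁻¹ *
      ∑ A ∈ P.powerset, (if prd A ≤ y then (prd A : ℝ)⁻¹ else 0) := by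
    have h1 : recipSum P y = ∑ x ∈ P.powerset.sigma (fun B => B.powerset),
        if prd x.1 ≤ y then (prd x.1 : ℝ)⁻¹ * ww x.2 else 0 := by
      rw [Finset.sum_sigma]
      refine Finset.sum_congr rfl fun B hB => ?_
      split_ifs with h
      · exact e B hB
      · simp
    rw [h1]
    simp_rw [Finset.mul_sum]
    rw [← Finset.sum_product']
    have hinj : Set.InjOn (fun x : (Σ _ : Finset ℕ, Finset ℕ) => (x.2, x.1 \ x.2))
        (P.powerset.sigma (fun B => B.powerset) : Finset (Σ _ : Finset ℕ, Finset ℕ)) := by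
      rintro ⟨B, C⟩ hx ⟨B', C'⟩ hx' h
      simp only [Finset.coe_sigma, Set.mem_sigma_iff, Finset.mem_coe, Finset.mem_powerset] at hx hx'
      simp only [Prod.mk.injEq] at h
      obtain ⟨rfl, h2⟩ := h
      have : B = B' := by
        rw [← Finset.sdiff_union_of_subset hx.2, h2, Finset.sdiff_union_of_subset hx'.2]
      subst this; rfl
    refine le_trans ?_ (Finset.sum_le_sum_of_subset_of_nonneg (s := (P.powerset.sigma
      (fun B => B.powerset)).image fun x : (Σ _ : Finset ℕ, Finset ℕ) => (x.2, x.1 \ x.2)) ?_ ?_)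
    · rw [Finset.sum_image hinj]
      refine Finset.sum_le_sum ?_
      rintro ⟨B, C⟩ hx
      simp only [Finset.mem_sigma, Finset.mem_powerset] at hx
      have hp : prd B = prd C * prd (B \ C) := by
        rw [mul_comm]; exact (Finset.prod_sdiff hx.2).symm
      have hpC : 0 < prd C := prd_pos fun p hp => hP p (hx.1 (hx.2 hp))
      have hpD : 0 < prd (B \ C) := prd_pos fun p hp =>
        hP p (hx.1 (Finset.mem_sdiff.1 hp).1)
      have hwC : 0 ≤ ww C := ww_nonneg fun p hp => hP p (hx.1 (hx.2 hp))
      simp only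
      split_ifs with h1 h2
      · rw [hp, Nat.cast_mul, mul_inv]
        exact le_of_eq (by ring)
      · exact absurd ((Nat.le_mul_of_pos_left _ hpC).trans (hp ▸ h1)) h2
      · positivity
      · positivity
    · intro x hx
      obtain ⟨⟨B, C⟩, hy, rfl⟩ := Finset.mem_image.1 hx
      simp only [Finset.mem_sigma, Finset.mem_powerset] at hy
      simp only [Finset.mem_product, Finset.mem_powerset]
      exact ⟨hy.2.trans hy.1, Finset.sdiff_subset.trans hy.1⟩
    · rintro ⟨C, A⟩ hx _
      simp only [Finset.mem_product] at hx
      have hwC : 0 ≤ ww C := ww_nonneg (hB' C hx.1)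
      simp only
      split_ifs <;> positivity
  refine hsplit.trans ?_
  rw [← Finset.sum_mul]
  refine mul_le_mul ?_ (sum_prd_inv_le hP y) (Finset.sum_nonneg fun B _ => by
    split_ifs <;> positivity) (by norm_num)
  refine le_trans (le_of_eq ?_) (prod_one_add_inv_mul_le P fun p hp => (hP p hp).two_le)
  rw [Finset.prod_one_add]
  refine Finset.sum_congr rfl fun C _ => ?_
  rw [ww, prd, Nat.cast_prod, ← Finset.prod_inv_distrib, ← Finset.prod_mul_distrib]
  exact Finset.prod_congr rfl fun p _ => by rw [mul_inv, mul_comm]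

theorem recipSum_union_eq {P Q : Finset ℕ} (hPQ : Disjoint P Q) (y : ℕ) :
    recipSum (P ∪ Q) y = ∑ C ∈ P.powerset, ∑ B ∈ Q.powerset,
      if prd C * prd B ≤ y then ww C * ww B else 0 := by
  rw [← Finset.sum_product', recipSum]
  symm
  refine Finset.sum_nbij' (fun x => x.1 ∪ x.2) (fun A => (A ∩ P, A ∩ Q)) ?_ ?_ ?_ ?_ ?_
  · rintro ⟨C, B⟩ h
    simp only [Finset.mem_product, Finset.mem_powerset] at h ⊢
    exact Finset.union_subset_union h.1 h.2
  · intro A h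
    simp only [Finset.mem_product, Finset.mem_powerset]
    exact ⟨Finset.inter_subset_right, Finset.inter_subset_right⟩
  · rintro ⟨C, B⟩ h
    simp only [Finset.mem_product, Finset.mem_powerset] at h
    have hd := Finset.disjoint_left.1 hPQ
    ext p
    · have h1 := @h.1 p; have h2 := @h.2 p; have h3 := @hd p
      simp only [Finset.mem_inter, Finset.mem_union]; tauto
    · have h1 := @h.1 p; have h2 := @h.2 p; have h3 := @hd p
      simp only [Finset.mem_inter, Finset.mem_union]; tauto
  · intro A h
    simp only [Finset.mem_powerset] at h
    simp only
    rw [← Finset.inter_union_distrib_left, Finset.inter_eq_left.2 h]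
  · rintro ⟨C, B⟩ h
    simp only [Finset.mem_product, Finset.mem_powerset] at h
    have hd : Disjoint C B := Finset.disjoint_of_subset_left h.1
      (Finset.disjoint_of_subset_right h.2 hPQ)
    have e1 : prd (C ∪ B) = prd C * prd B := Finset.prod_union hd
    have e2 : ww (C ∪ B) = ww C * ww B := Finset.prod_union hd
    simp only [e1, e2]

theorem recipSum_union_le {P Q : Finset ℕ} (hPQ : Disjoint P Q) (hP : ∀ p ∈ P, p.Prime)
    (hQ : ∀ p ∈ Q, p.Prime) (y : ℕ) :
    recipSum (P ∪ Q) y ≤ (∏ p ∈ P, (1 + ((p : ℝ) - 1)⁻¹)) * recipSum Q y := by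
  rw [recipSum_union_eq hPQ, Finset.prod_one_add, recipSum, Finset.sum_mul_sum]
  refine Finset.sum_le_sum fun C hC => Finset.sum_le_sum fun B hB => ?_
  have hC' := fun p hp => hP p (Finset.mem_powerset.1 hC hp)
  have hB' := fun p hp => hQ p (Finset.mem_powerset.1 hB hp)
  have h1 : 0 ≤ ww C * ww B := mul_nonneg (ww_nonneg hC') (ww_nonneg hB')
  have h2 : ∏ p ∈ C, ((p : ℝ) - 1)⁻¹ = ww C := rfl
  rw [h2]
  split_ifs with h h'
  · exact le_rfl
  · exact absurd ((Nat.le_mul_of_pos_left _ (prd_pos hC')).trans h) h'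
  · exact h1
  · simp

theorem le_recipSum_union {P Q : Finset ℕ} (hPQ : Disjoint P Q) (hP : ∀ p ∈ P, p.Prime)
    (hQ : ∀ p ∈ Q, p.Prime) (y : ℕ) :
    (∏ p ∈ P, (1 + ((p : ℝ) - 1)⁻¹)) * recipSum Q y ≤ recipSum (P ∪ Q) (prd P * y) := by
  rw [recipSum_union_eq hPQ, Finset.prod_one_add, recipSum, Finset.sum_mul_sum]
  refine Finset.sum_le_sum fun C hC => Finset.sum_le_sum fun B hB => ?_
  have hC' := fun p hp => hP p (Finset.mem_powerset.1 hC hp)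
  have hB' := fun p hp => hQ p (Finset.mem_powerset.1 hB hp)
  have h1 : 0 ≤ ww C * ww B := mul_nonneg (ww_nonneg hC') (ww_nonneg hB')
  have h2 : ∏ p ∈ C, ((p : ℝ) - 1)⁻¹ = ww C := rfl
  rw [h2]
  split_ifs with h h'
  · exact le_rfl
  · refine absurd (Nat.mul_le_mul ?_ h) h'
    exact Nat.le_of_dvd (prd_pos hP) (Finset.prod_dvd_prod_of_subset _ _ _ (Finset.mem_powerset.1 hC))
  · simp [h1]
  · simp

end SquarefreeSums

section Cutoff

/-- A sum of dyadically weighted step functions, used as the cutoff of the sieve. -/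
noncomputable def cutoff (Y J a : ℕ) : ℝ :=
  ∑ j ∈ Finset.range (J + 1), (1 / 2 : ℝ) ^ j * (if a ≤ Y ^ 2 ^ j then 1 else 0)

theorem cutoff_nonneg (Y J a : ℕ) : 0 ≤ cutoff Y J a :=
  Finset.sum_nonneg fun j _ => by split_ifs <;> positivity

theorem cutoff_antitone (Y J : ℕ) : Antitone (cutoff Y J) := fun a b hab =>
  Finset.sum_le_sum fun j _ => by
    split_ifs with h1 h2
    · exact le_rfl
    · exact absurd (hab.trans h1) h2
    · simp
    · exact le_rfl

theorem sum_half_pow_le (n : ℕ) : ∑ j ∈ Finset.range n, (1 / 2 : ℝ) ^ j ≤ 2 := by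
  rw [geom_sum_eq (by norm_num)]
  have : (0 : ℝ) < (1 / 2) ^ n := by positivity
  rw [div_le_iff_of_neg (by norm_num)]
  linarith

theorem cutoff_le_two (Y J a : ℕ) : cutoff Y J a ≤ 2 := by
  refine le_trans (Finset.sum_le_sum fun j _ => ?_) (sum_half_pow_le (J + 1))
  split_ifs
  · simp
  · simp

theorem one_le_cutoff {Y J a : ℕ} (h : a ≤ Y) : 1 ≤ cutoff Y J a := by
  rw [cutoff, Finset.sum_range_succ']
  have : 0 ≤ ∑ j ∈ Finset.range J, (1 / 2 : ℝ) ^ (j + 1) * (if a ≤ Y ^ 2 ^ (j + 1) then 1 else 0) :=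
    Finset.sum_nonneg fun j _ => by split_ifs <;> positivity
  simp only [pow_zero, pow_one, if_pos h]
  linarith

theorem cutoff_eq_zero {Y J a Z : ℕ} (hY : 1 ≤ Y) (hZ : Y ^ 2 ^ J ≤ Z) (h : Z < a) :
    cutoff Y J a = 0 := by
  refine Finset.sum_eq_zero fun j hj => ?_
  rw [if_neg, mul_zero]
  have : Y ^ 2 ^ j ≤ Y ^ 2 ^ J := Nat.pow_le_pow_right hY
    (Nat.pow_le_pow_right two_pos (by have := Finset.mem_range.1 hj; omega))
  omega

theorem sum_half_pow_sq_le (n : ℕ) (e : ℕ → ℝ) (he : ∀ j, e j = 0 ∨ e j = 1) :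
    (∑ j ∈ Finset.range n, (1 / 2 : ℝ) ^ j * e j) ^ 2 ≤
      4 * ∑ j ∈ Finset.range n, (1 / 4 : ℝ) ^ j * e j := by
  have hnn : ∀ j, 0 ≤ e j := fun j => by rcases he j with h | h <;> rw [h]; exact zero_le_one
  have hle : ∀ j, e j ≤ 1 := fun j => by rcases he j with h | h <;> rw [h]; exact zero_le_one
  induction n generalizing e with
  | zero => simp
  | succ n ih =>
    rcases he 0 with h0 | h0
    · rw [Finset.sum_range_succ', Finset.sum_range_succ', h0]
      have := ih (fun j => e (j + 1)) (fun j => he _) (fun j => hnn _) (fun j => hle _)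
      simp_rw [pow_succ', mul_assoc]
      rw [← Finset.mul_sum, ← Finset.mul_sum]
      linarith
    · have h1 : ∑ j ∈ Finset.range (n + 1), (1 / 2 : ℝ) ^ j * e j ≤ 2 :=
        (Finset.sum_le_sum fun j _ => mul_le_of_le_one_right (by positivity) (hle j)).trans
          (sum_half_pow_le _)
      have h2 : 0 ≤ ∑ j ∈ Finset.range (n + 1), (1 / 2 : ℝ) ^ j * e j :=
        Finset.sum_nonneg fun j _ => mul_nonneg (by positivity) (hnn j)
      have h3 : 1 ≤ ∑ j ∈ Finset.range (n + 1), (1 / 4 : ℝ) ^ j * e j := by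
        rw [Finset.sum_range_succ', h0]
        have := Finset.sum_nonneg fun j (_ : j ∈ Finset.range n) =>
          mul_nonneg (by positivity : (0 : ℝ) ≤ (1 / 4) ^ (j + 1)) (hnn (j + 1))
        simp only [pow_zero]
        linarith
      nlinarith

theorem cutoff_sq_le (Y J a : ℕ) : cutoff Y J a ^ 2 ≤
    4 * ∑ j ∈ Finset.range (J + 1), (1 / 4 : ℝ) ^ j * (if a ≤ Y ^ 2 ^ j then 1 else 0) :=
  sum_half_pow_sq_le _ _ fun j => by split_ifs <;> simp

variable {Q : Finset ℕ} (hQ : ∀ p ∈ Q, p.Prime) {G L : ℝ} {Y J : ℕ}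

include hQ

theorem mul_sum_cutoff_ge (hlow : ∀ y, y ≤ Y ^ 2 ^ J → Real.log y ≤ G * recipSum Q y)
    (hY : 1 ≤ Y) :
    (J + 1) * Real.log Y ≤ G * ∑ B ∈ Q.powerset, cutoff Y J (prd B) * ww B := by
  have e : ∑ B ∈ Q.powerset, cutoff Y J (prd B) * ww B =
      ∑ j ∈ Finset.range (J + 1), (1 / 2 : ℝ) ^ j * recipSum Q (Y ^ 2 ^ j) := by
    simp_rw [cutoff, Finset.sum_mul, recipSum, Finset.mul_sum]
    rw [Finset.sum_comm]
    refine Finset.sum_congr rfl fun j _ => Finset.sum_congr rfl fun B _ => ?_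
    split_ifs <;> simp
  rw [e, Finset.mul_sum]
  have : ∀ j ∈ Finset.range (J + 1), Real.log Y ≤ G * ((1 / 2 : ℝ) ^ j * recipSum Q (Y ^ 2 ^ j)) := by
    intro j hj
    have h := hlow (Y ^ 2 ^ j) (Nat.pow_le_pow_right hY
      (Nat.pow_le_pow_right two_pos (by have := Finset.mem_range.1 hj; omega)))
    rw [Nat.cast_pow, Real.log_pow] at h
    push_cast at h
    calc Real.log Y = (1 / 2 : ℝ) ^ j * (2 ^ j * Real.log Y) := by
          rw [← mul_assoc, ← mul_pow]; norm_num
      _ ≤ (1 / 2 : ℝ) ^ j * (G * recipSum Q (Y ^ 2 ^ j)) := mul_le_mul_of_nonneg_left h (by positivity)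
      _ = _ := by ring
  calc ((J : ℝ) + 1) * Real.log Y = ∑ j ∈ Finset.range (J + 1), Real.log Y := by simp
    _ ≤ _ := Finset.sum_le_sum this

theorem mul_sum_cutoff_sq_ge (hG : 0 < G) (hlow : ∀ y, y ≤ Y ^ 2 ^ J → Real.log y ≤ G * recipSum Q y) :
    Real.log Y ≤ G * ∑ B ∈ Q.powerset, cutoff Y J (prd B) ^ 2 * ww B := by
  refine (hlow Y (Nat.le_self_pow (by positivity) Y)).trans (mul_le_mul_of_nonneg_left ?_ hG.le)
  refine Finset.sum_le_sum fun B hB => ?_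
  have hw : 0 ≤ ww B := ww_nonneg fun p hp => hQ p (Finset.mem_powerset.1 hB hp)
  split_ifs with h
  · exact le_mul_of_one_le_left hw (one_le_pow₀ (one_le_cutoff h))
  · positivity

theorem mul_sum_cutoff_sq_le (hG : 0 < G)
    (hup : ∀ y, 1 ≤ y → G * recipSum Q y ≤ 3 * (1 + L + Real.log y)) (hY : 1 ≤ Y)
    (hL : 1 + L ≤ Real.log Y) :
    G * ∑ B ∈ Q.powerset, cutoff Y J (prd B) ^ 2 * ww B ≤ 48 * Real.log Y := by
  have hl0 : 0 ≤ Real.log Y := Real.log_natCast_nonneg Y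
  have e : ∑ B ∈ Q.powerset, cutoff Y J (prd B) ^ 2 * ww B ≤
      ∑ j ∈ Finset.range (J + 1), 4 * (1 / 4 : ℝ) ^ j * recipSum Q (Y ^ 2 ^ j) := by
    simp_rw [recipSum, Finset.mul_sum]
    rw [Finset.sum_comm]
    refine Finset.sum_le_sum fun B hB => ?_
    have hw : 0 ≤ ww B := ww_nonneg fun p hp => hQ p (Finset.mem_powerset.1 hB hp)
    refine (mul_le_mul_of_nonneg_right (cutoff_sq_le Y J _) hw).trans (le_of_eq ?_)
    rw [Finset.mul_sum, Finset.sum_mul]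
    refine Finset.sum_congr rfl fun j _ => ?_
    split_ifs <;> simp [mul_assoc]
  refine (mul_le_mul_of_nonneg_left e hG.le).trans ?_
  rw [Finset.mul_sum]
  have : ∀ j ∈ Finset.range (J + 1), G * (4 * (1 / 4 : ℝ) ^ j * recipSum Q (Y ^ 2 ^ j)) ≤
      24 * Real.log Y * (1 / 2 : ℝ) ^ j := by
    intro j hj
    have h := hup (Y ^ 2 ^ j) (Nat.one_le_pow _ _ hY)
    rw [Nat.cast_pow, Real.log_pow] at h
    push_cast at h
    have h1 : (1 : ℝ) ≤ 2 ^ j := one_le_pow₀ (by norm_num)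
    have h2 : 1 + L + 2 ^ j * Real.log Y ≤ 2 * (2 ^ j * Real.log Y) := by nlinarith
    calc G * (4 * (1 / 4 : ℝ) ^ j * recipSum Q (Y ^ 2 ^ j)) =
        4 * (1 / 4 : ℝ) ^ j * (G * recipSum Q (Y ^ 2 ^ j)) := by ring
      _ ≤ 4 * (1 / 4 : ℝ) ^ j * (3 * (2 * (2 ^ j * Real.log Y))) := 
              mul_le_mul_of_nonneg_left (h.trans (by linarith)) (by positivity)
      _ = 24 * Real.log Y * ((1 / 4 : ℝ) ^ j * 2 ^ j) := by ring
      _ = _ := by rw [← mul_pow]; norm_num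
  refine (Finset.sum_le_sum this).trans ?_
  rw [← Finset.mul_sum]
  have := mul_le_mul_of_nonneg_left (sum_half_pow_le (J + 1)) (by positivity : 0 ≤ 24 * Real.log Y)
  linarith

theorem sum_cutoff_sq_log_le (hG : 0 < G) (hlow : ∀ y, y ≤ Y ^ 2 ^ J → Real.log y ≤ G * recipSum Q y)
    (hup : ∀ y, 1 ≤ y → G * recipSum Q y ≤ 3 * (1 + L + Real.log y)) (hY : 1 ≤ Y)
    (hL : 1 + L ≤ Real.log Y) :
    ∑ B ∈ Q.powerset, cutoff Y J (prd B) ^ 2 * ww B * Real.log (prd B) ≤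
      24 * (J + 1) * Real.log Y * ∑ B ∈ Q.powerset, cutoff Y J (prd B) ^ 2 * ww B := by
  have hl0 : 0 ≤ Real.log Y := Real.log_natCast_nonneg Y
  have e : ∑ B ∈ Q.powerset, cutoff Y J (prd B) ^ 2 * ww B * Real.log (prd B) ≤
      ∑ j ∈ Finset.range (J + 1), 4 * (1 / 4 : ℝ) ^ j * (2 ^ j * Real.log Y) *
        recipSum Q (Y ^ 2 ^ j) := by
    simp_rw [recipSum, Finset.mul_sum]
    rw [Finset.sum_comm]
    refine Finset.sum_le_sum fun B hB => ?_
    have hpr : ∀ p ∈ B, p.Prime := fun p hp => hQ p (Finset.mem_powerset.1 hB hp)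
    have hw : 0 ≤ ww B := ww_nonneg hpr
    have hlg : 0 ≤ Real.log (prd B) := Real.log_natCast_nonneg _
    rw [mul_assoc]
    refine (mul_le_mul_of_nonneg_right (cutoff_sq_le Y J _) (mul_nonneg hw hlg)).trans ?_
    rw [Finset.mul_sum, Finset.sum_mul]
    refine Finset.sum_le_sum fun j _ => ?_
    split_ifs with h
    · have : Real.log (prd B) ≤ 2 ^ j * Real.log Y := by
        have := Real.log_le_log (by exact_mod_cast prd_pos hpr)
          (by exact_mod_cast h : (prd B : ℝ) ≤ ((Y ^ 2 ^ j : ℕ) : ℝ))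
        rwa [Nat.cast_pow, Real.log_pow, Nat.cast_pow, Nat.cast_two] at this
      have h4 : 0 ≤ 4 * (1 / 4 : ℝ) ^ j * ww B := by positivity
      nlinarith [mul_le_mul_of_nonneg_left this h4]
    · simp
  refine e.trans ?_
  rw [← mul_le_mul_iff_right₀ hG]
  have hA2 := mul_sum_cutoff_sq_ge hQ hG hlow (J := J)
  set A2 := ∑ B ∈ Q.powerset, cutoff Y J (prd B) ^ 2 * ww B
  calc _ = ∑ j ∈ Finset.range (J + 1), G * (4 * (1 / 4 : ℝ) ^ j * (2 ^ j * Real.log Y) *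
        recipSum Q (Y ^ 2 ^ j)) := Finset.mul_sum _ _ _
    _ ≤ ∑ j ∈ Finset.range (J + 1), 24 * Real.log Y * Real.log Y := by
        refine Finset.sum_le_sum fun j hj => ?_
        have h := hup (Y ^ 2 ^ j) (Nat.one_le_pow _ _ hY)
        rw [Nat.cast_pow, Real.log_pow] at h
        push_cast at h
        have h1 : (1 : ℝ) ≤ 2 ^ j := one_le_pow₀ (by norm_num)
        have h2 : 1 + L + 2 ^ j * Real.log Y ≤ 2 * (2 ^ j * Real.log Y) := by nlinarith
        calc _ = 4 * ((1 / 4 : ℝ) ^ j * 2 ^ j) * Real.log Y * (G * recipSum Q (Y ^ 2 ^ j)) := by ring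
          _ ≤ 4 * ((1 / 4 : ℝ) ^ j * 2 ^ j) * Real.log Y * (3 * (2 * (2 ^ j * Real.log Y))) := by
              exact mul_le_mul_of_nonneg_left (h.trans (by linarith)) (by positivity)
          _ = 24 * Real.log Y * Real.log Y * ((1 / 4 : ℝ) ^ j * 2 ^ j * 2 ^ j) := by ring
          _ = _ := by rw [← mul_pow, ← mul_pow]; norm_num
    _ = 24 * (J + 1) * Real.log Y * Real.log Y := by simp; ring
    _ ≤ 24 * (J + 1) * Real.log Y * (G * A2) := by gcongr
    _ = _ := by ring

end Cutoff

section Transfer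

theorem sum_finset_subtype (Q : Finset ℕ) (g : Finset ℕ → ℝ) :
    ∑ B : Finset ↥Q, g (B.map (Function.Embedding.subtype _)) = ∑ B ∈ Q.powerset, g B := by
  refine Finset.sum_nbij' (fun B => B.map (Function.Embedding.subtype _))
    (fun B => B.subtype (· ∈ Q)) ?_ ?_ ?_ ?_ ?_
  · intro B _
    rw [Finset.mem_powerset]
    intro p hp
    obtain ⟨q, _, rfl⟩ := Finset.mem_map.1 hp
    exact q.2
  · simp
  · intro B _; ext p; simp
  · intro B hB
    rw [Finset.mem_powerset] at hB
    rw [Finset.subtype_map_of_mem fun x hx => hB hx]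
  · simp

theorem prd_map {Q : Finset ℕ} (B : Finset ↥Q) :
    prd (B.map (Function.Embedding.subtype _)) = sz (fun p : ↥Q => (p : ℕ)) B :=
  Finset.prod_map _ _ _

theorem ww_map {Q : Finset ℕ} (B : Finset ↥Q) :
    ww (B.map (Function.Embedding.subtype _)) = wt (fun p : ↥Q => (p : ℕ)) B :=
  Finset.prod_map _ _ _

end Transfer

section Errors

variable {τ ι : Type} [Fintype τ] [DecidableEq τ] [Fintype ι] [DecidableEq ι]

theorem card_colSupp_fiber_le (A : Finset τ) :
    ((Finset.univ.filter fun x : (τ → Option ι) × (τ → Option ι) =>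
      colSupp x.1 x.2 = A).card : ℝ) ≤ ((Fintype.card ι + 1 : ℝ) ^ 2) ^ A.card := by
  let t : τ → Finset (Option ι) := fun p => if p ∈ A then Finset.univ else {none}
  have hcard : (Fintype.piFinset t).card = (Fintype.card ι + 1) ^ A.card := by
    rw [Fintype.card_piFinset, ← Finset.prod_subset (Finset.subset_univ A), ← Finset.prod_const]
    · exact Finset.prod_congr rfl fun p hp => by simp [t, hp]
    · intro p _ hp; simp [t, hp]
  have hsub : (Finset.univ.filter fun x : (τ → Option ι) × (τ → Option ι) =>
      colSupp x.1 x.2 = A) ⊆ Fintype.piFinset t ×ˢ Fintype.piFinset t := by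
    rintro ⟨U, V⟩ h
    simp only [Finset.mem_filter, Finset.mem_univ, true_and] at h
    have h1 : ∀ p, p ∉ A → U p = none ∧ V p = none := by
      intro p hp
      rw [← h] at hp
      simpa [colSupp, not_or] using hp
    simp only [Finset.mem_product, Fintype.mem_piFinset, t]
    constructor <;> intro p <;> split_ifs with hp <;> simp [h1 p, hp]
  have := Finset.card_le_card hsub
  rw [Finset.card_product, hcard] at this
  calc _ ≤ (((Fintype.card ι + 1) ^ A.card * (Fintype.card ι + 1) ^ A.card : ℕ) : ℝ) := by
        exact_mod_cast this
    _ = _ := by push_cast; rw [← pow_mul, ← pow_add, two_mul]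

theorem abs_coef_le (pr : τ → ℕ) (η : ℕ → ℝ) (hη0 : ∀ a, 0 ≤ η a) (hη2 : ∀ a, η a ≤ 2) (Z : ℕ)
    (U : τ → Option ι) :
    |coef pr η Z U| ≤ 2 ^ Fintype.card ι * (if sz pr (csupp U) ≤ Z * Z then 1 else 0) := by
  rw [coef, abs_mul, abs_mul, abs_pow, abs_neg, abs_one, one_pow, one_mul]
  refine mul_le_mul ?_ (by split_ifs <;> simp) (abs_nonneg _) (by positivity)
  rw [abs_of_nonneg (Finset.prod_nonneg fun i _ => hη0 _)]
  exact (Finset.prod_le_prod (fun i _ => hη0 _) fun i _ => hη2 _).trans (by simp)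

theorem sieve_error_le (pr : τ → ℕ) (hpr : ∀ p, 1 ≤ pr p) (η : ℕ → ℝ) (hη0 : ∀ a, 0 ≤ η a)
    (hη2 : ∀ a, η a ≤ 2) (Z : ℕ) (E : Finset τ → ℝ) (hE : ∀ A, 0 ≤ E A) :
    ∑ U : τ → Option ι, ∑ V, |coef pr η Z U| * |coef pr η Z V| *
        (2 ^ (colSupp U V).card * E (colSupp U V)) ≤
      4 ^ Fintype.card ι * ∑ A, if sz pr A ≤ Z ^ 4 then
        (2 * (Fintype.card ι + 1 : ℝ) ^ 2) ^ A.card * E A else 0 := by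
  let g : Finset τ → ℝ := fun A => if sz pr A ≤ Z ^ 4 then 2 ^ A.card * E A else 0
  have hg : ∀ A, 0 ≤ g A := fun A => by
    simp only [g]; split_ifs
    · exact mul_nonneg (by positivity) (hE A)
    · exact le_rfl
  have hterm : ∀ U V : τ → Option ι, |coef pr η Z U| * |coef pr η Z V| *
        (2 ^ (colSupp U V).card * E (colSupp U V)) ≤ 4 ^ Fintype.card ι * g (colSupp U V) := by
    intro U V
    have h0 : 0 ≤ 2 ^ (colSupp U V).card * E (colSupp U V) := mul_nonneg (by positivity) (hE _)
    have hU := abs_coef_le pr η hη0 hη2 Z U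
    have hV := abs_coef_le pr η hη0 hη2 Z V
    by_cases h1 : sz pr (csupp U) ≤ Z * Z
    swap
    · rw [if_neg h1, mul_zero] at hU
      rw [le_antisymm hU (abs_nonneg _), zero_mul, zero_mul]
      exact mul_nonneg (by positivity) (hg _)
    by_cases h2 : sz pr (csupp V) ≤ Z * Z
    swap
    · rw [if_neg h2, mul_zero] at hV
      rw [le_antisymm hV (abs_nonneg _), mul_zero, zero_mul]
      exact mul_nonneg (by positivity) (hg _)
    rw [if_pos h1, mul_one] at hU
    rw [if_pos h2, mul_one] at hV
    have hs : sz pr (colSupp U V) ≤ Z ^ 4 := by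
      have e : colSupp U V = csupp U ∪ (csupp V \ csupp U) := by
        ext p
        simp only [colSupp, csupp, Finset.mem_filter, Finset.mem_univ, true_and, Finset.mem_union,
          Finset.mem_sdiff]
        tauto
      have h3 : sz pr (csupp V \ csupp U) ≤ sz pr (csupp V) :=
        Finset.prod_le_prod_of_subset_of_one_le' Finset.sdiff_subset fun p _ _ => hpr p
      rw [e, sz, Finset.prod_union Finset.disjoint_sdiff]
      calc _ ≤ (Z * Z) * (Z * Z) := Nat.mul_le_mul h1 (h3.trans h2)
        _ = Z ^ 4 := by ring
    simp only [g, if_pos hs]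
    refine mul_le_mul_of_nonneg_right ?_ h0
    calc _ ≤ (2 : ℝ) ^ Fintype.card ι * 2 ^ Fintype.card ι :=
          mul_le_mul hU hV (abs_nonneg _) (by positivity)
      _ = _ := by rw [← mul_pow]; norm_num
  refine (Finset.sum_le_sum fun U _ => Finset.sum_le_sum fun V _ => hterm U V).trans ?_
  simp_rw [← Finset.mul_sum]
  refine mul_le_mul_of_nonneg_left ?_ (by positivity)
  rw [← Finset.sum_product', Finset.univ_product_univ,
    ← Finset.sum_fiberwise (g := fun x : (τ → Option ι) × (τ → Option ι) => colSupp x.1 x.2)]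
  refine Finset.sum_le_sum fun A _ => ?_
  rw [Finset.sum_congr rfl (g := fun _ => g A) fun x hx => by rw [(Finset.mem_filter.1 hx).2],
    Finset.sum_const, nsmul_eq_mul]
  refine (mul_le_mul_of_nonneg_right (card_colSupp_fiber_le A) (hg A)).trans (le_of_eq ?_)
  simp only [g]
  split_ifs
  · rw [mul_pow]; ring
  · simp

theorem sum_pow_card_le {Q : Finset ℕ} (hQ : ∀ p ∈ Q, p.Prime) (κ : ℝ) (hκ0 : 0 ≤ κ)
    (hκ : ∀ p ∈ Q, κ ≤ p) (X : ℕ) :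
    ∑ A : Finset ↥Q, (if sz (fun p : ↥Q => (p : ℕ)) A ≤ X then κ ^ A.card else 0) ≤ (X : ℝ) ^ 2 := by
  rw [← Finset.sum_filter]
  have hinj : Set.InjOn (sz fun p : ↥Q => (p : ℕ))
      (Finset.univ.filter fun A : Finset ↥Q => sz (fun p : ↥Q => (p : ℕ)) A ≤ X :
        Finset (Finset ↥Q)) := by
    intro A _ B _ h
    rw [← prd_map, ← prd_map] at h
    have hp : ∀ (C : Finset ↥Q), ∀ p ∈ C.map (Function.Embedding.subtype _), p.Prime := by
      intro C p hp
      obtain ⟨q, _, rfl⟩ := Finset.mem_map.1 hp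
      exact hQ _ q.2
    have := congrArg Nat.primeFactors h
    rw [primeFactors_prd (hp A), primeFactors_prd (hp B)] at this
    exact Finset.map_injective _ this
  have hcard : (Finset.univ.filter fun A : Finset ↥Q => sz (fun p : ↥Q => (p : ℕ)) A ≤ X).card ≤ X := by
    rw [← Finset.card_image_of_injOn hinj]
    refine (Finset.card_le_card (t := Finset.Icc 1 X) fun n hn => ?_).trans (by simp)
    obtain ⟨A, hA, rfl⟩ := Finset.mem_image.1 hn
    exact Finset.mem_Icc.2 ⟨Finset.prod_pos fun p _ => (hQ _ p.2).pos, (Finset.mem_filter.1 hA).2⟩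
  calc _ ≤ ∑ A ∈ (Finset.univ.filter fun A : Finset ↥Q => sz (fun p : ↥Q => (p : ℕ)) A ≤ X), (X : ℝ) := by
        refine Finset.sum_le_sum fun A hA => ?_
        have h1 : κ ^ A.card ≤ ((sz (fun p : ↥Q => (p : ℕ)) A : ℕ) : ℝ) := by
          rw [sz, Nat.cast_prod, ← Finset.prod_const]
          exact Finset.prod_le_prod (fun _ _ => hκ0) fun p _ => hκ _ p.2
        exact h1.trans (by exact_mod_cast (Finset.mem_filter.1 hA).2)
    _ ≤ _ := by
        rw [Finset.sum_const, nsmul_eq_mul, sq]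
        gcongr

end Errors

section Residues

variable {Q : Finset ℕ}

theorem exists_residue_class (hQ : ∀ p ∈ Q, p.Prime) {W : ℕ} (hW : ∀ p ∈ Q, p.Coprime W) (b : ℕ)
    (a : ∀ p : ↥Q, ZMod p) (A : Finset ↥Q) :
    ∃ c, ∀ n, n ≡ c [MOD sz (fun p : ↥Q => (p : ℕ)) A * W] ↔
      n ≡ b [MOD W] ∧ ∀ p ∈ A, (n : ZMod p) = a p := by
  induction A using Finset.induction_on with
  | empty => exact ⟨b, fun n => by simp [sz]⟩
  | insert p A hp ih =>
    obtain ⟨c, hc⟩ := ih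
    have : NeZero (p : ℕ) := ⟨(hQ _ p.2).ne_zero⟩
    have hcop : Nat.Coprime p (sz (fun p : ↥Q => (p : ℕ)) A * W) := by
      refine Nat.Coprime.mul_right ?_ (hW _ p.2)
      refine Nat.Coprime.prod_right fun q hq => ?_
      refine (Nat.coprime_primes (hQ _ p.2) (hQ _ q.2)).2 fun h => hp ?_
      rwa [Subtype.ext h]
    obtain ⟨d, hd1, hd2⟩ := Nat.chineseRemainder hcop (a p).val c
    refine ⟨d, fun n => ?_⟩
    have e : sz (fun p : ↥Q => (p : ℕ)) (insert p A) * W =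
        p * (sz (fun p : ↥Q => (p : ℕ)) A * W) := by
      rw [sz, Finset.prod_insert hp, mul_assoc]; rfl
    rw [e, ← Nat.modEq_and_modEq_iff_modEq_mul hcop]
    have h1 : n ≡ d [MOD p] ↔ (n : ZMod p) = a p := by
      rw [← ZMod.natCast_eq_natCast_iff, (ZMod.natCast_eq_natCast_iff _ _ _).2 hd1,
        ZMod.natCast_zmod_val]
    have h2 : n ≡ d [MOD sz (fun p : ↥Q => (p : ℕ)) A * W] ↔
        n ≡ c [MOD sz (fun p : ↥Q => (p : ℕ)) A * W] :=
      ⟨fun h => h.trans hd2, fun h => h.trans hd2.symm⟩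
    rw [h1, h2, hc, Finset.forall_mem_insert]
    tauto

theorem abs_count_sub_le (L r v : ℕ) (hr : 0 < r) :
    |(((Finset.range L).filter fun n => n ≡ v [MOD r]).card : ℝ) - L / r| ≤ 1 := by
  rw [← Nat.count_eq_card_filter_range, Nat.count_modEq_card _ hr]
  have hr' : (0 : ℝ) < r := by exact_mod_cast hr
  have h1 : (L : ℝ) = r * (L / r : ℕ) + (L % r : ℕ) := by exact_mod_cast (Nat.div_add_mod L r).symm
  have h2 : ((L % r : ℕ) : ℝ) < r := by exact_mod_cast Nat.mod_lt L hr
  have h3 : (0 : ℝ) ≤ (L % r : ℕ) := by positivity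
  have h4 : (L : ℝ) / r = (L / r : ℕ) + ((L % r : ℕ) : ℝ) / r := by
    rw [div_eq_iff hr'.ne', add_mul, div_mul_cancel₀ _ hr'.ne']
    linarith
  have h5 : ((L % r : ℕ) : ℝ) / r ≤ 1 := (div_le_one hr').2 h2.le
  have h6 : 0 ≤ ((L % r : ℕ) : ℝ) / r := by positivity
  rw [h4, abs_le]
  push_cast
  split_ifs <;> constructor <;> linarith

theorem count_residue_error (hQ : ∀ p ∈ Q, p.Prime) {W : ℕ} (hW0 : 0 < W)
    (hW : ∀ p ∈ Q, p.Coprime W) (b L : ℕ) (A : Finset ↥Q) (a : ∀ p : ↥Q, ZMod p) :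
    |∑ n ∈ (Finset.range L).filter (fun n => n ≡ b [MOD W]),
        (1 : ℝ) * (if ∀ p ∈ A, (n : ZMod p) = a p then 1 else 0) -
      (L / W : ℝ) * ∏ p ∈ A, ((p : ℕ) : ℝ)⁻¹| ≤ 1 := by
  obtain ⟨c, hc⟩ := exists_residue_class hQ hW b a A
  have h1 : ∑ n ∈ (Finset.range L).filter (fun n => n ≡ b [MOD W]),
        (1 : ℝ) * (if ∀ p ∈ A, (n : ZMod p) = a p then 1 else 0) =
      ((Finset.range L).filter fun n => n ≡ c [MOD sz (fun p : ↥Q => (p : ℕ)) A * W]).card := by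
    simp_rw [hc, one_mul]
    rw [← Finset.sum_filter, Finset.filter_filter, Finset.sum_const, nsmul_eq_mul, mul_one]
  have h2 : (L / W : ℝ) * ∏ p ∈ A, ((p : ℕ) : ℝ)⁻¹ =
      L / ((sz (fun p : ↥Q => (p : ℕ)) A * W : ℕ) : ℝ) := by
    rw [Finset.prod_inv_distrib, ← Nat.cast_prod, Nat.cast_mul, div_mul_eq_div_div_swap, sz]
    rfl
  rw [h1, h2]
  exact abs_count_sub_le _ _ _ (Nat.mul_pos (Finset.prod_pos fun p _ => (hQ _ p.2).pos) hW0)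

theorem totient_sz_mul (hQ : ∀ p ∈ Q, p.Prime) {W : ℕ} (hW : ∀ p ∈ Q, p.Coprime W)
    (A : Finset ↥Q) :
    (((sz (fun p : ↥Q => (p : ℕ)) A * W).totient : ℕ) : ℝ) =
      (∏ p ∈ A, (((p : ℕ) : ℝ) - 1)) * W.totient := by
  induction A using Finset.induction_on with
  | empty => simp [sz]
  | insert p A hp ih =>
    have hcop : Nat.Coprime p (sz (fun p : ↥Q => (p : ℕ)) A * W) := by
      refine Nat.Coprime.mul_right ?_ (hW _ p.2)
      refine Nat.Coprime.prod_right fun q hq => ?_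
      refine (Nat.coprime_primes (hQ _ p.2) (hQ _ q.2)).2 fun h => hp ?_
      rwa [Subtype.ext h]
    have e : sz (fun p : ↥Q => (p : ℕ)) (insert p A) * W =
        p * (sz (fun p : ↥Q => (p : ℕ)) A * W) := by
      rw [sz, Finset.prod_insert hp, mul_assoc]; rfl
    rw [e, Nat.totient_mul hcop, Nat.cast_mul, ih, Finset.prod_insert hp,
      Nat.totient_prime (hQ _ p.2), Nat.cast_sub (hQ _ p.2).one_le, Nat.cast_one, mul_assoc]

theorem squarefree_sz (hQ : ∀ p ∈ Q, p.Prime) (A : Finset ↥Q) :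
    Squarefree (sz (fun p : ↥Q => (p : ℕ)) A) := by
  refine Finset.squarefree_prod_of_pairwise_isCoprime ?_ fun p _ => (hQ _ p.2).squarefree
  · intro p _ q _ hpq
    rw [Function.onFun, ← Nat.coprime_iff_isRelPrime]
    exact (Nat.coprime_primes (hQ _ p.2) (hQ _ q.2)).2 fun h => hpq (Subtype.ext h)

theorem coprime_sz {W : ℕ} (hW : ∀ p ∈ Q, p.Coprime W) (A : Finset ↥Q) :
    (sz (fun p : ↥Q => (p : ℕ)) A).Coprime W :=
  Nat.Coprime.prod_left fun p _ => hW _ p.2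

theorem exists_admissible_residue {ι : Type} [Fintype ι] (h : ι → ℕ)
    (hM : ∀ i, (Fintype.card ι).factorial ∣ h i) (s : Finset ℕ) (hs : ∀ p ∈ s, p.Prime) :
    ∃ b, ∀ i, (b + h i).Coprime (∏ p ∈ s, p) := by
  have loc : ∀ p : ℕ, p.Prime → ∃ a : ZMod p, ∀ i, a + (h i : ZMod p) ≠ 0 := by
    intro p hp
    have := Fact.mk hp
    rcases le_or_gt p (Fintype.card ι) with hle | hlt
    · refine ⟨1, fun i => ?_⟩
      have : (h i : ZMod p) = 0 := (ZMod.natCast_eq_zero_iff _ _).2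
        ((Nat.dvd_factorial hp.pos hle).trans (hM i))
      rw [this, add_zero]
      exact one_ne_zero
    · by_contra hcon
      push Not at hcon
      choose f hf using hcon
      have hinj : Function.Injective f := by
        intro a a' e
        have h1 := hf a; have h2 := hf a'
        rw [e] at h1
        exact add_right_cancel (h1.trans h2.symm)
      have := Fintype.card_le_of_injective f hinj
      rw [ZMod.card] at this
      omega
  have key : ∃ b : ℕ, ∀ p ∈ s, ∀ i, ((b : ZMod p) + (h i : ZMod p)) ≠ 0 := by
    induction s using Finset.induction_on with
    | empty => exact ⟨0, by simp⟩
    | insert p s hp ih =>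
      obtain ⟨b, hb⟩ := ih fun q hq => hs q (Finset.mem_insert_of_mem hq)
      have hpp := hs p (Finset.mem_insert_self _ _)
      obtain ⟨a, ha⟩ := loc p hpp
      have : NeZero p := ⟨hpp.ne_zero⟩
      have hcop : Nat.Coprime p (∏ q ∈ s, q) := Nat.Coprime.prod_right fun q hq =>
        (Nat.coprime_primes hpp (hs q (Finset.mem_insert_of_mem hq))).2 fun e => hp (e ▸ hq)
      obtain ⟨d, hd1, hd2⟩ := Nat.chineseRemainder hcop a.val b
      refine ⟨d, fun q hq i => ?_⟩
      rcases Finset.mem_insert.1 hq with rfl | hq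
      · rw [(ZMod.natCast_eq_natCast_iff _ _ _).2 hd1, ZMod.natCast_zmod_val]
        exact ha i
      · rw [(ZMod.natCast_eq_natCast_iff _ _ _).2 (hd2.of_dvd (Finset.dvd_prod_of_mem _ hq))]
        exact hb q hq i
  obtain ⟨b, hb⟩ := key
  refine ⟨b, fun i => Nat.Coprime.prod_right fun p hp => ?_⟩
  rw [Nat.coprime_comm, (hs p hp).coprime_iff_not_dvd, ← ZMod.natCast_eq_zero_iff]
  push_cast
  exact hb p hp i

end Residues

section PrimeSide

/-- `PrimeWeightsFor c W κ δ N w T E` says that the nonnegative weight `w` on the primes of size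
about `N` has total mass `T` and is well distributed, on weighted average over moduli `q * W`. -/
structure PrimeWeightsFor (c : ℝ) (W : ℕ) (κ δ : ℝ) (N : ℕ) (w : ℕ → ℝ) (T : ℝ) (E : ℕ → ℝ) :
    Prop where
  nonneg : ∀ l, 0 ≤ w l
  le_log : ∀ l, w l ≤ Real.log (3 * N)
  prime : ∀ l, w l ≠ 0 → l.Prime
  le_three_mul : ∀ l, w l ≠ 0 → N ≤ 3 * l
  le : ∀ l, w l ≠ 0 → l ≤ 3 * N
  mass : c * N ≤ T
  error_nonneg : ∀ q, 0 ≤ E q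
  error : ∀ q, Squarefree q → q.Coprime W → q ^ 50 ≤ N → ∀ a, a.Coprime (q * W) →
    |∑ l ∈ Finset.range (3 * N + 1), (if l ≡ a [MOD q * W] then w l else 0) -
      T / (q * W).totient| ≤ E q
  sum_error : ∑ q ∈ (Finset.Icc 1 N).filter (fun q => Squarefree q ∧ q.Coprime W ∧ q ^ 50 ≤ N),
    κ ^ q.primeFactors.card * E q ≤ δ * N

variable {Q : Finset ℕ} {c : ℝ} {W : ℕ} {κ δ : ℝ} {N : ℕ} {w : ℕ → ℝ} {T : ℝ} {E : ℕ → ℝ}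

/-- The error function for the prime side of the sieve. -/
noncomputable def primeError (N : ℕ) (w : ℕ → ℝ) (T : ℝ) (E : ℕ → ℝ) (q : ℕ) : ℝ :=
  if q ^ 50 ≤ N then E q else ∑ l ∈ Finset.range (3 * N + 1), w l + T

theorem prime_residue_error (hc : 0 ≤ c) (H : PrimeWeightsFor c W κ δ N w T E)
    (hQ : ∀ p ∈ Q, p.Prime) (hW0 : 0 < W)
    (hW : ∀ p ∈ Q, p.Coprime W) (hQN : ∀ p ∈ Q, 3 * p < N) (b h : ℕ) (hb : (b + h).Coprime W)
    (hN : 3 * h ≤ N) (A : Finset ↥Q) (a : ∀ p : ↥Q, ZMod p) :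
    |∑ n ∈ (Finset.range (3 * N + 1)).filter (fun n => n ≡ b [MOD W]),
        w (n + h) * (if ∀ p ∈ A, (n : ZMod p) = a p then 1 else 0) -
      (T / W.totient : ℝ) * ∏ p ∈ A, (if a p = -(h : ZMod p) then 0 else (((p : ℕ) : ℝ) - 1)⁻¹)| ≤
      primeError N w T E (sz (fun p : ↥Q => (p : ℕ)) A) := by
  have hT : 0 ≤ T := le_trans (by positivity) H.mass
  have hE0 : 0 ≤ primeError N w T E (sz (fun p : ↥Q => (p : ℕ)) A) := by
    rw [primeError]
    split_ifs
    · exact H.error_nonneg _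
    · exact add_nonneg (Finset.sum_nonneg fun l _ => H.nonneg l) hT
  have hφ : (1 : ℝ) ≤ W.totient := by exact_mod_cast Nat.totient_pos.2 hW0
  by_cases hz : ∃ p ∈ A, a p = -(h : ZMod p)
  · obtain ⟨p, hpA, hp⟩ := hz
    rw [Finset.prod_eq_zero hpA (by rw [if_pos hp]), mul_zero, Finset.sum_eq_zero, sub_zero, abs_zero]
    · exact hE0
    · intro n _
      by_cases hw : w (n + h) = 0
      · rw [hw, zero_mul]
      rw [if_neg, mul_zero]
      intro hn
      have h1 : ((n + h : ℕ) : ZMod p) = 0 := by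
        push_cast; rw [hn p hpA, hp]; ring
      have h2 := (ZMod.natCast_eq_zero_iff _ _).1 h1
      have h3 := (Nat.prime_dvd_prime_iff_eq (hQ _ p.2) (H.prime _ hw)).1 h2
      have h4 := hQN _ p.2
      have h5 := H.le_three_mul _ hw
      omega
  push Not at hz
  have hprod : ∏ p ∈ A, (if a p = -(h : ZMod p) then (0 : ℝ) else (((p : ℕ) : ℝ) - 1)⁻¹) =
      (∏ p ∈ A, (((p : ℕ) : ℝ) - 1))⁻¹ := by
    rw [← Finset.prod_inv_distrib]
    exact Finset.prod_congr rfl fun p hp => by rw [if_neg (hz p hp)]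
  obtain ⟨d, hd⟩ := exists_residue_class hQ hW b a A
  have hsum : ∑ n ∈ (Finset.range (3 * N + 1)).filter (fun n => n ≡ b [MOD W]),
        w (n + h) * (if ∀ p ∈ A, (n : ZMod p) = a p then 1 else 0) =
      ∑ l ∈ Finset.range (3 * N + 1),
        (if l ≡ d + h [MOD sz (fun p : ↥Q => (p : ℕ)) A * W] then w l else 0) := by
    simp_rw [mul_ite, mul_one, mul_zero]
    rw [← Finset.sum_filter, Finset.filter_filter]
    simp_rw [← hd]
    rw [Finset.sum_filter]
    refine Finset.sum_bij_ne_zero (fun n _ _ => n + h) ?_ ?_ ?_ ?_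
    · intro n _ hne
      split_ifs at hne with h1
      · exact Finset.mem_range.2 (Nat.lt_succ_of_le (H.le _ hne))
      · exact absurd rfl hne
    · intro n _ _ n' _ _ e; exact Nat.add_right_cancel e
    · intro l hl hne
      split_ifs at hne with h1
      · have h2 := H.le_three_mul _ hne
        have h3 := Finset.mem_range.1 hl
        have hlh : l - h + h = l := by omega
        refine ⟨l - h, Finset.mem_range.2 (by omega), ?_, hlh⟩
        rw [hlh, if_pos]
        · exact hne
        · exact Nat.ModEq.add_right_cancel' h (by rw [hlh]; exact h1)
      · exact absurd rfl hne
    · intro n _ _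
      by_cases h1 : n ≡ d [MOD sz (fun p : ↥Q => (p : ℕ)) A * W]
      · rw [if_pos h1, if_pos (h1.add_right h)]
      · rw [if_neg h1, if_neg fun h2 => h1 (Nat.ModEq.add_right_cancel' h h2)]
  have htot : (T / W.totient : ℝ) * (∏ p ∈ A, (((p : ℕ) : ℝ) - 1))⁻¹ =
      T / ((sz (fun p : ↥Q => (p : ℕ)) A * W).totient : ℕ) := by
    rw [totient_sz_mul hQ hW, div_mul_eq_div_div_swap, div_eq_mul_inv (T / _)]
  rw [hprod, hsum, htot]
  rw [primeError]
  split_ifs with hs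
  · refine H.error _ (squarefree_sz hQ A) (coprime_sz hW A) hs _ ?_
    have hdd := (hd d).1 (Nat.ModEq.refl d)
    refine Nat.Coprime.mul_right (Nat.Coprime.prod_right fun p hp => ?_) ?_
    · rw [Nat.coprime_comm, (hQ _ p.2).coprime_iff_not_dvd, ← ZMod.natCast_eq_zero_iff]
      push_cast
      rw [hdd.2 p hp]
      intro e
      exact hz p hp (eq_neg_of_add_eq_zero_left e)
    · rw [Nat.Coprime, (hdd.1.add_right h).gcd_eq]
      exact hb
  · have h1 : 0 ≤ T / ((sz (fun p : ↥Q => (p : ℕ)) A * W).totient : ℕ) := by positivity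
    have h2 : T / ((sz (fun p : ↥Q => (p : ℕ)) A * W).totient : ℕ) ≤ T := by
      have hpos : 0 < sz (fun p : ↥Q => (p : ℕ)) A * W :=
        Nat.mul_pos (Finset.prod_pos fun p _ => (hQ _ p.2).pos) hW0
      refine div_le_self hT ?_
      exact_mod_cast Nat.totient_pos.2 hpos
    have h3 : 0 ≤ ∑ l ∈ Finset.range (3 * N + 1),
        (if l ≡ d + h [MOD sz (fun p : ↥Q => (p : ℕ)) A * W] then w l else 0) :=
      Finset.sum_nonneg fun l _ => by split_ifs; exacts [H.nonneg l, le_rfl]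
    have h4 : ∑ l ∈ Finset.range (3 * N + 1),
        (if l ≡ d + h [MOD sz (fun p : ↥Q => (p : ℕ)) A * W] then w l else 0) ≤
        ∑ l ∈ Finset.range (3 * N + 1), w l :=
      Finset.sum_le_sum fun l _ => by split_ifs; exacts [le_rfl, H.nonneg l]
    rw [abs_le]
    constructor <;> linarith

theorem sum_primeError_le (H : PrimeWeightsFor c W κ δ N w T E) (hκ : 0 ≤ κ)
    (hQ : ∀ p ∈ Q, p.Prime) (hW : ∀ p ∈ Q, p.Coprime W) (X : ℕ) (hX : X ^ 50 ≤ N) :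
    ∑ A : Finset ↥Q, (if sz (fun p : ↥Q => (p : ℕ)) A ≤ X then
      κ ^ A.card * primeError N w T E (sz (fun p : ↥Q => (p : ℕ)) A) else 0) ≤ δ * N := by
  refine le_trans ?_ H.sum_error
  rw [← Finset.sum_filter]
  have hp : ∀ (C : Finset ↥Q), ∀ p ∈ C.map (Function.Embedding.subtype _), p.Prime := by
    intro C p hp
    obtain ⟨q, _, rfl⟩ := Finset.mem_map.1 hp
    exact hQ _ q.2
  have hinj : Set.InjOn (sz fun p : ↥Q => (p : ℕ))
      (Finset.univ.filter fun A : Finset ↥Q => sz (fun p : ↥Q => (p : ℕ)) A ≤ X :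
        Finset (Finset ↥Q)) := by
    intro A _ B _ h
    rw [← prd_map, ← prd_map] at h
    have := congrArg Nat.primeFactors h
    rw [primeFactors_prd (hp A), primeFactors_prd (hp B)] at this
    exact Finset.map_injective _ this
  refine le_trans (le_of_eq ?_) (Finset.sum_le_sum_of_subset_of_nonneg
    (s := (Finset.univ.filter fun A : Finset ↥Q => sz (fun p : ↥Q => (p : ℕ)) A ≤ X).image
      (sz fun p : ↥Q => (p : ℕ))) ?_ ?_)
  · rw [Finset.sum_image hinj]
    refine Finset.sum_congr rfl fun A hA => ?_
    have hA := (Finset.mem_filter.1 hA).2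
    rw [primeError, if_pos ((Nat.pow_le_pow_left hA 50).trans hX), ← prd_map,
      primeFactors_prd (hp A), Finset.card_map]
  · intro q hq
    obtain ⟨A, hA, rfl⟩ := Finset.mem_image.1 hq
    have hA := (Finset.mem_filter.1 hA).2
    have h50 := (Nat.pow_le_pow_left hA 50).trans hX
    refine Finset.mem_filter.2 ⟨Finset.mem_Icc.2 ⟨Finset.prod_pos fun p _ => (hQ _ p.2).pos, ?_⟩,
      squarefree_sz hQ A, coprime_sz hW A, h50⟩
    exact (Nat.le_self_pow (by norm_num) _).trans h50
  · intro q _ _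
    exact mul_nonneg (by positivity) (H.error_nonneg q)

end PrimeSide

section Comparison

variable {k : ℕ} {Q : Finset ℕ} {c : ℝ} {W : ℕ} {δ : ℝ} {N : ℕ} {w : ℕ → ℝ} {T : ℝ} {E : ℕ → ℝ}

theorem sieve_comparison (hk : 2 ≤ k) (h : Fin k → ℕ) (hinj : Function.Injective h) (hc : 0 ≤ c)
    (H : PrimeWeightsFor c W (2 * (k + 1 : ℝ) ^ 2) δ N w T E) (hQ : ∀ p ∈ Q, p.Prime) (hW0 : 0 < W)
    (hW : ∀ p ∈ Q, p.Coprime W) (hQN : ∀ p ∈ Q, 3 * p < N) (hQh : ∀ p ∈ Q, ∀ i, h i < p)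
    (hQk : ∀ p ∈ Q, 2 * (k + 1) ^ 2 ≤ p) (hhN : ∀ i, 3 * h i ≤ N) (b : ℕ)
    (hb : ∀ i, (b + h i).Coprime W) (η : ℕ → ℝ) (hη : Antitone η) (hη0 : ∀ a, 0 ≤ η a)
    (hη2 : ∀ a, η a ≤ 2) (Z : ℕ) (hZ : 2 ≤ Z) (hηZ : ∀ a, Z < a → η a = 0)
    (hZN : (Z ^ 4) ^ 50 ≤ N)
    (hS : 16 * (k : ℝ) ^ 2 * ∑ p ∈ Q, ((p : ℝ) - 1)⁻¹ ^ 2 ≤ 1) (Λ : ℝ) (hΛ0 : 0 ≤ Λ)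
    (hΛ : ∑ B ∈ Q.powerset, η (prd B) ^ 2 * ww B * Real.log (prd B) ≤
      Λ * ∑ B ∈ Q.powerset, η (prd B) ^ 2 * ww B) (hΛZ : 4 * k * Λ ≤ Real.log Z)
    (hno : ∀ n i j, i ≠ j → (n + h i).Prime → ¬(n + h j).Prime) :
    k * (T / W.totient * (1 / 2 * (∑ B ∈ Q.powerset, η (prd B) * ww B) ^ 2 *
      (∑ B ∈ Q.powerset, η (prd B) ^ 2 * ww B) ^ (k - 1)) - 4 ^ k * (δ * N)) ≤
    Real.log (3 * N) * (((3 * N + 1 : ℕ) : ℝ) / W * ((∏ p ∈ Q, (1 + ((p : ℝ) * (p - 2))⁻¹)) *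
      (∑ B ∈ Q.powerset, η (prd B) ^ 2 * ww B) ^ k) + 4 ^ k * ((Z ^ 4 : ℕ) : ℝ) ^ 2) := by
  set pr : ↥Q → ℕ := fun p => p with hpr_def
  have : ∀ p : ↥Q, NeZero (p : ℕ) := fun p => ⟨(hQ _ p.2).ne_zero⟩
  have hk9 : 2 * 3 ^ 2 ≤ 2 * (k + 1) ^ 2 := by gcongr; omega
  have hpr3 : ∀ p, 3 ≤ pr p := fun p => by have := hQk _ p.2; simp only [pr]; omega
  have hprk : ∀ p, Fintype.card (Fin k) + 1 ≤ pr p := fun p => by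
    have := hQk _ p.2
    rw [Fintype.card_fin]; simp only [pr]; nlinarith
  have hcard : ∀ p : ↥Q, Fintype.card (ZMod p) = pr p := fun p => ZMod.card _
  let r : ∀ p : ↥Q, Fin k → ZMod p := fun p i => -(h i : ZMod p)
  have hr : ∀ p, Function.Injective (r p) := by
    intro p i j hij
    have h1 : ((h i : ℕ) : ZMod p) = h j := neg_injective hij
    rw [ZMod.natCast_eq_natCast_iff', Nat.mod_eq_of_lt (hQh _ p.2 i),
      Nat.mod_eq_of_lt (hQh _ p.2 j)] at h1
    exact hinj h1
  let f : ℕ → ℝ := fun n => (∑ U, coef pr η Z U * ∏ p, locW (pr p) (r p) (U p) (n : ZMod p)) ^ 2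
  have hf : ∀ n, 0 ≤ f n := fun n => sq_nonneg _
  have eA : ∀ g : ℕ → ℝ, ∑ B : Finset ↥Q, g (sz pr B) * wt pr B =
      ∑ B ∈ Q.powerset, g (prd B) * ww B := fun g => by
    rw [← sum_finset_subtype]
    simp_rw [prd_map, ww_map, hpr_def]
  have eA1 := eA η
  have eA2 := eA fun a => η a ^ 2
  have eL := eA fun a => η a ^ 2 * Real.log a
  set A1 := ∑ B ∈ Q.powerset, η (prd B) * ww B
  set A2 := ∑ B ∈ Q.powerset, η (prd B) ^ 2 * ww B
  set I := (Finset.range (3 * N + 1)).filter fun n => n ≡ b [MOD W]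
  have hlow : ∀ i, T / W.totient * (1 / 2 * A1 ^ 2 * A2 ^ (k - 1)) - 4 ^ k * (δ * N) ≤
      ∑ n ∈ I, w (n + h i) * f n := by
    intro i
    have hE0 : ∀ A : Finset ↥Q, 0 ≤ primeError N w T E (sz pr A) := fun A =>
      (abs_nonneg _).trans (prime_residue_error hc H hQ hW0 hW hQN b (h i) (hb i) (hhN i) A 0)
    have h1 := sieve_second_moment (Ω := fun p : ↥Q => ZMod p) pr hpr3 hcard
      (fun p n => (n : ZMod p)) r I (fun n => w (n + h i))
      (T / W.totient) (fun p x => if x = r p i then 0 else ((pr p : ℝ) - 1)⁻¹) (fun p => by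
        have h3 : (3 : ℝ) ≤ pr p := by exact_mod_cast hpr3 p
        rw [Finset.sum_ite, Finset.sum_const_zero, zero_add, Finset.sum_const,
          Finset.filter_ne' Finset.univ (r p i), Finset.card_erase_of_mem (Finset.mem_univ _),
          Finset.card_univ, hcard, nsmul_eq_mul, Nat.cast_sub (by have := hpr3 p; omega)]
        rw [Nat.cast_one, mul_inv_cancel₀]; linarith)
      (fun A => primeError N w T E (sz pr A))
      (fun A a => prime_residue_error hc H hQ hW0 hW hQN b (h i) (hb i) (hhN i) A a) (coef pr η Z)
    have h2 := half_le_diag (Ω := fun p : ↥Q => ZMod p) pr hpr3 hprk hcard r hr η hη hη0 Z hZ hηZ i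
      (by
        rw [Fintype.card_fin, hpr_def]
        rwa [← Finset.sum_coe_sort Q] at hS) Λ hΛ0
      (by
        rw [eA2]
        refine le_trans (le_of_eq ?_) (hΛ.trans_eq rfl)
        rw [← Finset.sum_congr rfl fun B _ => mul_right_comm _ _ _, eL]
        exact Finset.sum_congr rfl fun B _ => mul_right_comm _ _ _) (by rwa [Fintype.card_fin])
    have h3 := sieve_error_le (ι := Fin k) pr (fun p => le_trans (by norm_num) (hpr3 p)) η hη0 hη2 Z
      (fun A => primeError N w T E (sz pr A)) hE0
    have h4 := sum_primeError_le H (by positivity) hQ hW (Z ^ 4) hZN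
    rw [Fintype.card_fin] at h2 h3
    rw [eA1, eA2] at h2
    have h5 := (abs_le.1 (h1.trans (h3.trans (mul_le_mul_of_nonneg_left h4 (by positivity))))).1
    have h6 : 0 ≤ T / W.totient :=
      div_nonneg (le_trans (by positivity) H.mass) (by positivity)
    have h7 := mul_le_mul_of_nonneg_left h2 h6
    simp only [f]
    linarith
  have hup : ∑ n ∈ I, f n ≤ ((3 * N + 1 : ℕ) : ℝ) / W *
      ((∏ p ∈ Q, (1 + ((p : ℝ) * (p - 2))⁻¹)) * A2 ^ k) + 4 ^ k * ((Z ^ 4 : ℕ) : ℝ) ^ 2 := by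
    have h1 := sieve_second_moment (Ω := fun p : ↥Q => ZMod p) pr hpr3 hcard
      (fun p n => (n : ZMod p)) r I (fun _ => 1)
      (((3 * N + 1 : ℕ) : ℝ) / W) (fun p _ => ((pr p : ℝ))⁻¹) (fun p => by
        rw [Finset.sum_const, Finset.card_univ, hcard, nsmul_eq_mul, mul_inv_cancel₀]
        have := hpr3 p
        positivity)
      (fun A => 1)
      (fun A a => count_residue_error hQ hW0 hW b (3 * N + 1) A a) (coef pr η Z)
    have h2 := diag_upper (Ω := fun p : ↥Q => ZMod p) pr hpr3 hcard r hr η Z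
    have h3 := sieve_error_le (ι := Fin k) pr (fun p => le_trans (by norm_num) (hpr3 p)) η hη0 hη2 Z
      (fun A => 1) fun _ => zero_le_one
    have h4 := sum_pow_card_le hQ (2 * (k + 1 : ℝ) ^ 2) (by positivity)
      (fun p hp => by exact_mod_cast hQk p hp) (Z ^ 4)
    simp_rw [mul_one, Fintype.card_fin] at h3
    rw [Fintype.card_fin, eA2] at h2
    simp_rw [mul_one] at h1
    have h5 := (abs_le.1 (h1.trans (h3.trans (mul_le_mul_of_nonneg_left h4 (by positivity))))).2
    have h7 := mul_le_mul_of_nonneg_left h2 (by positivity : 0 ≤ ((3 * N + 1 : ℕ) : ℝ) / W)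
    have e : ∏ p, (1 + ((pr p : ℝ) * (pr p - 2))⁻¹) = ∏ p ∈ Q, (1 + ((p : ℝ) * (p - 2))⁻¹) := by
      rw [← Finset.prod_coe_sort Q]
    rw [e] at h7
    simp_rw [one_mul] at h5
    linarith
  have hpt : ∀ n, ∑ i, w (n + h i) ≤ Real.log (3 * N) := by
    intro n
    by_cases hz : ∃ i, w (n + h i) ≠ 0
    · obtain ⟨i, hi⟩ := hz
      rw [Finset.sum_eq_single i]
      · exact H.le_log _
      · intro j _ hj
        by_contra hne
        exact hno n i j hj.symm (H.prime _ hi) (H.prime _ hne)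
      · simp
    · push Not at hz
      rw [Finset.sum_eq_zero fun i _ => hz i]
      have := H.le_log 0
      exact (H.nonneg 0).trans this
  have hlog : 0 ≤ Real.log (3 * N) := (H.nonneg 0).trans (H.le_log 0)
  calc _ = ∑ i : Fin k, (T / W.totient * (1 / 2 * A1 ^ 2 * A2 ^ (k - 1)) - 4 ^ k * (δ * N)) := by
        rw [Finset.sum_const, Finset.card_univ, Fintype.card_fin, nsmul_eq_mul]
    _ ≤ ∑ i : Fin k, ∑ n ∈ I, w (n + h i) * f n := Finset.sum_le_sum fun i _ => hlow i
    _ = ∑ n ∈ I, (∑ i, w (n + h i)) * f n := by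
        rw [Finset.sum_comm]; simp_rw [Finset.sum_mul]
    _ ≤ ∑ n ∈ I, Real.log (3 * N) * f n :=
        Finset.sum_le_sum fun n _ => mul_le_mul_of_nonneg_right (hpt n) (hf n)
    _ ≤ _ := by
        rw [← Finset.mul_sum]
        exact mul_le_mul_of_nonneg_left hup hlog

end Comparison

section BoundedGaps

theorem sum_inv_sub_one_sq_le {Q : Finset ℕ} {D : ℕ} (hD : 1 ≤ D) (hQ : ∀ p ∈ Q, D < p) :
    ∑ p ∈ Q, ((p : ℝ) - 1)⁻¹ ^ 2 ≤ 2 / D := by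
  have h := sum_Ioo_inv_sq_le (α := ℝ) (D - 1) (Q.sup id + 1)
  have e : (((D - 1 : ℕ) : ℝ) + 1) = D := by rw [Nat.cast_sub hD]; push_cast; ring
  rw [e] at h
  refine le_trans ?_ h
  have e2 : ∑ p ∈ Q, ((p : ℝ) - 1)⁻¹ ^ 2 = ∑ p ∈ Q.image Nat.pred, ((p : ℝ) ^ 2)⁻¹ := by
    rw [Finset.sum_image]
    · refine Finset.sum_congr rfl fun p hp => ?_
      have := hQ p hp
      rw [Nat.pred_eq_sub_one, Nat.cast_sub (by omega), inv_pow, Nat.cast_one]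
    · intro p hp q hq hpq
      have h1 := hQ p hp
      have h2 := hQ q hq
      have h3 : p - 1 = q - 1 := by simpa using hpq
      omega
  rw [e2]
  refine Finset.sum_le_sum_of_subset_of_nonneg ?_ fun _ _ _ => by positivity
  intro x hx
  obtain ⟨p, hp, rfl⟩ := Finset.mem_image.1 hx
  have h1 := hQ p hp
  have h2 : p ≤ Q.sup id := Finset.le_sup (f := id) hp
  rw [Finset.mem_Ioo, Nat.pred_eq_sub_one]
  omega

theorem prod_one_add_le_three {Q : Finset ℕ} {D : ℕ} (hD : 4 ≤ D) (hQ : ∀ p ∈ Q, D < p) :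
    ∏ p ∈ Q, (1 + ((p : ℝ) * (p - 2))⁻¹) ≤ 3 := by
  have h1 : ∏ p ∈ Q, (1 + ((p : ℝ) * (p - 2))⁻¹) ≤ ∏ p ∈ Q, Real.exp (2 * ((p : ℝ) - 1)⁻¹ ^ 2) := by
    have hp5 : ∀ p ∈ Q, (5 : ℝ) ≤ p := fun p hp => by
      exact_mod_cast (by have := hQ p hp; omega : 5 ≤ p)
    refine Finset.prod_le_prod (fun p hp => ?_) fun p hp => ?_
    · have := hp5 p hp
      have : 0 ≤ ((p : ℝ) * (p - 2))⁻¹ := inv_nonneg.2 (mul_nonneg (by linarith) (by linarith))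
      linarith
    · have h5 := hp5 p hp
      rw [add_comm]
      refine le_trans (add_le_add_left ?_ 1) (Real.add_one_le_exp _)
      rw [inv_pow, ← div_eq_mul_inv, inv_eq_one_div, div_le_div_iff₀ (by nlinarith) (by nlinarith)]
      nlinarith
  refine h1.trans ?_
  rw [← Real.exp_sum, ← Finset.mul_sum]
  have h2 := sum_inv_sub_one_sq_le (by omega) hQ
  have h4 : (4 : ℝ) ≤ D := by exact_mod_cast hD
  have h3 : (2 : ℝ) / D ≤ 1 / 2 := by
    rw [div_le_div_iff₀ (by linarith) (by norm_num)]; linarith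
  refine (Real.exp_le_exp.2 (by linarith : _ ≤ (1 : ℝ))).trans ?_
  linarith [Real.exp_one_lt_d9]

theorem numeric_comparison {k : ℕ} (hk : 1 ≤ k) {J c N φ W G l A₁ A₂ T LN P Z K : ℝ}
    (hW : W = G * φ) (hφ : 0 < φ) (hG : 0 < G) (hl : G ≤ l) (hJ : 0 ≤ J) (hc : 0 ≤ c)
    (hN : 1 ≤ N) (hA₁ : (J + 1) * l ≤ G * A₁) (hA₂ : l ≤ G * A₂) (hA₂' : G * A₂ ≤ 48 * l)
    (hT : c * N ≤ T) (hP : P ≤ 3) (hZ : K * Z ≤ N / W) (hLN0 : 0 ≤ LN)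
    (hLN : LN ≤ 4 * (19200 * k * (J + 1)) * l)
    (hmain : k * (T / φ * (1 / 2 * A₁ ^ 2 * A₂ ^ (k - 1)) - c / (4 * φ) * N) ≤
      LN * ((3 * N + 1) / W * (P * A₂ ^ k) + K * Z)) :
    c * (J + 1) ≤ 16 * 19200 * 577 := by
  have hA₂1 : 1 ≤ A₂ := by
    by_contra hcon
    push Not at hcon
    nlinarith
  have hW0 : 0 < W := by rw [hW]; positivity
  have hl0 : 0 < l := by linarith
  set x := l / G with hx
  have hx1 : 1 ≤ x := by rw [hx, le_div_iff₀ hG]; linarith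
  have ha1 : (J + 1) * x ≤ A₁ := by
    rw [hx, ← mul_div_assoc, div_le_iff₀ hG]; linarith
  have ha2 : A₂ ≤ 48 * x := by
    rw [hx, ← mul_div_assoc, le_div_iff₀ hG]; linarith
  set B := A₂ ^ (k - 1) with hB
  have hB1 : 1 ≤ B := one_le_pow₀ hA₂1
  have hAk : A₂ ^ k = B * A₂ := by rw [hB, ← pow_succ, Nat.sub_add_cancel hk]
  have hk1 : (1 : ℝ) ≤ k := by exact_mod_cast hk
  have hJ1 : 1 ≤ J + 1 := by linarith
  have hJx : 1 ≤ (J + 1) * x := one_le_mul_of_one_le_of_one_le hJ1 hx1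
  have hcN : 0 ≤ c * N := by positivity
  have low : k * (c * N / φ * (1 / 4 * ((J + 1) * x) ^ 2 * B)) ≤
      k * (T / φ * (1 / 2 * A₁ ^ 2 * B) - c / (4 * φ) * N) := by
    refine mul_le_mul_of_nonneg_left ?_ (by linarith)
    have h1 : c * N / φ * (1 / 2 * ((J + 1) * x) ^ 2 * B) ≤ T / φ * (1 / 2 * A₁ ^ 2 * B) := by
      gcongr
      exact div_nonneg (hcN.trans hT) hφ.le
    have h2 : c / (4 * φ) * N ≤ c * N / φ * (1 / 4 * ((J + 1) * x) ^ 2 * B) := by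
      have e : c / (4 * φ) * N = c * N / φ * (1 / 4) := by field_simp
      rw [e]
      refine mul_le_mul_of_nonneg_left ?_ (by positivity)
      have : 1 ≤ ((J + 1) * x) ^ 2 * B :=
        one_le_mul_of_one_le_of_one_le (one_le_pow₀ hJx) hB1
      linarith
    linarith
  have up : LN * ((3 * N + 1) / W * (P * A₂ ^ k) + K * Z) ≤ LN * (577 * x * B * (N / W)) := by
    refine mul_le_mul_of_nonneg_left ?_ hLN0
    have h1 : (3 * N + 1) / W * (P * A₂ ^ k) ≤ (4 * N) / W * (3 * (B * (48 * x))) := by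
      rw [hAk]
      have : P * (B * A₂) ≤ 3 * (B * (48 * x)) :=
        mul_le_mul hP (by gcongr) (by positivity) (by norm_num)
      have h2 : (3 * N + 1) / W ≤ 4 * N / W := by gcongr; linarith
      refine (mul_le_mul_of_nonneg_left this (by positivity)).trans
        (mul_le_mul_of_nonneg_right h2 (by positivity))
    have h2 : N / W ≤ x * B * (N / W) :=
      le_mul_of_one_le_left (by positivity) (one_le_mul_of_one_le_of_one_le hx1 hB1)
    have e : (4 * N) / W * (3 * (B * (48 * x))) = 576 * x * B * (N / W) := by ring
    linarith
  have h := low.trans (hmain.trans up)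
  have h2 : k * (c * N / φ * (1 / 4 * ((J + 1) * x) ^ 2 * B)) ≤
      4 * (19200 * k * (J + 1)) * l * (577 * x * B * (N / W)) :=
    h.trans (mul_le_mul_of_nonneg_right hLN (by positivity))
  have e1 : k * (c * N / φ * (1 / 4 * ((J + 1) * x) ^ 2 * B)) =
      (k * N / φ * (J + 1) * x ^ 2 * B / 4) * (c * (J + 1)) := by ring
  have e2 : 4 * (19200 * k * (J + 1)) * l * (577 * x * B * (N / W)) =
      (k * N / φ * (J + 1) * x ^ 2 * B / 4) * (16 * 19200 * 577) := by
    rw [hW, hx]; field_simp; ring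
  rw [e1, e2] at h2
  exact le_of_mul_le_mul_left h2 (by positivity)

theorem prod_mul_totient_prd {B : Finset ℕ} (hB : ∀ p ∈ B, p.Prime) :
    (prd B : ℝ) = (∏ p ∈ B, (1 + ((p : ℝ) - 1)⁻¹)) * ((prd B).totient : ℝ) := by
  have h := Nat.totient_mul_prod_primeFactors (prd B)
  rw [primeFactors_prd hB] at h
  have h1 : (prd B).totient = ∏ p ∈ B, (p - 1) := by
    have e : ∏ p ∈ B, p = prd B := rfl
    rw [e, mul_comm] at h
    exact Nat.eq_of_mul_eq_mul_left (prd_pos hB) h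
  rw [h1, prd, Nat.cast_prod, Nat.cast_prod, ← Finset.prod_mul_distrib]
  refine Finset.prod_congr rfl fun p hp => ?_
  have h2 := (hB p hp).two_le
  have h3 : (2 : ℝ) ≤ p := by exact_mod_cast h2
  rw [Nat.cast_sub (by omega), Nat.cast_one, add_mul, inv_mul_cancel₀ (by linarith)]
  ring

theorem exists_pow_le_lt {m : ℕ} (hm : m ≠ 0) (N : ℕ) : ∃ Y : ℕ, Y ^ m ≤ N ∧ N < (Y + 1) ^ m := by
  refine ⟨Nat.findGreatest (fun Y => Y ^ m ≤ N) N, ?_, ?_⟩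
  · exact Nat.findGreatest_spec (P := fun Y => Y ^ m ≤ N) (Nat.zero_le N) (by simp [hm])
  · by_contra hh
    push Not at hh
    have := Nat.le_findGreatest (P := fun Y => Y ^ m ≤ N) ((Nat.le_self_pow hm _).trans hh) hh
    omega

theorem three_mul_le_pow {m N Y : ℕ} (hY : 4 ≤ Y) (hm : m ≠ 0) (hN : N < (Y + 1) ^ m) :
    3 * N ≤ Y ^ (4 * m) := by
  have h1 : 3 ≤ Y ^ (2 * m) := le_trans (by omega : 3 ≤ Y) (Nat.le_self_pow (by omega) Y)
  have h2 : (Y + 1) ^ m ≤ (Y * Y) ^ m := Nat.pow_le_pow_left (by nlinarith) m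
  calc 3 * N ≤ 3 * (Y + 1) ^ m := by omega
    _ ≤ Y ^ (2 * m) * (Y * Y) ^ m := Nat.mul_le_mul h1 h2
    _ = Y ^ (4 * m) := by rw [← pow_two, ← pow_mul, ← pow_add]; congr 1; ring

set_option maxHeartbeats 1000000 in
theorem exists_prime_pair_of_weights {c : ℝ} (hc : 0 < c)
    (hI : ∀ W : ℕ, 0 < W → ∀ κ : ℝ, 0 ≤ κ → ∀ δ : ℝ, 0 < δ → ∀ N₀ : ℕ, ∃ N, N₀ ≤ N ∧
      ∃ w T E, PrimeWeightsFor c W κ δ N w T E) :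
    ∃ k : ℕ, ∀ h : Fin k → ℕ, Function.Injective h → (∀ i, k.factorial ∣ h i) →
      ∃ n i j, i ≠ j ∧ (n + h i).Prime ∧ (n + h j).Prime := by
  obtain ⟨J, hJ⟩ := exists_nat_gt (16 * 19200 * 577 / c)
  have hJ1 : 1 ≤ J := by
    by_contra hcon
    have : J = 0 := by omega
    rw [this] at hJ
    have : 0 ≤ 16 * 19200 * 577 / c := by positivity
    push_cast at hJ
    linarith
  obtain ⟨k, hk⟩ : ∃ k, k = 2 ^ J := ⟨_, rfl⟩
  refine ⟨k, fun h hinj hdvd => ?_⟩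
  by_contra hcon
  push Not at hcon
  have hk2 : 2 ≤ k := by rw [hk]; exact Nat.le_self_pow (by omega) 2
  set D := 32 * k ^ 2 + ∑ i, h i with hD
  have hk4 : 4 ≤ k ^ 2 := by nlinarith
  set PD := (Finset.range (D + 1)).filter Nat.Prime with hPD
  have hPDp : ∀ p ∈ PD, p.Prime := fun p hp => (Finset.mem_filter.1 hp).2
  set W := prd PD with hW
  have hW0 : 0 < W := prd_pos hPDp
  set G := ∏ p ∈ PD, (1 + ((p : ℝ) - 1)⁻¹) with hG
  have hG0 : 0 < G := by
    refine Finset.prod_pos fun p hp => ?_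
    have : (2 : ℝ) ≤ p := by exact_mod_cast (hPDp p hp).two_le
    have : 0 ≤ ((p : ℝ) - 1)⁻¹ := inv_nonneg.2 (by linarith)
    linarith
  have hWG : (W : ℝ) = G * W.totient := prod_mul_totient_prd hPDp
  have hφ : (0 : ℝ) < W.totient := by exact_mod_cast Nat.totient_pos.2 hW0
  obtain ⟨b, hb⟩ := exists_admissible_residue h (by simpa using hdvd) PD hPDp
  obtain ⟨m, hm⟩ : ∃ m, m = 19200 * k * (J + 1) := ⟨_, rfl⟩
  obtain ⟨Y₀, hY₀⟩ := exists_nat_gt (Real.exp (4 + G + Real.log W))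
  obtain ⟨N, hN, w, T, E, H⟩ := hI W hW0 (2 * (k + 1 : ℝ) ^ 2) (by positivity)
    (c / (4 * W.totient) / 4 ^ k) (by positivity) (Y₀ ^ m + 3 * D)
  have hm1 : m ≠ 0 := by rw [hm]; positivity
  obtain ⟨Y, hYN, hNY⟩ := exists_pow_le_lt hm1 N
  have hY₀Y : Y₀ ≤ Y := by
    have h1 : Y₀ ^ m < (Y + 1) ^ m := by omega
    exact Nat.lt_succ_iff.1 (lt_of_pow_lt_pow_left₀ m (Nat.zero_le _) h1)
  have hlogW : 0 ≤ Real.log W := Real.log_natCast_nonneg W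
  have hY4' : Real.exp (4 + G + Real.log W) < Y := hY₀.trans_le (by exact_mod_cast hY₀Y)
  have hYpos : (0 : ℝ) < Y := (Real.exp_pos _).trans hY4'
  have hlY : 4 + G + Real.log W ≤ Real.log Y := (Real.le_log_iff_exp_le hYpos).2 hY4'.le
  have hY4 : 4 ≤ Y := by
    have : (4 : ℝ) ≤ Y := by
      have := Real.add_one_le_exp (4 + G + Real.log W)
      linarith
    exact_mod_cast this
  have hWY : W ≤ Y := by
    have : (W : ℝ) ≤ Y := by
      rw [← Real.log_le_log_iff (by exact_mod_cast hW0) hYpos]; linarith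
    exact_mod_cast this
  obtain ⟨Z, hZ⟩ : ∃ Z, Z = Y ^ (96 * k * (J + 1)) := ⟨_, rfl⟩
  set Q := (Finset.range (Y ^ k + 1)).filter (fun p => p.Prime ∧ D < p) with hQ
  have hQp : ∀ p ∈ Q, p.Prime := fun p hp => (Finset.mem_filter.1 hp).2.1
  have hQD : ∀ p ∈ Q, D < p := fun p hp => (Finset.mem_filter.1 hp).2.2
  have hQY : ∀ p ∈ Q, p ≤ Y ^ k := fun p hp =>
    Nat.lt_succ_iff.1 (Finset.mem_range.1 (Finset.mem_filter.1 hp).1)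
  have hdisj : Disjoint PD Q := by
    rw [Finset.disjoint_left]
    intro p h1 h2
    have h3 := Finset.mem_range.1 (Finset.mem_filter.1 h1).1
    have h4 := hQD p h2
    omega
  have hunion : ∀ p ∈ PD ∪ Q, p.Prime := fun p hp =>
    (Finset.mem_union.1 hp).elim (hPDp p) (hQp p)
  have hkJ : k ≤ 96 * k * (J + 1) := by nlinarith
  have hkk : Y ^ 2 ^ J ≤ Z := hZ ▸ Nat.pow_le_pow_right (by omega) (by rw [← hk]; exact hkJ)
  have hlow : ∀ y, y ≤ Y ^ 2 ^ J → Real.log y ≤ G * recipSum Q y := by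
    intro y hy
    refine (log_le_recipSum hunion y fun p hp hpy => ?_).trans
      (recipSum_union_le hdisj hPDp hQp y)
    rw [Finset.mem_union]
    rw [← hk] at hy
    by_cases hpD : p ≤ D
    · left
      exact Finset.mem_filter.2 ⟨Finset.mem_range.2 (by omega), hp⟩
    · right
      exact Finset.mem_filter.2 ⟨Finset.mem_range.2 (by omega), hp, by omega⟩
  have hup : ∀ y, 1 ≤ y → G * recipSum Q y ≤ 3 * (1 + Real.log W + Real.log y) := by
    intro y hy
    refine (le_recipSum_union hdisj hPDp hQp y).trans ((recipSum_le hunion _).trans ?_)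
    rw [Nat.cast_mul, Real.log_mul (by exact_mod_cast hW0.ne') (by positivity)]
    linarith
  have hY1 : 1 ≤ Y := by omega
  have hL : 1 + Real.log W ≤ Real.log Y := by linarith
  have hA₁ := mul_sum_cutoff_ge hQp hlow hY1
  have hA₂ := mul_sum_cutoff_sq_ge hQp hG0 hlow
  have hA₂' := mul_sum_cutoff_sq_le (J := J) hQp hG0 hup hY1 hL
  have hΛ := sum_cutoff_sq_log_le hQp hG0 hlow hup hY1 hL
  have hQW : ∀ p ∈ Q, p.Coprime W := fun p hp => by
    refine Nat.Coprime.prod_right fun q hq => (Nat.coprime_primes (hQp p hp) (hPDp q hq)).2 ?_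
    rintro rfl
    exact Finset.disjoint_left.1 hdisj hq hp
  have hkm : k + 1 ≤ m := by rw [hm]; nlinarith
  have hpw : Y ^ (k + 1) ≤ N := (Nat.pow_le_pow_right hY1 hkm).trans hYN
  have hN1 : 1 ≤ N := le_trans (Nat.one_le_pow _ _ hY1) hYN
  have hZN : (Z ^ 4) ^ 50 ≤ N := by
    rw [hZ, ← pow_mul, ← pow_mul]
    refine le_trans (le_of_eq ?_) hYN
    rw [hm]; ring
  have hlogZ : Real.log Z = 96 * k * (J + 1) * Real.log Y := by
    rw [hZ, Nat.cast_pow, Real.log_pow]; push_cast; ring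
  have hhi : ∀ i, h i ≤ D := fun i =>
    (Finset.single_le_sum (f := h) (fun _ _ => Nat.zero_le _) (Finset.mem_univ i)).trans (by omega)
  have main := sieve_comparison hk2 h hinj hc.le H hQp hW0 hQW
    (fun p hp => by
      have h1 := hQY p hp
      have h2 : 4 * Y ^ k ≤ Y ^ (k + 1) := by rw [pow_succ, mul_comm]; gcongr
      have := (hQp p hp).pos
      omega)
    (fun p hp i => (hhi i).trans_lt (hQD p hp))
    (fun p hp => by
      have := hQD p hp
      have : 2 * (k + 1) ^ 2 ≤ 32 * k ^ 2 := by nlinarith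
      omega)
    (fun i => by have := hhi i; omega) b hb (cutoff Y J) (cutoff_antitone Y J)
    (cutoff_nonneg Y J) (cutoff_le_two Y J) Z
    (le_trans (by omega : 2 ≤ Y) (hZ ▸ Nat.le_self_pow (by positivity) Y))
    (fun a ha => cutoff_eq_zero hY1 hkk ha) hZN
    (by
      have h1 := sum_inv_sub_one_sq_le (by omega : 1 ≤ D) hQD
      have h2 : (32 * (k : ℝ) ^ 2) ≤ D := by exact_mod_cast (by omega : 32 * k ^ 2 ≤ D)
      have h3 : (0 : ℝ) < k := by positivity
      calc 16 * (k : ℝ) ^ 2 * ∑ p ∈ Q, ((p : ℝ) - 1)⁻¹ ^ 2 ≤ 16 * (k : ℝ) ^ 2 * (2 / D) := by gcongr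
        _ ≤ 1 := by
          rw [← mul_div_assoc, div_le_one (by nlinarith)]; linarith)
    (24 * (J + 1) * Real.log Y) (by positivity) hΛ (by rw [hlogZ]; apply le_of_eq; ring)
    (fun n i j hij h1 h2 => hcon n i j hij h1 h2)
  have hlog0 : 0 ≤ Real.log (3 * N) := (H.nonneg 0).trans (H.le_log 0)
  have hfin := numeric_comparison (k := k) (by omega) (J := J) (c := c) (N := N)
    (K := 4 ^ k) (Z := ((Z ^ 4 : ℕ) : ℝ) ^ 2) hWG hφ hG0
    (by linarith) (by positivity) hc.le (by exact_mod_cast hN1) hA₁ hA₂ hA₂' H.mass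
    (prod_one_add_le_three (by omega) hQD) (by
      rw [le_div_iff₀ (by exact_mod_cast hW0)]
      have h1 : 4 ^ k * (Z ^ 4) ^ 2 * W ≤ N := by
        calc 4 ^ k * (Z ^ 4) ^ 2 * W ≤ Y ^ k * (Z ^ 4) ^ 2 * Y := by gcongr
          _ = Y ^ (k + 768 * k * (J + 1) + 1) := by rw [hZ]; ring
          _ ≤ Y ^ m := Nat.pow_le_pow_right hY1 (by rw [hm]; nlinarith)
          _ ≤ N := hYN
      exact_mod_cast h1) hlog0 (by
      have h1 : 3 * N ≤ Y ^ (4 * m) := three_mul_le_pow hY4 hm1 hNY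
      have h2 : Real.log (3 * N) ≤ Real.log ((Y : ℝ) ^ (4 * m)) := by
        refine Real.log_le_log (by positivity) ?_
        exact_mod_cast h1
      rw [Real.log_pow] at h2
      refine h2.trans (le_of_eq ?_)
      rw [hm]; push_cast; ring) (by
      refine le_trans (le_of_eq ?_) (main.trans (le_of_eq ?_))
      · rw [← mul_assoc (4 ^ k : ℝ), mul_div_cancel₀ _ (by positivity)]
      · push_cast; ring)
  rw [div_lt_iff₀ hc] at hJ
  nlinarith

end BoundedGaps

section LogBounds

open Finset Filter Topology

/-- Abel summation: sums of a sequence with bounded partial sums against a sequence of bounded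
variation. -/
theorem norm_sum_mul_le_of_norm_sum_le {g f : ℕ → ℂ} {h : ℕ → ℝ} {B : ℝ} {M N : ℕ}
    (hMN : M ≤ N) (hg : ∀ n, ‖∑ k ∈ Ico M n, g k‖ ≤ B)
    (hd : ∀ n, M ≤ n → ‖f n - f (n + 1)‖ ≤ h n - h (n + 1)) (hf : ‖f N‖ ≤ h N) :
    ‖∑ n ∈ Ico M N, g n * f n‖ ≤ B * h M := by
  have hB : 0 ≤ B := (norm_nonneg _).trans (hg M)
  have key : ∀ d, ‖∑ n ∈ Ico M (M + d), g n * f n -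
      (∑ n ∈ Ico M (M + d), g n) * f (M + d)‖ ≤ B * (h M - h (M + d)) := by
    intro d
    induction d with
    | zero => simp
    | succ d ih =>
      rw [← add_assoc, sum_Ico_succ_top (by omega), sum_Ico_succ_top (by omega)]
      have e : (∑ n ∈ Ico M (M + d), g n * f n) + g (M + d) * f (M + d) -
          ((∑ n ∈ Ico M (M + d), g n) + g (M + d)) * f (M + d + 1) =
          (∑ n ∈ Ico M (M + d), g n * f n - (∑ n ∈ Ico M (M + d), g n) * f (M + d)) +
          (∑ n ∈ Ico M (M + d + 1), g n) * (f (M + d) - f (M + d + 1)) := by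
        rw [sum_Ico_succ_top (by omega)]; ring
      rw [e]
      refine (norm_add_le _ _).trans ?_
      rw [norm_mul]
      have h1 := mul_le_mul (hg (M + d + 1)) (hd (M + d) (by omega)) (norm_nonneg _) hB
      linarith
  obtain ⟨d, rfl⟩ := Nat.exists_eq_add_of_le hMN
  have h1 := key d
  have h2 : ‖(∑ n ∈ Ico M (M + d), g n) * f (M + d)‖ ≤ B * h (M + d) := by
    rw [norm_mul]; exact mul_le_mul (hg _) hf (norm_nonneg _) hB
  have h3 := norm_add_le (∑ n ∈ Ico M (M + d), g n * f n -
      (∑ n ∈ Ico M (M + d), g n) * f (M + d)) ((∑ n ∈ Ico M (M + d), g n) * f (M + d))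
  rw [sub_add_cancel] at h3
  linarith

theorem norm_sub_le_of_norm_deriv_le {f f' : ℝ → ℂ} {h h' : ℝ → ℝ} {a b : ℝ} (hab : a ≤ b)
    (hf : ∀ x ∈ Set.Icc a b, HasDerivAt f (f' x) x)
    (hh : ∀ x ∈ Set.Icc a b, HasDerivAt h (h' x) x)
    (hb : ∀ x ∈ Set.Icc a b, ‖f' x‖ ≤ -h' x) : ‖f a - f b‖ ≤ h a - h b := by
  rw [norm_sub_rev]
  refine image_norm_le_of_norm_deriv_right_le_deriv_boundary' (f := fun x => f x - f a)
    (f' := f') (B := fun x => h a - h x) (B' := fun x => - h' x) (a := a) (b := b)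
    ?_ ?_ ?_ ?_ ?_ ?_ (Set.right_mem_Icc.2 hab)
  · exact fun x hx => ((hf x hx).continuousAt.sub continuousAt_const).continuousWithinAt
  · exact fun x hx => ((hf x ⟨hx.1, hx.2.le⟩).sub_const _).hasDerivWithinAt
  · simp
  · exact fun x hx => (continuousAt_const.sub (hh x hx).continuousAt).continuousWithinAt
  · exact fun x hx => ((hh x ⟨hx.1, hx.2.le⟩).const_sub _).hasDerivWithinAt
  · exact fun x hx => hb x ⟨hx.1, hx.2.le⟩

theorem exists_log_pow_le_mul_rpow (i : ℕ) {δ : ℝ} (hδ : 0 < δ) :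
    ∃ A : ℝ, 1 ≤ A ∧ ∀ x : ℝ, 1 ≤ x → Real.log x ^ i ≤ A * x ^ δ := by
  set η := δ / (i + 1) with hη
  have hη0 : 0 < η := by positivity
  refine ⟨max 1 ((1 / η) ^ i), le_max_left _ _, fun x hx => ?_⟩
  have h0 := Real.log_nonneg hx
  have h1 := Real.log_le_rpow_div (by linarith : 0 ≤ x) hη0
  calc Real.log x ^ i ≤ (x ^ η / η) ^ i := pow_le_pow_left₀ h0 h1 i
    _ = (1 / η) ^ i * x ^ (η * i) := by
      rw [div_eq_mul_one_div, mul_pow, mul_comm, Real.rpow_mul (by linarith), Real.rpow_natCast]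
    _ ≤ max 1 ((1 / η) ^ i) * x ^ δ := by
      refine mul_le_mul (le_max_right _ _) (Real.rpow_le_rpow_of_exponent_le hx ?_)
        (by positivity) (by positivity)
      rw [hη, div_mul_eq_mul_div, div_le_iff₀ (by positivity)]
      nlinarith

theorem exists_norm_log_pow_mul_cpow_sub_le (i : ℕ) : ∃ A : ℝ, 1 ≤ A ∧ ∀ s : ℂ, 1 ≤ s.re →
    (∀ x : ℝ, 1 ≤ x → ‖((Real.log x : ℝ) : ℂ) ^ i * (x : ℂ) ^ (-s)‖ ≤
      A * ‖s‖ * x ^ (-(1 / 2) : ℝ)) ∧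
    ∀ a b : ℝ, 1 ≤ a → a ≤ b →
      ‖((Real.log a : ℝ) : ℂ) ^ i * (a : ℂ) ^ (-s) - ((Real.log b : ℝ) : ℂ) ^ i * (b : ℂ) ^ (-s)‖ ≤
      A * ‖s‖ * a ^ (-(1 / 2) : ℝ) - A * ‖s‖ * b ^ (-(1 / 2) : ℝ) := by
  obtain ⟨A₁, hA₁, h₁⟩ := exists_log_pow_le_mul_rpow i (δ := 1 / 2) (by norm_num)
  obtain ⟨A₂, hA₂, h₂⟩ := exists_log_pow_le_mul_rpow (i - 1) (δ := 1 / 2) (by norm_num)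
  refine ⟨2 * (A₁ + i * A₂), by nlinarith [show (0 : ℝ) ≤ i * A₂ by positivity], fun s hs => ?_⟩
  have hs1 : 1 ≤ ‖s‖ := hs.trans ((le_abs_self _).trans (Complex.abs_re_le_norm s))
  have hA : 0 ≤ (i : ℝ) * A₂ := by positivity
  have hcpow : ∀ x : ℝ, 1 ≤ x → ‖(x : ℂ) ^ (-s)‖ ≤ x ^ (-1 : ℝ) := fun x hx => by
    rw [Complex.norm_cpow_eq_rpow_re_of_pos (by linarith)]
    exact Real.rpow_le_rpow_of_exponent_le hx (by simpa using hs)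
  constructor
  · intro x hx
    have hl := Real.log_nonneg hx
    rw [norm_mul, norm_pow, Complex.norm_real, Real.norm_of_nonneg hl]
    calc _ ≤ (A₁ * x ^ (1 / 2 : ℝ)) * x ^ (-1 : ℝ) :=
          mul_le_mul (h₁ x hx) (hcpow x hx) (norm_nonneg _) (by positivity)
      _ = A₁ * x ^ (-(1 / 2) : ℝ) := by
        rw [mul_assoc, ← Real.rpow_add (by linarith)]; norm_num
      _ ≤ _ := by
        gcongr
        nlinarith
  · intro a b ha hab
    refine norm_sub_le_of_norm_deriv_le hab
      (f := fun x : ℝ => ((Real.log x : ℝ) : ℂ) ^ i * (x : ℂ) ^ (-s))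
      (f' := fun x => (i : ℂ) * ((Real.log x : ℝ) : ℂ) ^ (i - 1) * ((x⁻¹ : ℝ) : ℂ) * (x : ℂ) ^ (-s) +
        ((Real.log x : ℝ) : ℂ) ^ i * (-s * (x : ℂ) ^ (-s - 1)))
      (h := fun x => 2 * (A₁ + i * A₂) * ‖s‖ * x ^ (-(1 / 2) : ℝ))
      (h' := fun x => 2 * (A₁ + i * A₂) * ‖s‖ * ((-(1 / 2)) * x ^ (-(1 / 2) - 1 : ℝ)))
      ?_ ?_ ?_
    · intro x hx
      have hx0 : x ≠ 0 := by linarith [hx.1]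
      have h1 : HasDerivAt (fun x : ℝ => ((Real.log x : ℝ) : ℂ)) ((x⁻¹ : ℝ) : ℂ) x :=
        (Real.hasDerivAt_log hx0).ofReal_comp
      have h2 : HasDerivAt (fun x : ℝ => (x : ℂ) ^ (-s)) (-s * (x : ℂ) ^ (-s - 1)) x :=
        hasDerivAt_ofReal_cpow_const hx0 (by
          intro h
          have h3 : s.re = 0 := by rw [neg_eq_zero.1 h]; simp
          linarith)
      exact (h1.fun_pow i).mul h2
    · intro x hx
      exact (Real.hasDerivAt_rpow_const (Or.inl (by linarith [hx.1]))).const_mul _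
    · intro x hx
      have hx1 : 1 ≤ x := ha.trans hx.1
      have hx0 : 0 < x := by linarith
      have hl := Real.log_nonneg hx1
      refine (norm_add_le _ _).trans ?_
      have e1 : ‖(x : ℂ) ^ (-s - 1)‖ ≤ x ^ (-2 : ℝ) := by
        rw [Complex.norm_cpow_eq_rpow_re_of_pos hx0]
        exact Real.rpow_le_rpow_of_exponent_le hx1 (by simp; linarith)
      have e2 : ‖((x⁻¹ : ℝ) : ℂ)‖ = x ^ (-1 : ℝ) := by
        rw [Complex.norm_real, Real.norm_of_nonneg (by positivity), Real.rpow_neg_one]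
      simp only [norm_mul, norm_pow, norm_neg, Complex.norm_natCast, e2, Complex.norm_real,
        Real.norm_of_nonneg hl]
      have t1 : (i : ℝ) * Real.log x ^ (i - 1) * x ^ (-1 : ℝ) * ‖(x : ℂ) ^ (-s)‖ ≤
          i * A₂ * x ^ (-(3 / 2) : ℝ) := by
        calc _ ≤ (i : ℝ) * (A₂ * x ^ (1 / 2 : ℝ)) * x ^ (-1 : ℝ) * x ^ (-1 : ℝ) := by
              gcongr
              · exact h₂ x hx1
              · exact hcpow x hx1
          _ = i * A₂ * (x ^ (1 / 2 : ℝ) * x ^ (-1 : ℝ) * x ^ (-1 : ℝ)) := by ring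
          _ = _ := by rw [← Real.rpow_add hx0, ← Real.rpow_add hx0]; norm_num
      have t2 : Real.log x ^ i * (‖s‖ * ‖(x : ℂ) ^ (-s - 1)‖) ≤ A₁ * ‖s‖ * x ^ (-(3 / 2) : ℝ) := by
        calc _ ≤ (A₁ * x ^ (1 / 2 : ℝ)) * (‖s‖ * x ^ (-2 : ℝ)) := by
              gcongr
              exact h₁ x hx1
          _ = A₁ * ‖s‖ * (x ^ (1 / 2 : ℝ) * x ^ (-2 : ℝ)) := by ring
          _ = _ := by rw [← Real.rpow_add hx0]; norm_num
      have e3 : (-(1 / 2) - 1 : ℝ) = -(3 / 2) := by norm_num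
      rw [e3]
      have hxp : 0 ≤ x ^ (-(3 / 2) : ℝ) := by positivity
      have : i * A₂ * x ^ (-(3 / 2) : ℝ) ≤ i * A₂ * ‖s‖ * x ^ (-(3 / 2) : ℝ) := by
        exact mul_le_mul_of_nonneg_right (le_mul_of_one_le_right hA hs1) hxp
      linarith

end LogBounds

section LSeriesDerivatives

open Finset Filter Topology

theorem logMul_iterate_apply (g : ℕ → ℂ) (i n : ℕ) :
    LSeries.logMul^[i] g n = ((Real.log n : ℝ) : ℂ) ^ i * g n := by
  induction i with
  | zero => simp
  | succ i ih =>
    rw [Function.iterate_succ_apply', LSeries.logMul, ih, ← Complex.natCast_log]; ring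

theorem abscissaOfAbsConv_logMul_iterate_le_one {g : ℕ → ℂ} (hg : ∀ n, ‖g n‖ ≤ 1) (i : ℕ) :
    LSeries.abscissaOfAbsConv (LSeries.logMul^[i] g) ≤ 1 := by
  rw [LSeries.absicssaOfAbsConv_logPowMul]
  exact LSeries.abscissaOfAbsConv_le_one_of_isBigO_one
    (Asymptotics.IsBigO.of_bound 1 (Eventually.of_forall fun n => by simpa using hg n))

theorem LSeriesSummable_logMul_iterate {g : ℕ → ℂ} (hg : ∀ n, ‖g n‖ ≤ 1) (i : ℕ) {s : ℂ}
    (hs : 1 < s.re) : LSeriesSummable (LSeries.logMul^[i] g) s :=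
  LSeriesSummable_of_abscissaOfAbsConv_lt_re
    ((abscissaOfAbsConv_logMul_iterate_le_one hg i).trans_lt (by exact_mod_cast hs))

theorem exists_norm_LSeries_logMul_le (i : ℕ) : ∃ C : ℝ, 1 ≤ C ∧ ∀ (g : ℕ → ℂ) (B : ℝ),
    1 ≤ B → (∀ n, ‖g n‖ ≤ 1) → (∀ a b, ‖∑ n ∈ Ico a b, g n‖ ≤ B) → ∀ s : ℂ, 1 < s.re →
    ‖LSeries (LSeries.logMul^[i] g) s‖ ≤ C * (1 + Real.log B) ^ (i + 1) * ‖s‖ := by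
  obtain ⟨A, hA, h⟩ := exists_norm_log_pow_mul_cpow_sub_le i
  refine ⟨2 ^ (i + 1) + A, by linarith [show (0 : ℝ) < 2 ^ (i + 1) by positivity],
    fun g B hB hg hgB s hs => ?_⟩
  have hs1 : 1 ≤ ‖s‖ := hs.le.trans ((le_abs_self _).trans (Complex.abs_re_le_norm s))
  have hlB := Real.log_nonneg hB
  set X := ⌈B ^ 2⌉₊ with hX
  have hX1 : B ^ 2 ≤ X := Nat.le_ceil _
  have hX2 : (X : ℝ) ≤ 2 * B ^ 2 := by
    have := Nat.ceil_lt_add_one (show 0 ≤ B ^ 2 by positivity)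
    nlinarith
  have hXp : (1 : ℝ) ≤ X := by nlinarith
  have hXp' : 1 ≤ X := by exact_mod_cast hXp
  have hlX : Real.log X ≤ 1 + 2 * Real.log B := by
    calc Real.log X ≤ Real.log (2 * B ^ 2) := Real.log_le_log (by linarith) hX2
      _ = Real.log 2 + 2 * Real.log B := by
        rw [Real.log_mul (by norm_num) (by positivity), Real.log_pow]; simp
      _ ≤ _ := by linarith [Real.log_two_lt_d9]
  have hlX0 := Real.log_nonneg hXp
  have hterm : ∀ n : ℕ, 1 ≤ n → LSeries.term (LSeries.logMul^[i] g) s n =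
      g n * (((Real.log n : ℝ) : ℂ) ^ i * ((n : ℝ) : ℂ) ^ (-s)) := fun n hn => by
    rw [LSeries.term_of_ne_zero (by omega), logMul_iterate_apply, Complex.cpow_neg]
    push_cast
    rw [div_eq_mul_inv]; ring
  have h1 : ‖∑ n ∈ range X, LSeries.term (LSeries.logMul^[i] g) s n‖ ≤
      2 ^ (i + 1) * (1 + Real.log B) ^ (i + 1) := by
    have hb : ∀ n ∈ range X, ‖LSeries.term (LSeries.logMul^[i] g) s n‖ ≤
        Real.log X ^ i * (n : ℝ)⁻¹ := by
      intro n hn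
      rcases Nat.eq_zero_or_pos n with rfl | hn0
      · simp
      have hn1 : (1 : ℝ) ≤ n := by exact_mod_cast hn0
      have hnX : (n : ℝ) ≤ X := by exact_mod_cast (mem_range.1 hn).le
      rw [hterm n hn0, norm_mul, norm_mul, norm_pow, Complex.norm_real,
        Real.norm_of_nonneg (Real.log_nonneg hn1), Complex.norm_cpow_eq_rpow_re_of_pos (by linarith)]
      calc _ ≤ 1 * (Real.log X ^ i * (n : ℝ) ^ (-1 : ℝ)) := by
            gcongr
            · exact hg n
            · simpa using hs.le
        _ = _ := by rw [one_mul, Real.rpow_neg_one]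
    refine (norm_sum_le_of_le _ hb).trans ?_
    rw [← mul_sum]
    have hh : ∑ n ∈ range X, (n : ℝ)⁻¹ ≤ 1 + Real.log X := by
      have h1 := harmonic_le_one_add_log X
      refine le_trans ?_ h1
      rw [harmonic]
      push_cast
      calc ∑ n ∈ range X, (n : ℝ)⁻¹ ≤ ∑ n ∈ range (X + 1), (n : ℝ)⁻¹ :=
            sum_le_sum_of_subset_of_nonneg (range_subset_range.2 (by omega))
              (fun _ _ _ => by positivity)
        _ = _ := by rw [sum_range_succ']; simp
    calc _ ≤ (2 * (1 + Real.log B)) ^ i * (2 * (1 + Real.log B)) := by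
          gcongr
          · linarith
          · linarith
      _ = _ := by rw [← pow_succ, mul_pow]
  have h2 : ∀ N, X ≤ N → ‖∑ n ∈ Ico X N, LSeries.term (LSeries.logMul^[i] g) s n‖ ≤ A * ‖s‖ := by
    intro N hN
    rw [sum_congr rfl fun n hn => hterm n (hXp'.trans (mem_Ico.1 hn).1)]
    refine (norm_sum_mul_le_of_norm_sum_le (h := fun n : ℕ => A * ‖s‖ * (n : ℝ) ^ (-(1 / 2) : ℝ))
      hN (hgB X) ?_ ?_).trans ?_
    · intro n hn
      have := (h s hs.le).2 n (n + 1) (by exact_mod_cast hXp'.trans hn) (by linarith)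
      exact_mod_cast this
    · exact (h s hs.le).1 N (by exact_mod_cast hXp'.trans hN)
    · have : (X : ℝ) ^ (-(1 / 2) : ℝ) ≤ B⁻¹ := by
        rw [Real.rpow_neg (by linarith), ← Real.sqrt_eq_rpow]
        exact inv_anti₀ (by linarith) (Real.le_sqrt_of_sq_le hX1)
      calc _ ≤ B * (A * ‖s‖ * B⁻¹) := by gcongr
        _ = A * ‖s‖ := by field_simp
  have hlim := (LSeriesSummable_logMul_iterate hg i hs).hasSum.tendsto_sum_nat
  refine le_of_tendsto hlim.norm ?_
  filter_upwards [eventually_ge_atTop X] with N hN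
  rw [range_eq_Ico, ← sum_Ico_consecutive _ (Nat.zero_le X) hN, ← range_eq_Ico]
  refine (norm_add_le _ _).trans ?_
  have h3 := h2 N hN
  have hp : 1 ≤ (1 + Real.log B) ^ (i + 1) := one_le_pow₀ (by linarith)
  have h4 : A * ‖s‖ ≤ A * (1 + Real.log B) ^ (i + 1) * ‖s‖ := by
    gcongr; exact le_mul_of_one_le_right (by linarith) hp
  have h5 : 2 ^ (i + 1) * (1 + Real.log B) ^ (i + 1) ≤
      2 ^ (i + 1) * (1 + Real.log B) ^ (i + 1) * ‖s‖ := le_mul_of_one_le_right (by positivity) hs1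
  linarith

end LSeriesDerivatives

section CharacterSums

open Finset Filter Topology MeasureTheory

theorem sum_Ico_periodic_eq_sum_zmod {r : ℕ} [NeZero r] (g : ZMod r → ℂ) (a : ℕ) :
    ∑ n ∈ Ico a (a + r), g n = ∑ x, g x := by
  have hinj : Set.InjOn (fun n : ℕ => (n : ZMod r)) (Ico a (a + r) : Finset ℕ) := by
    intro x hx y hy hxy
    simp only [coe_Ico, Set.mem_Ico] at hx hy
    have := (ZMod.natCast_eq_natCast_iff x y r).1 hxy
    rcases le_total x y with h | h
    · have h1 := (Nat.modEq_iff_dvd' h).1 this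
      have := Nat.eq_zero_of_dvd_of_lt h1 (by omega)
      omega
    · have h1 := (Nat.modEq_iff_dvd' h).1 this.symm
      have := Nat.eq_zero_of_dvd_of_lt h1 (by omega)
      omega
  rw [← sum_image (f := g) hinj]
  congr 1
  exact eq_univ_of_card _ (by rw [card_image_of_injOn hinj]; simp)

theorem norm_sum_Ico_le_of_sum_zmod_eq_zero {r : ℕ} [NeZero r] (g : ZMod r → ℂ)
    (hg : ∀ x, ‖g x‖ ≤ 1) (h0 : ∑ x, g x = 0) (a b : ℕ) : ‖∑ n ∈ Ico a b, g n‖ ≤ r := by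
  induction hd : b - a using Nat.strong_induction_on generalizing a b with
  | _ d ih =>
    by_cases h : d < r
    · refine (norm_sum_le_of_le _ (f := fun n : ℕ => g n) fun n _ => hg n).trans ?_
      simp only [sum_const, Nat.card_Ico, mul_one, nsmul_eq_mul]
      exact_mod_cast (by omega : b - a ≤ r)
    · have hr := NeZero.pos r
      rw [← sum_Ico_consecutive _ (by omega : a ≤ a + r) (by omega : a + r ≤ b),
        sum_Ico_periodic_eq_sum_zmod, h0, zero_add]
      exact ih (b - (a + r)) (by omega) _ _ rfl

theorem norm_sum_Ico_character_le {r : ℕ} [NeZero r] {χ : DirichletCharacter ℂ r} (hχ : χ ≠ 1)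
    (a b : ℕ) : ‖∑ n ∈ Ico a b, χ n‖ ≤ r :=
  norm_sum_Ico_le_of_sum_zmod_eq_zero χ (fun x => χ.norm_le_one x)
    (MulChar.sum_eq_zero_of_ne_one hχ) a b

theorem norm_LSeries_one_sub_le {s : ℂ} (hs : 1 < s.re) :
    ‖LSeries 1 s - s / (s - 1)‖ ≤ ‖s‖ := by
  have hs1 : s - 1 ≠ 0 := fun h => by
    rw [sub_eq_zero.1 h] at hs; simp at hs
  have h1 : LSeries 1 s = s * ∫ t in Set.Ioi (1 : ℝ), ((⌊t⌋₊ : ℝ) : ℂ) * (t : ℂ) ^ (-(s + 1)) := by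
    rw [LSeries_eq_mul_integral' 1 zero_le_one hs]
    · simp
    · simp only [Pi.one_apply, norm_one, sum_const, Nat.card_Icc, Real.rpow_one]
      exact Asymptotics.isBigO_of_le _ fun n => by simp
  have h2 : ∫ t in Set.Ioi (1 : ℝ), (t : ℂ) ^ (-s) = 1 / (s - 1) := by
    rw [integral_Ioi_cpow_of_lt (by simpa using hs) one_pos]
    simp only [Complex.ofReal_one, Complex.one_cpow]
    rw [show -s + 1 = -(s - 1) by ring, neg_div_neg_eq]
  have hint := integrableOn_Ioi_cpow_of_lt (a := -s) (c := 1) (by simpa using hs) one_pos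
  have hb : ∀ t ∈ Set.Ioi (1 : ℝ), ‖(((⌊t⌋₊ : ℝ) - t : ℝ) : ℂ) * (t : ℂ) ^ (-(s + 1))‖ ≤
      t ^ (-2 : ℝ) := by
    intro t ht
    have ht : (1 : ℝ) < t := ht
    rw [norm_mul, Complex.norm_real, Complex.norm_cpow_eq_rpow_re_of_pos (by linarith)]
    have hf1 := Nat.floor_le (by linarith : 0 ≤ t)
    have hf2 := Nat.lt_floor_add_one t
    calc _ ≤ 1 * t ^ (-2 : ℝ) := by
          gcongr
          · rw [Real.norm_eq_abs, abs_le]; constructor <;> linarith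
          · exact ht.le
          · simp; linarith
      _ = _ := one_mul _
  have hdom := integrableOn_Ioi_rpow_of_lt (a := (-2 : ℝ)) (c := 1) (by norm_num) one_pos
  have hint2 : IntegrableOn (fun t : ℝ => (((⌊t⌋₊ : ℝ) - t : ℝ) : ℂ) * (t : ℂ) ^ (-(s + 1)))
      (Set.Ioi 1) := by
    refine Integrable.mono' hdom ?_ ((ae_restrict_iff' measurableSet_Ioi).2
      (Eventually.of_forall hb))
    refine AEStronglyMeasurable.mul ?_ ?_
    · have : Measurable fun t : ℝ => (((⌊t⌋₊ : ℝ) - t : ℝ) : ℂ) :=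
        Complex.measurable_ofReal.comp
          (((measurable_from_nat (f := fun n : ℕ => (n : ℝ))).comp Nat.measurable_floor).sub
            measurable_id)
      exact this.aestronglyMeasurable
    · exact (integrableOn_Ioi_cpow_of_lt (a := -(s + 1)) (by simp; linarith)
        one_pos).aestronglyMeasurable
  have h3 : ∫ t in Set.Ioi (1 : ℝ), ((⌊t⌋₊ : ℝ) : ℂ) * (t : ℂ) ^ (-(s + 1)) =
      (∫ t in Set.Ioi (1 : ℝ), (((⌊t⌋₊ : ℝ) - t : ℝ) : ℂ) * (t : ℂ) ^ (-(s + 1))) +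
        ∫ t in Set.Ioi (1 : ℝ), (t : ℂ) ^ (-s) := by
    rw [← integral_add hint2 hint]
    refine setIntegral_congr_fun measurableSet_Ioi fun t ht => ?_
    have ht0 : (t : ℂ) ≠ 0 := by
      exact_mod_cast (by linarith [show (1 : ℝ) < t from ht] : t ≠ 0)
    have : (t : ℂ) ^ (-s) = t * (t : ℂ) ^ (-(s + 1)) := by
      rw [show -s = 1 + -(s + 1) by ring, Complex.cpow_add _ _ ht0, Complex.cpow_one]
    simp only [this]
    push_cast
    ring
  rw [h1, h3, h2, mul_add, mul_one_div, add_sub_cancel_right, norm_mul]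
  refine mul_le_of_le_one_right (norm_nonneg _) ?_
  refine (norm_integral_le_of_norm_le hdom ((ae_restrict_iff' measurableSet_Ioi).2
      (Eventually.of_forall hb))).trans ?_
  rw [integral_Ioi_rpow_of_lt (by norm_num) one_pos]
  norm_num

theorem norm_LSeries_le_LSeries_one {g : ℕ → ℂ} (hg : ∀ n, ‖g n‖ ≤ 1) {s : ℂ} (hs : 1 < s.re) :
    ‖LSeries g s‖ ≤ s.re ^ 2 / (s.re - 1) := by
  have h1 := norm_LSeries_one_sub_le (s := (s.re : ℂ)) (by simpa using hs)
  have hσ : (0 : ℝ) < s.re - 1 := by linarith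
  have h2 : ‖LSeries 1 (s.re : ℂ)‖ ≤ s.re ^ 2 / (s.re - 1) := by
    have h3 := norm_sub_norm_le (LSeries 1 (s.re : ℂ)) ((s.re : ℂ) / (s.re - 1))
    have h4 : ‖(s.re : ℂ) / (s.re - 1)‖ = s.re / (s.re - 1) := by
      rw [norm_div, ← Complex.ofReal_one, ← Complex.ofReal_sub, Complex.norm_real, Complex.norm_real,
        Real.norm_of_nonneg (by linarith), Real.norm_of_nonneg hσ.le]
    have h5 : ‖(s.re : ℂ)‖ = s.re := by rw [Complex.norm_real, Real.norm_of_nonneg (by linarith)]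
    have h6 : ‖LSeries 1 (s.re : ℂ)‖ ≤ s.re + s.re / (s.re - 1) := by linarith
    refine h6.trans ?_
    rw [le_div_iff₀ hσ, add_mul, div_mul_cancel₀ _ hσ.ne']
    linarith
  refine le_trans ?_ h2
  have hsum : LSeriesSummable 1 (s.re : ℂ) := LSeriesSummable_one_iff.2 (by simpa using hs)
  have e : ∀ n, LSeries.term 1 (s.re : ℂ) n = ((‖LSeries.term 1 (s.re : ℂ) n‖ : ℝ) : ℂ) := by
    intro n
    rcases Nat.eq_zero_or_pos n with rfl | hn
    · simp
    · rw [LSeries.term_of_ne_zero hn.ne', ← Complex.ofReal_natCast, ← Complex.ofReal_cpow (by positivity)]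
      simp only [Pi.one_apply, norm_div, norm_one, Complex.norm_real]
      rw [Real.norm_of_nonneg (by positivity)]
      push_cast
      rfl
  have hle : ∀ n, ‖LSeries.term g s n‖ ≤ ‖LSeries.term 1 (s.re : ℂ) n‖ := by
    intro n
    rw [LSeries.norm_term_eq, LSeries.norm_term_eq]
    split_ifs with h
    · exact le_rfl
    · simp only [Complex.ofReal_re, Pi.one_apply, norm_one]
      gcongr
      exact hg n
  refine (tsum_of_norm_bounded hsum.norm.hasSum hle).trans ?_
  rw [LSeries, tsum_congr e, ← Complex.ofReal_tsum, Complex.norm_real]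
  exact le_abs_self _

theorem norm_LSeries_logMul_sub_le {g : ℕ → ℂ} (hg : ∀ n, ‖g n‖ ≤ 1) {K : ℝ} {z w : ℂ}
    (hz : 1 < z.re) (hw : 1 < w.re)
    (hK : ∀ s : ℂ, 1 < s.re → s ∈ segment ℝ z w → ‖LSeries (LSeries.logMul g) s‖ ≤ K) :
    ‖LSeries g z - LSeries g w‖ ≤ K * ‖z - w‖ := by
  have hre : ∀ s ∈ segment ℝ z w, 1 < s.re := fun s hs =>
    (convex_halfSpace_re_gt 1).segment_subset hz hw hs
  have hd : ∀ s ∈ segment ℝ z w,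
      HasDerivWithinAt (LSeries g) (-LSeries (LSeries.logMul g) s) (segment ℝ z w) s := fun s hs =>
    (LSeries_hasDerivAt ((abscissaOfAbsConv_logMul_iterate_le_one hg 0).trans_lt
      (by exact_mod_cast hre s hs))).hasDerivWithinAt
  have := (convex_segment z w).norm_image_sub_le_of_norm_hasDerivWithin_le hd
    (fun s hs => by rw [norm_neg]; exact hK s (hre s hs) hs) (right_mem_segment ℝ z w)
    (left_mem_segment ℝ z w)
  exact this

end CharacterSums

section ZeroFreeRegion

open Finset Filter Topology MeasureTheory

theorem exists_norm_LSeries_trivial_character_le : ∃ C : ℝ, 1 ≤ C ∧ ∀ (r : ℕ) [NeZero r] (s : ℂ),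
    1 < s.re → ‖LSeries (fun n => (1 : DirichletCharacter ℂ r) n) s‖ ≤
      ‖s‖ * (1 + 1 / ‖s - 1‖) + C * (1 + Real.log r) * ‖s‖ := by
  obtain ⟨C, hC, h⟩ := exists_norm_LSeries_logMul_le 0
  refine ⟨C, hC, fun r _ s hs => ?_⟩
  have hr : (0 : ℝ) < r := by exact_mod_cast NeZero.pos r
  have hr1 : (1 : ℝ) ≤ r := by exact_mod_cast NeZero.pos r
  set ρ : ℝ := r.totient / r with hρ
  have hρ0 : 0 ≤ ρ := by positivity
  have hρ1 : ρ ≤ 1 := by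
    rw [hρ, div_le_one hr]; exact_mod_cast Nat.totient_le r
  set g : ZMod r → ℂ := fun x => (1 : DirichletCharacter ℂ r) x - ρ with hg
  have hgn : ∀ x, ‖g x‖ ≤ 1 := by
    intro x
    by_cases hx : IsUnit x
    · simp only [hg, MulChar.one_apply hx]
      rw [← Complex.ofReal_one, ← Complex.ofReal_sub, Complex.norm_real, Real.norm_eq_abs, abs_le]
      constructor <;> linarith
    · simp only [hg, MulChar.map_nonunit _ hx, zero_sub, norm_neg]
      rw [Complex.norm_real, Real.norm_of_nonneg hρ0]; exact hρ1
  have hsum : ∑ x, g x = 0 := by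
    simp only [hg, sum_sub_distrib]
    rw [MulChar.sum_one_eq_card_units, ZMod.card_units_eq_totient]
    simp only [hρ, sum_const, card_univ, ZMod.card, nsmul_eq_mul]
    push_cast
    rw [mul_div_cancel₀ _ (by exact_mod_cast hr.ne'), sub_self]
  have h1 := h (fun n : ℕ => g n) r hr1 (fun n => hgn n)
    (norm_sum_Ico_le_of_sum_zmod_eq_zero g hgn hsum) s hs
  simp only [Function.iterate_zero, id_eq, zero_add, pow_one] at h1
  have e : (fun n : ℕ => (1 : DirichletCharacter ℂ r) n) =
      (fun n : ℕ => g n) + (ρ : ℂ) • (1 : ℕ → ℂ) := by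
    ext n; simp [hg]
  have hs1 : LSeriesSummable 1 s := LSeriesSummable_one_iff.2 hs
  have hs2 : LSeriesSummable (fun n : ℕ => g n) s :=
    LSeriesSummable_logMul_iterate (fun n => hgn n) 0 hs
  rw [e, LSeries_add hs2 (hs1.smul _), LSeries_smul]
  have h2 := norm_LSeries_one_sub_le hs
  have h3 : ‖LSeries 1 s‖ ≤ ‖s‖ * (1 + 1 / ‖s - 1‖) := by
    have := norm_sub_norm_le (LSeries 1 s) (s / (s - 1))
    rw [norm_div] at this
    rw [mul_add, mul_one, mul_one_div]
    linarith
  refine (norm_add_le _ _).trans ?_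
  rw [norm_mul, Complex.norm_real, Real.norm_of_nonneg hρ0]
  have h4 : ρ * ‖LSeries 1 s‖ ≤ ‖LSeries 1 s‖ := mul_le_of_le_one_left (norm_nonneg _) hρ1
  linarith

/-- Propagation of a lower bound at a point at moderate distance from the edge. -/
theorem inv_le_of_three_four_one {l : ℝ → ℝ} {K Z x : ℝ} (hK : 1 ≤ K) (hZ : 1 ≤ Z) (hx1 : x ≤ 1)
    (h0 : ∀ y, 0 ≤ l y)
    (h1 : ∀ y, 0 < y → y ≤ 1 → 1 ≤ (4 / y) ^ 3 * l y ^ 4 * Z)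
    (h2 : ∀ y, x ≤ y → y ≤ 1 → l y ≤ l x + K * y) : (1024 * K ^ 4 * Z)⁻¹ ≤ l x := by
  set y := (1024 * K ^ 4 * Z)⁻¹ with hy
  have hK4 : 1 ≤ K ^ 4 := one_le_pow₀ hK
  have hP : 1 ≤ 1024 * K ^ 4 * Z := by nlinarith
  have hy0 : 0 < y := by positivity
  have hy1 : y ≤ 1 := inv_le_one_of_one_le₀ hP
  have hyP : y * (1024 * K ^ 4 * Z) = 1 := inv_mul_cancel₀ (by positivity)
  have key : ∀ u, y ≤ u → u ≤ 1 → 2 * K * y ≤ l u := by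
    intro u hu hu1
    have hu0 : 0 < u := hy0.trans_le hu
    have h3 := h1 u hu0 hu1
    have h4 : u ^ 3 ≤ 64 * Z * l u ^ 4 := by
      have : (4 / u) ^ 3 * l u ^ 4 * Z = 64 * Z * l u ^ 4 / u ^ 3 := by
        rw [div_pow]; ring
      rw [this, le_div_iff₀ (by positivity)] at h3
      linarith
    have h5 : y ^ 3 ≤ u ^ 3 := pow_le_pow_left₀ hy0.le hu 3
    have h6 : 64 * Z * (2 * K * y) ^ 4 = y ^ 3 := by
      calc _ = y ^ 3 * (y * (1024 * K ^ 4 * Z)) := by ring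
        _ = _ := by rw [hyP, mul_one]
    have h7 : (2 * K * y) ^ 4 ≤ l u ^ 4 := by
      have : 64 * Z * (2 * K * y) ^ 4 ≤ 64 * Z * l u ^ 4 := by rw [h6]; linarith
      exact le_of_mul_le_mul_left this (by positivity)
    exact le_of_pow_le_pow_left₀ (by norm_num) (h0 u) h7
  have hKy : y ≤ K * y := le_mul_of_one_le_left hy0.le hK
  rcases le_total y x with h | h
  · linarith [key x h hx1]
  · linarith [key y le_rfl hy1, h2 y h hy1]

theorem norm_one_add_add_I_mul_le (x t : ℝ) : ‖(1 + x + Complex.I * t : ℂ)‖ ≤ 1 + |x| + |t| := by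
  refine (norm_add₃_le).trans ?_
  simp [Complex.norm_real]

/-- The 3-4-1 inequality with the trivial character estimated by its logarithmic pole. -/
theorem one_le_three_four_one {r : ℕ} [NeZero r] (χ : DirichletCharacter ℂ r) {x : ℝ} (hx : 0 < x)
    (hx1 : x ≤ 1) (t : ℝ) {Z : ℝ}
    (hZ : ‖LSeries (fun n => (χ ^ 2) n) (1 + x + 2 * Complex.I * t)‖ ≤ Z) :
    1 ≤ (4 / x) ^ 3 * ‖LSeries (fun n => χ n) (1 + x + Complex.I * t)‖ ^ 4 * Z := by
  have h := DirichletCharacter.norm_LSeries_product_ge_one χ hx t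
  rw [norm_mul, norm_mul, norm_pow, norm_pow] at h
  refine h.le.trans ?_
  have h1 := norm_LSeries_le_LSeries_one (g := fun n => (1 : DirichletCharacter ℂ r) n)
    (fun n => DirichletCharacter.norm_le_one _ _) (s := 1 + x) (by simpa using hx)
  have h2 : ‖LSeries (fun n => (1 : DirichletCharacter ℂ r) n) (1 + x)‖ ≤ 4 / x := by
    refine h1.trans ?_
    simp only [Complex.add_re, Complex.one_re, Complex.ofReal_re, add_sub_cancel_left]
    gcongr
    nlinarith
  gcongr

set_option maxHeartbeats 1000000 in
theorem exists_norm_LSeries_character_ge : ∃ c : ℝ, 0 < c ∧ ∀ (q : ℝ), 1 ≤ q →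
    ∀ (r : ℕ) [NeZero r] (χ : DirichletCharacter ℂ r), χ ≠ 1 → 1 + Real.log r ≤ q →
    (χ ^ 2 = 1 → (q ^ 7)⁻¹ ≤ ‖χ.LFunction 1‖) → ∀ x : ℝ, 0 < x → x ≤ 1 → ∀ t : ℝ,
    c * ((q * (3 + |t|)) ^ 18)⁻¹ ≤ ‖LSeries (fun n => χ n) (1 + x + Complex.I * t)‖ := by
  obtain ⟨C₀, hC₀, hL₀⟩ := exists_norm_LSeries_logMul_le 0
  obtain ⟨C₁, hC₁, hL₁⟩ := exists_norm_LSeries_logMul_le 1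
  obtain ⟨C₂, hC₂, hT⟩ := exists_norm_LSeries_trivial_character_le
  set c₁ : ℝ := 1 / (16 * C₁) with hc₁
  have hc₁0 : 0 < c₁ := by positivity
  have hc₁1 : c₁ ≤ 1 := by rw [hc₁, div_le_one (by positivity)]; linarith
  set C' : ℝ := 2 * (1 + 1 / (2 * c₁) + C₀ + C₂) with hC'
  have hC'1 : 1 ≤ C' := by
    have : 0 < 1 / (2 * c₁) := by positivity
    linarith
  have hC'0 : 0 < C' := by linarith
  set c := min (min (1 / 2) (c₁ / 4)) (1024 * C₁ ^ 4 * C')⁻¹ with hc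
  have hc0 : 0 < c := by positivity
  refine ⟨c, hc0, fun q hq r _ χ hχ hr hreal x hx hx1 t => ?_⟩
  have ht0 := abs_nonneg t
  set D := q * (3 + |t|) with hD
  have hqD : q ≤ D := by rw [hD]; nlinarith
  have htD : 3 + |t| ≤ D := by rw [hD]; nlinarith
  have hD1 : 1 ≤ D := hq.trans hqD
  have hr1 : (1 : ℝ) ≤ r := by exact_mod_cast NeZero.pos r
  have hlr := Real.log_nonneg hr1
  have hχn : ∀ n : ℕ, ‖χ n‖ ≤ 1 := fun n => χ.norm_le_one _
  have hχs := norm_sum_Ico_character_le hχ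
  have hb1 : ∀ s : ℂ, 1 < s.re → ‖s‖ ≤ 3 + |t| →
      ‖LSeries (LSeries.logMul fun n => χ n) s‖ ≤ C₁ * D ^ 2 := by
    intro s hs hs2
    refine (hL₁ (fun n => χ n) r hr1 hχn hχs s hs).trans ?_
    calc C₁ * (1 + Real.log r) ^ (1 + 1) * ‖s‖ ≤ C₁ * q ^ (1 + 1) * (3 + |t|) := by gcongr
      _ ≤ C₁ * q ^ 2 * (3 + |t|) ^ 2 := by
        norm_num
        gcongr
        nlinarith
      _ = _ := by rw [hD]; ring
  have hkey : ∀ Z, 1 ≤ Z → Z ≤ C' * D ^ 10 → (∀ y : ℝ, 0 < y → y ≤ 1 →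
      ‖LSeries (fun n => (χ ^ 2) n) (1 + y + 2 * Complex.I * t)‖ ≤ Z) →
      c * (D ^ 18)⁻¹ ≤ ‖LSeries (fun n => χ n) (1 + x + Complex.I * t)‖ := by
    intro Z hZ1 hZ hZL
    have hD2 : 1 ≤ D ^ 2 := one_le_pow₀ hD1
    have h1 := inv_le_of_three_four_one (K := C₁ * D ^ 2) (Z := Z) (x := x)
      (l := fun y => ‖LSeries (fun n => χ n) (1 + y + Complex.I * t)‖) (by nlinarith) hZ1 hx1
      (fun y => norm_nonneg _)
      (fun y hy hy1 => one_le_three_four_one χ hy hy1 t (hZL y hy hy1)) (by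
        intro y hxy hy1
        have hy0 : 0 < y := by linarith
        have h2 := norm_LSeries_logMul_sub_le hχn (K := C₁ * D ^ 2)
          (z := 1 + y + Complex.I * t) (w := 1 + x + Complex.I * t) (by simpa using hy0)
          (by simpa using hx) (by
            intro s hs hseg
            refine hb1 s hs ?_
            have : s ∈ Metric.closedBall (0 : ℂ) (3 + |t|) := by
              refine (convex_closedBall _ _).segment_subset ?_ ?_ hseg <;>
              · rw [mem_closedBall_zero_iff]
                refine (norm_one_add_add_I_mul_le _ _).trans ?_
                rw [abs_of_pos (by assumption)]; linarith
            simpa using this)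
        have h3 := norm_sub_norm_le (LSeries (fun n => χ n) (1 + y + Complex.I * t))
          (LSeries (fun n => χ n) (1 + x + Complex.I * t))
        have h4 : ‖(1 + y + Complex.I * t : ℂ) - (1 + x + Complex.I * t)‖ ≤ y := by
          rw [show (1 + y + Complex.I * t : ℂ) - (1 + x + Complex.I * t) = ((y - x : ℝ) : ℂ) by
            push_cast; ring, Complex.norm_real, Real.norm_of_nonneg (by linarith)]
          linarith
        have h5 : C₁ * D ^ 2 * ‖(1 + y + Complex.I * t : ℂ) - (1 + x + Complex.I * t)‖ ≤
            C₁ * D ^ 2 * y := by gcongr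
        linarith)
    refine le_trans ?_ h1
    calc c * (D ^ 18)⁻¹ ≤ (1024 * C₁ ^ 4 * C')⁻¹ * (D ^ 18)⁻¹ := by
          gcongr; exact min_le_right _ _
      _ = (1024 * (C₁ * D ^ 2) ^ 4 * (C' * D ^ 10))⁻¹ := by
        rw [← mul_inv]; ring_nf
      _ ≤ _ := by gcongr
  have hs2 : ∀ y : ℝ, 0 < y → y ≤ 1 → ‖(1 + y + 2 * Complex.I * t : ℂ)‖ ≤ 2 * (3 + |t|) := by
    intro y hy hy1
    have := norm_one_add_add_I_mul_le y (2 * t)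
    rw [abs_of_pos hy, abs_mul, abs_two] at this
    push_cast at this
    rw [show (1 + y + 2 * Complex.I * t : ℂ) = 1 + y + Complex.I * (2 * t) by ring]
    linarith
  have hD10 : D ≤ D ^ 10 := le_self_pow₀ hD1 (by norm_num)
  by_cases h2 : χ ^ 2 = 1
  · set y₀ := c₁ * (q ^ 9)⁻¹ with hy₀
    have hq9 : 1 ≤ q ^ 9 := one_le_pow₀ hq
    have hy₀0 : 0 < y₀ := by positivity
    have hy₀1 : y₀ ≤ 1 := mul_le_one₀ hc₁1 (by positivity) (inv_le_one_of_one_le₀ hq9)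
    have hD9 : (D ^ 18)⁻¹ ≤ (q ^ 9)⁻¹ := by
      gcongr
      exact (pow_le_pow_left₀ (by linarith) hqD 9).trans (pow_le_pow_right₀ hD1 (by norm_num))
    have hD7 : (D ^ 18)⁻¹ ≤ (q ^ 7)⁻¹ := by
      gcongr
      exact (pow_le_pow_left₀ (by linarith) hqD 7).trans (pow_le_pow_right₀ hD1 (by norm_num))
    by_cases hty : y₀ ≤ |t|
    · refine hkey (C' * D ^ 10) (by nlinarith) le_rfl fun y hy hy1 => ?_
      rw [h2]
      have hre : 1 < (1 + y + 2 * Complex.I * t : ℂ).re := by simpa using hy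
      refine (hT r _ hre).trans ?_
      have h3 : 1 / ‖(1 + y + 2 * Complex.I * t : ℂ) - 1‖ ≤ 1 / (2 * c₁) * q ^ 9 := by
        have h4 : 2 * y₀ ≤ ‖(1 + y + 2 * Complex.I * t : ℂ) - 1‖ := by
          have := Complex.abs_im_le_norm ((1 + y + 2 * Complex.I * t : ℂ) - 1)
          simp [abs_mul] at this
          linarith
        refine (one_div_le_one_div_of_le (by positivity) h4).trans_eq ?_
        rw [hy₀]; field_simp
      have h5 := hs2 y hy hy1
      calc _ ≤ 2 * (3 + |t|) * (1 + 1 / (2 * c₁) * q ^ 9) + C₂ * q * (2 * (3 + |t|)) := by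
            gcongr
        _ = 2 * (3 + |t|) * (1 * 1 + 1 / (2 * c₁) * q ^ 9 + C₂ * q) := by ring
        _ ≤ 2 * D * (1 * D ^ 9 + 1 / (2 * c₁) * D ^ 9 + C₂ * D ^ 9) := by
            gcongr
            · exact one_le_pow₀ hD1
            · exact hqD.trans (le_self_pow₀ hD1 (by norm_num))
        _ ≤ C' * D ^ 10 := by
            rw [hC']
            have : 0 ≤ C₀ * D ^ 10 := by positivity
            linarith
    · push Not at hty
      by_cases hxy : y₀ ≤ x
      · have h3 := one_le_three_four_one χ hx hx1 t (Z := 4 / x) (by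
          refine (norm_LSeries_le_LSeries_one (fun n => DirichletCharacter.norm_le_one _ _)
            (by simpa using hx)).trans ?_
          simp
          gcongr
          nlinarith)
        have h4 : (x / 4) ^ 4 ≤ ‖LSeries (fun n => χ n) (1 + x + Complex.I * t)‖ ^ 4 := by
          have e : (4 / x) ^ 3 * ‖LSeries (fun n => χ n) (1 + x + Complex.I * t)‖ ^ 4 * (4 / x) =
            ‖LSeries (fun n => χ n) (1 + x + Complex.I * t)‖ ^ 4 / (x / 4) ^ 4 := by
            field_simp
          rw [e, le_div_iff₀ (by positivity)] at h3
          linarith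
        have h5 := le_of_pow_le_pow_left₀ (by norm_num) (norm_nonneg _) h4
        refine le_trans ?_ h5
        calc c * (D ^ 18)⁻¹ ≤ c₁ / 4 * (q ^ 9)⁻¹ := by
              gcongr; exact (min_le_left _ _).trans (min_le_right _ _)
          _ = y₀ / 4 := by rw [hy₀]; ring
          _ ≤ _ := by linarith
      · push Not at hxy
        have h3 : ∀ u : ℝ, 0 < u → u < x → ‖χ.LFunction (1 + u)‖ ≤
            ‖LSeries (fun n => χ n) (1 + x + Complex.I * t)‖ + 1 / 2 * (q ^ 7)⁻¹ := by
          intro u hu hux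
          have hure : 1 < (1 + u : ℂ).re := by simpa using hu
          rw [DirichletCharacter.LFunction_eq_LSeries χ hure]
          have h4 := norm_LSeries_logMul_sub_le hχn (K := C₁ * q ^ 2 * 4)
            (z := 1 + u) (w := 1 + x + Complex.I * t) hure
            (by simpa using hx) (by
              intro s hs hseg
              have : s ∈ Metric.closedBall (0 : ℂ) 4 := by
                refine (convex_closedBall _ _).segment_subset ?_ ?_ hseg <;>
                rw [mem_closedBall_zero_iff]
                · have := norm_one_add_add_I_mul_le u 0
                  simp only [Complex.ofReal_zero, mul_zero, add_zero, abs_zero] at this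
                  rw [abs_of_pos hu] at this; linarith
                · refine (norm_one_add_add_I_mul_le _ _).trans ?_
                  rw [abs_of_pos hx]; linarith
              rw [mem_closedBall_zero_iff] at this
              refine (hL₁ (fun n => χ n) r hr1 hχn hχs s hs).trans ?_
              gcongr)
          have h5 : ‖(1 + u : ℂ) - (1 + x + Complex.I * t)‖ ≤ 2 * y₀ := by
            rw [show (1 + u : ℂ) - (1 + x + Complex.I * t) = ((u - x : ℝ) : ℂ) - Complex.I * t by
              push_cast; ring]
            refine (norm_sub_le _ _).trans ?_
            simp only [norm_mul, Complex.norm_I, Complex.norm_real, Real.norm_eq_abs, one_mul]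
            rw [abs_of_neg (by linarith : u - x < 0)]
            linarith
          have h6 : C₁ * q ^ 2 * 4 * (2 * y₀) = 1 / 2 * (q ^ 7)⁻¹ := by
            rw [hy₀, hc₁]
            field_simp
            norm_num
          have h7 : C₁ * q ^ 2 * 4 * ‖(1 + u : ℂ) - (1 + x + Complex.I * t)‖ ≤
            C₁ * q ^ 2 * 4 * (2 * y₀) := by gcongr
          have h8 := norm_sub_norm_le (LSeries (fun n => χ n) (1 + u))
            (LSeries (fun n => χ n) (1 + x + Complex.I * t))
          linarith
        have hlim : Tendsto (fun u : ℝ => ‖χ.LFunction (1 + u)‖) (𝓝[>] 0) (𝓝 ‖χ.LFunction 1‖) := by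
          have hcont : Continuous fun u : ℝ => ‖χ.LFunction (1 + u)‖ :=
            ((DirichletCharacter.differentiable_LFunction hχ).continuous.comp
              (by fun_prop : Continuous fun u : ℝ => (1 + u : ℂ))).norm
          have := hcont.tendsto 0
          simp only [Complex.ofReal_zero, add_zero] at this
          exact this.mono_left nhdsWithin_le_nhds
        have h4 : ‖χ.LFunction 1‖ ≤
            ‖LSeries (fun n => χ n) (1 + x + Complex.I * t)‖ + 1 / 2 * (q ^ 7)⁻¹ := by
          refine le_of_tendsto hlim ?_
          filter_upwards [Ioo_mem_nhdsGT hx] with u hu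
          exact h3 u hu.1 hu.2
        have h5 := hreal h2
        have h6 : c * (D ^ 18)⁻¹ ≤ 1 / 2 * (q ^ 7)⁻¹ := by
          gcongr
          exact (min_le_left _ _).trans (min_le_left _ _)
        linarith
  · refine hkey (C' * D ^ 10) (by nlinarith) le_rfl fun y hy hy1 => ?_
    have h3 := hL₀ (fun n => (χ ^ 2) n) r hr1 (fun n => DirichletCharacter.norm_le_one _ _)
      (norm_sum_Ico_character_le h2) (1 + y + 2 * Complex.I * t) (by simpa using hy)
    refine h3.trans ?_
    calc C₀ * (1 + Real.log r) ^ (0 + 1) * ‖(1 + y + 2 * Complex.I * t : ℂ)‖ ≤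
          C₀ * q * (2 * (3 + |t|)) := by
            rw [zero_add, pow_one]
            gcongr
            exact hs2 y hy hy1
      _ = 2 * C₀ * D := by rw [hD]; ring
      _ ≤ C' * D ^ 10 := by
        have hCC : 2 * C₀ ≤ C' := by
          have : 0 < 1 / (2 * c₁) := by positivity
          linarith
        exact mul_le_mul hCC hD10 (by linarith) hC'0.le

end ZeroFreeRegion

section ExceptionalZeros

open Finset Filter Topology MeasureTheory

theorem one_le_norm_inv_product {a b : ℂ} (ha : a = 0 ∨ a = 1 ∨ a = -1)
    (hb : b = 0 ∨ b = 1 ∨ b = -1) {x : ℝ} (hx : 0 ≤ x) (hx1 : x < 1) :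
    1 ≤ ‖(1 - (x : ℂ))⁻¹ * (1 - a * x)⁻¹ * (1 - b * x)⁻¹ * (1 - a * b * x)⁻¹‖ := by
  have h1 : ‖1 - (x : ℂ)‖ = 1 - x := by
    rw [← Complex.ofReal_one, ← Complex.ofReal_sub, Complex.norm_of_nonneg (by linarith)]
  have h2 : ‖1 + (x : ℂ)‖ = 1 + x := by
    rw [← Complex.ofReal_one, ← Complex.ofReal_add, Complex.norm_of_nonneg (by linarith)]
  have h3 : 0 < 1 - x := by linarith
  have h4 : 0 < 1 + x := by linarith
  have h5 : (1 - x) * (1 + x) ≤ 1 := by nlinarith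
  have h7 : 0 < (1 - x) * (1 + x) := by positivity
  have h6 : (1 - x) * (1 - x) ≤ 1 := by nlinarith
  rw [← mul_inv, ← mul_inv, ← mul_inv, norm_inv]
  refine (one_le_inv₀ ?_).2 ?_
  · rcases ha with rfl | rfl | rfl <;> rcases hb with rfl | rfl | rfl <;>
      simp [h1, h2, h3.ne', h3, h4]
  · rcases ha with rfl | rfl | rfl <;> rcases hb with rfl | rfl | rfl <;>
      simp [h1, h2] <;> nlinarith

theorem hasProd_LSeries {a : ℕ →*₀ ℂ} (ha : ∀ n, ‖a n‖ ≤ 1) {s : ℂ} (hs : 1 < s.re) :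
    HasProd (fun p : Nat.Primes => (1 - a p * (p : ℂ) ^ (-s))⁻¹) (LSeries (fun n => a n) s) := by
  have hs0 : s ≠ 0 := Complex.ne_zero_of_one_lt_re hs
  have hsum : Summable (fun n => ‖(a * riemannZetaSummandHom hs0) n‖) := by
    refine Summable.of_nonneg_of_le (fun _ => norm_nonneg _) (fun n => ?_)
      (summable_riemannZetaSummand hs)
    change ‖a n * riemannZetaSummandHom hs0 n‖ ≤ _
    rw [norm_mul]
    exact mul_le_of_le_one_left (norm_nonneg _) (ha n)
  have := EulerProduct.eulerProduct_completely_multiplicative_hasProd hsum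
  have hL : LSeries (fun n => a n) s = ∑' n, (a * riemannZetaSummandHom hs0) n := by
    rw [LSeries]
    refine tsum_congr fun n => ?_
    rcases eq_or_ne n 0 with rfl | hn
    · simp
    · rw [LSeries.term_of_ne_zero hn, div_eq_mul_inv, ← Complex.cpow_neg]; rfl
  rw [hL]
  exact this

theorem one_le_norm_LSeries_product {a b : ℕ →*₀ ℂ} (ha : ∀ n, a n = 0 ∨ a n = 1 ∨ a n = -1)
    (hb : ∀ n, b n = 0 ∨ b n = 1 ∨ b n = -1) {σ : ℝ} (hσ : 1 < σ) :
    1 ≤ ‖LSeries 1 (σ : ℂ)‖ * ‖LSeries (fun n => a n) (σ : ℂ)‖ *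
      ‖LSeries (fun n => b n) (σ : ℂ)‖ * ‖LSeries (fun n => a n * b n) (σ : ℂ)‖ := by
  have hs : 1 < (σ : ℂ).re := by simpa
  have hn : ∀ {z : ℂ}, (z = 0 ∨ z = 1 ∨ z = -1) → ‖z‖ ≤ 1 := by
    rintro z (rfl | rfl | rfl) <;> simp
  have h2 := hasProd_LSeries (fun n => hn (ha n)) hs
  have h3 := hasProd_LSeries (fun n => hn (hb n)) hs
  have h4 := hasProd_LSeries (a := a * b) (fun n => by
    change ‖a n * b n‖ ≤ 1
    rw [norm_mul]
    exact mul_le_one₀ (hn (ha n)) (norm_nonneg _) (hn (hb n))) hs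
  have h1 := riemannZeta_eulerProduct_hasProd hs
  rw [← LSeries_one_eq_riemannZeta hs] at h1
  have h := ((h1.mul h2).mul h3).mul h4
  have h5 := (continuous_norm.tendsto _).comp h
  simp only [norm_mul] at h5
  refine ge_of_tendsto' h5 fun S => ?_
  simp only [Function.comp_apply]
  rw [norm_prod]
  rw [← Finset.prod_const_one (s := S)]
  refine Finset.prod_le_prod (fun _ _ => zero_le_one) fun p _ => ?_
  have hp : (0 : ℝ) < (p : ℕ) := by exact_mod_cast p.2.pos
  have hpp : ((p : ℕ) : ℂ) ^ (-(σ : ℂ)) = (((p : ℕ) : ℝ) ^ (-σ) : ℝ) := by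
    rw [Complex.ofReal_cpow hp.le]; simp
  have := one_le_norm_inv_product (ha p) (hb p) (x := ((p : ℕ) : ℝ) ^ (-σ)) (by positivity)
    (Real.rpow_lt_one_of_one_lt_of_neg (by exact_mod_cast p.2.one_lt) (by linarith))
  rw [hpp]
  exact this

theorem eq_of_changeLevel_eq {r m n : ℕ} [NeZero n] {χ : DirichletCharacter ℂ r}
    {ψ : DirichletCharacter ℂ m} (hχ : χ.IsPrimitive) (hψ : ψ.IsPrimitive) (hr : r ∣ n) (hm : m ∣ n)
    (h : DirichletCharacter.changeLevel hr χ = DirichletCharacter.changeLevel hm ψ) :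
    (⟨r, χ⟩ : Σ n, DirichletCharacter ℂ n) = ⟨m, ψ⟩ := by
  have h1 := DirichletCharacter.conductor_changeLevel χ hr
  have h2 := DirichletCharacter.conductor_changeLevel ψ hm
  rw [h, h2] at h1
  rw [DirichletCharacter.IsPrimitive] at hχ hψ
  rw [hχ, hψ] at h1
  subst h1
  rw [DirichletCharacter.changeLevel_injective hr h]

theorem eq_zero_or_one_or_neg_one_of_sq_eq_one {r : ℕ} {χ : DirichletCharacter ℂ r}
    (h : χ ^ 2 = 1) (x : ZMod r) : χ x = 0 ∨ χ x = 1 ∨ χ x = -1 := by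
  by_cases hx : IsUnit x
  · right
    have h1 : (χ ^ 2) x = 1 := by rw [h, MulChar.one_apply hx]
    rw [MulChar.pow_apply' χ two_ne_zero] at h1
    exact mul_self_eq_one_iff.1 (by rwa [← sq])
  · left; exact MulChar.map_nonunit χ hx

theorem exists_hom_eq_character {r : ℕ} (χ : DirichletCharacter ℂ r) (hχ : χ ≠ 1) :
    ∃ a : ℕ →*₀ ℂ, ∀ n : ℕ, a n = χ n := by
  have hr : r ≠ 1 := by
    rintro rfl
    exact hχ (DirichletCharacter.level_one χ)
  have : Nontrivial (ZMod r) := ZMod.nontrivial_iff.2 hr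
  exact ⟨{ toFun := fun n => χ n
           map_zero' := by rw [Nat.cast_zero, MulChar.map_zero]
           map_one' := by rw [Nat.cast_one, map_one]
           map_mul' := fun x y => by rw [Nat.cast_mul, map_mul] }, fun n => rfl⟩

theorem changeLevel_mul_changeLevel_apply {r m : ℕ} [NeZero r] [NeZero m]
    (χ : DirichletCharacter ℂ r) (ψ : DirichletCharacter ℂ m) (n : ℕ) :
    (DirichletCharacter.changeLevel (Nat.dvd_mul_right r m) χ *
      DirichletCharacter.changeLevel (Nat.dvd_mul_left m r) ψ) n = χ n * ψ n := by
  by_cases h : n.Coprime (r * m)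
  · have h' : IsCoprime (n : ℤ) ((r * m : ℕ) : ℤ) := Nat.isCoprime_iff_coprime.2 h
    rw [MulChar.mul_apply, ← Int.cast_natCast, DirichletCharacter.changeLevel_eq_cast_of_dvd' _ _ h',
      DirichletCharacter.changeLevel_eq_cast_of_dvd' _ _ h', Int.cast_natCast, Int.cast_natCast]
  · rw [MulChar.map_nonunit _ (mt (ZMod.isUnit_iff_coprime _ _).1 h)]
    rw [Nat.coprime_mul_iff_right, not_and_or] at h
    rcases h with h | h
    · rw [MulChar.map_nonunit χ (mt (ZMod.isUnit_iff_coprime _ _).1 h), zero_mul]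
    · rw [MulChar.map_nonunit ψ (mt (ZMod.isUnit_iff_coprime _ _).1 h), mul_zero]

theorem exists_norm_LSeries_character_sub_le : ∃ C : ℝ, 1 ≤ C ∧ ∀ (r : ℕ) [NeZero r]
    (χ : DirichletCharacter ℂ r), χ ≠ 1 → ∀ q : ℝ, 1 + Real.log r ≤ q → ∀ x : ℝ, 0 < x → x ≤ 1 →
      ‖LSeries (fun n => χ n) (1 + x) - χ.LFunction 1‖ ≤ C * q ^ 2 * x := by
  obtain ⟨C, hC, h⟩ := exists_norm_LSeries_logMul_le 1
  refine ⟨C * 2, by linarith, fun r _ χ hχ q hq x hx hx1 => ?_⟩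
  have hr1 : (1 : ℝ) ≤ r := by exact_mod_cast NeZero.pos r
  have hlr : 0 ≤ Real.log r := Real.log_nonneg hr1
  have hq0 : 0 ≤ q := by linarith
  have hdiff : ∀ u : ℝ, 0 < u → u < x →
      ‖LSeries (fun n => χ n) (1 + x) - LSeries (fun n => χ n) (1 + u)‖ ≤ C * 2 * q ^ 2 * x := by
    intro u hu hux
    have hK : ∀ s : ℂ, 1 < s.re → s ∈ segment ℝ (1 + x : ℂ) (1 + u) →
        ‖LSeries (LSeries.logMul fun n => χ n) s‖ ≤ C * 2 * q ^ 2 := by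
      intro s hs hseg
      have hs2 : ‖s‖ ≤ 2 := by
        have hb : segment ℝ (1 + x : ℂ) (1 + u) ⊆ Metric.closedBall 0 2 := by
          refine (convex_closedBall (0 : ℂ) 2).segment_subset ?_ ?_ <;> rw [mem_closedBall_zero_iff]
          · refine (norm_add_le _ _).trans ?_
            rw [norm_one, Complex.norm_of_nonneg hx.le]; linarith
          · refine (norm_add_le _ _).trans ?_
            rw [norm_one, Complex.norm_of_nonneg hu.le]; linarith
        simpa using hb hseg
      refine (h (fun n => χ n) r hr1 (fun n => DirichletCharacter.norm_le_one _ _)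
        (norm_sum_Ico_character_le hχ) s hs).trans ?_
      calc C * (1 + Real.log r) ^ (1 + 1) * ‖s‖ ≤ C * q ^ 2 * 2 := by gcongr
        _ = _ := by ring
    refine (norm_LSeries_logMul_sub_le (fun n => DirichletCharacter.norm_le_one _ _)
      (by simpa using hx) (by simpa using hu) hK).trans ?_
    gcongr
    rw [show (1 + x - (1 + u) : ℂ) = ((x - u : ℝ) : ℂ) by push_cast; ring,
      Complex.norm_of_nonneg (by linarith)]
    linarith
  have hlim : Tendsto (fun u : ℝ => ‖LSeries (fun n => χ n) (1 + x) - χ.LFunction (1 + u)‖)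
      (𝓝[>] 0) (𝓝 ‖LSeries (fun n => χ n) (1 + x) - χ.LFunction 1‖) := by
    have hcont : Continuous fun u : ℝ =>
        ‖LSeries (fun n => χ n) (1 + x) - χ.LFunction (1 + u)‖ :=
      (continuous_const.sub ((DirichletCharacter.differentiable_LFunction hχ).continuous.comp
        (by fun_prop : Continuous fun u : ℝ => (1 + u : ℂ)))).norm
    have := hcont.tendsto 0
    simp only [Complex.ofReal_zero, add_zero] at this
    exact this.mono_left nhdsWithin_le_nhds
  refine le_of_tendsto hlim ?_
  filter_upwards [Ioo_mem_nhdsGT hx] with u hu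
  rw [DirichletCharacter.LFunction_eq_LSeries χ (by simpa using hu.1)]
  exact hdiff u hu.1 hu.2

theorem exists_one_le_mul_LFunction_one : ∃ C : ℝ, 1 ≤ C ∧ ∀ (r m : ℕ) [NeZero r] [NeZero m]
    (χ : DirichletCharacter ℂ r) (ψ : DirichletCharacter ℂ m), χ.IsPrimitive → ψ.IsPrimitive →
    χ ≠ 1 → ψ ≠ 1 → χ ^ 2 = 1 → ψ ^ 2 = 1 →
    (⟨r, χ⟩ : Σ n, DirichletCharacter ℂ n) ≠ ⟨m, ψ⟩ → ∀ q : ℝ, 1 + Real.log r ≤ q →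
    1 + Real.log m ≤ q → ∀ x : ℝ, 0 < x → x ≤ 1 →
    1 ≤ C * q / x * (‖χ.LFunction 1‖ + C * q ^ 2 * x) * (‖ψ.LFunction 1‖ + C * q ^ 2 * x) := by
  obtain ⟨C, hC, h⟩ := exists_norm_LSeries_logMul_le 0
  obtain ⟨C', hC', h'⟩ := exists_norm_LSeries_character_sub_le
  refine ⟨16 * C + C', by linarith, fun r m _ _ χ ψ hχ hψ hχ1 hψ1 hχ2 hψ2 hne q hqr hqm x hx hx1 => ?_⟩
  obtain ⟨a, ha⟩ := exists_hom_eq_character χ hχ1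
  obtain ⟨b, hb⟩ := exists_hom_eq_character ψ hψ1
  have hr1 : (1 : ℝ) ≤ r := by exact_mod_cast NeZero.pos r
  have hm1 : (1 : ℝ) ≤ m := by exact_mod_cast NeZero.pos m
  have hlr : 0 ≤ Real.log r := Real.log_nonneg hr1
  have hq0 : 0 < q := by linarith
  have key := one_le_norm_LSeries_product (a := a) (b := b) (σ := 1 + x)
    (fun n => by rw [ha]; exact eq_zero_or_one_or_neg_one_of_sq_eq_one hχ2 _)
    (fun n => by rw [hb]; exact eq_zero_or_one_or_neg_one_of_sq_eq_one hψ2 _) (by linarith)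
  simp only [ha, hb] at key
  have hs : 1 < ((1 + x : ℝ) : ℂ).re := by rw [Complex.ofReal_re]; linarith
  have hsn : ‖((1 + x : ℝ) : ℂ)‖ ≤ 2 := by rw [Complex.norm_of_nonneg (by linarith)]; linarith
  have h1 : ‖LSeries 1 ((1 + x : ℝ) : ℂ)‖ ≤ 4 / x := by
    refine (norm_LSeries_le_LSeries_one (by simp) hs).trans ?_
    rw [Complex.ofReal_re, add_sub_cancel_left]
    gcongr
    nlinarith
  have h2 : ‖LSeries (fun n => χ n) ((1 + x : ℝ) : ℂ)‖ ≤ ‖χ.LFunction 1‖ + C' * q ^ 2 * x := by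
    have := h' r χ hχ1 q hqr x hx hx1
    have h3 := norm_sub_norm_le (LSeries (fun n => χ n) (1 + x)) (χ.LFunction 1)
    push_cast
    linarith
  have h3 : ‖LSeries (fun n => ψ n) ((1 + x : ℝ) : ℂ)‖ ≤ ‖ψ.LFunction 1‖ + C' * q ^ 2 * x := by
    have := h' m ψ hψ1 q hqm x hx hx1
    have h3 := norm_sub_norm_le (LSeries (fun n => ψ n) (1 + x)) (ψ.LFunction 1)
    push_cast
    linarith
  have h4 : ‖LSeries (fun n => χ n * ψ n) ((1 + x : ℝ) : ℂ)‖ ≤ 4 * C * q := by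
    set θ := DirichletCharacter.changeLevel (Nat.dvd_mul_right r m) χ *
      DirichletCharacter.changeLevel (Nat.dvd_mul_left m r) ψ with hθ
    have hrm : NeZero (r * m) := ⟨mul_ne_zero (NeZero.ne r) (NeZero.ne m)⟩
    have hθ1 : θ ≠ 1 := by
      intro h5
      refine hne (eq_of_changeLevel_eq hχ hψ (Nat.dvd_mul_right r m) (Nat.dvd_mul_left m r) ?_)
      have h6 : DirichletCharacter.changeLevel (Nat.dvd_mul_left m r) ψ *
          DirichletCharacter.changeLevel (Nat.dvd_mul_left m r) ψ = 1 := by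
        rw [← map_mul, ← sq, hψ2, map_one]
      exact (eq_inv_of_mul_eq_one_left h5).trans (eq_inv_of_mul_eq_one_left h6).symm
    have h7 : (fun n : ℕ => χ n * ψ n) = fun n : ℕ => θ n := by
      funext n; exact (changeLevel_mul_changeLevel_apply χ ψ n).symm
    rw [h7]
    have hrm1 : (1 : ℝ) ≤ (r * m : ℕ) := by exact_mod_cast NeZero.pos (r * m)
    refine (h (fun n => θ n) (r * m : ℕ) hrm1 (fun n => DirichletCharacter.norm_le_one _ _)
      (norm_sum_Ico_character_le hθ1) _ hs).trans ?_
    have h8 : Real.log (r * m : ℕ) = Real.log r + Real.log m := by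
      rw [Nat.cast_mul, Real.log_mul (by positivity) (by positivity)]
    calc C * (1 + Real.log (r * m : ℕ)) ^ (0 + 1) * ‖((1 + x : ℝ) : ℂ)‖ ≤ C * (2 * q) * 2 := by
          rw [zero_add, pow_one, h8]; gcongr; linarith
      _ = _ := by ring
  calc (1 : ℝ) ≤ 4 / x * (‖χ.LFunction 1‖ + C' * q ^ 2 * x) * (‖ψ.LFunction 1‖ + C' * q ^ 2 * x) *
        (4 * C * q) := key.trans (by gcongr)
    _ = (16 * C) * q / x * (‖χ.LFunction 1‖ + C' * q ^ 2 * x) *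
        (‖ψ.LFunction 1‖ + C' * q ^ 2 * x) := by field_simp; ring
    _ ≤ _ := by gcongr <;> linarith

theorem exists_forall_inv_le_norm_LFunction_one (q₀ : ℝ) : ∃ q : ℝ, q₀ ≤ q ∧ 1 ≤ q ∧
    ∀ (r : ℕ) [NeZero r] (χ : DirichletCharacter ℂ r), χ.IsPrimitive → χ ≠ 1 → χ ^ 2 = 1 →
      1 + Real.log r ≤ q → (q ^ 7)⁻¹ ≤ ‖χ.LFunction 1‖ := by
  obtain ⟨C, hC, h⟩ := exists_one_le_mul_LFunction_one
  set q₁ : ℝ := max q₀ (2 * C * (1 + C) * (1 + C)) with hq₁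
  have hq₁C : 2 * C * (1 + C) * (1 + C) ≤ q₁ := le_max_right _ _
  have hq₁1 : 8 ≤ q₁ := by
    refine le_trans ?_ hq₁C
    have h1 : 2 ≤ 1 + C := by linarith
    have h2 : 2 * (1 : ℝ) ≤ 2 * C := by linarith
    calc (8 : ℝ) = 2 * 1 * 2 * 2 := by norm_num
      _ ≤ _ := by gcongr
  by_cases hgood : ∀ (r : ℕ) [NeZero r] (χ : DirichletCharacter ℂ r), χ.IsPrimitive → χ ≠ 1 →
      χ ^ 2 = 1 → 1 + Real.log r ≤ q₁ → (q₁ ^ 7)⁻¹ ≤ ‖χ.LFunction 1‖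
  · exact ⟨q₁, le_max_left _ _, by linarith, hgood⟩
  push Not at hgood
  obtain ⟨m, _, ψ, hψ, hψ1, hψ2, hm, hv⟩ := hgood
  set v := ‖ψ.LFunction 1‖ with hvdef
  have hv0 : 0 < v := norm_pos_iff.2 (DirichletCharacter.LFunction_apply_one_ne_zero hψ1)
  set q : ℝ := (v⁻¹) ^ ((7 : ℝ)⁻¹) with hq
  have hq7 : q ^ 7 = v⁻¹ := by
    rw [hq, ← Real.rpow_natCast, ← Real.rpow_mul (by positivity)]; norm_num
  have hq0 : 0 < q := by positivity
  have hqq : q₁ ≤ q := by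
    refine le_of_pow_le_pow_left₀ (n := 7) (by norm_num) hq0.le ?_
    rw [hq7]
    exact (le_inv_comm₀ (by positivity) hv0).2 hv.le
  refine ⟨q, (le_max_left _ _).trans hqq, by linarith, fun r _ χ hχ hχ1 hχ2 hr => ?_⟩
  by_cases hne : (⟨r, χ⟩ : Σ n, DirichletCharacter ℂ n) = ⟨m, ψ⟩
  · rw [hq7, inv_inv]
    obtain ⟨rfl, h1⟩ := Sigma.mk.inj hne
    obtain rfl := eq_of_heq h1
    exact le_rfl
  · have hq1 : 1 ≤ q := by linarith
    have key := h r m χ ψ hχ hψ hχ1 hψ1 hχ2 hψ2 hne q hr (by linarith) ((q ^ 9)⁻¹) (by positivity)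
      (inv_le_one_of_one_le₀ (one_le_pow₀ hq1))
    by_contra! hlt
    have e1 : C * q ^ 2 * (q ^ 9)⁻¹ = C * (q ^ 7)⁻¹ := by field_simp
    have e2 : v = (q ^ 7)⁻¹ := by rw [hq7, inv_inv]
    rw [e1, ← hvdef, e2] at key
    have : C * q / (q ^ 9)⁻¹ * (‖χ.LFunction 1‖ + C * (q ^ 7)⁻¹) * ((q ^ 7)⁻¹ + C * (q ^ 7)⁻¹) ≤
        C * q / (q ^ 9)⁻¹ * ((q ^ 7)⁻¹ + C * (q ^ 7)⁻¹) * ((q ^ 7)⁻¹ + C * (q ^ 7)⁻¹) := by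
      gcongr
    have e3 : C * q / (q ^ 9)⁻¹ * ((q ^ 7)⁻¹ + C * (q ^ 7)⁻¹) * ((q ^ 7)⁻¹ + C * (q ^ 7)⁻¹) =
        C * (1 + C) * (1 + C) * (q ^ 4)⁻¹ := by field_simp
    rw [e3] at this
    have h5 : q ≤ q ^ 4 := by simpa using pow_le_pow_right₀ hq1 (show 1 ≤ 4 by norm_num)
    have h6 : C * (1 + C) * (1 + C) * (q ^ 4)⁻¹ < 1 := by
      rw [← div_eq_mul_inv, div_lt_one (by positivity)]
      have : 0 < C * (1 + C) * (1 + C) := by positivity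
      linarith
    linarith

end ExceptionalZeros

section LogarithmicDerivative

open Finset Filter Topology MeasureTheory ArithmeticFunction

theorem norm_iteratedDeriv_LSeries {f : ℕ → ℂ} (hf : LSeries.abscissaOfAbsConv f ≤ 1) (m : ℕ)
    {s : ℂ} (hs : 1 < s.re) :
    ‖iteratedDeriv m (LSeries f) s‖ = ‖LSeries (LSeries.logMul^[m] f) s‖ := by
  rw [LSeries_iteratedDeriv m (hf.trans_lt (by exact_mod_cast hs)), norm_mul, norm_pow, norm_neg,
    norm_one, one_pow, one_mul]

theorem abscissaOfAbsConv_twist_vonMangoldt_le_one {r : ℕ} (χ : DirichletCharacter ℂ r) :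
    LSeries.abscissaOfAbsConv (fun n => χ n * (vonMangoldt n : ℂ)) ≤ 1 := by
  refine LSeries.abscissaOfAbsConv_le_of_forall_lt_LSeriesSummable (x := 1) fun y hy => ?_
  exact DirichletCharacter.LSeriesSummable_twist_vonMangoldt χ (by simpa using hy)

theorem contDiffAt_LSeries {f : ℕ → ℂ} (hf : LSeries.abscissaOfAbsConv f ≤ 1)
    {s : ℂ} (hs : 1 < s.re) (n : WithTop ℕ∞) : ContDiffAt ℂ n (LSeries f) s :=
  (LSeries_analyticOnNhd f s (hf.trans_lt (by exact_mod_cast hs))).contDiffAt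

theorem norm_LSeries_logMul_twist_vonMangoldt_mul_le {r : ℕ} (χ : DirichletCharacter ℂ r) (j : ℕ)
    {s : ℂ} (hs : 1 < s.re) :
    ‖LSeries (LSeries.logMul^[j] fun n => χ n * (vonMangoldt n : ℂ)) s‖ *
      ‖LSeries (fun n => χ n) s‖ ≤ ‖LSeries (LSeries.logMul^[j + 1] fun n => χ n) s‖ +
      ∑ i ∈ range j, (j.choose i) * ‖LSeries (LSeries.logMul^[i] fun n => χ n * (vonMangoldt n : ℂ)) s‖ *
        ‖LSeries (LSeries.logMul^[j - i] fun n => χ n) s‖ := by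
  have hg : ∀ n : ℕ, ‖χ n‖ ≤ 1 := fun n => DirichletCharacter.norm_le_one _ _
  have ha := abscissaOfAbsConv_logMul_iterate_le_one hg 0
  have ha' : LSeries.abscissaOfAbsConv (fun n : ℕ => χ n) ≤ 1 := ha
  have hb := abscissaOfAbsConv_twist_vonMangoldt_le_one χ
  set L := LSeries (fun n : ℕ => χ n) with hL
  set F := LSeries (fun n : ℕ => χ n * (vonMangoldt n : ℂ)) with hF
  have h1 : F * L =ᶠ[𝓝 s] fun z => -deriv L z := by
    have : {z : ℂ | 1 < z.re} ∈ 𝓝 s := (isOpen_lt continuous_const Complex.continuous_re).mem_nhds hs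
    filter_upwards [this] with z hz
    have := DirichletCharacter.LSeries_twist_vonMangoldt_eq χ hz
    have h2 := DirichletCharacter.LSeries_ne_zero_of_one_lt_re χ hz
    change F z = -deriv L z / L z at this
    rw [Pi.mul_apply, this, div_mul_cancel₀ _ h2]
  have h2 := h1.iteratedDeriv_eq j
  rw [iteratedDeriv_mul (contDiffAt_LSeries hb hs _) (contDiffAt_LSeries ha' hs _),
    sum_range_succ] at h2
  have h3 : iteratedDeriv j (fun z => -deriv L z) s = - iteratedDeriv (j + 1) L s := by
    rw [iteratedDeriv_succ']
    exact iteratedDeriv_neg j _ s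
  rw [h3] at h2
  simp only [Nat.choose_self, Nat.cast_one, one_mul, Nat.sub_self, iteratedDeriv_zero] at h2
  rw [← norm_iteratedDeriv_LSeries hb j hs, ← norm_iteratedDeriv_LSeries ha' (j + 1) hs, ← norm_mul,
    eq_sub_of_add_eq' h2]
  refine (norm_sub_le _ _).trans ?_
  rw [norm_neg]
  refine add_le_add le_rfl ((norm_sum_le _ _).trans (sum_le_sum fun i _ => ?_))
  rw [← norm_iteratedDeriv_LSeries hb i hs, ← norm_iteratedDeriv_LSeries ha' (j - i) hs, norm_mul,
    norm_mul, Complex.norm_natCast]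

theorem exists_forall_lt_norm_LSeries_logMul_twist_vonMangoldt_le (j : ℕ) : ∃ C : ℝ, 1 ≤ C ∧
    ∃ k : ℕ, ∀ q : ℝ, 1 ≤ q → ∀ (r : ℕ) [NeZero r] (χ : DirichletCharacter ℂ r), χ ≠ 1 →
    1 + Real.log r ≤ q → (χ ^ 2 = 1 → (q ^ 7)⁻¹ ≤ ‖χ.LFunction 1‖) → ∀ x : ℝ, 0 < x → x ≤ 1 →
    ∀ t : ℝ, ∀ i < j, ‖LSeries (LSeries.logMul^[i] fun n => χ n * (vonMangoldt n : ℂ))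
      (1 + x + Complex.I * t)‖ ≤ C * (q * (3 + |t|)) ^ k := by
  induction j with
  | zero => exact ⟨1, le_rfl, 0, by simp⟩
  | succ j ih =>
    obtain ⟨C, hC, k, h⟩ := ih
    obtain ⟨c, hc, hlow⟩ := exists_norm_LSeries_character_ge
    choose A hA hup using exists_norm_LSeries_logMul_le
    set B : ℝ := ∑ i ∈ range (j + 2), A i with hB
    have hAB : ∀ i ≤ j + 1, A i ≤ B := fun i hi =>
      single_le_sum (f := A) (fun i _ => by linarith [hA i]) (mem_range.2 (by omega))
    have hB1 : 1 ≤ B := (hA 0).trans (hAB 0 (by omega))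
    refine ⟨C + c⁻¹ * (2 * B + 2 ^ j * C * (2 * B)), ?_, k + (j + 3) + 18, ?_⟩
    · have : 0 ≤ c⁻¹ * (2 * B + 2 ^ j * C * (2 * B)) := by positivity
      linarith
    intro q hq r _ χ hχ hr hreal x hx hx1 t i hi
    set D := q * (3 + |t|) with hD
    have hD1 : 1 ≤ D := one_le_mul_of_one_le_of_one_le hq (by linarith [abs_nonneg t])
    set s : ℂ := 1 + x + Complex.I * t with hs
    have hsre : 1 < s.re := by simpa [hs] using hx
    have hsn : ‖s‖ ≤ 2 * (3 + |t|) := by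
      calc ‖s‖ ≤ ‖(1 : ℂ)‖ + ‖(x : ℂ)‖ + ‖Complex.I * t‖ := norm_add₃_le
        _ = 1 + x + |t| := by
          rw [norm_one, Complex.norm_of_nonneg hx.le, norm_mul, Complex.norm_I, one_mul,
            Complex.norm_real, Real.norm_eq_abs]
        _ ≤ _ := by linarith [abs_nonneg t]
    have hr1 : (1 : ℝ) ≤ r := by exact_mod_cast NeZero.pos r
    have hlr : 0 ≤ Real.log r := Real.log_nonneg hr1
    rcases Nat.lt_succ_iff_lt_or_eq.1 hi with hij | rfl
    · refine (h q hq r χ hχ hr hreal x hx hx1 t i hij).trans ?_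
      gcongr
      · have : 0 ≤ c⁻¹ * (2 * B + 2 ^ j * C * (2 * B)) := by positivity
        linarith
      · omega
    · have hL : ∀ l ≤ i + 1, ‖LSeries (LSeries.logMul^[l] fun n => χ n) s‖ ≤ 2 * B * D ^ (i + 3) := by
        intro l hl
        refine (hup l (fun n => χ n) r hr1 (fun n => DirichletCharacter.norm_le_one _ _)
          (norm_sum_Ico_character_le hχ) s hsre).trans ?_
        have e1 : (1 + Real.log r) ^ (l + 1) ≤ D ^ (i + 2) := by
          calc (1 + Real.log r) ^ (l + 1) ≤ D ^ (l + 1) := by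
                gcongr
                refine hr.trans ?_
                rw [hD]
                exact le_mul_of_one_le_right (by linarith) (by linarith [abs_nonneg t])
            _ ≤ _ := pow_le_pow_right₀ hD1 (by omega)
        have e2 : ‖s‖ ≤ 2 * D := by
          refine hsn.trans ?_
          have : (3 + |t|) ≤ D := by
            rw [hD]; exact le_mul_of_one_le_left (by positivity) hq
          linarith
        calc A l * (1 + Real.log r) ^ (l + 1) * ‖s‖ ≤ B * D ^ (i + 2) * (2 * D) := by
              gcongr
              exact hAB l hl
          _ = _ := by ring
      have hl := hlow q hq r χ hχ hr hreal x hx hx1 t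
      have key := norm_LSeries_logMul_twist_vonMangoldt_mul_le χ i hsre
      have hsum : ∑ l ∈ range i, (i.choose l) *
          ‖LSeries (LSeries.logMul^[l] fun n => χ n * (vonMangoldt n : ℂ)) s‖ *
          ‖LSeries (LSeries.logMul^[i - l] fun n => χ n) s‖ ≤
          2 ^ i * ((C * D ^ k) * (2 * B * D ^ (i + 3))) := by
        calc _ ≤ ∑ l ∈ range i, (i.choose l : ℝ) * ((C * D ^ k) * (2 * B * D ^ (i + 3))) := by
              refine sum_le_sum fun l hl => ?_
              rw [mul_assoc]
              have := h q hq r χ hχ hr hreal x hx hx1 t l (mem_range.1 hl)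
              have h2 := hL (i - l) (by omega)
              gcongr
          _ = (∑ l ∈ range i, (i.choose l : ℝ)) * ((C * D ^ k) * (2 * B * D ^ (i + 3))) := by
              rw [sum_mul]
          _ ≤ _ := by
              gcongr
              have := Nat.sum_range_choose i
              have h3 : ∑ l ∈ range i, i.choose l ≤ 2 ^ i := by
                rw [← this, sum_range_succ]; omega
              exact_mod_cast h3
      have h1 := hL (i + 1) le_rfl
      have hDk : 1 ≤ D ^ k := one_le_pow₀ hD1
      have h4 : ‖LSeries (LSeries.logMul^[i] fun n => χ n * (vonMangoldt n : ℂ)) s‖ *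
          (c * (D ^ 18)⁻¹) ≤ (2 * B + 2 ^ i * C * (2 * B)) * D ^ (k + (i + 3)) := by
        calc _ ≤ _ := mul_le_mul_of_nonneg_left hl (norm_nonneg _)
          _ ≤ _ := key
          _ ≤ 2 * B * D ^ (i + 3) * D ^ k + 2 ^ i * ((C * D ^ k) * (2 * B * D ^ (i + 3))) :=
            add_le_add (h1.trans (le_mul_of_one_le_right (by positivity) hDk)) hsum
          _ = _ := by ring
      have hD0 : 0 < D := by linarith
      calc ‖LSeries (LSeries.logMul^[i] fun n => χ n * (vonMangoldt n : ℂ)) s‖ =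
            ‖LSeries (LSeries.logMul^[i] fun n => χ n * (vonMangoldt n : ℂ)) s‖ *
            (c * (D ^ 18)⁻¹) * (c⁻¹ * D ^ 18) := by field_simp
        _ ≤ (2 * B + 2 ^ i * C * (2 * B)) * D ^ (k + (i + 3)) * (c⁻¹ * D ^ 18) := by gcongr
        _ = c⁻¹ * (2 * B + 2 ^ i * C * (2 * B)) * D ^ (k + (i + 3) + 18) := by ring
        _ ≤ _ := by gcongr; linarith

end LogarithmicDerivative

section FourierKernels

open Finset Filter Topology MeasureTheory
open scoped FourierTransform SchwartzMap ContDiff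

structure IsFourierKernel (K Kh : ℝ → ℂ) : Prop where
  continuous : Continuous Kh
  integrable : ∀ k : ℕ, Integrable fun t => (3 + |t|) ^ k * ‖Kh t‖
  eq_integral : ∀ u : ℝ, K u = ∫ t : ℝ, Kh t * Complex.exp (-(Complex.I * t * u))

theorem exists_isFourierKernel {K : ℝ → ℂ} (hK : ContDiff ℝ ∞ K) (hc : HasCompactSupport K) :
    ∃ Kh, IsFourierKernel K Kh := by
  set f : 𝓢(ℝ, ℂ) := hc.toSchwartzMap hK with hf
  set g : 𝓢(ℝ, ℂ) := 𝓕 f with hg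
  have hfK : ∀ u, f u = K u := fun u => rfl
  have h2π : (-(2 * Real.pi)⁻¹ : ℝ) ≠ 0 := by simp [Real.pi_ne_zero]
  refine ⟨fun t => ((2 * Real.pi)⁻¹ : ℝ) * g (-(2 * Real.pi)⁻¹ * t), ?_, ?_, ?_⟩
  · exact continuous_const.mul (g.continuous.comp (by fun_prop))
  · intro k
    have h1 : Integrable fun ξ : ℝ => (3 + |(-(2 * Real.pi)⁻¹)⁻¹ * ξ|) ^ k * ‖g ξ‖ := by
      simp only [add_pow, sum_mul, abs_mul, mul_pow]
      refine integrable_finsetSum _ fun i _ => ?_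
      have := (g.integrable_pow_mul volume (k - i)).const_mul
        (3 ^ i * |(-(2 * Real.pi)⁻¹)⁻¹| ^ (k - i) * (k.choose i : ℝ))
      refine this.congr (Eventually.of_forall fun ξ => ?_)
      simp only [Real.norm_eq_abs]; ring
    have h2 := (h1.comp_mul_left' h2π).const_mul (2 * Real.pi)⁻¹
    refine h2.congr (Eventually.of_forall fun t => ?_)
    simp only [norm_mul, Complex.norm_real]
    rw [inv_mul_cancel_left₀ h2π, Real.norm_of_nonneg (by positivity)]; ring
  · intro u
    have h1 : K u = 𝓕⁻ g u := by rw [hg, FourierTransform.fourierInv_fourier_eq, hfK]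
    rw [h1, SchwartzMap.fourierInv_coe, Real.fourierInv_eq']
    have h3 := Measure.integral_comp_mul_left
      (fun ξ : ℝ => Complex.exp (2 * Real.pi * Complex.I * ξ * u) * g ξ) (-(2 * Real.pi)⁻¹)
    rw [inv_neg, inv_inv, abs_neg, abs_of_pos Real.two_pi_pos] at h3
    have h4 : ∫ t : ℝ, ((2 * Real.pi)⁻¹ : ℝ) * g (-(2 * Real.pi)⁻¹ * t) *
        Complex.exp (-(Complex.I * t * u)) = ((2 * Real.pi)⁻¹ : ℝ) * ∫ t : ℝ, (fun ξ : ℝ =>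
          Complex.exp (2 * Real.pi * Complex.I * ξ * u) * g ξ) (-(2 * Real.pi)⁻¹ * t) := by
      rw [← integral_const_mul]
      refine integral_congr_ae (Eventually.of_forall fun t => ?_)
      have hπ : (Real.pi : ℂ) ≠ 0 := by exact_mod_cast Real.pi_ne_zero
      have : -(Complex.I * t * u) = 2 * Real.pi * Complex.I * ((-(2 * Real.pi)⁻¹ * t : ℝ) : ℂ) * u := by
        push_cast; field_simp
      simp only [this]; ring
    rw [h4, h3, Complex.real_smul, ← mul_assoc, ← Complex.ofReal_mul,
      inv_mul_cancel₀ Real.two_pi_pos.ne', Complex.ofReal_one, one_mul]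
    refine integral_congr_ae (Eventually.of_forall fun t => ?_)
    simp only [smul_eq_mul, RCLike.inner_apply, conj_trivial]
    congr 2
    push_cast; ring

theorem term_add_I_mul (f : ℕ → ℂ) (σ t : ℝ) (n : ℕ) :
    LSeries.term f (σ + Complex.I * t) n =
      LSeries.term f σ n * Complex.exp (-(Complex.I * t * (Real.log n : ℝ))) := by
  rcases eq_or_ne n 0 with rfl | hn
  · simp
  · have hn0 : (n : ℂ) ≠ 0 := by exact_mod_cast hn
    rw [LSeries.term_of_ne_zero hn, LSeries.term_of_ne_zero hn, Complex.cpow_add _ _ hn0,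
      Complex.cpow_def_of_ne_zero hn0 (Complex.I * t), Complex.exp_neg, ← Complex.natCast_log,
      mul_comm _ (Complex.I * (t : ℂ)), div_mul_eq_div_div, ← div_eq_mul_inv]

theorem norm_exp_neg_I_mul (a b : ℝ) : ‖Complex.exp (-(Complex.I * a * b))‖ = 1 := by
  rw [Complex.norm_exp]; simp

theorem norm_exp_I_mul (a b : ℝ) : ‖Complex.exp (Complex.I * a * b)‖ = 1 := by
  rw [Complex.norm_exp]; simp

theorem IsFourierKernel.integrable_norm {K Kh : ℝ → ℂ} (h : IsFourierKernel K Kh) :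
    Integrable fun t => ‖Kh t‖ := by
  simpa using h.integrable 0

theorem IsFourierKernel.tsum_term_mul {K Kh : ℝ → ℂ} (h : IsFourierKernel K Kh) {f : ℕ → ℂ}
    {σ : ℝ} (hf : LSeriesSummable f σ) (ℓ : ℝ) :
    ∑' n : ℕ, LSeries.term f σ n * K (Real.log n - ℓ) =
      ∫ t : ℝ, Kh t * Complex.exp (Complex.I * t * ℓ) * LSeries f (σ + Complex.I * t) := by
  set F : ℕ → ℝ → ℂ := fun n t =>
    Kh t * Complex.exp (Complex.I * t * ℓ) * LSeries.term f (σ + Complex.I * t) n with hF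
  have hFn : ∀ n t, ‖F n t‖ = ‖LSeries.term f σ n‖ * ‖Kh t‖ := by
    intro n t
    rw [hF]
    simp only
    rw [term_add_I_mul, norm_mul, norm_mul, norm_mul, norm_exp_I_mul, norm_exp_neg_I_mul]
    ring
  have hFc : ∀ n, Continuous (F n) := by
    intro n
    simp only [hF, term_add_I_mul]
    have := h.continuous
    fun_prop
  have hint : ∀ n, Integrable (F n) := by
    intro n
    refine (integrable_norm_iff (hFc n).aestronglyMeasurable).1 ?_
    simp only [hFn]
    exact h.integrable_norm.const_mul _
  have hsum : Summable fun n => ∫ t, ‖F n t‖ := by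
    simp only [hFn, integral_const_mul]
    exact hf.norm.mul_right _
  have h1 := (hasSum_integral_of_summable_integral_norm hint hsum).tsum_eq
  have h2 : ∀ n, ∫ t, F n t = LSeries.term f σ n * K (Real.log n - ℓ) := by
    intro n
    rw [h.eq_integral, ← integral_const_mul]
    refine integral_congr_ae (Eventually.of_forall fun t => ?_)
    simp only [hF, term_add_I_mul]
    have : -(Complex.I * t * ((Real.log n - ℓ : ℝ) : ℂ)) =
        Complex.I * t * ℓ + -(Complex.I * t * (Real.log n : ℝ)) := by push_cast; ring
    rw [this, Complex.exp_add]; ring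
  simp only [h2] at h1
  rw [h1]
  refine integral_congr_ae (Eventually.of_forall fun t => ?_)
  simp only [hF]
  rw [tsum_mul_left]; rfl

theorem IsFourierKernel.norm_tsum_term_mul_le {K Kh : ℝ → ℂ} (h : IsFourierKernel K Kh) {f : ℕ → ℂ}
    {σ : ℝ} (hf : LSeriesSummable f σ) (ℓ : ℝ) :
    ‖∑' n : ℕ, LSeries.term f σ n * K (Real.log n - ℓ)‖ ≤
      ∫ t : ℝ, ‖Kh t‖ * ‖LSeries f (σ + Complex.I * t)‖ := by
  rw [h.tsum_term_mul hf]
  refine (norm_integral_le_integral_norm _).trans (le_of_eq ?_)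
  refine integral_congr_ae (Eventually.of_forall fun t => ?_)
  simp only [norm_mul, norm_exp_I_mul, mul_one]

end FourierKernels

section SmoothCutoffs

open Finset Filter Topology MeasureTheory

theorem term_ofReal_eq (f : ℕ → ℂ) {n : ℕ} (hn : n ≠ 0) (σ : ℝ) :
    LSeries.term f σ n = f n * (((n : ℝ) ^ (-σ) : ℝ) : ℂ) := by
  rw [LSeries.term_of_ne_zero hn, div_eq_mul_inv, ← Complex.cpow_neg, Complex.ofReal_cpow (by positivity)]
  simp

structure IsCutoff (K : ℝ → ℂ) (A : ℝ) : Prop where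
  differentiable : Differentiable ℝ K
  norm_le : ∀ u, ‖K u‖ ≤ A
  norm_deriv_le : ∀ u, ‖deriv K u‖ ≤ A
  eq_zero : ∀ u, 1 < |u| → K u = 0

theorem IsCutoff.nonneg {K : ℝ → ℂ} {A : ℝ} (hK : IsCutoff K A) : 0 ≤ A :=
  (norm_nonneg _).trans (hK.norm_le 0)

theorem IsCutoff.norm_rpow_mul_sub_le {K : ℝ → ℂ} {A : ℝ} (hK : IsCutoff K A) {σ : ℝ} (hσ : 1 ≤ σ)
    (hσ2 : σ ≤ 2) (ℓ : ℝ) {a b : ℝ} (ha : 1 ≤ a) (hab : a ≤ b) :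
    ‖((a ^ (-σ) : ℝ) : ℂ) * K (Real.log a - ℓ) - ((b ^ (-σ) : ℝ) : ℂ) * K (Real.log b - ℓ)‖ ≤
      3 * A / a - 3 * A / b := by
  have hA := hK.nonneg
  refine norm_sub_le_of_norm_deriv_le (f := fun x : ℝ => ((x ^ (-σ) : ℝ) : ℂ) * K (Real.log x - ℓ))
    (f' := fun x => ((-σ * x ^ (-σ - 1) : ℝ) : ℂ) * K (Real.log x - ℓ) +
      ((x ^ (-σ) : ℝ) : ℂ) * (((x⁻¹ : ℝ) : ℂ) * deriv K (Real.log x - ℓ)))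
    (h := fun x => 3 * A / x) (h' := fun x => -(3 * A / x ^ 2)) hab ?_ ?_ ?_
  · intro x hx
    have hx0 : 0 < x := by linarith [hx.1]
    refine HasDerivAt.mul ?_ ?_
    · exact (Real.hasDerivAt_rpow_const (Or.inl hx0.ne')).ofReal_comp
    · have h1 := (hK.differentiable (Real.log x - ℓ)).hasDerivAt
      have := h1.scomp x ((Real.hasDerivAt_log hx0.ne').sub_const ℓ)
      rw [Complex.real_smul] at this
      exact this
  · intro x hx
    have hx0 : 0 < x := by linarith [hx.1]
    have := (hasDerivAt_inv hx0.ne').const_mul (3 * A)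
    simp only [← div_eq_mul_inv] at this
    have e : -(3 * A / x ^ 2) = 3 * A * -(x ^ 2)⁻¹ := by field_simp
    rw [e]
    exact this
  · intro x hx
    have hx1 : 1 ≤ x := by linarith [hx.1]
    have hx0 : 0 < x := by linarith
    have e1 : x ^ (-σ - 1) ≤ (x ^ 2)⁻¹ := by
      rw [← Real.rpow_natCast, ← Real.rpow_neg hx0.le]
      exact Real.rpow_le_rpow_of_exponent_le hx1 (by push_cast; linarith)
    have e2 : x ^ (-σ) * x⁻¹ ≤ (x ^ 2)⁻¹ := by
      rw [← Real.rpow_neg_one x, ← Real.rpow_add hx0]; exact e1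
    have e3 : 0 ≤ x ^ (-σ - 1) := by positivity
    refine (norm_add_le _ _).trans ?_
    simp only [norm_mul, Complex.norm_real, Real.norm_eq_abs, neg_neg]
    rw [abs_neg, abs_of_pos (show 0 < σ by linarith), abs_of_nonneg e3,
      abs_of_pos (show 0 < x ^ (-σ) by positivity), abs_of_pos (show 0 < x⁻¹ by positivity), ← mul_assoc]
    calc σ * x ^ (-σ - 1) * ‖K (Real.log x - ℓ)‖ + x ^ (-σ) * x⁻¹ * ‖deriv K (Real.log x - ℓ)‖ ≤
        2 * (x ^ 2)⁻¹ * A + (x ^ 2)⁻¹ * A := by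
          gcongr
          · exact hK.norm_le _
          · exact hK.norm_deriv_le _
      _ = _ := by ring

theorem IsCutoff.eq_zero_of_lt {K : ℝ → ℂ} {A : ℝ} (hK : IsCutoff K A) {ℓ x : ℝ} (hx : 0 < x)
    (h : x < Real.exp (ℓ - 1)) : K (Real.log x - ℓ) = 0 := by
  refine hK.eq_zero _ ?_
  have := (Real.log_lt_iff_lt_exp hx).2 h
  rw [lt_abs]; right; linarith

theorem IsCutoff.eq_zero_of_gt {K : ℝ → ℂ} {A : ℝ} (hK : IsCutoff K A) {ℓ x : ℝ}
    (h : Real.exp (ℓ + 1) < x) : K (Real.log x - ℓ) = 0 := by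
  refine hK.eq_zero _ ?_
  have := (Real.lt_log_iff_exp_lt ((Real.exp_pos _).trans h)).2 h
  rw [lt_abs]; left; linarith

theorem IsCutoff.norm_tsum_character_le {K : ℝ → ℂ} {A : ℝ} (hK : IsCutoff K A) {r : ℕ} [NeZero r]
    {χ : DirichletCharacter ℂ r} (hχ : χ ≠ 1) {σ : ℝ} (hσ : 1 ≤ σ) (hσ2 : σ ≤ 2) (ℓ : ℝ) :
    ‖∑' n : ℕ, LSeries.term (fun n => χ n) σ n * K (Real.log n - ℓ)‖ ≤
      9 * A * r * Real.exp (-ℓ) := by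
  have hA := hK.nonneg
  set M := ⌈Real.exp (ℓ - 1)⌉₊ with hM
  have hMpos : 0 < M := Nat.ceil_pos.2 (Real.exp_pos _)
  have hM1 : Real.exp (ℓ - 1) ≤ M := Nat.le_ceil _
  set N := M + ⌈Real.exp (ℓ + 1)⌉₊ + 1 with hN
  have hzero : ∀ n ∉ Ico M N, LSeries.term (fun n => χ n) σ n * K (Real.log n - ℓ) = 0 := by
    intro n hn
    rw [mem_Ico, not_and_or, not_le, not_lt] at hn
    rcases eq_or_ne n 0 with rfl | hn0
    · simp
    rcases hn with hn | hn
    · rw [hK.eq_zero_of_lt (by positivity) (Nat.lt_ceil.1 hn), mul_zero]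
    · rw [hK.eq_zero_of_gt, mul_zero]
      refine (Nat.le_ceil _).trans_lt ?_
      exact_mod_cast (show ⌈Real.exp (ℓ + 1)⌉₊ < n by omega)
  rw [tsum_eq_sum hzero]
  have h1 := norm_sum_mul_le_of_norm_sum_le (g := fun n : ℕ => χ n)
    (f := fun n : ℕ => (((n : ℝ) ^ (-σ) : ℝ) : ℂ) * K (Real.log n - ℓ))
    (h := fun n : ℕ => 3 * A / (n : ℝ)) (B := r) (M := M) (N := N) (by omega)
    (fun n => norm_sum_Ico_character_le hχ M n)
    (fun n hn => by
      have h1n : (1 : ℝ) ≤ n := by exact_mod_cast hMpos.trans_le hn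
      exact hK.norm_rpow_mul_sub_le hσ hσ2 ℓ h1n (by push_cast; linarith)) (by
      have : K (Real.log N - ℓ) = 0 := hK.eq_zero_of_gt
        ((Nat.le_ceil _).trans_lt (by exact_mod_cast (show ⌈Real.exp (ℓ + 1)⌉₊ < N by omega)))
      change ‖(((N : ℝ) ^ (-σ) : ℝ) : ℂ) * K (Real.log N - ℓ)‖ ≤ 3 * A / (N : ℝ)
      rw [this, mul_zero, norm_zero]
      positivity)
  have h2 : ∑ n ∈ Ico M N, LSeries.term (fun n => χ n) σ n * K (Real.log n - ℓ) =
      ∑ n ∈ Ico M N, χ n * ((((n : ℝ) ^ (-σ) : ℝ) : ℂ) * K (Real.log n - ℓ)) := by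
    refine sum_congr rfl fun n hn => ?_
    rw [mem_Ico] at hn
    rw [term_ofReal_eq _ (by omega), mul_assoc]
  rw [h2]
  refine h1.trans ?_
  have h3 : 3 * A / (M : ℝ) ≤ 9 * A * Real.exp (-ℓ) := by
    rw [div_le_iff₀ (by exact_mod_cast hMpos)]
    have h4 : 1 ≤ 3 * Real.exp (-ℓ) * M := by
      have h5 : Real.exp 1 ≤ 3 := Real.exp_one_lt_d9.le.trans (by norm_num)
      calc (1 : ℝ) = Real.exp 1 * Real.exp (-ℓ) * Real.exp (ℓ - 1) := by
            rw [← Real.exp_add, ← Real.exp_add, ← Real.exp_zero]; congr 1; ring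
        _ ≤ _ := by gcongr
    nlinarith
  calc (r : ℝ) * (3 * A / (M : ℝ)) ≤ r * (9 * A * Real.exp (-ℓ)) := by gcongr
    _ = _ := by ring

end SmoothCutoffs

section SmoothCutoffSums

open Finset Filter Topology MeasureTheory

theorem sum_norm_sq_le_of_gram_le {ι : Type*} (S : Finset ι) (T : Finset ℕ) (θ : ι → ℕ → ℂ)
    {u : ℕ → ℝ} (hu : ∀ n, 0 ≤ u n) (a : ℕ → ℂ) {Δ : ℝ}
    (hΔ0 : 0 ≤ Δ)
    (hΔ : ∀ i ∈ S, ∑ j ∈ S, ‖∑ n ∈ T, u n * (θ i n * starRingEnd ℂ (θ j n))‖ ≤ Δ) :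
    ∑ i ∈ S, ‖∑ n ∈ T, a n * u n * θ i n‖ ^ 2 ≤ Δ * ∑ n ∈ T, ‖a n‖ ^ 2 * u n := by
  set A : ι → ℂ := fun i => ∑ n ∈ T, a n * u n * θ i n with hA
  set G : ι → ι → ℂ := fun i j => ∑ n ∈ T, u n * (θ i n * starRingEnd ℂ (θ j n)) with hG
  set B : ℕ → ℂ := fun n => ∑ i ∈ S, starRingEnd ℂ (A i) * θ i n with hB
  set E : ℝ := ∑ i ∈ S, ‖A i‖ ^ 2 with hE
  have hE0 : 0 ≤ E := by positivity
  have hP0 : 0 ≤ ∑ n ∈ T, ‖a n‖ ^ 2 * u n := sum_nonneg fun n _ => mul_nonneg (sq_nonneg _) (hu n)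
  have hEB : (E : ℂ) = ∑ n ∈ T, a n * u n * B n := by
    rw [hE]
    push_cast
    simp only [hB, mul_sum]
    rw [sum_comm]
    refine sum_congr rfl fun i _ => ?_
    rw [← Complex.conj_mul', hA]
    simp only [mul_sum]
    exact sum_congr rfl fun n _ => by ring
  have hE1 : E ≤ ∑ n ∈ T, ‖a n‖ * u n * ‖B n‖ := by
    calc E = ‖(E : ℂ)‖ := by rw [Complex.norm_of_nonneg hE0]
      _ ≤ _ := by
        rw [hEB]
        refine (norm_sum_le _ _).trans (le_of_eq (sum_congr rfl fun n _ => ?_))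
        rw [norm_mul, norm_mul, Complex.norm_of_nonneg (hu n)]
  have hGs : ∀ i j, ‖G i j‖ = ‖G j i‖ := by
    intro i j
    rw [← Complex.norm_conj, hG]
    simp only [map_sum, map_mul, Complex.conj_ofReal, Complex.conj_conj]
    exact congrArg _ (sum_congr rfl fun n _ => by ring)
  have hQ : ∑ n ∈ T, u n * ‖B n‖ ^ 2 ≤ Δ * E := by
    have h1 : ((∑ n ∈ T, u n * ‖B n‖ ^ 2 : ℝ) : ℂ) =
        ∑ i ∈ S, ∑ j ∈ S, starRingEnd ℂ (A i) * A j * G i j := by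
      push_cast
      have : ∀ n, (u n : ℂ) * (‖B n‖ : ℂ) ^ 2 = ∑ i ∈ S, ∑ j ∈ S,
          starRingEnd ℂ (A i) * A j * (u n * (θ i n * starRingEnd ℂ (θ j n))) := by
        intro n
        rw [← Complex.mul_conj', hB]
        simp only [map_sum, map_mul, Complex.conj_conj]
        rw [sum_mul_sum, mul_sum]
        refine sum_congr rfl fun i _ => ?_
        rw [mul_sum]
        exact sum_congr rfl fun j _ => by ring
      simp only [this]
      rw [sum_comm]
      refine sum_congr rfl fun i _ => ?_
      rw [sum_comm]
      refine sum_congr rfl fun j _ => ?_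
      exact (mul_sum _ _ _).symm
    have h2 : ∑ n ∈ T, u n * ‖B n‖ ^ 2 ≤ ∑ i ∈ S, ∑ j ∈ S, ‖A i‖ * ‖A j‖ * ‖G i j‖ := by
      calc ∑ n ∈ T, u n * ‖B n‖ ^ 2 = ‖((∑ n ∈ T, u n * ‖B n‖ ^ 2 : ℝ) : ℂ)‖ := by
            rw [Complex.norm_of_nonneg (sum_nonneg fun n _ => mul_nonneg (hu n) (sq_nonneg _))]
        _ ≤ _ := by
            rw [h1]
            refine (norm_sum_le _ _).trans (sum_le_sum fun i _ => (norm_sum_le _ _).trans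
              (sum_le_sum fun j _ => ?_))
            rw [norm_mul, norm_mul, Complex.norm_conj]
    have h3 : ∑ i ∈ S, ∑ j ∈ S, ‖A i‖ * ‖A j‖ * ‖G i j‖ ≤
        ∑ i ∈ S, ∑ j ∈ S, (‖A i‖ ^ 2 / 2 * ‖G i j‖ + ‖A j‖ ^ 2 / 2 * ‖G j i‖) := by
      refine sum_le_sum fun i _ => sum_le_sum fun j _ => ?_
      rw [hGs j i, ← add_mul]
      have := sq_nonneg (‖A i‖ - ‖A j‖)
      exact mul_le_mul_of_nonneg_right (by nlinarith) (norm_nonneg _)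
    have h4 : ∑ i ∈ S, ∑ j ∈ S, ‖A i‖ ^ 2 / 2 * ‖G i j‖ ≤ Δ * E / 2 := by
      calc _ = ∑ i ∈ S, ‖A i‖ ^ 2 / 2 * ∑ j ∈ S, ‖G i j‖ :=
            sum_congr rfl fun i _ => by rw [mul_sum]
        _ ≤ ∑ i ∈ S, ‖A i‖ ^ 2 / 2 * Δ :=
            sum_le_sum fun i hi => mul_le_mul_of_nonneg_left (hΔ i hi) (by positivity)
        _ = _ := by rw [← sum_mul, ← sum_div, hE]; ring
    simp only [sum_add_distrib] at h3
    rw [sum_comm (f := fun i j => ‖A j‖ ^ 2 / 2 * ‖G j i‖)] at h3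
    linarith
  have hcs : (∑ n ∈ T, ‖a n‖ * u n * ‖B n‖) ^ 2 ≤
      (∑ n ∈ T, ‖a n‖ ^ 2 * u n) * ∑ n ∈ T, u n * ‖B n‖ ^ 2 :=
    sum_sq_le_sum_mul_sum_of_sq_le_mul T (fun n _ => mul_nonneg (sq_nonneg _) (hu n))
      (fun n _ => mul_nonneg (hu n) (sq_nonneg _)) (fun n _ => by apply le_of_eq; ring)
  rcases hE0.eq_or_lt with h0 | h0
  · rw [← h0]; positivity
  · have h5 : E * E ≤ Δ * (∑ n ∈ T, ‖a n‖ ^ 2 * u n) * E := by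
      calc E * E = E ^ 2 := (sq E).symm
        _ ≤ (∑ n ∈ T, ‖a n‖ * u n * ‖B n‖) ^ 2 := by gcongr
        _ ≤ _ := hcs
        _ ≤ (∑ n ∈ T, ‖a n‖ ^ 2 * u n) * (Δ * E) := by gcongr
        _ = _ := by ring
    exact le_of_mul_le_mul_right h5 h0

end SmoothCutoffSums

section LargeSieve

open Finset Filter Topology MeasureTheory

theorem norm_sum_Ico_mul_conj_le {r m : ℕ} [NeZero r] [NeZero m] {χ : DirichletCharacter ℂ r}
    {ψ : DirichletCharacter ℂ m} (hχ : χ.IsPrimitive) (hψ : ψ.IsPrimitive)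
    (hne : (⟨r, χ⟩ : Σ n, DirichletCharacter ℂ n) ≠ ⟨m, ψ⟩) (a b : ℕ) :
    ‖∑ n ∈ Ico a b, χ n * starRingEnd ℂ (ψ n)‖ ≤ (r * m : ℕ) := by
  have hrm : NeZero (r * m) := ⟨mul_ne_zero (NeZero.ne r) (NeZero.ne m)⟩
  have hθ1 : DirichletCharacter.changeLevel (Nat.dvd_mul_right r m) χ *
      DirichletCharacter.changeLevel (Nat.dvd_mul_left m r) ψ⁻¹ ≠ 1 := by
    intro h5
    rw [map_inv, mul_inv_eq_one] at h5
    exact hne (eq_of_changeLevel_eq hχ hψ _ _ h5)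
  have h := norm_sum_Ico_character_le hθ1 a b
  convert h using 2
  refine sum_congr rfl fun n _ => ?_
  rw [changeLevel_mul_changeLevel_apply, ← MulChar.star_eq_inv]
  rfl

theorem norm_sum_Ico_rpow_mul_le {g : ℕ → ℂ} {B : ℝ} {M : ℕ} (hM : 0 < M)
    (hg : ∀ N, ‖∑ n ∈ Ico M N, g n‖ ≤ B) {σ : ℝ} (hσ : 1 ≤ σ) (N : ℕ) :
    ‖∑ n ∈ Ico M N, (((n : ℝ) ^ (-σ) : ℝ) : ℂ) * g n‖ ≤ B / M := by
  have hB : 0 ≤ B := (norm_nonneg _).trans (hg M)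
  have hM1 : (1 : ℝ) ≤ M := by exact_mod_cast hM
  rcases le_total M N with h | h
  · have h1 := norm_sum_mul_le_of_norm_sum_le (g := g)
      (f := fun n : ℕ => (((n : ℝ) ^ (-σ) : ℝ) : ℂ)) (h := fun n : ℕ => (n : ℝ) ^ (-σ)) h hg
      (fun n hn => by
        have h1n : (1 : ℝ) ≤ n := by exact_mod_cast hM.trans_le hn
        rw [← Complex.ofReal_sub, Complex.norm_of_nonneg]
        rw [sub_nonneg]
        refine Real.rpow_le_rpow_of_nonpos (by linarith) (by push_cast; linarith) (by linarith))
      (by simp only [Complex.norm_real]; rw [Real.norm_of_nonneg (by positivity)])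
    simp only [mul_comm (g _)] at h1
    refine h1.trans ?_
    rw [div_eq_mul_inv]
    gcongr
    rw [← Real.rpow_neg_one]
    exact Real.rpow_le_rpow_of_exponent_le hM1 (by linarith)
  · rw [Ico_eq_empty_of_le h]; simp; positivity

theorem summable_rpow_neg {ℓ : ℝ} (hℓ : 1 ≤ ℓ) :
    Summable fun n : ℕ => (n : ℝ) ^ (-(1 + 1 / ℓ)) := by
  refine Real.summable_nat_rpow.2 ?_
  linarith [show 0 < 1 / ℓ by positivity]

theorem tsum_rpow_neg_le {ℓ : ℝ} (hℓ : 1 ≤ ℓ) : ∑' n : ℕ, (n : ℝ) ^ (-(1 + 1 / ℓ)) ≤ 4 * ℓ := by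
  have hℓ0 : 0 < ℓ := by linarith
  have h1 : 1 / ℓ ≤ 1 := by rw [div_le_one hℓ0]; exact hℓ
  have h0 : 0 < 1 / ℓ := by positivity
  have hs : 1 < ((1 + 1 / ℓ : ℝ) : ℂ).re := by rw [Complex.ofReal_re]; linarith
  have h := norm_LSeries_le_LSeries_one (g := 1) (fun n => by simp) hs
  have e : ∀ n, LSeries.term 1 ((1 + 1 / ℓ : ℝ) : ℂ) n = (((n : ℝ) ^ (-(1 + 1 / ℓ)) : ℝ) : ℂ) := by
    intro n
    rcases eq_or_ne n 0 with rfl | hn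
    · rw [LSeries.term_zero, Nat.cast_zero, Real.zero_rpow (by linarith), Complex.ofReal_zero]
    · rw [term_ofReal_eq _ hn, Pi.one_apply, one_mul]
  rw [LSeries, tsum_congr e, ← Complex.ofReal_tsum, Complex.norm_of_nonneg
    (tsum_nonneg fun n => by positivity), Complex.ofReal_re] at h
  refine h.trans ?_
  rw [add_sub_cancel_left, div_le_iff₀ h0]
  have : 4 * ℓ * (1 / ℓ) = 4 := by field_simp
  rw [this]
  nlinarith

theorem sum_rpow_neg_le (T : Finset ℕ) {ℓ : ℝ} (hℓ : 1 ≤ ℓ) :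
    ∑ n ∈ T, (n : ℝ) ^ (-(1 + 1 / ℓ)) ≤ 4 * ℓ :=
  ((summable_rpow_neg hℓ).sum_le_tsum _ fun n _ => by positivity).trans (tsum_rpow_neg_le hℓ)

theorem sum_norm_LSeries_sq_le (S : Finset (Σ n, DirichletCharacter ℂ n)) {R M : ℕ}
    (hS : ∀ p ∈ S, p.1 ≠ 0 ∧ p.1 ≤ R ∧ p.2.IsPrimitive) (hM : 0 < M) (hSM : S.card * R ^ 2 ≤ M)
    {ℓ : ℝ} (hℓ : 1 ≤ ℓ) {a : ℕ → ℂ} (ha : LSeriesSummable a (1 + 1 / ℓ : ℝ))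
    (ha2 : Summable fun n : ℕ => ‖a n‖ ^ 2 * (n : ℝ) ^ (-(1 + 1 / ℓ))) (t : ℝ) :
    ∑ p ∈ S, ‖LSeries (fun n => if M ≤ n then p.2 n * a n else 0) ((1 + 1 / ℓ : ℝ) + Complex.I * t)‖ ^ 2 ≤
      5 * ℓ * ∑' n : ℕ, ‖a n‖ ^ 2 * (n : ℝ) ^ (-(1 + 1 / ℓ)) := by
  set σ : ℝ := 1 + 1 / ℓ with hσ
  have hℓ0 : 0 < ℓ := by linarith
  have hσ1 : 1 ≤ σ := by rw [hσ]; linarith [show 0 < 1 / ℓ by positivity]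
  set b : ℕ → ℂ := fun n => a n * Complex.exp (-(Complex.I * t * (Real.log n : ℝ))) with hb
  have hbn : ∀ n, ‖b n‖ = ‖a n‖ := fun n => by
    simp only [hb]; rw [norm_mul, norm_exp_neg_I_mul, mul_one]
  have hfin : ∀ N, ∑ p ∈ S, ‖∑ n ∈ Ico M N, b n * ((n : ℝ) ^ (-σ) : ℝ) * p.2 n‖ ^ 2 ≤
      5 * ℓ * ∑' n : ℕ, ‖a n‖ ^ 2 * (n : ℝ) ^ (-σ) := by
    intro N
    refine (sum_norm_sq_le_of_gram_le S (Ico M N) (fun p n => p.2 n)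
      (u := fun n : ℕ => (n : ℝ) ^ (-σ)) (fun n => by positivity) b (Δ := 5 * ℓ) (by positivity)
      ?_).trans ?_
    · intro p hp
      classical
      have hRM : (S.card : ℝ) * ((R : ℝ) ^ 2 / M) ≤ 1 := by
        rw [← mul_div_assoc, div_le_one (by exact_mod_cast hM)]
        exact_mod_cast hSM
      have h1 : ∀ p' ∈ S, ‖∑ n ∈ Ico M N, (((n : ℝ) ^ (-σ) : ℝ) : ℂ) *
          (p.2 n * starRingEnd ℂ (p'.2 n))‖ ≤ (if p' = p then 4 * ℓ else 0) + (R : ℝ) ^ 2 / M := by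
        intro p' hp'
        have hx : 0 ≤ (R : ℝ) ^ 2 / M := by positivity
        by_cases hpp : p' = p
        · rw [if_pos hpp]
          refine le_add_of_le_of_nonneg ?_ hx
          refine le_trans ?_ (sum_rpow_neg_le (Ico M N) hℓ)
          refine (norm_sum_le _ _).trans (sum_le_sum fun n _ => ?_)
          rw [norm_mul, norm_mul, Complex.norm_conj, Complex.norm_of_nonneg (by positivity)]
          exact mul_le_of_le_one_right (by positivity) (mul_le_one₀
            (DirichletCharacter.norm_le_one _ _) (norm_nonneg _) (DirichletCharacter.norm_le_one _ _))
        · rw [if_neg hpp, zero_add]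
          have : NeZero p.1 := ⟨(hS p hp).1⟩
          have : NeZero p'.1 := ⟨(hS p' hp').1⟩
          refine (norm_sum_Ico_rpow_mul_le hM (norm_sum_Ico_mul_conj_le (hS p hp).2.2
            (hS p' hp').2.2 (fun h => hpp h.symm) M) hσ1 N).trans ?_
          gcongr
          have := Nat.mul_le_mul (hS p hp).2.1 (hS p' hp').2.1
          rw [sq]
          exact_mod_cast this
      refine (sum_le_sum h1).trans ?_
      rw [sum_add_distrib, sum_ite_eq' S p, if_pos hp, sum_const, nsmul_eq_mul]
      linarith
    · simp only [hbn]
      gcongr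
      exact ha2.sum_le_tsum _ (fun n _ => by positivity)
  have hlim : Tendsto (fun N => ∑ p ∈ S, ‖∑ n ∈ Ico M N, b n * ((n : ℝ) ^ (-σ) : ℝ) * p.2 n‖ ^ 2) atTop
      (𝓝 (∑ p ∈ S, ‖LSeries (fun n => if M ≤ n then p.2 n * a n else 0) (σ + Complex.I * t)‖ ^ 2)) := by
    refine tendsto_finsetSum S fun p hp => ?_
    refine (Tendsto.norm ?_).pow 2
    have hs : LSeriesSummable (fun n => if M ≤ n then p.2 n * a n else 0) (σ + Complex.I * t) := by
      refine Summable.of_norm_bounded ha.norm fun n => ?_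
      rw [term_add_I_mul, norm_mul, norm_exp_neg_I_mul, mul_one]
      refine LSeries.norm_term_le _ ?_
      split_ifs
      · rw [norm_mul]
        exact mul_le_of_le_one_left (norm_nonneg _) (DirichletCharacter.norm_le_one _ _)
      · simp
    refine hs.hasSum.tendsto_sum_nat.congr fun N => ?_
    have e : ∀ n ∈ range N, LSeries.term (fun n => if M ≤ n then p.2 n * a n else 0)
        (σ + Complex.I * t) n = if M ≤ n then b n * ((n : ℝ) ^ (-σ) : ℝ) * p.2 n else 0 := by
      intro n _
      split_ifs with h
      · rw [term_add_I_mul, term_ofReal_eq _ (by omega), if_pos h, hb]; ring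
      · rcases eq_or_ne n 0 with rfl | hn
        · simp
        · rw [LSeries.term_of_ne_zero hn, if_neg h, zero_div]
    rw [sum_congr rfl e, ← sum_filter]
    refine sum_congr ?_ fun _ _ => rfl
    ext n; simp [and_comm]
  exact le_of_tendsto' hlim hfin

end LargeSieve

section DivisorBounds

open Finset Filter Topology MeasureTheory

theorem vonMangoldt_sq_mul_rpow_le {ℓ : ℝ} (hℓ : 1 ≤ ℓ) (n : ℕ) :
    ‖(ArithmeticFunction.vonMangoldt n : ℂ)‖ ^ 2 * (n : ℝ) ^ (-(1 + 1 / ℓ)) ≤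
      16 * ℓ ^ 2 * (n : ℝ) ^ (-(1 + 1 / (2 * ℓ))) := by
  have hℓ0 : 0 < ℓ := by linarith
  rcases eq_or_ne n 0 with rfl | hn
  · simp; positivity
  have hn0 : (0 : ℝ) < n := by positivity
  have h1 : ‖(ArithmeticFunction.vonMangoldt n : ℂ)‖ ≤ 4 * ℓ * (n : ℝ) ^ (1 / (4 * ℓ)) := by
    rw [Complex.norm_of_nonneg ArithmeticFunction.vonMangoldt_nonneg]
    refine ArithmeticFunction.vonMangoldt_le_log.trans ?_
    refine (Real.log_le_rpow_div hn0.le (show 0 < 1 / (4 * ℓ) by positivity)).trans (le_of_eq ?_)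
    field_simp
  calc _ ≤ (4 * ℓ * (n : ℝ) ^ (1 / (4 * ℓ))) ^ 2 * (n : ℝ) ^ (-(1 + 1 / ℓ)) := by gcongr
    _ = 16 * ℓ ^ 2 * (((n : ℝ) ^ (1 / (4 * ℓ)) * (n : ℝ) ^ (1 / (4 * ℓ))) *
        (n : ℝ) ^ (-(1 + 1 / ℓ))) := by ring
    _ = _ := by
      rw [← Real.rpow_add hn0, ← Real.rpow_add hn0]
      congr 2
      field_simp
      ring

theorem summable_vonMangoldt_sq {ℓ : ℝ} (hℓ : 1 ≤ ℓ) :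
    Summable fun n : ℕ => ‖(ArithmeticFunction.vonMangoldt n : ℂ)‖ ^ 2 * (n : ℝ) ^ (-(1 + 1 / ℓ)) :=
  Summable.of_nonneg_of_le (fun n => by positivity) (vonMangoldt_sq_mul_rpow_le hℓ)
    ((summable_rpow_neg (ℓ := 2 * ℓ) (by linarith)).mul_left _)

theorem tsum_vonMangoldt_sq_le {ℓ : ℝ} (hℓ : 1 ≤ ℓ) :
    ∑' n : ℕ, ‖(ArithmeticFunction.vonMangoldt n : ℂ)‖ ^ 2 * (n : ℝ) ^ (-(1 + 1 / ℓ)) ≤ 128 * ℓ ^ 3 := by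
  have h2 : 1 ≤ 2 * ℓ := by linarith
  refine ((summable_vonMangoldt_sq hℓ).tsum_le_tsum (vonMangoldt_sq_mul_rpow_le hℓ)
    ((summable_rpow_neg h2).mul_left _)).trans ?_
  rw [tsum_mul_left]
  have := tsum_rpow_neg_le h2
  calc _ ≤ 16 * ℓ ^ 2 * (4 * (2 * ℓ)) := by gcongr
    _ = _ := by ring

theorem LSeries_convolution_one_one_apply (n : ℕ) :
    (LSeries.convolution 1 1 : ℕ → ℂ) n = (n.divisors.card : ℂ) := by
  rw [LSeries.convolution_def]
  simp only [Pi.one_apply, mul_one, sum_const, nsmul_eq_mul]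
  rw [← Nat.map_div_right_divisors, card_map]

theorem card_divisors_mul_le (a b : ℕ) :
    (a * b).divisors.card ≤ a.divisors.card * b.divisors.card := by
  rw [Nat.divisors_mul]
  exact Finset.card_mul_le

theorem card_divisors_sq_le (n : ℕ) :
    (n.divisors.card : ℝ) ^ 2 ≤
      ‖(LSeries.convolution (LSeries.convolution 1 1) (LSeries.convolution 1 1) : ℕ → ℂ) n‖ := by
  rw [LSeries.convolution_def]
  simp only [LSeries_convolution_one_one_apply]
  have : (n.divisors.card) ^ 2 ≤
      ∑ p ∈ n.divisorsAntidiagonal, p.1.divisors.card * p.2.divisors.card := by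
    calc n.divisors.card ^ 2 = ∑ _p ∈ n.divisorsAntidiagonal, n.divisors.card := by
          rw [sum_const, ← Nat.map_div_right_divisors, card_map, smul_eq_mul, sq]
      _ ≤ _ := sum_le_sum fun p hp => by
          rw [← (Nat.mem_divisorsAntidiagonal.1 hp).1]
          exact card_divisors_mul_le _ _
  rw [show (∑ p ∈ n.divisorsAntidiagonal, (p.1.divisors.card : ℂ) * (p.2.divisors.card : ℂ)) =
    ((∑ p ∈ n.divisorsAntidiagonal, p.1.divisors.card * p.2.divisors.card : ℕ) : ℂ) by push_cast; rfl,
    Complex.norm_natCast]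
  exact_mod_cast this

theorem summable_and_tsum_sq_le_of_norm_le_card_divisors {b : ℕ → ℂ}
    (hb : ∀ n, ‖b n‖ ≤ n.divisors.card) {ℓ : ℝ} (hℓ : 1 ≤ ℓ) :
    (Summable fun n : ℕ => ‖b n‖ ^ 2 * (n : ℝ) ^ (-(1 + 1 / ℓ))) ∧
      ∑' n : ℕ, ‖b n‖ ^ 2 * (n : ℝ) ^ (-(1 + 1 / ℓ)) ≤ 256 * ℓ ^ 4 := by
  have hℓ0 : 0 < ℓ := by linarith
  have h0 : 0 < 1 / ℓ := by positivity
  have hs : 1 < ((1 + 1 / ℓ : ℝ) : ℂ).re := by rw [Complex.ofReal_re]; linarith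
  have h1 : LSeriesSummable 1 ((1 + 1 / ℓ : ℝ) : ℂ) := LSeriesSummable_one_iff.2 hs
  have h2 := h1.convolution h1
  have h4 := h2.convolution h2
  have e : ∀ n, LSeries.term (LSeries.convolution (LSeries.convolution 1 1)
      (LSeries.convolution 1 1)) ((1 + 1 / ℓ : ℝ) : ℂ) n =
      ((‖(LSeries.convolution (LSeries.convolution 1 1) (LSeries.convolution 1 1) : ℕ → ℂ) n‖ *
        (n : ℝ) ^ (-(1 + 1 / ℓ)) : ℝ) : ℂ) := by
    intro n
    rcases eq_or_ne n 0 with rfl | hn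
    · simp
    · rw [term_ofReal_eq _ hn, Complex.ofReal_mul]
      congr 1
      rw [LSeries.convolution_def]
      simp only [LSeries_convolution_one_one_apply]
      rw [show (∑ p ∈ n.divisorsAntidiagonal, (p.1.divisors.card : ℂ) * (p.2.divisors.card : ℂ)) =
        ((∑ p ∈ n.divisorsAntidiagonal, p.1.divisors.card * p.2.divisors.card : ℕ) : ℂ) by
          push_cast; rfl, Complex.norm_natCast]
      push_cast; rfl
  have hsum : Summable fun n : ℕ => ‖(LSeries.convolution (LSeries.convolution 1 1)
      (LSeries.convolution 1 1) : ℕ → ℂ) n‖ * (n : ℝ) ^ (-(1 + 1 / ℓ)) := by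
    have := h4
    rw [LSeriesSummable, funext e] at this
    exact Complex.summable_ofReal.1 this
  have hle : ∀ n : ℕ, ‖b n‖ ^ 2 * (n : ℝ) ^ (-(1 + 1 / ℓ)) ≤
      ‖(LSeries.convolution (LSeries.convolution 1 1) (LSeries.convolution 1 1) : ℕ → ℂ) n‖ *
        (n : ℝ) ^ (-(1 + 1 / ℓ)) := fun n => by
    refine mul_le_mul_of_nonneg_right ?_ (by positivity)
    refine le_trans ?_ (card_divisors_sq_le n)
    gcongr
    exact hb n
  have hS := Summable.of_nonneg_of_le (fun n => by positivity) hle hsum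
  refine ⟨hS, (hS.tsum_le_tsum hle hsum).trans ?_⟩
  have h5 : ‖LSeries (LSeries.convolution (LSeries.convolution 1 1) (LSeries.convolution 1 1))
      ((1 + 1 / ℓ : ℝ) : ℂ)‖ = ‖LSeries 1 ((1 + 1 / ℓ : ℝ) : ℂ)‖ ^ 4 := by
    rw [LSeries_convolution' h2 h2, LSeries_convolution' h1 h1, norm_mul, norm_mul]; ring
  rw [LSeries, tsum_congr e, ← Complex.ofReal_tsum, Complex.norm_of_nonneg
    (tsum_nonneg fun n => by positivity)] at h5
  rw [h5]
  have h6 := norm_LSeries_le_LSeries_one (g := 1) (fun n => by simp) hs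
  have h7 : ‖LSeries 1 ((1 + 1 / ℓ : ℝ) : ℂ)‖ ≤ 4 * ℓ := by
    refine h6.trans ?_
    have h8 : 1 / ℓ ≤ 1 := by rw [div_le_one hℓ0]; exact hℓ
    rw [Complex.ofReal_re, add_sub_cancel_left, div_le_iff₀ h0]
    have : 4 * ℓ * (1 / ℓ) = 4 := by field_simp
    rw [this]
    nlinarith
  calc _ ≤ (4 * ℓ) ^ 4 := by gcongr
    _ = _ := by ring

end DivisorBounds

section VaughanIdentity

open Finset Filter Topology MeasureTheory

theorem continuous_LSeries_add_I_mul {f : ℕ → ℂ} {σ : ℝ} (hf : LSeriesSummable f σ) :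
    Continuous fun t : ℝ => LSeries f (σ + Complex.I * t) := by
  refine continuous_tsum (u := fun n => ‖LSeries.term f σ n‖) (fun n => ?_) hf.norm fun n t => ?_
  · simp only [term_add_I_mul]; fun_prop
  · rw [term_add_I_mul, norm_mul, norm_exp_neg_I_mul, mul_one]

theorem norm_LSeries_add_I_mul_le {f : ℕ → ℂ} {σ : ℝ} (hf : LSeriesSummable f σ) (t : ℝ) :
    ‖LSeries f (σ + Complex.I * t)‖ ≤ ∑' n, ‖LSeries.term f σ n‖ := by
  refine tsum_of_norm_bounded hf.norm.hasSum fun n => ?_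
  rw [term_add_I_mul, norm_mul, norm_exp_neg_I_mul, mul_one]

theorem IsFourierKernel.integrable_mul {K Kh : ℝ → ℂ} (h : IsFourierKernel K Kh) {g : ℝ → ℂ}
    (hg : Continuous g) {C : ℝ} (hC : ∀ t, ‖g t‖ ≤ C) : Integrable fun t => Kh t * g t := by
  have h1 : Integrable Kh := (integrable_norm_iff h.continuous.aestronglyMeasurable).1 h.integrable_norm
  exact h1.mul_bdd (c := C) hg.aestronglyMeasurable (Eventually.of_forall hC)

theorem IsFourierKernel.integrable_exp_mul {K Kh : ℝ → ℂ} (h : IsFourierKernel K Kh) {g : ℝ → ℂ}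
    (hg : Continuous g) {C : ℝ} (hC : ∀ t, ‖g t‖ ≤ C) (ℓ : ℝ) :
    Integrable fun t : ℝ => Kh t * Complex.exp (Complex.I * t * ℓ) * g t := by
  have := h.integrable_mul (g := fun t : ℝ => Complex.exp (Complex.I * t * ℓ) * g t) (by fun_prop)
    (C := C) (fun t => by rw [norm_mul, norm_exp_I_mul, one_mul]; exact hC t)
  simpa only [mul_assoc] using this

theorem IsFourierKernel.integral_sum_mul_LSeries {K Kh : ℝ → ℂ} (h : IsFourierKernel K Kh) {f : ℕ → ℂ}
    {σ : ℝ} (hf : LSeriesSummable f σ) (ℓ : ℝ) {ι : Type*} (P : Finset ι) (c : ι → ℂ) (d : ι → ℝ) :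
    ∫ t : ℝ, Kh t * Complex.exp (Complex.I * t * ℓ) *
        ((∑ i ∈ P, c i * Complex.exp (-(Complex.I * t * d i))) * LSeries f (σ + Complex.I * t)) =
      ∑ i ∈ P, c i * ∑' n : ℕ, LSeries.term f σ n * K (Real.log n - (ℓ - d i)) := by
  simp only [h.tsum_term_mul hf, ← integral_const_mul]
  rw [← integral_finsetSum]
  · refine integral_congr_ae (Eventually.of_forall fun t => ?_)
    simp only [sum_mul, mul_sum]
    refine sum_congr rfl fun i _ => ?_
    have : Complex.I * t * ((ℓ - d i : ℝ) : ℂ) = Complex.I * t * ℓ + -(Complex.I * t * d i) := by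
      push_cast; ring
    rw [this, Complex.exp_add]; ring
  · intro i _
    exact (h.integrable_exp_mul (continuous_LSeries_add_I_mul hf)
      (norm_LSeries_add_I_mul_le hf) _).const_mul _

theorem LSeries_ite_le_eq_sum (f : ℕ → ℂ) (V : ℕ) (σ t : ℝ) :
    LSeries (fun n => if n ≤ V then f n else 0) (σ + Complex.I * t) =
      ∑ n ∈ Icc 1 V, f n * (((n : ℝ) ^ (-σ) : ℝ) : ℂ) *
        Complex.exp (-(Complex.I * t * (Real.log n : ℝ))) := by
  rw [LSeries, tsum_eq_sum (s := Icc 1 V)]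
  · refine sum_congr rfl fun n hn => ?_
    rw [mem_Icc] at hn
    rw [term_add_I_mul, term_ofReal_eq _ (by omega), if_pos hn.2]
  · intro n hn
    rw [mem_Icc] at hn
    rcases eq_or_ne n 0 with rfl | h0
    · simp
    · rw [LSeries.term_of_ne_zero h0, if_neg (by omega), zero_div]

theorem LSeriesSummable_ite_le (f : ℕ → ℂ) (V : ℕ) (s : ℂ) :
    LSeriesSummable (fun n => if n ≤ V then f n else 0) s := by
  refine summable_of_ne_finset_zero (s := Icc 1 V) fun n hn => ?_
  rw [mem_Icc] at hn
  rcases eq_or_ne n 0 with rfl | h0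
  · simp
  · rw [LSeries.term_of_ne_zero h0, if_neg (by omega), zero_div]

theorem convolution_one_moebius_le_apply {V n : ℕ} (hn : n ≤ V) :
    LSeries.convolution 1 (fun n => if n ≤ V then (ArithmeticFunction.moebius n : ℂ) else 0) n =
      if n = 1 then 1 else 0 := by
  have h : LSeries.convolution 1 (fun n => (ArithmeticFunction.moebius n : ℂ)) n =
      if n = 1 then 1 else 0 := by
    have h2 := congrFun (DirichletCharacter.convolution_mul_moebius (1 : DirichletCharacter ℂ 1)) n
    rw [DirichletCharacter.modOne_eq_one, one_mul] at h2
    rw [h2, LSeries.delta]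
  rw [← h, LSeries.convolution_def, LSeries.convolution_def]
  refine sum_congr rfl fun p hp => ?_
  have := Nat.mem_divisorsAntidiagonal.1 hp
  have h3 : p.2 ∣ n := ⟨p.1, by rw [← this.1, mul_comm]⟩
  rw [if_pos ((Nat.le_of_dvd (Nat.pos_of_ne_zero this.2) h3).trans hn)]

theorem norm_convolution_one_moebius_le (V n : ℕ) :
    ‖(LSeries.convolution 1 (fun n => if n ≤ V then (ArithmeticFunction.moebius n : ℂ) else 0) : ℕ → ℂ) n‖
      ≤ n.divisors.card := by
  rw [LSeries.convolution_def]
  refine (norm_sum_le _ _).trans ?_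
  calc _ ≤ ∑ _p ∈ n.divisorsAntidiagonal, (1 : ℝ) := sum_le_sum fun p _ => by
        rw [Pi.one_apply, one_mul]
        split_ifs
        · rw [← Complex.ofReal_intCast, Complex.norm_real, Real.norm_eq_abs]
          exact_mod_cast ArithmeticFunction.abs_moebius_le_one
        · simp
    _ = _ := by rw [sum_const, ← Nat.map_div_right_divisors, card_map, nsmul_eq_mul, mul_one]

theorem LSeriesSummable_character_mul_ite {r : ℕ} (χ : DirichletCharacter ℂ r) {a : ℕ → ℂ} {s : ℂ}
    (ha : LSeriesSummable a s) (M : ℕ) :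
    LSeriesSummable (fun n => if M ≤ n then χ n * a n else 0) s := by
  refine Summable.of_norm_bounded ha.norm fun n => LSeries.norm_term_le s ?_
  split_ifs
  · rw [norm_mul]
    exact mul_le_of_le_one_left (norm_nonneg _) (DirichletCharacter.norm_le_one _ _)
  · simp

theorem LSeries_twist_vonMangoldt_eq_vaughan {r : ℕ} (χ : DirichletCharacter ℂ r) {V : ℕ} (hV : 1 ≤ V)
    {s : ℂ} (hs : 1 < s.re) :
    LSeries (fun n => χ n * (ArithmeticFunction.vonMangoldt n : ℂ)) s =
      -(LSeries (fun n => if V + 1 ≤ n then χ n * (ArithmeticFunction.vonMangoldt n : ℂ) else 0) s *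
        LSeries (fun n => if V + 1 ≤ n then χ n * LSeries.convolution 1
          (fun n => if n ≤ V then (ArithmeticFunction.moebius n : ℂ) else 0) n else 0) s) +
      LSeries (fun n => if n ≤ V then χ n * (ArithmeticFunction.moebius n : ℂ) else 0) s *
        LSeries (LSeries.logMul fun n => χ n) s +
      LSeries (fun n => if n ≤ V then χ n * (ArithmeticFunction.vonMangoldt n : ℂ) else 0) s -
      LSeries (fun n => if n ≤ V then χ n * (ArithmeticFunction.vonMangoldt n : ℂ) else 0) s *
        LSeries (fun n => if n ≤ V then χ n * (ArithmeticFunction.moebius n : ℂ) else 0) s *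
        LSeries (fun n => χ n) s := by
  set mV : ℕ → ℂ := fun n => if n ≤ V then (ArithmeticFunction.moebius n : ℂ) else 0 with hmV
  have hχ : LSeriesSummable (fun n => χ n) s := χ.LSeriesSummable_of_one_lt_re hs
  have hΛ := ArithmeticFunction.LSeriesSummable_vonMangoldt hs
  have hb : LSeriesSummable (LSeries.convolution 1 mV) s :=
    (LSeriesSummable_one_iff.2 hs).convolution (LSeriesSummable_ite_le _ _ _)
  have h1 : LSeries (fun n => χ n * (ArithmeticFunction.vonMangoldt n : ℂ)) s =
      LSeries (fun n => if n ≤ V then χ n * (ArithmeticFunction.vonMangoldt n : ℂ) else 0) s +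
      LSeries (fun n => if V + 1 ≤ n then χ n * (ArithmeticFunction.vonMangoldt n : ℂ) else 0) s := by
    rw [← LSeries_add (LSeriesSummable_ite_le _ _ _) (LSeriesSummable_character_mul_ite χ hΛ _)]
    congr 1
    funext n
    simp only [Pi.add_apply]
    by_cases h : n ≤ V
    · rw [if_pos h, if_neg (by omega), add_zero]
    · rw [if_neg h, if_pos (by omega), zero_add]
  have h2 : LSeries (fun n => χ n) s *
      LSeries (fun n => if n ≤ V then χ n * (ArithmeticFunction.moebius n : ℂ) else 0) s =
      1 + LSeries (fun n => if V + 1 ≤ n then χ n * LSeries.convolution 1 mV n else 0) s := by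
    rw [← LSeries_convolution' hχ (LSeriesSummable_ite_le _ _ _)]
    have e1 : (fun n => if n ≤ V then χ n * (ArithmeticFunction.moebius n : ℂ) else 0) =
        (fun n : ℕ => χ n) * mV := by
      funext n; simp only [hmV, Pi.mul_apply, mul_ite, mul_zero]
    have e2 : LSeries.convolution (fun n : ℕ => χ n) ((fun n : ℕ => χ n) * mV) =
        (fun n : ℕ => χ n) * LSeries.convolution 1 mV := by
      have := DirichletCharacter.mul_convolution_distrib χ 1 mV
      rw [mul_one] at this
      exact this
    have hδ : LSeriesSummable LSeries.delta s := by
      refine summable_of_ne_finset_zero (s := {1}) fun n hn => ?_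
      rw [LSeries.term_delta, if_neg (by simpa using hn)]
    have hδ1 : LSeries LSeries.delta s = 1 := by rw [LSeries_delta, Pi.one_apply]
    rw [e1, e2, ← hδ1, ← LSeries_add hδ (LSeriesSummable_character_mul_ite χ hb _)]
    congr 1
    funext n
    simp only [Pi.add_apply, Pi.mul_apply, LSeries.delta]
    by_cases h : n ≤ V
    · rw [if_neg (show ¬ V + 1 ≤ n by omega), add_zero, convolution_one_moebius_le_apply h]
      split_ifs with h1
      · simp [h1]
      · simp
    · rw [if_pos (show V + 1 ≤ n by omega), if_neg (by omega), zero_add]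
  have h3 : LSeries (fun n => χ n * (ArithmeticFunction.vonMangoldt n : ℂ)) s * LSeries (fun n => χ n) s =
      LSeries (LSeries.logMul fun n => χ n) s := by
    have h4 := DirichletCharacter.convolution_twist_vonMangoldt χ
    refine (LSeries_convolution' (DirichletCharacter.LSeriesSummable_twist_vonMangoldt χ hs) hχ).symm.trans ?_
    rw [h4]
    congr 1
    funext n
    simp [LSeries.logMul, mul_comm]
  set F := LSeries (fun n => χ n * (ArithmeticFunction.vonMangoldt n : ℂ)) s
  set L := LSeries (fun n => χ n) s
  set G := LSeries (fun n => if n ≤ V then χ n * (ArithmeticFunction.vonMangoldt n : ℂ) else 0) s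
  set M := LSeries (fun n => if n ≤ V then χ n * (ArithmeticFunction.moebius n : ℂ) else 0) s
  rw [← h3, show LSeries (fun n => if V + 1 ≤ n then χ n * LSeries.convolution 1 mV n else 0) s = L * M - 1 by
    rw [h2]; ring, show LSeries (fun n => if V + 1 ≤ n then χ n * (ArithmeticFunction.vonMangoldt n : ℂ) else 0) s
      = F - G by rw [h1]; ring]
  ring

end VaughanIdentity

section VaughanSums

open Finset Filter Topology MeasureTheory

theorem IsCutoff.id_mul {K : ℝ → ℂ} {A : ℝ} (hK : IsCutoff K A) :
    IsCutoff (fun u => (u : ℂ) * K u) (2 * A) := by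
  have hA := hK.nonneg
  have hu : ∀ u : ℝ, ∀ z : ℂ, (1 < |u| → z = 0) → ‖(u : ℂ) * z‖ ≤ ‖z‖ := by
    intro u z hz
    by_cases h : 1 < |u|
    · simp [hz h]
    · rw [norm_mul, Complex.norm_real, Real.norm_eq_abs]
      exact mul_le_of_le_one_left (norm_nonneg _) (not_lt.1 h)
  have hd : ∀ u : ℝ, HasDerivAt (fun u : ℝ => (u : ℂ) * K u) (1 * K u + u * deriv K u) u := fun u =>
    (Complex.ofRealCLM.hasDerivAt (x := u)).mul (hK.differentiable u).hasDerivAt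
  have hd0 : ∀ u, 1 < |u| → deriv K u = 0 := by
    intro u h
    have : K =ᶠ[𝓝 u] fun _ => 0 := by
      filter_upwards [(isOpen_lt continuous_const continuous_abs).mem_nhds h] with v hv using hK.eq_zero v hv
    rw [this.deriv_eq, deriv_const]
  refine ⟨fun u => (hd u).differentiableAt, fun u => ?_, fun u => ?_, fun u h => ?_⟩
  · refine (hu u _ (hK.eq_zero u)).trans ((hK.norm_le u).trans (by linarith))
  · rw [(hd u).deriv, one_mul]
    refine (norm_add_le _ _).trans ?_
    have := (hu u _ (hd0 u)).trans (hK.norm_deriv_le u)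
    linarith [hK.norm_le u]
  · rw [hK.eq_zero u h, mul_zero]

theorem IsCutoff.summable_term_mul {K : ℝ → ℂ} {A : ℝ} (hK : IsCutoff K A) {f : ℕ → ℂ} {s : ℂ}
    (hf : LSeriesSummable f s) (ℓ : ℝ) : Summable fun n : ℕ => LSeries.term f s n * K (Real.log n - ℓ) := by
  refine Summable.of_norm_bounded (hf.norm.mul_right A) fun n => ?_
  rw [norm_mul]
  exact mul_le_mul_of_nonneg_left (hK.norm_le _) (norm_nonneg _)

theorem term_logMul (f : ℕ → ℂ) (s : ℂ) (n : ℕ) :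
    LSeries.term (LSeries.logMul f) s n = (Real.log n : ℝ) * LSeries.term f s n := by
  rcases eq_or_ne n 0 with rfl | hn
  · simp
  · rw [LSeries.term_of_ne_zero hn, LSeries.term_of_ne_zero hn, LSeries.logMul, ← Complex.natCast_log]
    ring

theorem IsCutoff.norm_tsum_logMul_character_le {K : ℝ → ℂ} {A : ℝ} (hK : IsCutoff K A) {r : ℕ} [NeZero r]
    {χ : DirichletCharacter ℂ r} (hχ : χ ≠ 1) {σ : ℝ} (hσ : 1 < σ) (hσ2 : σ ≤ 2) (ℓ : ℝ) :
    ‖∑' n : ℕ, LSeries.term (LSeries.logMul fun n => χ n) σ n * K (Real.log n - ℓ)‖ ≤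
      9 * (|ℓ| + 2) * A * r * Real.exp (-ℓ) := by
  have hf : LSeriesSummable (fun n => χ n) σ := χ.LSeriesSummable_of_one_lt_re (by simpa using hσ)
  have e : ∀ n : ℕ, LSeries.term (LSeries.logMul fun n => χ n) σ n * K (Real.log n - ℓ) =
      LSeries.term (fun n => χ n) σ n * (((Real.log n - ℓ : ℝ) : ℂ) * K (Real.log n - ℓ)) +
        ℓ * (LSeries.term (fun n => χ n) σ n * K (Real.log n - ℓ)) := by
    intro n
    rw [term_logMul]; push_cast; ring
  rw [tsum_congr e, (hK.id_mul.summable_term_mul hf ℓ).tsum_add ((hK.summable_term_mul hf ℓ).mul_left _),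
    tsum_mul_left]
  refine (norm_add_le _ _).trans ?_
  have h1 := hK.id_mul.norm_tsum_character_le hχ hσ.le hσ2 ℓ
  have h2 := hK.norm_tsum_character_le hχ hσ.le hσ2 ℓ
  rw [norm_mul, Complex.norm_real, Real.norm_eq_abs]
  have h3 := mul_le_mul_of_nonneg_left h2 (abs_nonneg ℓ)
  refine (add_le_add h1 h3).trans (le_of_eq ?_)
  ring

theorem rpow_neg_mul_exp_le {m : ℕ} (hm : 1 ≤ m) {σ : ℝ} (hσ : 1 ≤ σ) (ℓ : ℝ) :
    (m : ℝ) ^ (-σ) * Real.exp (-(ℓ - Real.log m)) ≤ Real.exp (-ℓ) := by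
  have hm1 : (1 : ℝ) ≤ m := by exact_mod_cast hm
  have hm0 : (0 : ℝ) < m := by linarith
  rw [show -(ℓ - Real.log m) = -ℓ + Real.log m by ring, Real.exp_add, Real.exp_log hm0]
  have : (m : ℝ) ^ (-σ) ≤ (m : ℝ)⁻¹ := by
    rw [← Real.rpow_neg_one]
    exact Real.rpow_le_rpow_of_exponent_le hm1 (by linarith)
  calc (m : ℝ) ^ (-σ) * (Real.exp (-ℓ) * m) ≤ (m : ℝ)⁻¹ * (Real.exp (-ℓ) * m) := by gcongr
    _ = _ := by field_simp

set_option maxHeartbeats 1000000 in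
theorem IsFourierKernel.norm_tsum_twist_vonMangoldt_le {K Kh : ℝ → ℂ} (h : IsFourierKernel K Kh) {A : ℝ}
    (hK : IsCutoff K A) {r : ℕ} [NeZero r] {χ : DirichletCharacter ℂ r} (hχ : χ ≠ 1) {ℓ : ℝ} (hℓ : 2 ≤ ℓ)
    {V : ℕ} (hV : 1 ≤ V) (hVℓ : (V : ℝ) ^ 4 ≤ Real.exp ℓ) :
    ‖∑' n : ℕ, LSeries.term (fun n => χ n * (ArithmeticFunction.vonMangoldt n : ℂ)) (1 + 1 / ℓ : ℝ) n *
        K (Real.log n - ℓ)‖ ≤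
      (∫ t : ℝ, ‖Kh t‖ *
        (‖LSeries (fun n => if V + 1 ≤ n then χ n * (ArithmeticFunction.vonMangoldt n : ℂ) else 0)
            ((1 + 1 / ℓ : ℝ) + Complex.I * t)‖ *
        ‖LSeries (fun n => if V + 1 ≤ n then χ n * LSeries.convolution 1
          (fun n => if n ≤ V then (ArithmeticFunction.moebius n : ℂ) else 0) n else 0)
            ((1 + 1 / ℓ : ℝ) + Complex.I * t)‖)) +
      27 * A * ℓ * V ^ 2 * r * Real.exp (-ℓ) := by
  set σ : ℝ := 1 + 1 / ℓ with hσ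
  have hℓ0 : 0 < ℓ := by linarith
  have hA := hK.nonneg
  have hi0 : 0 < 1 / ℓ := by positivity
  have hi1 : 1 / ℓ ≤ 1 := by rw [div_le_one hℓ0]; linarith
  have hσ1 : 1 < σ := by linarith
  have hσ2 : σ ≤ 2 := by linarith
  have hs : 1 < (σ : ℂ).re := by simpa using hσ1
  set fT : ℕ → ℂ := fun n => if V + 1 ≤ n then χ n * (ArithmeticFunction.vonMangoldt n : ℂ) else 0 with hfT
  set fB : ℕ → ℂ := fun n => if V + 1 ≤ n then χ n * LSeries.convolution 1
          (fun n => if n ≤ V then (ArithmeticFunction.moebius n : ℂ) else 0) n else 0 with hfB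
  set fM : ℕ → ℂ := fun n => if n ≤ V then χ n * (ArithmeticFunction.moebius n : ℂ) else 0 with hfM
  set fG : ℕ → ℂ := fun n => if n ≤ V then χ n * (ArithmeticFunction.vonMangoldt n : ℂ) else 0 with hfG
  have hχs : LSeriesSummable (fun n => χ n) σ := χ.LSeriesSummable_of_one_lt_re hs
  have hF : LSeriesSummable (fun n => χ n * (ArithmeticFunction.vonMangoldt n : ℂ)) σ :=
    DirichletCharacter.LSeriesSummable_twist_vonMangoldt χ hs
  have hT : LSeriesSummable fT σ :=
    LSeriesSummable_character_mul_ite χ (ArithmeticFunction.LSeriesSummable_vonMangoldt hs) _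
  have hB : LSeriesSummable fB σ := LSeriesSummable_character_mul_ite χ
    ((LSeriesSummable_one_iff.2 hs).convolution (LSeriesSummable_ite_le _ _ _)) _
  have hM : LSeriesSummable fM σ := LSeriesSummable_ite_le _ _ _
  have hG : LSeriesSummable fG σ := LSeriesSummable_ite_le _ _ _
  have hD : LSeriesSummable (LSeries.logMul fun n => χ n) σ :=
    LSeriesSummable_logMul_iterate (g := fun n => χ n) (fun n => DirichletCharacter.norm_le_one _ _) 1 hs
  have hcont := fun {f : ℕ → ℂ} (hf : LSeriesSummable f σ) => continuous_LSeries_add_I_mul hf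
  have hbd := fun {f : ℕ → ℂ} (hf : LSeriesSummable f σ) => norm_LSeries_add_I_mul_le hf
  have hbd2 : ∀ {f g : ℕ → ℂ}, LSeriesSummable f σ → LSeriesSummable g σ → ∀ t : ℝ,
      ‖LSeries f (σ + Complex.I * t) * LSeries g (σ + Complex.I * t)‖ ≤
        (∑' n, ‖LSeries.term f σ n‖) * ∑' n, ‖LSeries.term g σ n‖ := fun hf hg t => by
    rw [norm_mul]
    exact mul_le_mul (hbd hf t) (hbd hg t) (norm_nonneg _) (tsum_nonneg fun n => norm_nonneg _)
  have i1 := h.integrable_exp_mul ((hcont hT).mul (hcont hB)) (hbd2 hT hB) ℓ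
  have i2 := h.integrable_exp_mul ((hcont hM).mul (hcont hD)) (hbd2 hM hD) ℓ
  have i3 := h.integrable_exp_mul (hcont hG) (hbd hG) ℓ
  have i4 := h.integrable_exp_mul (((hcont hG).mul (hcont hM)).mul (hcont hχs))
    (fun t => (norm_mul_le _ _).trans (mul_le_mul (hbd2 hG hM t) (hbd hχs t) (norm_nonneg _)
      (mul_nonneg (tsum_nonneg fun n => norm_nonneg _) (tsum_nonneg fun n => norm_nonneg _)))) ℓ
  rw [h.tsum_term_mul hF]
  have key : ∫ t : ℝ, Kh t * Complex.exp (Complex.I * t * ℓ) *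
      LSeries (fun n => χ n * (ArithmeticFunction.vonMangoldt n : ℂ)) (σ + Complex.I * t) =
      -(∫ t : ℝ, Kh t * Complex.exp (Complex.I * t * ℓ) *
          (LSeries fT (σ + Complex.I * t) * LSeries fB (σ + Complex.I * t))) +
        (∫ t : ℝ, Kh t * Complex.exp (Complex.I * t * ℓ) * (LSeries fM (σ + Complex.I * t) *
          LSeries (LSeries.logMul fun n => χ n) (σ + Complex.I * t))) +
        (∫ t : ℝ, Kh t * Complex.exp (Complex.I * t * ℓ) * LSeries fG (σ + Complex.I * t)) -
        ∫ t : ℝ, Kh t * Complex.exp (Complex.I * t * ℓ) * (LSeries fG (σ + Complex.I * t) *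
          LSeries fM (σ + Complex.I * t) * LSeries (fun n => χ n) (σ + Complex.I * t)) := by
    have k := integral_sub' ((i1.neg.add i2).add i3) i4
    rw [integral_add' (i1.neg.add i2) i3, integral_add' i1.neg i2, integral_neg'] at k
    refine Eq.trans ?_ k
    refine integral_congr_ae (Eventually.of_forall fun t => ?_)
    simp only [Pi.add_apply, Pi.neg_apply, Pi.sub_apply, Pi.mul_apply]
    rw [LSeries_twist_vonMangoldt_eq_vaughan χ hV (s := σ + Complex.I * t) (by simpa using hσ1)]
    ring
  have hV1 : (1 : ℝ) ≤ V := by exact_mod_cast hV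
  have hlogV : Real.log V ≤ ℓ / 4 := by
    rw [le_div_iff₀ (by norm_num), mul_comm]
    have := Real.log_le_log (by positivity) hVℓ
    rwa [Real.log_pow, Real.log_exp] at this
  have hlog : ∀ m ∈ Icc 1 V, 0 ≤ Real.log m ∧ Real.log m ≤ ℓ / 4 := fun m hm => by
    rw [mem_Icc] at hm
    have : (1 : ℝ) ≤ m := by exact_mod_cast hm.1
    refine ⟨Real.log_nonneg this, le_trans (Real.log_le_log (by linarith) ?_) hlogV⟩
    exact_mod_cast hm.2
  have b1 : ‖∫ t : ℝ, Kh t * Complex.exp (Complex.I * t * ℓ) *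
      (LSeries fT (σ + Complex.I * t) * LSeries fB (σ + Complex.I * t))‖ ≤
      ∫ t : ℝ, ‖Kh t‖ * (‖LSeries fT (σ + Complex.I * t)‖ * ‖LSeries fB (σ + Complex.I * t)‖) := by
    refine (norm_integral_le_integral_norm _).trans (le_of_eq ?_)
    refine integral_congr_ae (Eventually.of_forall fun t => ?_)
    simp only [norm_mul, norm_exp_I_mul, mul_one]
  have b3 : ∫ t : ℝ, Kh t * Complex.exp (Complex.I * t * ℓ) * LSeries fG (σ + Complex.I * t) = 0 := by
    rw [← h.tsum_term_mul hG]
    refine (tsum_congr fun n => ?_).trans tsum_zero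
    rcases eq_or_ne n 0 with rfl | hn
    · simp
    by_cases hnV : n ≤ V
    · have := (hlog n (mem_Icc.2 ⟨by omega, hnV⟩)).2
      rw [hK.eq_zero _ (by rw [lt_abs]; right; linarith), mul_zero]
    · rw [LSeries.term_of_ne_zero hn, hfG]
      simp only
      rw [if_neg hnV, zero_div, zero_mul]
  have hχ1 : ∀ n : ℕ, ‖χ n‖ ≤ 1 := fun n => DirichletCharacter.norm_le_one _ _
  have hμ1 : ∀ n : ℕ, ‖(ArithmeticFunction.moebius n : ℂ)‖ ≤ 1 := fun n => by
    rw [← Complex.ofReal_intCast, Complex.norm_real, Real.norm_eq_abs]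
    exact_mod_cast ArithmeticFunction.abs_moebius_le_one
  have hΛ1 : ∀ n ∈ Icc 1 V, ‖(ArithmeticFunction.vonMangoldt n : ℂ)‖ ≤ ℓ := fun n hn => by
    rw [Complex.norm_of_nonneg ArithmeticFunction.vonMangoldt_nonneg]
    linarith [ArithmeticFunction.vonMangoldt_le_log (n := n), (hlog n hn).2]
  have b2 : ‖∫ t : ℝ, Kh t * Complex.exp (Complex.I * t * ℓ) * (LSeries fM (σ + Complex.I * t) *
      LSeries (LSeries.logMul fun n => χ n) (σ + Complex.I * t))‖ ≤
      18 * A * ℓ * V * r * Real.exp (-ℓ) := by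
    simp only [hfM, LSeries_ite_le_eq_sum]
    rw [h.integral_sum_mul_LSeries hD ℓ (Icc 1 V) _ (fun m : ℕ => Real.log m)]
    refine (norm_sum_le _ _).trans ((sum_le_sum (g := fun _ => 18 * A * ℓ * r * Real.exp (-ℓ))
      fun m hm => ?_).trans (le_of_eq ?_))
    · obtain ⟨l0, l1⟩ := hlog m hm
      have h1 := hK.norm_tsum_logMul_character_le hχ hσ1 hσ2 (ℓ - Real.log m)
      have h2 : |ℓ - Real.log m| ≤ ℓ := by rw [abs_of_nonneg (by linarith)]; linarith
      rw [norm_mul, norm_mul, norm_mul, Complex.norm_of_nonneg (by positivity)]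
      have h3 := rpow_neg_mul_exp_le (mem_Icc.1 hm).1 hσ1.le ℓ
      calc _ ≤ 1 * 1 * (m : ℝ) ^ (-σ) *
            (9 * (ℓ + ℓ) * A * r * Real.exp (-(ℓ - Real.log m))) := by
            gcongr
            · exact hχ1 m
            · exact hμ1 m
            · refine h1.trans ?_
              gcongr
        _ = 18 * A * ℓ * r * ((m : ℝ) ^ (-σ) * Real.exp (-(ℓ - Real.log m))) := by ring
        _ ≤ _ := by gcongr
    · rw [sum_const, Nat.card_Icc, nsmul_eq_mul, Nat.add_sub_cancel]; ring
  have b4 : ‖∫ t : ℝ, Kh t * Complex.exp (Complex.I * t * ℓ) * (LSeries fG (σ + Complex.I * t) *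
          LSeries fM (σ + Complex.I * t) * LSeries (fun n => χ n) (σ + Complex.I * t))‖ ≤
      9 * A * ℓ * V ^ 2 * r * Real.exp (-ℓ) := by
    have e : ∀ t : ℝ, LSeries fG (σ + Complex.I * t) * LSeries fM (σ + Complex.I * t) =
        ∑ i ∈ Icc 1 V ×ˢ Icc 1 V, ((χ i.1 * (ArithmeticFunction.vonMangoldt i.1 : ℂ) *
          (((i.1 : ℝ) ^ (-σ) : ℝ) : ℂ)) * (χ i.2 * (ArithmeticFunction.moebius i.2 : ℂ) *
          (((i.2 : ℝ) ^ (-σ) : ℝ) : ℂ))) *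
          Complex.exp (-(Complex.I * t * ((Real.log i.1 + Real.log i.2 : ℝ) : ℂ))) := by
      intro t
      rw [hfG, hfM, LSeries_ite_le_eq_sum, LSeries_ite_le_eq_sum, sum_mul_sum, ← sum_product']
      refine sum_congr rfl fun i _ => ?_
      have : -(Complex.I * t * ((Real.log i.1 + Real.log i.2 : ℝ) : ℂ)) =
          -(Complex.I * t * (Real.log i.1 : ℝ)) + -(Complex.I * t * (Real.log i.2 : ℝ)) := by
        push_cast; ring
      rw [this, Complex.exp_add]
      ring
    simp only [e]
    rw [h.integral_sum_mul_LSeries hχs ℓ (Icc 1 V ×ˢ Icc 1 V) _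
      (fun i : ℕ × ℕ => Real.log i.1 + Real.log i.2)]
    refine (norm_sum_le _ _).trans ((sum_le_sum (g := fun _ => 9 * A * ℓ * r * Real.exp (-ℓ))
      fun i hi => ?_).trans (le_of_eq ?_))
    · rw [mem_product] at hi
      have h1 := hK.norm_tsum_character_le hχ hσ1.le hσ2 (ℓ - (Real.log i.1 + Real.log i.2))
      have h3 := rpow_neg_mul_exp_le (mem_Icc.1 hi.1).1 hσ1.le ℓ
      have h4 := rpow_neg_mul_exp_le (mem_Icc.1 hi.2).1 hσ1.le (ℓ - Real.log i.1)
      rw [norm_mul, norm_mul, norm_mul, norm_mul, norm_mul, norm_mul,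
        Complex.norm_of_nonneg (r := (i.1 : ℝ) ^ (-σ)) (by positivity),
        Complex.norm_of_nonneg (r := (i.2 : ℝ) ^ (-σ)) (by positivity)]
      calc _ ≤ (1 * ℓ * (i.1 : ℝ) ^ (-σ)) * (1 * 1 * (i.2 : ℝ) ^ (-σ)) *
            (9 * A * r * Real.exp (-(ℓ - (Real.log i.1 + Real.log i.2)))) := by
            gcongr
            · exact hχ1 _
            · exact hΛ1 _ hi.1
            · exact hχ1 _
            · exact hμ1 _
        _ = 9 * A * ℓ * r * ((i.1 : ℝ) ^ (-σ) * ((i.2 : ℝ) ^ (-σ) *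
            Real.exp (-(ℓ - Real.log i.1 - Real.log i.2)))) := by
              rw [← sub_sub]; ring
        _ ≤ 9 * A * ℓ * r * ((i.1 : ℝ) ^ (-σ) * Real.exp (-(ℓ - Real.log i.1))) := by gcongr
        _ ≤ _ := by gcongr
    · rw [sum_const, card_product, Nat.card_Icc, nsmul_eq_mul, Nat.add_sub_cancel]; push_cast; ring
  rw [key, b3, add_zero]
  refine (norm_sub_le _ _).trans ((add_le_add_left (norm_add_le _ _) _).trans ?_)
  rw [norm_neg]
  have : 18 * A * ℓ * V * r * Real.exp (-ℓ) ≤ 18 * A * ℓ * V ^ 2 * r * Real.exp (-ℓ) := by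
    gcongr
    nlinarith
  linarith

end VaughanSums

section VaughanEstimate

open Finset Filter Topology MeasureTheory

theorem sum_mul_le_of_sum_sq_le {ι : Type*} (S : Finset ι) {x y : ι → ℝ} {a b : ℝ}
    (hx : ∑ i ∈ S, x i ^ 2 ≤ a) (hy : ∑ i ∈ S, y i ^ 2 ≤ b) : ∑ i ∈ S, x i * y i ≤ (a + b) / 2 := by
  have : ∑ i ∈ S, x i * y i ≤ ∑ i ∈ S, (x i ^ 2 + y i ^ 2) / 2 :=
    sum_le_sum fun i _ => by linarith [two_mul_le_add_sq (x i) (y i)]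
  rw [← sum_div, sum_add_distrib] at this
  linarith

theorem sum_norm_LSeries_tail_mul_le (S : Finset (Σ n, DirichletCharacter ℂ n)) {R V : ℕ}
    (hS : ∀ p ∈ S, p.1 ≠ 0 ∧ p.1 ≤ R ∧ p.2.IsPrimitive) (hSV : S.card * R ^ 2 ≤ V)
    {ℓ : ℝ} (hℓ : 1 ≤ ℓ) (t : ℝ) :
    ∑ p ∈ S, ‖LSeries (fun n => if V + 1 ≤ n then p.2 n * (ArithmeticFunction.vonMangoldt n : ℂ) else 0)
            ((1 + 1 / ℓ : ℝ) + Complex.I * t)‖ *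
        ‖LSeries (fun n => if V + 1 ≤ n then p.2 n * LSeries.convolution 1
          (fun n => if n ≤ V then (ArithmeticFunction.moebius n : ℂ) else 0) n else 0)
            ((1 + 1 / ℓ : ℝ) + Complex.I * t)‖ ≤ 960 * ℓ ^ 5 := by
  have hℓ0 : 0 < ℓ := by linarith
  have hs : 1 < ((1 + 1 / ℓ : ℝ) : ℂ).re := by
    rw [Complex.ofReal_re]; linarith [show 0 < 1 / ℓ by positivity]
  have hΛ := ArithmeticFunction.LSeriesSummable_vonMangoldt hs
  have hb : LSeriesSummable (LSeries.convolution 1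
      (fun n => if n ≤ V then (ArithmeticFunction.moebius n : ℂ) else 0)) ((1 + 1 / ℓ : ℝ) : ℂ) :=
    (LSeriesSummable_one_iff.2 hs).convolution (LSeriesSummable_ite_le _ _ _)
  obtain ⟨h3, h4⟩ := summable_and_tsum_sq_le_of_norm_le_card_divisors
    (norm_convolution_one_moebius_le V) hℓ
  have h1 := sum_norm_LSeries_sq_le S hS (Nat.succ_pos V) (hSV.trans (Nat.le_succ V)) hℓ hΛ
    (summable_vonMangoldt_sq hℓ) t
  have h2 := sum_norm_LSeries_sq_le S hS (Nat.succ_pos V) (hSV.trans (Nat.le_succ V)) hℓ hb h3 t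
  have h5 := tsum_vonMangoldt_sq_le hℓ
  have h6 := h1.trans (mul_le_mul_of_nonneg_left h5 (by positivity))
  have h7 := h2.trans (mul_le_mul_of_nonneg_left h4 (by positivity))
  have h8 : ℓ ^ 4 ≤ ℓ ^ 5 := pow_le_pow_right₀ hℓ (by norm_num)
  refine (sum_mul_le_of_sum_sq_le S h6 h7).trans ?_
  linarith

theorem IsFourierKernel.sum_norm_tsum_twist_vonMangoldt_le {K Kh : ℝ → ℂ} (h : IsFourierKernel K Kh)
    {A : ℝ} (hK : IsCutoff K A) (S : Finset (Σ n, DirichletCharacter ℂ n)) {R V : ℕ}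
    (hS : ∀ p ∈ S, p.1 ≠ 0 ∧ p.1 ≤ R ∧ p.2.IsPrimitive ∧ p.2 ≠ 1) (hSV : S.card * R ^ 2 ≤ V)
    {ℓ : ℝ} (hℓ : 2 ≤ ℓ) (hV : 1 ≤ V) (hVℓ : (V : ℝ) ^ 4 ≤ Real.exp ℓ) :
    ∑ p ∈ S, ‖∑' n : ℕ, LSeries.term (fun n => p.2 n * (ArithmeticFunction.vonMangoldt n : ℂ))
        (1 + 1 / ℓ : ℝ) n * K (Real.log n - ℓ)‖ ≤
      (960 * (∫ t, ‖Kh t‖) + 27 * A) * ℓ ^ 5 := by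
  have hA := hK.nonneg
  have hℓ0 : 0 < ℓ := by linarith
  have hV1 : (1 : ℝ) ≤ V := by exact_mod_cast hV
  have hs : 1 < ((1 + 1 / ℓ : ℝ) : ℂ).re := by
    rw [Complex.ofReal_re]; linarith [show 0 < 1 / ℓ by positivity]
  refine (sum_le_sum (g := fun p => (∫ t : ℝ, ‖Kh t‖ *
        (‖LSeries (fun n => if V + 1 ≤ n then p.2 n * (ArithmeticFunction.vonMangoldt n : ℂ) else 0)
            ((1 + 1 / ℓ : ℝ) + Complex.I * t)‖ *
        ‖LSeries (fun n => if V + 1 ≤ n then p.2 n * LSeries.convolution 1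
          (fun n => if n ≤ V then (ArithmeticFunction.moebius n : ℂ) else 0) n else 0)
            ((1 + 1 / ℓ : ℝ) + Complex.I * t)‖)) +
      27 * A * ℓ * V ^ 2 * R * Real.exp (-ℓ)) fun p hp => ?_).trans ?_
  · have : NeZero p.1 := ⟨(hS p hp).1⟩
    refine (h.norm_tsum_twist_vonMangoldt_le hK (hS p hp).2.2.2 hℓ hV hVℓ).trans ?_
    gcongr
    exact_mod_cast (hS p hp).2.1
  rw [sum_add_distrib, add_mul]
  refine add_le_add ?_ ?_
  · rw [← integral_finsetSum]
    · simp only [← mul_sum]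
      rw [show 960 * (∫ t, ‖Kh t‖) * ℓ ^ 5 = ∫ t, ‖Kh t‖ * (960 * ℓ ^ 5) by
        rw [integral_mul_const]; ring]
      refine integral_mono_of_nonneg (Eventually.of_forall fun t => by positivity)
        (h.integrable_norm.mul_const _) (Eventually.of_forall fun t => ?_)
      refine mul_le_mul_of_nonneg_left ?_ (norm_nonneg _)
      exact sum_norm_LSeries_tail_mul_le S (fun p hp => ⟨(hS p hp).1, (hS p hp).2.1, (hS p hp).2.2.1⟩)
        hSV (by linarith) t
    · intro p _
      have hT := LSeriesSummable_character_mul_ite p.2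
        (ArithmeticFunction.LSeriesSummable_vonMangoldt hs) (V + 1)
      have hB := LSeriesSummable_character_mul_ite p.2 ((LSeriesSummable_one_iff.2 hs).convolution
        (LSeriesSummable_ite_le (fun n => (ArithmeticFunction.moebius n : ℂ)) V _)) (V + 1)
      have := (h.integrable_mul ((continuous_LSeries_add_I_mul hT).mul (continuous_LSeries_add_I_mul hB))
        (fun t => (norm_mul_le _ _).trans (mul_le_mul (norm_LSeries_add_I_mul_le hT t)
          (norm_LSeries_add_I_mul_le hB t) (norm_nonneg _) (tsum_nonneg fun n => norm_nonneg _)))).norm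
      refine this.congr (Eventually.of_forall fun t => ?_)
      simp only [Pi.mul_apply, norm_mul]
  · rw [sum_const, nsmul_eq_mul]
    have h1 : (S.card : ℝ) * R ≤ V := by
      have : S.card * R ≤ S.card * R ^ 2 := Nat.mul_le_mul_left _ (Nat.le_self_pow two_ne_zero R)
      exact_mod_cast this.trans hSV
    have h2 : (V : ℝ) ^ 3 * Real.exp (-ℓ) ≤ 1 := by
      rw [Real.exp_neg, ← div_eq_mul_inv, div_le_one (Real.exp_pos _)]
      exact (pow_le_pow_right₀ hV1 (by norm_num)).trans hVℓ
    have h3 : ℓ ≤ ℓ ^ 5 := le_self_pow₀ (by linarith) (by norm_num)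
    calc (S.card : ℝ) * (27 * A * ℓ * V ^ 2 * R * Real.exp (-ℓ)) =
        27 * A * ℓ * (V ^ 2 * ((S.card : ℝ) * R) * Real.exp (-ℓ)) := by ring
      _ ≤ 27 * A * ℓ * (V ^ 2 * V * Real.exp (-ℓ)) := by gcongr
      _ = 27 * A * ℓ * (V ^ 3 * Real.exp (-ℓ)) := by ring
      _ ≤ 27 * A * ℓ * 1 := by gcongr
      _ ≤ 27 * A * ℓ ^ 5 := by rw [mul_one]; gcongr

end VaughanEstimate

section PrimeCharacterSums

open Finset Filter Topology MeasureTheory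
open scoped ContDiff

theorem IsCutoff.pow_mul {K : ℝ → ℂ} {A : ℝ} (hK : IsCutoff K A) (i : ℕ) :
    IsCutoff (fun u => (u : ℂ) ^ i * K u) (2 ^ i * A) := by
  induction i with
  | zero => simpa using hK
  | succ i ih =>
    have := ih.id_mul
    convert this using 1
    · funext u; rw [pow_succ]; ring
    · rw [pow_succ]; ring

theorem term_logMul_iterate (f : ℕ → ℂ) (j : ℕ) (s : ℂ) (n : ℕ) :
    LSeries.term (LSeries.logMul^[j] f) s n = (((Real.log n : ℝ) : ℂ)) ^ j * LSeries.term f s n := by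
  rcases eq_or_ne n 0 with rfl | hn
  · simp
  · rw [LSeries.term_of_ne_zero hn, LSeries.term_of_ne_zero hn, logMul_iterate_apply]
    ring

theorem IsCutoff.norm_tsum_logMul_iterate_le {K : ℝ → ℂ} {A : ℝ} (hK : IsCutoff K A) {f : ℕ → ℂ}
    {s : ℂ} (hf : LSeriesSummable f s) (j : ℕ) {ℓ : ℝ} (hℓ : 0 ≤ ℓ) :
    ‖∑' n : ℕ, LSeries.term (LSeries.logMul^[j] f) s n * K (Real.log n - ℓ)‖ ≤
      ∑ i ∈ range (j + 1), ℓ ^ (j - i) * (j.choose i : ℝ) *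
        ‖∑' n : ℕ, LSeries.term f s n * (((Real.log n - ℓ : ℝ) : ℂ) ^ i * K (Real.log n - ℓ))‖ := by
  have e : ∀ n : ℕ, LSeries.term (LSeries.logMul^[j] f) s n * K (Real.log n - ℓ) =
      ∑ i ∈ range (j + 1), ((ℓ : ℂ) ^ (j - i) * (j.choose i : ℂ)) *
        (LSeries.term f s n * (((Real.log n - ℓ : ℝ) : ℂ) ^ i * K (Real.log n - ℓ))) := by
    intro n
    have : ((Real.log n : ℝ) : ℂ) = ((Real.log n - ℓ : ℝ) : ℂ) + ℓ := by push_cast; ring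
    rw [term_logMul_iterate]
    conv_lhs => rw [this, add_pow]
    simp only [sum_mul]
    exact sum_congr rfl fun i _ => by ring
  rw [tsum_congr e, Summable.tsum_finsetSum fun i _ => ((hK.pow_mul i).summable_term_mul hf ℓ).mul_left _]
  refine (norm_sum_le _ _).trans (sum_le_sum fun i _ => ?_)
  rw [tsum_mul_left, norm_mul, norm_mul, norm_pow, Complex.norm_real, Real.norm_of_nonneg hℓ,
    Complex.norm_natCast]

theorem exists_forall_sum_norm_tsum_logMul_twist_vonMangoldt_le {K : ℝ → ℂ} {A : ℝ} (hK : IsCutoff K A)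
    (hc : ContDiff ℝ ∞ K) (hs : HasCompactSupport K) (j : ℕ) :
    ∃ C : ℝ, 0 ≤ C ∧ ∀ (S : Finset (Σ n, DirichletCharacter ℂ n)) (R V : ℕ),
      (∀ p ∈ S, p.1 ≠ 0 ∧ p.1 ≤ R ∧ p.2.IsPrimitive ∧ p.2 ≠ 1) → S.card * R ^ 2 ≤ V →
      ∀ ℓ : ℝ, 2 ≤ ℓ → 1 ≤ V → (V : ℝ) ^ 4 ≤ Real.exp ℓ →
      ∑ p ∈ S, ‖∑' n : ℕ, LSeries.term (LSeries.logMul^[j] fun n => p.2 n *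
        (ArithmeticFunction.vonMangoldt n : ℂ)) (1 + 1 / ℓ : ℝ) n * K (Real.log n - ℓ)‖ ≤
      C * ℓ ^ (j + 5) := by
  have hcs : ∀ i : ℕ, ∃ Kh, IsFourierKernel (fun u : ℝ => (u : ℂ) ^ i * K u) Kh := fun i =>
    exists_isFourierKernel ((Complex.ofRealCLM.contDiff.pow i).mul hc) (hs.mul_left)
  choose Kh hKh using hcs
  refine ⟨∑ i ∈ range (j + 1), (j.choose i : ℝ) * (960 * (∫ t, ‖Kh i t‖) + 27 * (2 ^ i * A)), ?_, ?_⟩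
  · have := hK.nonneg
    exact sum_nonneg fun i _ => mul_nonneg (by positivity) (add_nonneg (mul_nonneg (by norm_num)
      (integral_nonneg fun t => norm_nonneg _)) (by positivity))
  intro S R V hS hSV ℓ hℓ hV hVℓ
  have hA := hK.nonneg
  have hσ : 1 < ((1 + 1 / ℓ : ℝ) : ℂ).re := by
    rw [Complex.ofReal_re]; linarith [show 0 < 1 / ℓ by positivity]
  refine (sum_le_sum fun p _ => hK.norm_tsum_logMul_iterate_le
    (DirichletCharacter.LSeriesSummable_twist_vonMangoldt p.2 hσ) j (by linarith)).trans ?_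
  rw [sum_comm, sum_mul]
  refine sum_le_sum fun i hi => ?_
  rw [← mul_sum]
  have h1 := (hKh i).sum_norm_tsum_twist_vonMangoldt_le (hK.pow_mul i) S hS hSV hℓ hV hVℓ
  have h2 : ℓ ^ (j - i) * ℓ ^ 5 ≤ ℓ ^ (j + 5) := by
    rw [← pow_add]; exact pow_le_pow_right₀ (by linarith) (by omega)
  have h3 : 0 ≤ 960 * (∫ t, ‖Kh i t‖) + 27 * (2 ^ i * A) := add_nonneg (mul_nonneg (by norm_num)
      (integral_nonneg fun t => norm_nonneg _)) (by positivity)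
  calc _ ≤ ℓ ^ (j - i) * (j.choose i : ℝ) * ((960 * (∫ t, ‖Kh i t‖) + 27 * (2 ^ i * A)) * ℓ ^ 5) := by
        refine mul_le_mul_of_nonneg_left ?_ (by positivity)
        exact h1
    _ = (j.choose i : ℝ) * (960 * (∫ t, ‖Kh i t‖) + 27 * (2 ^ i * A)) * (ℓ ^ (j - i) * ℓ ^ 5) := by ring
    _ ≤ _ := by gcongr

theorem exists_forall_norm_tsum_logMul_twist_vonMangoldt_le {K : ℝ → ℂ}
    (hc : ContDiff ℝ ∞ K) (hs : HasCompactSupport K) (j : ℕ) :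
    ∃ C : ℝ, 0 ≤ C ∧ ∃ k : ℕ, ∀ q : ℝ, 1 ≤ q → ∀ (r : ℕ) [NeZero r] (χ : DirichletCharacter ℂ r),
      χ ≠ 1 → 1 + Real.log r ≤ q → (χ ^ 2 = 1 → (q ^ 7)⁻¹ ≤ ‖χ.LFunction 1‖) → ∀ ℓ : ℝ, 1 ≤ ℓ →
      ‖∑' n : ℕ, LSeries.term (LSeries.logMul^[j] fun n => χ n *
        (ArithmeticFunction.vonMangoldt n : ℂ)) (1 + 1 / ℓ : ℝ) n * K (Real.log n - ℓ)‖ ≤ C * q ^ k := by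
  obtain ⟨Kh, hKh⟩ := exists_isFourierKernel hc hs
  obtain ⟨C, hC, k, h⟩ := exists_forall_lt_norm_LSeries_logMul_twist_vonMangoldt_le (j + 1)
  refine ⟨C * ∫ t, (3 + |t|) ^ k * ‖Kh t‖, mul_nonneg (by linarith)
    (integral_nonneg fun t => by positivity), k, fun q hq r _ χ hχ hr hχ2 ℓ hℓ => ?_⟩
  have hℓ0 : 0 < 1 / ℓ := by positivity
  have hℓ1 : 1 / ℓ ≤ 1 := by rw [div_le_one (by linarith)]; exact hℓ
  have hab : LSeries.abscissaOfAbsConv (LSeries.logMul^[j] fun n => χ n *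
      (ArithmeticFunction.vonMangoldt n : ℂ)) ≤ 1 := by
    rw [LSeries.absicssaOfAbsConv_logPowMul]
    exact abscissaOfAbsConv_twist_vonMangoldt_le_one χ
  have hsum : LSeriesSummable (LSeries.logMul^[j] fun n => χ n *
      (ArithmeticFunction.vonMangoldt n : ℂ)) (1 + 1 / ℓ : ℝ) := by
    refine LSeriesSummable_of_abscissaOfAbsConv_lt_re (hab.trans_lt ?_)
    rw [Complex.ofReal_re]
    exact_mod_cast (by linarith : (1 : ℝ) < 1 + 1 / ℓ)
  refine (hKh.norm_tsum_term_mul_le hsum ℓ).trans ?_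
  rw [show C * (∫ t, (3 + |t|) ^ k * ‖Kh t‖) * q ^ k =
    ∫ t, C * q ^ k * ((3 + |t|) ^ k * ‖Kh t‖) by rw [integral_const_mul]; ring]
  refine integral_mono_of_nonneg (Eventually.of_forall fun t => by positivity)
    ((hKh.integrable k).const_mul _) (Eventually.of_forall fun t => ?_)
  have h1 := h q hq r χ hχ hr hχ2 (1 / ℓ) hℓ0 hℓ1 t j (Nat.lt_succ_self j)
  rw [show ((1 + 1 / ℓ : ℝ) : ℂ) = 1 + ((1 / ℓ : ℝ) : ℂ) by push_cast; rfl]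
  simp only
  calc _ ≤ ‖Kh t‖ * (C * (q * (3 + |t|)) ^ k) := by gcongr
    _ = _ := by rw [mul_pow]; ring

end PrimeCharacterSums

section DivisorSums

open Finset Filter Topology MeasureTheory

theorem sum_filter_dvd_le {f : ℕ → ℝ} (hf : ∀ n, 0 ≤ f n) {d : ℕ} (hd : 0 < d) (N : ℕ) :
    ∑ m ∈ (Icc 1 N).filter (d ∣ ·), f m ≤ ∑ e ∈ Icc 1 N, f (d * e) := by
  rw [← sum_image (f := f) (g := fun e => d * e)
    (fun a _ b _ h => Nat.eq_of_mul_eq_mul_left hd h)]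
  refine sum_le_sum_of_subset_of_nonneg (fun m hm => ?_) fun m _ _ => hf m
  obtain ⟨hm, e, rfl⟩ := mem_filter.1 hm
  rw [mem_Icc] at hm
  refine mem_image.2 ⟨e, mem_Icc.2 ⟨?_, ?_⟩, rfl⟩
  · exact Nat.pos_of_ne_zero fun h => by simp [h] at hm
  · exact le_trans (Nat.le_mul_of_pos_left e hd) hm.2

theorem sum_inv_Icc_le_one_add_log (N : ℕ) :
    ∑ e ∈ Icc 1 N, (e : ℝ)⁻¹ ≤ 1 + Real.log N := by
  have := harmonic_le_one_add_log N
  rw [harmonic_eq_sum_Icc] at this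
  push_cast at this
  exact this

theorem sum_pow_card_primeFactors_divisors {m : ℕ} (hm : Squarefree m) (D : ℕ) :
    ∑ d ∈ m.divisors, (D : ℝ) ^ d.primeFactors.card = ((D : ℝ) + 1) ^ m.primeFactors.card := by
  have h := Finset.sum_pow_mul_eq_add_pow (D : ℝ) 1 m.primeFactors
  simp only [one_pow, mul_one] at h
  rw [← h, ← Nat.divisors_filter_squarefree_of_squarefree hm,
    Nat.sum_divisors_filter_squarefree hm.ne_zero]
  have : (UniqueFactorizationMonoid.normalizedFactors m).toFinset = m.primeFactors := by
    rw [Nat.primeFactors, List.toFinset, Nat.factors_eq]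
  rw [this]
  refine sum_congr rfl fun t ht => ?_
  congr 2
  have : t.val.prod = ∏ p ∈ t, p := by rw [Finset.prod_eq_multiset_prod, Multiset.map_id']
  rw [this]
  exact Nat.primeFactors_prod fun p hp => Nat.prime_of_mem_primeFactors (mem_powerset.1 ht hp)

theorem sum_squarefree_pow_card_div_le (D N : ℕ) :
    ∑ m ∈ (Icc 1 N).filter Squarefree, (D : ℝ) ^ m.primeFactors.card / m ≤
      (1 + Real.log N) ^ D := by
  have hlog : 0 ≤ 1 + Real.log N := by positivity
  induction D with
  | zero =>
    calc ∑ m ∈ (Icc 1 N).filter Squarefree, ((0 : ℕ) : ℝ) ^ m.primeFactors.card / m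
        ≤ ∑ m ∈ (Icc 1 N).filter Squarefree, (if m = 1 then 1 else 0 : ℝ) := by
          refine sum_le_sum fun m hm => ?_
          rw [mem_filter, mem_Icc] at hm
          split_ifs with h
          · simp [h]
          · have : m.primeFactors.card ≠ 0 := by
              rw [Ne, card_eq_zero, Nat.primeFactors_eq_empty]; omega
            simp [this]
      _ ≤ (1 + Real.log N) ^ 0 := by
          rw [sum_ite_eq']; split_ifs <;> simp
  | succ D ih =>
    calc ∑ m ∈ (Icc 1 N).filter Squarefree, ((D + 1 : ℕ) : ℝ) ^ m.primeFactors.card / m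
        ≤ ∑ m ∈ (Icc 1 N).filter Squarefree, ∑ d ∈ (Icc 1 N).filter Squarefree,
            if d ∣ m then (D : ℝ) ^ d.primeFactors.card * (m : ℝ)⁻¹ else 0 := by
          refine sum_le_sum fun m hm => ?_
          rw [mem_filter, mem_Icc] at hm
          push_cast
          rw [← sum_pow_card_primeFactors_divisors hm.2, div_eq_mul_inv, sum_mul, ← sum_filter]
          refine sum_le_sum_of_subset_of_nonneg (fun d hd => ?_) fun _ _ _ => by positivity
          have hdm := Nat.dvd_of_mem_divisors hd
          simp only [mem_filter, mem_Icc]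
          exact ⟨⟨⟨Nat.pos_of_mem_divisors hd, (Nat.le_of_dvd (by omega) hdm).trans hm.1.2⟩,
            hm.2.squarefree_of_dvd hdm⟩, hdm⟩
      _ = ∑ d ∈ (Icc 1 N).filter Squarefree, (D : ℝ) ^ d.primeFactors.card *
            ∑ m ∈ ((Icc 1 N).filter Squarefree).filter (d ∣ ·), (m : ℝ)⁻¹ := by
          rw [sum_comm]
          refine sum_congr rfl fun d _ => ?_
          rw [← sum_filter, mul_sum]
      _ ≤ ∑ d ∈ (Icc 1 N).filter Squarefree, (D : ℝ) ^ d.primeFactors.card / d *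
            (1 + Real.log N) := by
          refine sum_le_sum fun d hd => ?_
          rw [mem_filter, mem_Icc] at hd
          rw [div_mul_eq_mul_div, mul_div_assoc]
          gcongr
          calc ∑ m ∈ ((Icc 1 N).filter Squarefree).filter (d ∣ ·), (m : ℝ)⁻¹
              ≤ ∑ m ∈ (Icc 1 N).filter (d ∣ ·), (m : ℝ)⁻¹ := by
                refine sum_le_sum_of_subset_of_nonneg ?_ fun _ _ _ => by positivity
                exact filter_subset_filter _ (filter_subset _ _)
            _ ≤ ∑ e ∈ Icc 1 N, ((d * e : ℕ) : ℝ)⁻¹ :=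
                sum_filter_dvd_le (f := fun m => (m : ℝ)⁻¹) (fun _ => by positivity) hd.1.1 N
            _ = (d : ℝ)⁻¹ * ∑ e ∈ Icc 1 N, (e : ℝ)⁻¹ := by
                rw [mul_sum]; push_cast; simp only [mul_inv]
            _ ≤ (1 + Real.log N) / d := by
                rw [div_eq_inv_mul]; gcongr; exact sum_inv_Icc_le_one_add_log N
      _ ≤ (1 + Real.log N) ^ D * (1 + Real.log N) := by rw [← sum_mul]; gcongr
      _ = _ := (pow_succ _ _).symm

theorem pow_card_primeFactors_le_mul_sqrt {D g : ℕ} (hD : 1 ≤ D) (hg : g ≠ 0) :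
    (D : ℝ) ^ g.primeFactors.card ≤ (D : ℝ) ^ D ^ 2 * Real.sqrt g := by
  have hD' : (1 : ℝ) ≤ D := by exact_mod_cast hD
  calc (D : ℝ) ^ g.primeFactors.card = ∏ p ∈ g.primeFactors, (D : ℝ) := by simp
    _ ≤ ∏ p ∈ g.primeFactors, ((if p < D ^ 2 then (D : ℝ) else 1) * Real.sqrt p) := by
        refine prod_le_prod (fun _ _ => by positivity) fun p hp => ?_
        have hp1 : (1 : ℝ) ≤ p := by exact_mod_cast (Nat.prime_of_mem_primeFactors hp).one_le
        split_ifs with h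
        · exact le_mul_of_one_le_right (by positivity) (Real.one_le_sqrt.2 hp1)
        · rw [one_mul]
          refine Real.le_sqrt_of_sq_le ?_
          exact_mod_cast not_lt.1 h
    _ = (D : ℝ) ^ (g.primeFactors.filter (· < D ^ 2)).card *
          Real.sqrt (∏ p ∈ g.primeFactors, (p : ℝ)) := by
        rw [prod_mul_distrib, ← prod_filter, prod_const, Real.sqrt_prod _ fun _ _ => by positivity]
    _ ≤ _ := by
        gcongr
        · calc (g.primeFactors.filter (· < D ^ 2)).card ≤ (range (D ^ 2)).card :=
                card_le_card fun p hp => by simpa using (mem_filter.1 hp).2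
            _ = D ^ 2 := card_range _
        · rw [← Nat.cast_prod]
          exact Nat.cast_le.2 (Nat.le_of_dvd (Nat.pos_of_ne_zero hg) (Nat.prod_primeFactors_dvd g))

theorem Squarefree.le_two_pow_mul_totient {q : ℕ} (hq : Squarefree q) :
    q ≤ 2 ^ q.primeFactors.card * q.totient := by
  have h1 := Nat.prod_primeFactors_of_squarefree hq
  have h2 := Nat.totient_mul_prod_primeFactors q
  rw [h1, mul_comm] at h2
  rw [Nat.eq_of_mul_eq_mul_left (Nat.pos_of_ne_zero hq.ne_zero) h2, ← prod_const,
    ← prod_mul_distrib]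
  conv_lhs => rw [← h1]
  refine prod_le_prod' fun p hp => ?_
  have := (Nat.prime_of_mem_primeFactors hp).two_le
  omega

theorem sum_pow_card_div_totient_le {κ : ℝ} (hκ : 0 ≤ κ) {D W r : ℕ} (hD : 1 ≤ D)
    (hκD : 2 * κ ≤ D) (hW : 0 < W) (hr : 0 < r) (N : ℕ) :
    ∑ q ∈ (Icc 1 N).filter (fun q => Squarefree q ∧ r ∣ q * W),
      κ ^ q.primeFactors.card / (q * W).totient ≤
      (D : ℝ) ^ D ^ 2 * Real.sqrt W / Real.sqrt r * (1 + Real.log N) ^ D := by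
  have hD0 : (0 : ℝ) < D := by exact_mod_cast hD
  set g := r / r.gcd W with hg_def
  have hgcd : 0 < r.gcd W := Nat.gcd_pos_of_pos_left _ hr
  have hrg : r = g * r.gcd W := (Nat.div_mul_cancel (Nat.gcd_dvd_left r W)).symm
  have hg : 0 < g := Nat.pos_of_ne_zero fun h => by rw [h, zero_mul] at hrg; omega
  have hrgW : r ≤ g * W := by
    calc r = g * r.gcd W := hrg
      _ ≤ g * W := Nat.mul_le_mul_left _ (Nat.gcd_le_right _ hW)
  have hdvd : ∀ q, r ∣ q * W → g ∣ q := fun q h => by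
    have hco : g.Coprime (W / r.gcd W) := Nat.coprime_div_gcd_div_gcd hgcd
    refine hco.dvd_of_dvd_mul_right ?_
    rw [← Nat.mul_div_assoc _ (Nat.gcd_dvd_right r W)]
    exact Nat.div_dvd_div (Nat.gcd_dvd_left r W) h
  set f : ℕ → ℝ := fun q => if Squarefree q then (D : ℝ) ^ q.primeFactors.card / q else 0
    with hf_def
  have hf : ∀ q, 0 ≤ f q := fun q => by simp only [hf_def]; split_ifs <;> positivity
  have hmul : ∀ m, f (g * m) ≤ (D : ℝ) ^ g.primeFactors.card / g * f m := fun m => by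
    by_cases h : Squarefree (g * m)
    · have hco := Nat.coprime_of_squarefree_mul h
      have hm := h.of_mul_right
      simp only [hf_def, h, hm, if_true]
      rw [hco.primeFactors_mul, card_union_of_disjoint hco.disjoint_primeFactors, pow_add]
      push_cast
      rw [div_mul_div_comm]
    · simp only [hf_def, h, if_false]
      have := hf m
      simp only [hf_def] at this
      positivity
  calc ∑ q ∈ (Icc 1 N).filter (fun q => Squarefree q ∧ r ∣ q * W),
        κ ^ q.primeFactors.card / (q * W).totient
      ≤ ∑ q ∈ (Icc 1 N).filter (fun q => Squarefree q ∧ r ∣ q * W), f q := by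
        refine sum_le_sum fun q hq => ?_
        rw [mem_filter, mem_Icc] at hq
        simp only [hf_def, hq.2.1, if_true]
        have hq0 : (0 : ℝ) < q := by exact_mod_cast hq.1.1
        have ht : 0 < (q * W).totient := Nat.totient_pos.2 (Nat.mul_pos hq.1.1 hW)
        have ht' : (0 : ℝ) < (q * W).totient := by exact_mod_cast ht
        have hle : (q : ℝ) ≤ 2 ^ q.primeFactors.card * (q * W).totient := by
          have h1 := hq.2.1.le_two_pow_mul_totient
          have h2 : q.totient ≤ (q * W).totient :=
            Nat.le_of_dvd ht (Nat.totient_dvd_of_dvd (dvd_mul_right _ _))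
          exact_mod_cast h1.trans (Nat.mul_le_mul_left _ h2)
        rw [div_le_div_iff₀ ht' hq0]
        calc κ ^ q.primeFactors.card * q
            ≤ κ ^ q.primeFactors.card * (2 ^ q.primeFactors.card * (q * W).totient) := by gcongr
          _ = (2 * κ) ^ q.primeFactors.card * (q * W).totient := by rw [mul_pow]; ring
          _ ≤ _ := by gcongr
    _ ≤ ∑ q ∈ (Icc 1 N).filter (g ∣ ·), f q := by
        refine sum_le_sum_of_subset_of_nonneg (fun q hq => ?_) fun q _ _ => hf q
        rw [mem_filter] at hq ⊢
        exact ⟨hq.1, hdvd q hq.2.2⟩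
    _ ≤ ∑ m ∈ Icc 1 N, f (g * m) := sum_filter_dvd_le hf hg N
    _ ≤ ∑ m ∈ Icc 1 N, (D : ℝ) ^ g.primeFactors.card / g * f m := sum_le_sum fun m _ => hmul m
    _ = (D : ℝ) ^ g.primeFactors.card / g *
          ∑ m ∈ (Icc 1 N).filter Squarefree, (D : ℝ) ^ m.primeFactors.card / m := by
        rw [← mul_sum, sum_filter]
    _ ≤ ((D : ℝ) ^ D ^ 2 * Real.sqrt W / Real.sqrt r) * (1 + Real.log N) ^ D := by
        have hg0 : (0 : ℝ) < g := by exact_mod_cast hg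
        gcongr ?_ * ?_
        · have hs : Real.sqrt r ≤ Real.sqrt g * Real.sqrt W := by
            rw [← Real.sqrt_mul hg0.le]
            exact Real.sqrt_le_sqrt (by exact_mod_cast hrgW)
          have hr0 : 0 < Real.sqrt r := Real.sqrt_pos.2 (by exact_mod_cast hr)
          rw [div_le_div_iff₀ hg0 hr0]
          calc (D : ℝ) ^ g.primeFactors.card * Real.sqrt r
              ≤ ((D : ℝ) ^ D ^ 2 * Real.sqrt g) * (Real.sqrt g * Real.sqrt W) := by
                gcongr
                exact pow_card_primeFactors_le_mul_sqrt hD hg.ne'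
            _ = (D : ℝ) ^ D ^ 2 * Real.sqrt W * (Real.sqrt g * Real.sqrt g) := by ring
            _ = _ := by rw [Real.mul_self_sqrt hg0.le]
        · exact sum_squarefree_pow_card_div_le D N

end DivisorSums

section PrimeWeights

open Finset Filter Topology MeasureTheory
open scoped ContDiff

/-- A smooth bump function supported on `[-1, 1]` and equal to `1` on `[-1/2, 1/2]`. -/
noncomputable def logBump : ContDiffBump (0 : ℝ) := ⟨1 / 2, 1, by norm_num, by norm_num⟩

theorem logBump_eq_zero {u : ℝ} (hu : 1 < |u|) : logBump u = 0 :=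
  logBump.zero_of_le_dist (by rw [Real.dist_eq, sub_zero]; exact hu.le)

theorem logBump_eq_one {u : ℝ} (hu : |u| ≤ 1 / 2) : logBump u = 1 :=
  logBump.one_of_mem_closedBall (by rw [Metric.mem_closedBall, Real.dist_eq, sub_zero]; exact hu)

theorem contDiff_ofReal_logBump : ContDiff ℝ ∞ fun u => ((logBump u : ℝ) : ℂ) :=
  Complex.ofRealCLM.contDiff.comp logBump.contDiff

theorem hasCompactSupport_ofReal_logBump : HasCompactSupport fun u => ((logBump u : ℝ) : ℂ) :=
  logBump.hasCompactSupport.comp_left Complex.ofReal_zero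

theorem exists_isCutoff_logBump : ∃ A, IsCutoff (fun u => ((logBump u : ℝ) : ℂ)) A := by
  obtain ⟨B, hB⟩ := hasCompactSupport_ofReal_logBump.deriv.exists_bound_of_continuous
    (contDiff_ofReal_logBump.continuous_deriv (by simp))
  refine ⟨max 1 B, contDiff_ofReal_logBump.differentiable (by simp), fun u => ?_,
    fun u => (hB u).trans (le_max_right _ _), fun u hu => by rw [logBump_eq_zero hu]; simp⟩
  rw [Complex.norm_of_nonneg logBump.nonneg]
  exact logBump.le_one.trans (le_max_left _ _)

/-- A smooth weight on the integers within a bounded factor of `N`. -/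
noncomputable def smoothWeight (j N n : ℕ) : ℝ :=
  ((N : ℝ) / n) ^ (1 + 1 / Real.log N) * (Real.log n / Real.log N) ^ j *
    logBump (Real.log n - Real.log N)

/-- A weight on the primes within a bounded factor of `N`. -/
noncomputable def primeWeight (j N n : ℕ) : ℝ :=
  if n.Prime then Real.exp (-3) * (Real.log n * smoothWeight j N n) else 0

section

variable {j N : ℕ}

theorem abs_log_sub_log_le_of_smoothWeight_ne_zero {n : ℕ} (h : smoothWeight j N n ≠ 0) :
    |Real.log n - Real.log N| ≤ 1 := by
  by_contra! h1
  exact h (by rw [smoothWeight, logBump_eq_zero h1, mul_zero])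

theorem smoothWeight_nonneg (j N n : ℕ) : 0 ≤ smoothWeight j N n := by
  have := logBump.nonneg (x := Real.log n - Real.log N)
  unfold smoothWeight
  positivity

theorem smoothWeight_zero (hN : 2 ≤ Real.log N) : smoothWeight j N 0 = 0 := by
  rw [smoothWeight, logBump_eq_zero, mul_zero]
  rw [Nat.cast_zero, Real.log_zero, zero_sub, abs_neg, abs_of_nonneg (by linarith)]
  linarith

theorem pos_of_two_le_log (hN : 2 ≤ Real.log N) : 0 < N := by
  refine Nat.pos_of_ne_zero fun h => ?_
  simp [h] at hN
  linarith

theorem smoothWeight_le (hN : 2 ≤ Real.log N) (hj : (j : ℝ) ≤ Real.log N) (n : ℕ) :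
    smoothWeight j N n ≤ Real.exp 3 := by
  by_cases h : smoothWeight j N n = 0
  · rw [h]; positivity
  have hn : 0 < n := Nat.pos_of_ne_zero fun hn => h (by rw [hn, smoothWeight_zero hN])
  have hn0 : (0 : ℝ) < n := by exact_mod_cast hn
  have hN0 : (0 : ℝ) < N := by exact_mod_cast pos_of_two_le_log hN
  have hab := abs_le.1 (abs_log_sub_log_le_of_smoothWeight_ne_zero h)
  have h1 : ((N : ℝ) / n) ^ (1 + 1 / Real.log N) ≤ Real.exp (3 / 2) := by
    rw [Real.rpow_def_of_pos (by positivity), Real.exp_le_exp, Real.log_div hN0.ne' hn0.ne']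
    have h2 : 1 / Real.log N ≤ 1 / 2 := one_div_le_one_div_of_le two_pos hN
    have h3 : 0 < 1 / Real.log N := by positivity
    nlinarith
  have h2 : (Real.log n / Real.log N) ^ j ≤ Real.exp 1 := by
    calc (Real.log n / Real.log N) ^ j ≤ Real.exp (1 / Real.log N) ^ j := by
          refine pow_le_pow_left₀ (by positivity) ?_ _
          refine le_trans ?_ (Real.add_one_le_exp _)
          rw [div_le_iff₀ (by linarith), add_mul, one_div_mul_cancel (by linarith)]
          linarith
      _ = Real.exp (j * (1 / Real.log N)) := (Real.exp_nat_mul _ _).symm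
      _ ≤ _ := by
          rw [Real.exp_le_exp, mul_one_div, div_le_one (by linarith)]
          exact hj
  calc smoothWeight j N n ≤ Real.exp (3 / 2) * Real.exp 1 * 1 := by
        unfold smoothWeight
        gcongr
        · exact logBump.nonneg
        · exact logBump.le_one
    _ ≤ Real.exp 3 := by
        rw [mul_one, ← Real.exp_add, Real.exp_le_exp]; norm_num

theorem primeWeight_nonneg (j N n : ℕ) : 0 ≤ primeWeight j N n := by
  have := smoothWeight_nonneg j N n
  unfold primeWeight
  split_ifs <;> positivity

theorem prime_of_primeWeight_ne_zero {n : ℕ} (h : primeWeight j N n ≠ 0) : n.Prime := by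
  by_contra h1
  exact h (if_neg h1)

theorem abs_log_sub_log_le_of_primeWeight_ne_zero {n : ℕ} (h : primeWeight j N n ≠ 0) :
    |Real.log n - Real.log N| ≤ 1 := by
  refine abs_log_sub_log_le_of_smoothWeight_ne_zero (j := j) fun h1 => h ?_
  unfold primeWeight
  rw [h1]
  simp

theorem le_three_mul_of_abs_log_sub_log_le {a b : ℕ} (ha : 0 < a) (hb : 0 < b)
    (h : |Real.log a - Real.log b| ≤ 1) : a ≤ 3 * b := by
  have ha0 : (0 : ℝ) < a := by exact_mod_cast ha
  have hb0 : (0 : ℝ) < b := by exact_mod_cast hb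
  have h1 : (a : ℝ) ≤ Real.exp 1 * b := by
    rw [← Real.log_le_log_iff ha0 (by positivity), Real.log_mul (by positivity) hb0.ne',
      Real.log_exp]
    linarith [(abs_le.1 h).2]
  have := Real.exp_one_lt_three
  have h2 : (a : ℝ) ≤ 3 * b := by nlinarith
  exact_mod_cast h2

theorem le_three_mul_of_primeWeight_ne_zero (hN : 0 < N) {n : ℕ} (h : primeWeight j N n ≠ 0) :
    n ≤ 3 * N :=
  le_three_mul_of_abs_log_sub_log_le (prime_of_primeWeight_ne_zero h).pos hN
    (abs_log_sub_log_le_of_primeWeight_ne_zero h)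

theorem le_three_mul_of_primeWeight_ne_zero' (hN : 0 < N) {n : ℕ} (h : primeWeight j N n ≠ 0) :
    N ≤ 3 * n :=
  le_three_mul_of_abs_log_sub_log_le hN (prime_of_primeWeight_ne_zero h).pos
    (by rw [abs_sub_comm]; exact abs_log_sub_log_le_of_primeWeight_ne_zero h)

theorem primeWeight_le_log (hN : 2 ≤ Real.log N) (hj : (j : ℝ) ≤ Real.log N) (n : ℕ) :
    primeWeight j N n ≤ Real.log (3 * N) := by
  have hN0 := pos_of_two_le_log hN
  have hN1 : (1 : ℝ) ≤ N := by exact_mod_cast hN0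
  by_cases h : primeWeight j N n = 0
  · rw [h]; exact Real.log_nonneg (by linarith)
  have hp := prime_of_primeWeight_ne_zero h
  have hn0 : (0 : ℝ) < n := by exact_mod_cast hp.pos
  have hle : (n : ℝ) ≤ 3 * N := by exact_mod_cast le_three_mul_of_primeWeight_ne_zero hN0 h
  have hlog : 0 ≤ Real.log n := Real.log_natCast_nonneg n
  rw [primeWeight, if_pos hp]
  calc Real.exp (-3) * (Real.log n * smoothWeight j N n)
      ≤ Real.exp (-3) * (Real.log n * Real.exp 3) := by gcongr; exact smoothWeight_le hN hj n
    _ = Real.log n := by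
        rw [mul_left_comm, ← Real.exp_add]; simp
    _ ≤ _ := Real.log_le_log hn0 hle

end

theorem term_logMul_mul_logBump_eq {j N : ℕ} (hN : 2 ≤ Real.log N) (f : ℕ → ℂ) (n : ℕ) :
    f n * (smoothWeight j N n : ℂ) = ((Real.exp 1 * N * (Real.log N)⁻¹ ^ j : ℝ) : ℂ) *
      (LSeries.term (LSeries.logMul^[j] f) (1 + 1 / Real.log N : ℝ) n *
        (logBump (Real.log n - Real.log N) : ℂ)) := by
  rcases Nat.eq_zero_or_pos n with rfl | hn
  · rw [smoothWeight_zero hN]; simp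
  have hN0 : (0 : ℝ) < N := by exact_mod_cast pos_of_two_le_log hN
  have hpow : (N : ℝ) ^ (1 + 1 / Real.log N) = Real.exp 1 * N := by
    rw [Real.rpow_def_of_pos hN0, mul_add, mul_one, mul_one_div_cancel (by linarith),
      Real.exp_add, Real.exp_log hN0, mul_comm]
  rw [term_logMul_iterate, term_ofReal_eq _ hn.ne', smoothWeight,
    Real.div_rpow hN0.le (by positivity), hpow, Real.rpow_neg (by positivity), div_pow]
  push_cast
  ring

theorem norm_sum_vonMangoldt_mul_smoothWeight_le {j N : ℕ} (hN : 2 ≤ Real.log N) (f : ℕ → ℂ) :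
    ‖∑ n ∈ range (3 * N + 1), f n * (ArithmeticFunction.vonMangoldt n : ℂ) *
        (smoothWeight j N n : ℂ)‖ =
      Real.exp 1 * N * (Real.log N)⁻¹ ^ j *
        ‖∑' n : ℕ, LSeries.term (LSeries.logMul^[j] fun n => f n *
          (ArithmeticFunction.vonMangoldt n : ℂ)) (1 + 1 / Real.log N : ℝ) n *
            (logBump (Real.log n - Real.log N) : ℂ)‖ := by
  rw [tsum_eq_sum (s := range (3 * N + 1)), sum_congr rfl fun n _ =>
    term_logMul_mul_logBump_eq hN (fun n => f n * (ArithmeticFunction.vonMangoldt n : ℂ)) n,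
    ← mul_sum, norm_mul, Complex.norm_of_nonneg (by positivity)]
  intro n hn
  rw [mem_range, not_lt] at hn
  rw [logBump_eq_zero, Complex.ofReal_zero, mul_zero]
  by_contra! h
  have := le_three_mul_of_abs_log_sub_log_le (by omega) (pos_of_two_le_log hN) h
  omega

theorem norm_sum_mul_primeWeight_le {j N : ℕ} (hN : 2 ≤ Real.log N) (hj : (j : ℝ) ≤ Real.log N)
    {f : ℕ → ℂ} (hf : ∀ n, ‖f n‖ ≤ 1) :
    ‖∑ n ∈ range (3 * N + 1), f n * (primeWeight j N n : ℂ)‖ ≤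
      N * (Real.log N)⁻¹ ^ j *
        ‖∑' n : ℕ, LSeries.term (LSeries.logMul^[j] fun n => f n *
          (ArithmeticFunction.vonMangoldt n : ℂ)) (1 + 1 / Real.log N : ℝ) n *
            (logBump (Real.log n - Real.log N) : ℂ)‖ +
        2 * Real.sqrt (3 * N) * Real.log (3 * N) := by
  have hN1 : (1 : ℝ) ≤ N := by exact_mod_cast pos_of_two_le_log hN
  have hsplit : ∑ n ∈ range (3 * N + 1), f n * (primeWeight j N n : ℂ) =
      (Real.exp (-3) : ℂ) * ∑ n ∈ range (3 * N + 1), f n *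
        (ArithmeticFunction.vonMangoldt n : ℂ) * (smoothWeight j N n : ℂ) -
      ∑ n ∈ (range (3 * N + 1)).filter (fun n => ¬ n.Prime), (Real.exp (-3) : ℂ) * (f n *
        (ArithmeticFunction.vonMangoldt n : ℂ) * (smoothWeight j N n : ℂ)) := by
    rw [mul_sum, eq_sub_iff_add_eq, sum_filter, ← sum_add_distrib]
    refine sum_congr rfl fun n _ => ?_
    unfold primeWeight
    by_cases h : n.Prime
    · simp only [h, if_true, not_true_eq_false, if_false, add_zero,
        ArithmeticFunction.vonMangoldt_apply_prime h]
      push_cast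
      ring
    · simp [h]
  have hpp : ∑ n ∈ (range (3 * N + 1)).filter (fun n => ¬ n.Prime),
      ArithmeticFunction.vonMangoldt n ≤ 2 * Real.sqrt (3 * N) * Real.log (3 * N) := by
    have h1 := Chebyshev.psi_sub_theta_le (x := ((3 * N : ℕ) : ℝ)) (by push_cast; linarith)
    rw [Chebyshev.psi_sub_theta_eq_sum_not_prime, Nat.floor_natCast] at h1
    push_cast at h1
    refine le_trans (le_of_eq ?_) h1
    refine (sum_subset (fun n hn => ?_) fun n hn hn2 => ?_).symm
    · simp only [mem_filter, mem_Ioc, mem_range] at hn ⊢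
      exact ⟨by omega, hn.2⟩
    · simp only [mem_filter, mem_Ioc, mem_range, not_and] at hn hn2
      have : n = 0 := by
        by_contra h0
        exact hn2 ⟨by omega, by omega⟩ hn.2
      simp [this]
  rw [hsplit]
  refine (norm_sub_le _ _).trans (add_le_add ?_ ?_)
  · rw [norm_mul, norm_sum_vonMangoldt_mul_smoothWeight_le hN, ← mul_assoc]
    gcongr ?_ * _
    rw [Complex.norm_of_nonneg (Real.exp_pos _).le, ← mul_assoc, ← mul_assoc, ← Real.exp_add]
    gcongr
    exact mul_le_of_le_one_left (by positivity) (Real.exp_le_one_iff.2 (by norm_num))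
  · refine (norm_sum_le _ _).trans (le_trans (sum_le_sum fun n _ => ?_) hpp)
    have h1 := ArithmeticFunction.vonMangoldt_nonneg (n := n)
    rw [norm_mul, norm_mul, norm_mul, Complex.norm_of_nonneg h1,
      Complex.norm_of_nonneg (smoothWeight_nonneg j N n), Complex.norm_of_nonneg (Real.exp_pos _).le]
    calc Real.exp (-3) * (‖f n‖ * ArithmeticFunction.vonMangoldt n * smoothWeight j N n)
        ≤ Real.exp (-3) * (1 * ArithmeticFunction.vonMangoldt n * Real.exp 3) := by
          gcongr
          · exact smoothWeight_nonneg j N n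
          · exact hf n
          · exact smoothWeight_le hN hj n
      _ = _ := by
          rw [mul_left_comm, one_mul, ← Real.exp_add]; simp

theorem exp_mul_log_le_primeWeight {j N n : ℕ} (hN : 2 ≤ Real.log N) (hj : (j : ℝ) ≤ Real.log N)
    (hn : n.Prime) (h1 : 0.62 * (N : ℝ) < n) (h2 : (n : ℝ) ≤ 1.6 * N) :
    Real.exp (-4) / 2 * Real.log n ≤ primeWeight j N n := by
  have hn0 : (0 : ℝ) < n := by exact_mod_cast hn.pos
  have hN0 : (0 : ℝ) < N := by exact_mod_cast pos_of_two_le_log hN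
  have hlog : 0 ≤ Real.log n := Real.log_natCast_nonneg n
  have hexp : (1.6 : ℝ) ≤ Real.exp (1 / 2) ∧ Real.exp (-(1 / 2)) ≤ 0.62 := by
    have h := Real.quadratic_le_exp_of_nonneg (x := 1 / 2) (by norm_num)
    have h5 : (1.62 : ℝ) ≤ Real.exp (1 / 2) := by linarith
    refine ⟨by linarith, ?_⟩
    rw [Real.exp_neg]
    refine (inv_anti₀ (by norm_num) h5).trans (by norm_num)
  have hu : Real.log n - Real.log N ≤ 1 / 2 := by
    rw [sub_le_iff_le_add, Real.log_le_iff_le_exp hn0, Real.exp_add, Real.exp_log hN0]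
    exact h2.trans (by gcongr; exact hexp.1)
  have hl : -(1 / 2) ≤ Real.log n - Real.log N := by
    rw [le_sub_iff_add_le, Real.le_log_iff_exp_le hn0, Real.exp_add, Real.exp_log hN0]
    exact (mul_le_mul_of_nonneg_right hexp.2 hN0.le).trans h1.le
  have hb : logBump (Real.log n - Real.log N) = 1 := logBump_eq_one (abs_le.2 ⟨hl, hu⟩)
  have hpow : Real.exp (-1) ≤ ((N : ℝ) / n) ^ (1 + 1 / Real.log N) := by
    rw [Real.rpow_def_of_pos (by positivity), Real.exp_le_exp, Real.log_div hN0.ne' hn0.ne']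
    have h2 : 1 / Real.log N ≤ 1 / 2 := one_div_le_one_div_of_le two_pos hN
    have h3 : 0 < 1 / Real.log N := by positivity
    nlinarith
  have hj2 : 1 / 2 ≤ (Real.log n / Real.log N) ^ j := by
    have hd : (1 : ℝ) / Real.log N ≤ 1 / 2 := one_div_le_one_div_of_le two_pos hN
    have hinv : (j : ℝ) * (1 / Real.log N) ≤ 1 := by
      rw [mul_one_div, div_le_one (by linarith)]; exact hj
    calc (1 : ℝ) / 2 ≤ 1 + j * (-(1 / 2 * (1 / Real.log N))) := by linarith
      _ ≤ (1 + -(1 / 2 * (1 / Real.log N))) ^ j := one_add_mul_le_pow (by linarith) j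
      _ ≤ _ := by
          refine pow_le_pow_left₀ (by linarith) ?_ _
          rw [le_div_iff₀ (by linarith), add_mul, neg_mul, mul_assoc,
            one_div_mul_cancel (by linarith)]
          linarith
  rw [primeWeight, if_pos hn, smoothWeight, hb, mul_one]
  calc Real.exp (-4) / 2 * Real.log n
      = Real.exp (-3) * (Real.log n * (Real.exp (-1) * (1 / 2))) := by
        rw [show (-4 : ℝ) = -3 + -1 by norm_num, Real.exp_add]; ring
    _ ≤ _ := by gcongr

theorem exists_forall_mul_le_theta_sub_theta :
    ∃ N₀ : ℕ, ∀ N : ℕ, N₀ ≤ N →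
      (N : ℝ) / 10 ≤ Chebyshev.theta (1.6 * N) - Chebyshev.theta (0.62 * N) := by
  have h1 : Tendsto (fun x : ℝ => Real.sqrt x * Real.log x / x) atTop (𝓝 0) := by
    have h := (isLittleO_log_rpow_atTop (r := 1 / 2) (by norm_num)).tendsto_div_nhds_zero
    refine h.congr' ?_
    filter_upwards [eventually_gt_atTop 0] with x hx
    rw [Real.sqrt_eq_rpow, div_eq_div_iff (by positivity) (by positivity)]
    have : x ^ (1 / 2 : ℝ) * x ^ (1 / 2 : ℝ) = x := by
      rw [← Real.rpow_add hx]; norm_num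
    linear_combination (-Real.log x) * this
  have h2 := (h1.const_mul 100)
  rw [mul_zero] at h2
  have h3 : Tendsto (fun N : ℕ => (1.6 : ℝ) * N) atTop atTop :=
    tendsto_natCast_atTop_atTop.const_mul_atTop (by norm_num)
  have h4 := h3.eventually (h2.eventually (gt_mem_nhds (zero_lt_one)))
  obtain ⟨N₀, hN₀⟩ := eventually_atTop.1 (h4.and (eventually_ge_atTop 100))
  refine ⟨N₀, fun N hN => ?_⟩
  obtain ⟨h5, h6⟩ := hN₀ N hN
  have h6' : (100 : ℝ) ≤ N := by exact_mod_cast h6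
  rw [← mul_div_assoc, div_lt_one (by linarith)] at h5
  have hx : (1 : ℝ) ≤ 1.6 * N := by linarith
  have ha := Chebyshev.theta_ge' hx
  have hb := Chebyshev.theta_le_log4_mul_x (x := 0.62 * N) (by positivity)
  have hl4 : Real.log 4 = 2 * Real.log 2 := by
    rw [show (4 : ℝ) = 2 ^ 2 by norm_num, Real.log_pow]; norm_num
  rw [hl4] at hb
  have hlog2 := Real.log_two_gt_d9
  have hlog2' := Real.log_two_lt_d9
  have hs : 1 ≤ Real.sqrt (1.6 * N) := Real.one_le_sqrt.2 hx
  have hl : 0 ≤ Real.log (1.6 * N) := Real.log_nonneg hx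
  have hc : Real.log (1.6 * N + 2) ≤ 2 * Real.log (1.6 * N) := by
    rw [← Real.log_rpow (by linarith)]
    refine Real.log_le_log (by linarith) ?_
    norm_cast
    nlinarith
  have hsl : Real.log (1.6 * N) ≤ Real.sqrt (1.6 * N) * Real.log (1.6 * N) :=
    le_mul_of_one_le_left hl hs
  nlinarith

theorem exists_forall_mul_le_sum_primeWeight (j : ℕ) :
    ∃ N₀ : ℕ, ∀ N : ℕ, N₀ ≤ N →
      Real.exp (-4) / 20 * N ≤ ∑ n ∈ range (3 * N + 1), primeWeight j N n := by
  obtain ⟨N₁, hN₁⟩ := exists_forall_mul_le_theta_sub_theta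
  have hlog : Tendsto (fun N : ℕ => Real.log N) atTop atTop :=
    Real.tendsto_log_atTop.comp tendsto_natCast_atTop_atTop
  obtain ⟨N₂, hN₂⟩ := eventually_atTop.1
    ((hlog.eventually_ge_atTop 2).and (hlog.eventually_ge_atTop j))
  refine ⟨max N₁ N₂, fun N hN => ?_⟩
  obtain ⟨h2, hj⟩ := hN₂ N ((le_max_right _ _).trans hN)
  have hth := hN₁ N ((le_max_left _ _).trans hN)
  have hN0 : (0 : ℝ) ≤ N := by positivity
  have hfl : ⌊0.62 * (N : ℝ)⌋₊ ≤ ⌊1.6 * (N : ℝ)⌋₊ := Nat.floor_mono (by linarith)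
  have hdiff : Chebyshev.theta (1.6 * N) - Chebyshev.theta (0.62 * N) =
      ∑ p ∈ (Ioc ⌊0.62 * (N : ℝ)⌋₊ ⌊1.6 * (N : ℝ)⌋₊).filter Nat.Prime, Real.log p := by
    rw [Chebyshev.theta, Chebyshev.theta, sub_eq_iff_eq_add, sum_filter, sum_filter, sum_filter,
      ← sum_union]
    · congr 1
      ext n
      simp only [mem_union, mem_Ioc]
      omega
    · rw [disjoint_left]
      intro n
      simp only [mem_Ioc]
      omega
  calc Real.exp (-4) / 20 * N = Real.exp (-4) / 2 * (N / 10) := by ring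
    _ ≤ Real.exp (-4) / 2 *
        ∑ p ∈ (Ioc ⌊0.62 * (N : ℝ)⌋₊ ⌊1.6 * (N : ℝ)⌋₊).filter Nat.Prime, Real.log p := by
        rw [← hdiff]; gcongr
    _ ≤ ∑ p ∈ (Ioc ⌊0.62 * (N : ℝ)⌋₊ ⌊1.6 * (N : ℝ)⌋₊).filter Nat.Prime, primeWeight j N p := by
        rw [mul_sum]
        refine sum_le_sum fun p hp => ?_
        rw [mem_filter, mem_Ioc] at hp
        exact exp_mul_log_le_primeWeight h2 hj hp.2
          ((Nat.floor_lt (by positivity)).1 hp.1.1) ((Nat.le_floor_iff (by positivity)).1 hp.1.2)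
    _ ≤ _ := by
        refine sum_le_sum_of_subset_of_nonneg (fun p hp => ?_) fun n _ _ => primeWeight_nonneg j N n
        rw [mem_filter, mem_Ioc] at hp
        have h3 := (Nat.le_floor_iff (by positivity)).1 hp.1.2
        have h4 : (p : ℝ) ≤ 3 * N := by linarith
        rw [mem_range, Nat.lt_succ_iff]
        exact_mod_cast h4

end PrimeWeights

section CharacterDecomposition

open Finset Filter Topology MeasureTheory

section

open scoped Classical in
/-- The nontrivial primitive Dirichlet characters of conductor at most `R`. -/
noncomputable def primitiveCharacters (R : ℕ) : Finset (Σ n, DirichletCharacter ℂ n) :=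
  ((range R).biUnion fun n => (univ : Finset (DirichletCharacter ℂ (n + 1))).image
    fun χ => (⟨n + 1, χ⟩ : Σ n, DirichletCharacter ℂ n)).filter
      fun p => p.2.IsPrimitive ∧ p.2 ≠ 1

theorem mem_primitiveCharacters {R : ℕ} {p : Σ n, DirichletCharacter ℂ n} :
    p ∈ primitiveCharacters R ↔ p.1 ≠ 0 ∧ p.1 ≤ R ∧ p.2.IsPrimitive ∧ p.2 ≠ 1 := by
  classical
  obtain ⟨n, χ⟩ := p
  simp only [primitiveCharacters, mem_filter, mem_biUnion, mem_range, mem_image, mem_univ, true_and]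
  constructor
  · rintro ⟨⟨m, hm, ψ, h⟩, h1, h2⟩
    have : m + 1 = n := congrArg Sigma.fst h
    exact ⟨by omega, by omega, h1, h2⟩
  · rintro ⟨h0, hR, h1, h2⟩
    refine ⟨⟨n - 1, by omega, ?_⟩, h1, h2⟩
    obtain ⟨m, rfl⟩ := Nat.exists_eq_succ_of_ne_zero h0
    exact ⟨χ, rfl⟩

theorem card_primitiveCharacters_le (R : ℕ) : (primitiveCharacters R).card ≤ R ^ 2 := by
  classical
  calc (primitiveCharacters R).card ≤ (range R).card * R := by
        refine (card_filter_le _ _).trans (card_biUnion_le_card_mul _ _ _ fun n hn => ?_)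
        refine card_image_le.trans ?_
        rw [card_univ, ← Nat.card_eq_fintype_card,
          DirichletCharacter.card_eq_totient_of_hasEnoughRootsOfUnity]
        exact (Nat.totient_le _).trans (mem_range.1 hn)
    _ = R ^ 2 := by rw [card_range, sq]

variable {s : Finset ℕ} {w : ℕ → ℝ} {M : ℕ}

theorem sum_residue_eq_inv_totient_mul_sum [NeZero M] {a : ℕ}
    (ha : a.Coprime M) :
    ((∑ l ∈ s, (if l ≡ a [MOD M] then w l else 0) : ℝ) : ℂ) =
      (M.totient : ℂ)⁻¹ * ∑ χ : DirichletCharacter ℂ M, χ (a : ZMod M)⁻¹ * ∑ l ∈ s, χ l * (w l : ℂ) := by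
  have hM : (M.totient : ℂ) ≠ 0 := by
    have := (Nat.totient_pos.2 (Nat.pos_of_ne_zero (NeZero.ne M))).ne'
    exact_mod_cast this
  have hu : IsUnit (a : ZMod M) := (ZMod.isUnit_iff_coprime a M).2 ha
  rw [eq_inv_mul_iff_mul_eq₀ hM]
  push_cast
  simp only [mul_sum, ← mul_assoc]
  rw [sum_comm]
  refine sum_congr rfl fun l _ => ?_
  rw [← sum_mul, DirichletCharacter.sum_char_inv_mul_char_eq ℂ hu]
  have : ((a : ZMod M) = l) ↔ l ≡ a [MOD M] := by
    rw [ZMod.natCast_eq_natCast_iff]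
    exact ⟨Nat.ModEq.symm, Nat.ModEq.symm⟩
  simp only [this]
  split_ifs <;> simp

theorem sum_primitiveCharacter_mul_eq (hco : ∀ l, w l ≠ 0 → l.Coprime M)
    (χ : DirichletCharacter ℂ M) :
    ∑ l ∈ s, χ.primitiveCharacter l * (w l : ℂ) = ∑ l ∈ s, χ l * (w l : ℂ) := by
  refine sum_congr rfl fun l _ => ?_
  by_cases h : w l = 0
  · simp [h]
  · have := χ.primitiveCharacter_apply_of_isCoprime (a := (l : ℤ))
      (Nat.isCoprime_iff_coprime.2 (hco l h))
    simp only [Int.cast_natCast] at this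
    rw [this]

/-- The primitive character inducing `χ`, bundled with its conductor. -/
noncomputable def primitiveSigma (χ : DirichletCharacter ℂ M) : Σ n, DirichletCharacter ℂ n :=
  ⟨χ.conductor, χ.primitiveCharacter⟩

theorem primitiveSigma_injective (M : ℕ) :
    Function.Injective (primitiveSigma : DirichletCharacter ℂ M → _) := by
  intro χ ψ h
  have key : ∀ (p : Σ n, DirichletCharacter ℂ n) (hp : p.1 ∣ M) (χ : DirichletCharacter ℂ M),
      primitiveSigma χ = p → χ = DirichletCharacter.changeLevel hp p.2 := by
    rintro p hp χ rfl
    exact χ.changeLevel_primitiveCharacter.symm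
  have h1 := key (primitiveSigma ψ) ψ.conductor_dvd_level χ h
  have h2 := key (primitiveSigma ψ) ψ.conductor_dvd_level ψ rfl
  exact h1.trans h2.symm

theorem sum_norm_sum_character_le [NeZero M] {R : ℕ} (hMR : M ≤ R)
    (hco : ∀ l, w l ≠ 0 → l.Coprime M) :
    ∑ χ ∈ (univ : Finset (DirichletCharacter ℂ M)).erase 1, ‖∑ l ∈ s, χ l * (w l : ℂ)‖ ≤
      ∑ p ∈ (primitiveCharacters R).filter (fun p => p.1 ∣ M), ‖∑ l ∈ s, p.2 l * (w l : ℂ)‖ := by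
  classical
  set F : (Σ n, DirichletCharacter ℂ n) → ℝ := fun p => ‖∑ l ∈ s, p.2 l * (w l : ℂ)‖ with hF
  have h1 : ∀ χ : DirichletCharacter ℂ M, ‖∑ l ∈ s, χ l * (w l : ℂ)‖ = F (primitiveSigma χ) :=
    fun χ => congrArg norm (sum_primitiveCharacter_mul_eq hco χ).symm
  rw [sum_congr rfl fun χ _ => h1 χ,
    ← sum_image (f := F) fun χ _ ψ _ h => primitiveSigma_injective M h]
  refine sum_le_sum_of_subset_of_nonneg (fun p hp => ?_) fun _ _ _ => norm_nonneg _
  obtain ⟨χ, hχ, rfl⟩ := mem_image.1 hp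
  rw [mem_filter, mem_primitiveCharacters]
  have hdvd : (primitiveSigma χ).1 ∣ M := χ.conductor_dvd_level
  have hne : (primitiveSigma χ).1 ≠ 0 := χ.conductor_ne_zero
  refine ⟨⟨hne, (Nat.le_of_dvd (Nat.pos_of_ne_zero (NeZero.ne M)) hdvd).trans hMR,
    χ.primitiveCharacter_isPrimitive, fun h => (mem_erase.1 hχ).1 ?_⟩, hdvd⟩
  have h2 : DirichletCharacter.changeLevel hdvd (primitiveSigma χ).2 = χ :=
    χ.changeLevel_primitiveCharacter
  rw [← h2, h, map_one]

theorem abs_sum_residue_sub_le [NeZero M] {R : ℕ} (hMR : M ≤ R)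
    (hco : ∀ l, w l ≠ 0 → l.Coprime M) {a : ℕ} (ha : a.Coprime M) :
    |∑ l ∈ s, (if l ≡ a [MOD M] then w l else 0) - (∑ l ∈ s, w l) / M.totient| ≤
      (∑ p ∈ (primitiveCharacters R).filter (fun p => p.1 ∣ M), ‖∑ l ∈ s, p.2 l * (w l : ℂ)‖) /
        M.totient := by
  have hu : IsUnit (a : ZMod M) := (ZMod.isUnit_iff_coprime a M).2 ha
  have hu' : IsUnit ((a : ZMod M)⁻¹) := by
    obtain ⟨u, hu⟩ := hu
    rw [← hu, ZMod.inv_coe_unit]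
    exact Units.isUnit _
  have hone : ∑ l ∈ s, (1 : DirichletCharacter ℂ M) l * (w l : ℂ) = ((∑ l ∈ s, w l : ℝ) : ℂ) := by
    push_cast
    refine sum_congr rfl fun l _ => ?_
    by_cases h : w l = 0
    · simp [h]
    · rw [MulChar.one_apply ((ZMod.isUnit_iff_coprime l M).2 (hco l h)), one_mul]
  have heq : (((∑ l ∈ s, (if l ≡ a [MOD M] then w l else 0)) -
      (∑ l ∈ s, w l) / M.totient : ℝ) : ℂ) = (M.totient : ℂ)⁻¹ *
        ∑ χ ∈ (univ : Finset (DirichletCharacter ℂ M)).erase 1,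
          χ (a : ZMod M)⁻¹ * ∑ l ∈ s, χ l * (w l : ℂ) := by
    rw [Complex.ofReal_sub, sum_residue_eq_inv_totient_mul_sum ha,
      ← add_sum_erase _ _ (mem_univ (1 : DirichletCharacter ℂ M)), hone, MulChar.one_apply hu']
    push_cast
    ring
  rw [← Real.norm_eq_abs, ← Complex.norm_real, heq, norm_mul, norm_inv, Complex.norm_natCast,
    div_eq_inv_mul]
  gcongr
  refine (norm_sum_le _ _).trans ((sum_le_sum fun χ _ => ?_).trans (sum_norm_sum_character_le hMR hco))
  rw [norm_mul]
  exact mul_le_of_le_one_left (norm_nonneg _) (χ.norm_le_one _)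

theorem sum_mul_sum_filter_dvd_div_totient_le {κ : ℝ} (hκ : 0 ≤ κ) {D W N : ℕ} (hD : 1 ≤ D)
    (hκD : 2 * κ ≤ D) (hW : 0 < W) {Q : Finset ℕ} (hQ : ∀ q ∈ Q, q ∈ Icc 1 N ∧ Squarefree q)
    {S : Finset (Σ n, DirichletCharacter ℂ n)} (hS : ∀ p ∈ S, p.1 ≠ 0)
    {F : (Σ n, DirichletCharacter ℂ n) → ℝ} (hF : ∀ p, 0 ≤ F p) :
    ∑ q ∈ Q, κ ^ q.primeFactors.card *
      ((∑ p ∈ S.filter (fun p => p.1 ∣ q * W), F p) / (q * W).totient) ≤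
      (D : ℝ) ^ D ^ 2 * Real.sqrt W * (1 + Real.log N) ^ D * ∑ p ∈ S, F p / Real.sqrt p.1 := by
  calc ∑ q ∈ Q, κ ^ q.primeFactors.card *
        ((∑ p ∈ S.filter (fun p => p.1 ∣ q * W), F p) / (q * W).totient)
      = ∑ p ∈ S, F p * ∑ q ∈ Q.filter (fun q => p.1 ∣ q * W),
          κ ^ q.primeFactors.card / (q * W).totient := by
        simp only [mul_sum, sum_div, sum_filter]
        rw [sum_comm]
        refine sum_congr rfl fun p _ => sum_congr rfl fun q _ => ?_
        split_ifs <;> ring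
    _ ≤ ∑ p ∈ S, F p * ((D : ℝ) ^ D ^ 2 * Real.sqrt W / Real.sqrt p.1 * (1 + Real.log N) ^ D) := by
        refine sum_le_sum fun p hp => mul_le_mul_of_nonneg_left ?_ (hF p)
        refine le_trans (sum_le_sum_of_subset_of_nonneg (fun q hq => ?_) fun _ _ _ => by positivity)
          (sum_pow_card_div_totient_le hκ hD hκD hW (Nat.pos_of_ne_zero (hS p hp)) N)
        rw [mem_filter] at hq ⊢
        exact ⟨(hQ q hq.1).1, (hQ q hq.1).2, hq.2⟩
    _ = _ := by
        rw [mul_sum]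
        exact sum_congr rfl fun p _ => by ring

end

end CharacterDecomposition

section ErrorTerms

open Finset Filter Topology MeasureTheory

theorem sum_primitiveCharacters_div_sqrt_le {R a : ℕ} {ℓ : ℝ} (hℓ : 1 ≤ ℓ)
    {τ : (Σ n, DirichletCharacter ℂ n) → ℝ} (hτ : ∀ p, 0 ≤ τ p) {G H : ℝ} (hG : 0 ≤ G)
    (small : ∀ p ∈ primitiveCharacters R, (p.1 : ℝ) ≤ ℓ ^ (2 * a) → τ p ≤ G)
    (large : ∑ p ∈ primitiveCharacters R, τ p ≤ H) :
    ∑ p ∈ primitiveCharacters R, τ p / Real.sqrt p.1 ≤ ℓ ^ (4 * a) * G + H / ℓ ^ a := by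
  classical
  rw [← sum_filter_add_sum_filter_not _ (fun p => (p.1 : ℝ) ≤ ℓ ^ (2 * a))]
  refine add_le_add ?_ ?_
  · calc ∑ p ∈ (primitiveCharacters R).filter (fun p => (p.1 : ℝ) ≤ ℓ ^ (2 * a)),
          τ p / Real.sqrt p.1
        ≤ ∑ p ∈ (primitiveCharacters R).filter (fun p => (p.1 : ℝ) ≤ ℓ ^ (2 * a)), G := by
          refine sum_le_sum fun p hp => ?_
          rw [mem_filter] at hp
          have h1 : (1 : ℝ) ≤ p.1 := by
            exact_mod_cast Nat.pos_of_ne_zero (mem_primitiveCharacters.1 hp.1).1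
          exact (div_le_self (hτ p) (Real.one_le_sqrt.2 h1)).trans (small p hp.1 hp.2)
      _ ≤ ((primitiveCharacters ⌊ℓ ^ (2 * a)⌋₊).card : ℝ) * G := by
          rw [sum_const, nsmul_eq_mul]
          gcongr
          intro p hp
          rw [mem_filter, mem_primitiveCharacters] at hp
          rw [mem_primitiveCharacters]
          exact ⟨hp.1.1, Nat.le_floor hp.2, hp.1.2.2⟩
      _ ≤ (⌊ℓ ^ (2 * a)⌋₊ : ℝ) ^ 2 * G := by
          gcongr
          exact_mod_cast card_primitiveCharacters_le _
      _ ≤ (ℓ ^ (2 * a)) ^ 2 * G := by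
          gcongr
          exact Nat.floor_le (by positivity)
      _ = ℓ ^ (4 * a) * G := by rw [← pow_mul]; congr 2; ring
  · calc ∑ p ∈ (primitiveCharacters R).filter (fun p => ¬ (p.1 : ℝ) ≤ ℓ ^ (2 * a)),
          τ p / Real.sqrt p.1
        ≤ ∑ p ∈ (primitiveCharacters R).filter (fun p => ¬ (p.1 : ℝ) ≤ ℓ ^ (2 * a)),
          τ p / ℓ ^ a := by
          refine sum_le_sum fun p hp => ?_
          rw [mem_filter, not_le] at hp
          refine div_le_div_of_nonneg_left (hτ p) (by positivity) (Real.le_sqrt_of_sq_le ?_)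
          rw [← pow_mul, mul_comm]
          exact hp.2.le
      _ ≤ ∑ p ∈ primitiveCharacters R, τ p / ℓ ^ a :=
          sum_le_sum_of_subset_of_nonneg (filter_subset _ _)
            fun p _ _ => div_nonneg (hτ p) (by positivity)
      _ ≤ H / ℓ ^ a := by
          rw [← sum_div]
          gcongr

theorem exists_forall_inv_le_norm_LFunction_one_and_log_le {a : ℕ} (ha : 1 ≤ a) (m₀ : ℕ) :
    ∃ (q : ℝ) (m : ℕ), m₀ ≤ m ∧ 1 ≤ q ∧ q ≤ 1 + 2 * a * Real.log (2 * Real.log ((m ^ 50 : ℕ) : ℝ)) ∧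
      ∀ (r : ℕ) [NeZero r] (χ : DirichletCharacter ℂ r), χ.IsPrimitive → χ ≠ 1 →
        (r : ℝ) ≤ Real.log ((m ^ 50 : ℕ) : ℝ) ^ (2 * a) →
          1 + Real.log r ≤ q ∧ (χ ^ 2 = 1 → (q ^ 7)⁻¹ ≤ ‖χ.LFunction 1‖) := by
  have ha0 : (0 : ℝ) < a := by exact_mod_cast ha
  have hlin : Tendsto (fun q : ℝ => (q - 1) / (2 * a)) atTop atTop :=
    (tendsto_atTop_add_const_right _ (-1) tendsto_id).atTop_div_const (by positivity)
  have hL : Tendsto (fun q : ℝ => Real.exp ((q - 1) / (2 * a))) atTop atTop :=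
    Real.tendsto_exp_atTop.comp hlin
  have hm : Tendsto (fun q : ℝ => ⌊Real.exp (Real.exp ((q - 1) / (2 * a)) / 50)⌋₊) atTop atTop :=
    tendsto_nat_floor_atTop.comp
      (Real.tendsto_exp_atTop.comp (hL.atTop_div_const (by norm_num)))
  obtain ⟨q₀, hq₀⟩ := eventually_atTop.1
    ((hm.eventually_ge_atTop (m₀ + 1)).and (hL.eventually_ge_atTop 100))
  obtain ⟨q, hq, hq1, hex⟩ := exists_forall_inv_le_norm_LFunction_one q₀
  obtain ⟨hm1, hL1⟩ := hq₀ q hq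
  set L := Real.exp ((q - 1) / (2 * a)) with hLdef
  set m := ⌊Real.exp (L / 50)⌋₊ with hmdef
  have hm0 : (0 : ℝ) < m := by exact_mod_cast (show 0 < m by omega)
  have hℓ : Real.log ((m ^ 50 : ℕ) : ℝ) = 50 * Real.log m := by
    push_cast
    rw [Real.log_pow]
    norm_num
  have hup : Real.log ((m ^ 50 : ℕ) : ℝ) ≤ L := by
    have : Real.log m ≤ L / 50 := by
      rw [Real.log_le_iff_le_exp hm0]
      exact Nat.floor_le (by positivity)
    rw [hℓ]; linarith
  have hlow : L ≤ 2 * Real.log ((m ^ 50 : ℕ) : ℝ) := by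
    have h1 : Real.exp (L / 50) ≤ Real.exp 1 * m := by
      have h2 := Nat.lt_floor_add_one (Real.exp (L / 50))
      have h3 := Real.exp_one_gt_d9
      have h4 : (1 : ℝ) ≤ m := by exact_mod_cast (show 1 ≤ m by omega)
      rw [← hmdef] at h2
      nlinarith
    have h2 : L / 50 ≤ 1 + Real.log m := by
      rw [← Real.exp_le_exp, Real.exp_add, Real.exp_log hm0]; exact h1
    rw [hℓ]; linarith
  have hLpow : L ^ (2 * a) = Real.exp (q - 1) := by
    rw [hLdef, ← Real.exp_nat_mul]
    congr 1
    push_cast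
    field_simp
  refine ⟨q, m, by omega, hq1, ?_, fun r _ χ hχ hχ1 hr => ?_⟩
  · have h1 : (q - 1) / (2 * a) ≤ Real.log (2 * Real.log ((m ^ 50 : ℕ) : ℝ)) := by
      rw [Real.le_log_iff_exp_le (by linarith)]
      exact hlow
    rw [div_le_iff₀ (by positivity)] at h1
    linarith
  · have hr0 : (0 : ℝ) < r := by exact_mod_cast Nat.pos_of_ne_zero (NeZero.ne r)
    have h0 : 0 ≤ Real.log ((m ^ 50 : ℕ) : ℝ) := Real.log_natCast_nonneg _
    have h1 : Real.log r ≤ q - 1 := by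
      rw [Real.log_le_iff_le_exp hr0, ← hLpow]
      exact hr.trans (by gcongr)
    exact ⟨by linarith, fun h => hex r χ hχ hχ1 h (by linarith)⟩

theorem eventually_add_mul_log_pow_le (a : ℝ) (k : ℕ) :
    ∀ᶠ x : ℝ in atTop, (1 + a * Real.log (2 * x)) ^ k ≤ x := by
  have h1 : (fun x : ℝ => 1 + a * Real.log (2 * x)) =O[atTop] fun x => Real.log x := by
    have hc : (fun _ : ℝ => 1 + a * Real.log 2) =O[atTop] fun x => Real.log x :=
      ((Asymptotics.isLittleO_const_left).2 (Or.inr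
        (tendsto_norm_atTop_atTop.comp Real.tendsto_log_atTop))).isBigO
    refine (hc.add ((Asymptotics.isBigO_refl _ _).const_mul_left a)).congr' ?_ EventuallyEq.rfl
    filter_upwards [eventually_gt_atTop 0] with x hx
    rw [Real.log_mul two_ne_zero hx.ne']
    ring
  have h2 := (h1.pow k).trans_isLittleO (Real.isLittleO_pow_log_id_atTop (n := k))
  filter_upwards [h2.bound (c := 1) one_pos, eventually_ge_atTop 0] with x hx h0
  have := (le_abs_self _).trans hx
  rwa [one_mul, id, Real.norm_of_nonneg h0] at this

theorem eventually_log_pow_le_natCast (i : ℕ) :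
    ∀ᶠ m : ℕ in atTop, Real.log ((m ^ 50 : ℕ) : ℝ) ^ i ≤ m := by
  have h1 : (fun x : ℝ => (50 * Real.log x) ^ i) =o[atTop] fun x : ℝ => x := by
    simp only [mul_pow]
    exact (Real.isLittleO_pow_log_id_atTop (n := i)).const_mul_left _
  have h2 := (h1.comp_tendsto tendsto_natCast_atTop_atTop).bound (c := 1) one_pos
  filter_upwards [h2] with m hm
  have := (le_abs_self _).trans hm
  simp only [Function.comp, one_mul, Real.norm_natCast] at this
  push_cast
  rw [Real.log_pow]
  exact_mod_cast this

end ErrorTerms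

section WeightedEquidistribution

open Finset Filter Topology MeasureTheory

theorem total_error_le {B C₁ C₂ ℓ δ Z : ℝ} {D m W : ℕ} (hB : 0 ≤ B) (hC₁ : 0 ≤ C₁) (hC₂ : 0 ≤ C₂)
    (hℓ : 1 ≤ ℓ) (hδ : 0 < δ) (hm : 1 ≤ m) (hℓm : ℓ ^ (D + 2) ≤ m) (hZ : Z ≤ 8 * m ^ 25 * ℓ)
    (hbig : B * 2 ^ D * (C₁ + C₂ + 8 * W ^ 2) / δ ≤ ℓ) :
    B * (1 + ℓ) ^ D * (m ^ 50 * ℓ⁻¹ ^ (5 * D + 26) * (ℓ ^ (4 * (D + 6)) * (C₂ * ℓ) +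
      C₁ * ℓ ^ (5 * D + 26 + 5) / ℓ ^ (D + 6)) + (W * m) ^ 2 * Z) ≤ δ * m ^ 50 := by
  have hℓ0 : 0 < ℓ := by linarith
  have hm' : (1 : ℝ) ≤ m := by exact_mod_cast hm
  have e1 : ℓ⁻¹ ^ (5 * D + 26) * (ℓ ^ (4 * (D + 6)) * (C₂ * ℓ)) = C₂ / ℓ ^ (D + 1) := by
    have : ℓ ^ (5 * D + 26) = ℓ ^ (4 * (D + 6)) * ℓ * ℓ ^ (D + 1) := by
      rw [← pow_succ, ← pow_add]; congr 1; ring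
    rw [inv_pow, this]
    field_simp
  have e2 : ℓ⁻¹ ^ (5 * D + 26) * (C₁ * ℓ ^ (5 * D + 26 + 5) / ℓ ^ (D + 6)) =
      C₁ / ℓ ^ (D + 1) := by
    have h1 : ℓ ^ (5 * D + 26 + 5) = ℓ ^ (5 * D + 26) * ℓ ^ 5 := pow_add _ _ _
    have h2 : ℓ ^ (D + 6) = ℓ ^ (D + 1) * ℓ ^ 5 := by rw [← pow_add]
    rw [inv_pow, h1, h2]
    field_simp
  have e3 : ((W : ℝ) * m) ^ 2 * Z ≤ m ^ 50 * (8 * W ^ 2 / ℓ ^ (D + 1)) := by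
    rw [← mul_div_assoc, le_div_iff₀ (by positivity)]
    calc ((W : ℝ) * m) ^ 2 * Z * ℓ ^ (D + 1)
        ≤ (W * m) ^ 2 * (8 * m ^ 25 * ℓ) * ℓ ^ (D + 1) := by gcongr
      _ = 8 * W ^ 2 * m ^ 27 * ℓ ^ (D + 2) := by ring
      _ ≤ 8 * W ^ 2 * m ^ 27 * m := by gcongr
      _ = 8 * W ^ 2 * (m : ℝ) ^ 28 := by ring
      _ ≤ 8 * W ^ 2 * (m : ℝ) ^ 50 := by gcongr; norm_num
      _ = _ := by ring
  rw [mul_assoc ((m : ℝ) ^ 50), mul_add (ℓ⁻¹ ^ (5 * D + 26)), e1, e2]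
  calc B * (1 + ℓ) ^ D * ((m : ℝ) ^ 50 * (C₂ / ℓ ^ (D + 1) + C₁ / ℓ ^ (D + 1)) + (W * m) ^ 2 * Z)
      ≤ B * (2 * ℓ) ^ D * ((m : ℝ) ^ 50 * (C₂ / ℓ ^ (D + 1) + C₁ / ℓ ^ (D + 1)) +
          m ^ 50 * (8 * W ^ 2 / ℓ ^ (D + 1))) := by
        have h1 : 1 + ℓ ≤ 2 * ℓ := by linarith
        have h2 : (m : ℝ) ^ 50 * (C₂ / ℓ ^ (D + 1) + C₁ / ℓ ^ (D + 1)) + (W * m) ^ 2 * Z ≤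
          (m : ℝ) ^ 50 * (C₂ / ℓ ^ (D + 1) + C₁ / ℓ ^ (D + 1)) +
          m ^ 50 * (8 * W ^ 2 / ℓ ^ (D + 1)) := by linarith
        refine (mul_le_mul_of_nonneg_left h2 (by positivity)).trans ?_
        gcongr
    _ = B * 2 ^ D * (C₁ + C₂ + 8 * W ^ 2) / ℓ * m ^ 50 := by
        rw [mul_pow, pow_succ]
        field_simp
        ring
    _ ≤ δ * m ^ 50 := by
        gcongr
        rw [div_le_iff₀ hℓ0]
        rw [div_le_iff₀ hδ] at hbig
        linarith

theorem sqrt_mul_log_three_mul_pow_le {m : ℕ} (hm : 1 ≤ m)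
    (hℓ : 2 ≤ Real.log ((m ^ 50 : ℕ) : ℝ)) :
    2 * Real.sqrt (3 * ((m ^ 50 : ℕ) : ℝ)) * Real.log (3 * ((m ^ 50 : ℕ) : ℝ)) ≤
      8 * m ^ 25 * Real.log ((m ^ 50 : ℕ) : ℝ) := by
  have hm' : (1 : ℝ) ≤ m := by exact_mod_cast hm
  have h1 : Real.sqrt (3 * ((m ^ 50 : ℕ) : ℝ)) ≤ 2 * m ^ 25 := by
    rw [Real.sqrt_le_left (by positivity)]
    push_cast
    nlinarith [pow_pos (show (0 : ℝ) < m by linarith) 50]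
  have h2 : Real.log (3 * ((m ^ 50 : ℕ) : ℝ)) ≤ 2 * Real.log ((m ^ 50 : ℕ) : ℝ) := by
    have h3 : Real.log 3 ≤ 2 := by
      rw [Real.log_le_iff_le_exp (by norm_num)]
      linarith [Real.add_one_le_exp (2 : ℝ)]
    rw [Real.log_mul (by norm_num) (by positivity)]
    linarith
  calc _ ≤ 2 * (2 * (m : ℝ) ^ 25) * (2 * Real.log ((m ^ 50 : ℕ) : ℝ)) := by
        gcongr
        exact Real.log_nonneg (by norm_cast; nlinarith [Nat.one_le_pow 50 m hm])
    _ = _ := by ring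

/-- For every modulus `W` there are arbitrarily large scales at which the smooth weights on primes
are well distributed on weighted average over moduli. -/
theorem exists_primeWeightsFor {W : ℕ} (hW : 0 < W) {κ : ℝ} (hκ : 0 ≤ κ) {δ : ℝ} (hδ : 0 < δ)
    (N₀ : ℕ) :
    ∃ N, N₀ ≤ N ∧ ∃ w T E, PrimeWeightsFor (Real.exp (-4) / 20) W κ δ N w T E := by
  set D := ⌈2 * κ⌉₊ + 1 with hD
  have hκD : 2 * κ ≤ D := (Nat.le_ceil _).trans (by rw [hD]; exact_mod_cast Nat.le_succ _)
  set j := 5 * D + 26 with hj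
  obtain ⟨A, hK⟩ := exists_isCutoff_logBump
  obtain ⟨C₁, hC₁, hlarge⟩ := exists_forall_sum_norm_tsum_logMul_twist_vonMangoldt_le hK
    contDiff_ofReal_logBump hasCompactSupport_ofReal_logBump j
  obtain ⟨C₂, hC₂, k, hsmall⟩ := exists_forall_norm_tsum_logMul_twist_vonMangoldt_le
    contDiff_ofReal_logBump hasCompactSupport_ofReal_logBump j
  obtain ⟨N₁, hmass⟩ := exists_forall_mul_le_sum_primeWeight j
  set B : ℝ := (D : ℝ) ^ D ^ 2 * Real.sqrt W with hB
  have htl : Tendsto (fun m : ℕ => Real.log ((m ^ 50 : ℕ) : ℝ)) atTop atTop :=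
    Real.tendsto_log_atTop.comp (tendsto_natCast_atTop_atTop.comp (tendsto_pow_atTop (by norm_num)))
  obtain ⟨m₀, hm₀⟩ := eventually_atTop.1 <|
    (eventually_ge_atTop (max (max N₀ N₁) (max W 2))).and <|
    (htl.eventually_ge_atTop (max (max 2 j) (B * 2 ^ D * (C₁ + C₂ + 8 * W ^ 2) / δ))).and <|
    (eventually_log_pow_le_natCast (D + 2)).and <|
    htl.eventually (eventually_add_mul_log_pow_le (2 * (D + 6 : ℕ)) k)
  obtain ⟨q, m, hm, hq1, hq, hSW⟩ :=
    exists_forall_inv_le_norm_LFunction_one_and_log_le (a := D + 6) (by omega) m₀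
  obtain ⟨hmm, hℓℓ, hℓm, hqk⟩ := hm₀ m hm
  simp only [max_le_iff] at hmm hℓℓ
  obtain ⟨⟨hmN₀, hmN₁⟩, hmW, hm2⟩ := hmm
  obtain ⟨⟨hℓ2, hℓj⟩, hbig⟩ := hℓℓ
  set N := m ^ 50 with hN
  set ℓ := Real.log (N : ℝ) with hℓ
  have hmN : m ≤ N := Nat.le_self_pow (by norm_num) m
  have hN0 : 0 < N := by omega
  have hqℓ : q ^ k ≤ ℓ := (pow_le_pow_left₀ (by linarith) hq k).trans hqk
  set w := primeWeight j N with hw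
  set S := primitiveCharacters (W * m) with hS
  set F : (Σ n, DirichletCharacter ℂ n) → ℝ :=
    fun p => ‖∑ l ∈ range (3 * N + 1), p.2 l * (w l : ℂ)‖ with hF
  set τ : (Σ n, DirichletCharacter ℂ n) → ℝ := fun p =>
    ‖∑' n : ℕ, LSeries.term (LSeries.logMul^[j] fun n => p.2 n *
      (ArithmeticFunction.vonMangoldt n : ℂ)) (1 + 1 / ℓ : ℝ) n *
        (logBump (Real.log n - ℓ) : ℂ)‖ with hτ
  set Z : ℝ := 2 * Real.sqrt (3 * N) * Real.log (3 * N) with hZ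
  have hZ0 : 0 ≤ Z := by
    have : 0 ≤ Real.log (3 * N) := by
      exact_mod_cast Real.log_natCast_nonneg (3 * N)
    positivity
  have hFτ : ∀ p, F p ≤ N * ℓ⁻¹ ^ j * τ p + Z := fun p =>
    norm_sum_mul_primeWeight_le hℓ2 hℓj fun n => p.2.norm_le_one _
  have hτsmall : ∀ p ∈ S, (p.1 : ℝ) ≤ ℓ ^ (2 * (D + 6)) → τ p ≤ C₂ * ℓ := by
    rintro ⟨r, χ⟩ hp hr
    obtain ⟨h0, -, hprim, h1⟩ := mem_primitiveCharacters.1 hp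
    have : NeZero r := ⟨h0⟩
    obtain ⟨h2, h3⟩ := hSW r χ hprim h1 hr
    exact (hsmall q hq1 r χ h1 h2 h3 ℓ (by linarith)).trans (by gcongr)
  have hτlarge : ∑ p ∈ S, τ p ≤ C₁ * ℓ ^ (j + 5) := by
    refine hlarge S (W * m) ((W * m) ^ 4) (fun p hp => mem_primitiveCharacters.1 hp) ?_ ℓ hℓ2
      (Nat.one_le_pow _ _ (Nat.mul_pos hW (by omega))) ?_
    · calc S.card * (W * m) ^ 2 ≤ (W * m) ^ 2 * (W * m) ^ 2 :=
            Nat.mul_le_mul_right _ (card_primitiveCharacters_le _)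
        _ = (W * m) ^ 4 := by ring
    · rw [hℓ, Real.exp_log (by exact_mod_cast hN0)]
      have : ((W * m) ^ 4) ^ 4 ≤ N := by
        calc ((W * m) ^ 4) ^ 4 ≤ ((m * m) ^ 4) ^ 4 := by gcongr
          _ = m ^ 32 := by ring
          _ ≤ m ^ 50 := Nat.pow_le_pow_right (by omega) (by norm_num)
      exact_mod_cast this
  have hFsum : ∑ p ∈ S, F p / Real.sqrt p.1 ≤
      N * ℓ⁻¹ ^ j * (ℓ ^ (4 * (D + 6)) * (C₂ * ℓ) + C₁ * ℓ ^ (j + 5) / ℓ ^ (D + 6)) +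
        (W * m) ^ 2 * Z := by
    calc ∑ p ∈ S, F p / Real.sqrt p.1
        ≤ ∑ p ∈ S, (N * ℓ⁻¹ ^ j * (τ p / Real.sqrt p.1) + Z) := by
          refine sum_le_sum fun p hp => ?_
          have h1 : (1 : ℝ) ≤ p.1 := by
            exact_mod_cast Nat.pos_of_ne_zero (mem_primitiveCharacters.1 hp).1
          have h2 : 1 ≤ Real.sqrt p.1 := Real.one_le_sqrt.2 h1
          calc F p / Real.sqrt p.1 ≤ (N * ℓ⁻¹ ^ j * τ p + Z) / Real.sqrt p.1 := by
                gcongr; exact hFτ p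
            _ = N * ℓ⁻¹ ^ j * (τ p / Real.sqrt p.1) + Z / Real.sqrt p.1 := by ring
            _ ≤ _ := by gcongr; exact div_le_self hZ0 h2
      _ = N * ℓ⁻¹ ^ j * (∑ p ∈ S, τ p / Real.sqrt p.1) + S.card * Z := by
          rw [sum_add_distrib, mul_sum, sum_const, nsmul_eq_mul]
      _ ≤ _ := by
          gcongr
          · exact sum_primitiveCharacters_div_sqrt_le (by linarith) (fun p => norm_nonneg _)
              (by positivity) hτsmall hτlarge
          · exact_mod_cast card_primitiveCharacters_le (W * m)
  have hle : ∀ {q' : ℕ}, q' ^ 50 ≤ N → q' ≤ m := fun h =>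
    (Nat.pow_le_pow_iff_left (by norm_num)).1 h
  refine ⟨N, hmN₀.trans hmN, w, ∑ l ∈ range (3 * N + 1), w l,
    fun q => (∑ p ∈ S.filter (fun p => p.1 ∣ q * W), F p) / (q * W).totient, ?_⟩
  refine
    { nonneg := primeWeight_nonneg j N
      le_log := primeWeight_le_log hℓ2 hℓj
      prime := fun l hl => prime_of_primeWeight_ne_zero hl
      le_three_mul := fun l hl => le_three_mul_of_primeWeight_ne_zero' hN0 hl
      le := fun l hl => le_three_mul_of_primeWeight_ne_zero hN0 hl
      mass := hmass N (hmN₁.trans hmN)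
      error_nonneg := fun q => div_nonneg (sum_nonneg fun p _ => norm_nonneg _) (by positivity)
      error := ?_
      sum_error := ?_ }
  · intro q' hq' _ hq50 a ha
    have hqm := hle hq50
    have hq0 : 0 < q' := Nat.pos_of_ne_zero hq'.ne_zero
    have : NeZero (q' * W) := ⟨(Nat.mul_pos hq0 hW).ne'⟩
    refine abs_sum_residue_sub_le (by rw [mul_comm]; exact Nat.mul_le_mul_left W hqm)
      (fun l hl => ?_) ha
    have hp := prime_of_primeWeight_ne_zero hl
    have hl3 := le_three_mul_of_primeWeight_ne_zero' hN0 hl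
    rw [Nat.coprime_comm]
    refine Nat.Coprime.symm ((hp.coprime_iff_not_dvd).2 fun hdvd => ?_)
    have h1 : l ≤ m * m := (Nat.le_of_dvd (Nat.mul_pos hq0 hW) hdvd).trans
      (Nat.mul_le_mul hqm hmW)
    have h2 : 4 * (m * m) ≤ N := by
      calc 4 * (m * m) = 2 ^ 2 * m ^ 2 := by ring
        _ ≤ m ^ 2 * m ^ 2 := by gcongr
        _ = m ^ 4 := by ring
        _ ≤ m ^ 50 := Nat.pow_le_pow_right (by omega) (by norm_num)
    have h3 : 0 < m * m := Nat.mul_pos (by omega) (by omega)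
    omega
  · refine (sum_mul_sum_filter_dvd_div_totient_le hκ (D := D) (by omega) hκD hW (N := N)
      (fun q' hq' => ?_) (fun p hp => (mem_primitiveCharacters.1 hp).1)
      (fun p => norm_nonneg _)).trans ?_
    · rw [mem_filter] at hq'
      exact ⟨hq'.1, hq'.2.1⟩
    · have hNm : (N : ℝ) = m ^ 50 := by rw [hN]; push_cast; rfl
      have hB0 : 0 ≤ B := by positivity
      have hfin := total_error_le (Z := Z) hB0 hC₁ hC₂ (show 1 ≤ ℓ by linarith) hδ
        (show 1 ≤ m by omega) hℓm (sqrt_mul_log_three_mul_pow_le (by omega) hℓ2) hbig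
      rw [← hNm] at hfin
      refine le_trans ?_ hfin
      exact mul_le_mul_of_nonneg_left hFsum (by positivity)

end WeightedEquidistribution

section Gaps

theorem exists_even_maillet_of_prime_pair (hP : ∃ k : ℕ, ∀ h : Fin k → ℕ, Function.Injective h →
      (∀ i, k.factorial ∣ h i) → ∃ n i j, i ≠ j ∧ (n + h i).Prime ∧ (n + h j).Prime)
    (ε : ℝ) (hε : 0 < ε) :
    ∃ x₀ : ℝ, ∀ x : ℝ, x₀ < x → ∃ m : ℕ, x ≤ (m : ℝ) ∧ (m : ℝ) ≤ x + x ^ ε ∧ Even m ∧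
      IsMaillet m := by
  obtain ⟨k, hk⟩ := hP
  by_contra hcon
  push Not at hcon
  have hstep : ∀ s : Finset ℕ, (∀ a ∈ s, 2 * k.factorial ∣ a) → ∃ b, 2 * k.factorial ∣ b ∧
      ∀ a ∈ s, a < b ∧ ¬IsMaillet (b - a) := by
    intro s hs
    set B := s.sup id with hB
    have hlim := (tendsto_rpow_atTop hε).eventually_ge_atTop ((B : ℝ) + 2 * k.factorial)
    obtain ⟨x₁, hx₁⟩ := Filter.eventually_atTop.1 hlim
    obtain ⟨x, hx, hgap⟩ := hcon (max x₁ 0)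
    have hx0 : 0 < x := (le_max_right _ _).trans_lt hx
    have hxp := hx₁ x ((le_max_left _ _).trans hx.le)
    have hM : 0 < 2 * k.factorial := by positivity
    refine ⟨2 * k.factorial * ⌈(x + B) / (2 * k.factorial : ℕ)⌉₊, dvd_mul_right _ _, fun a ha => ?_⟩
    have haB : a ≤ B := Finset.le_sup (f := id) ha
    have haB' : (a : ℝ) ≤ B := by exact_mod_cast haB
    set t := ⌈(x + B) / (2 * k.factorial : ℕ)⌉₊
    have hMr : (0 : ℝ) < (2 * k.factorial : ℕ) := by exact_mod_cast hM
    have h1 : x + B ≤ ((2 * k.factorial * t : ℕ) : ℝ) := by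
      have := Nat.le_ceil ((x + B) / (2 * k.factorial : ℕ))
      rw [div_le_iff₀ hMr] at this
      rw [Nat.cast_mul]; linarith
    have h2 : ((2 * k.factorial * t : ℕ) : ℝ) ≤ x + B + (2 * k.factorial : ℕ) := by
      have := (Nat.ceil_lt_add_one (a := (x + B) / (2 * k.factorial : ℕ)) (by positivity)).le
      have h3 := mul_le_mul_of_nonneg_left this hMr.le
      rw [mul_add, mul_div_cancel₀ _ hMr.ne', mul_one] at h3
      rw [Nat.cast_mul]; linarith
    have hlt : a < 2 * k.factorial * t := by
      have : (a : ℝ) < ((2 * k.factorial * t : ℕ) : ℝ) := by linarith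
      exact_mod_cast this
    refine ⟨hlt, hgap _ ?_ ?_ ?_⟩
    · rw [Nat.cast_sub hlt.le]; linarith
    · rw [Nat.cast_sub hlt.le]
      push_cast at h2 ⊢
      have : (0 : ℝ) ≤ a := Nat.cast_nonneg a
      linarith
    · refine (Nat.even_sub hlt.le).2 ⟨fun _ => ?_, fun _ => ?_⟩
      · exact even_iff_two_dvd.2 ((dvd_mul_right 2 _).trans (hs a ha))
      · exact even_iff_two_dvd.2 (by rw [mul_assoc]; exact dvd_mul_right 2 _)
  obtain ⟨f, hf, hr⟩ := exists_seq_of_forall_finset_exists (fun a => 2 * k.factorial ∣ a)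
    (fun a b => a < b ∧ ¬IsMaillet (b - a)) hstep
  have hpair : ∀ m n, m < n → ∀ t, (t + f m).Prime → (t + f n).Prime → False := by
    intro m n hmn t h1 h2
    obtain ⟨h3, h4⟩ := hr m n hmn
    refine h4 ⟨t + f n, t + f m, h2, h1, ?_⟩
    rw [Nat.cast_sub h3.le]; push_cast; ring
  have hmono : StrictMono f := fun m n hmn => (hr m n hmn).1
  obtain ⟨n, i, j, hij, hi, hj⟩ := hk (fun i => f i)
    (fun i j hij => Fin.ext (hmono.injective hij))
    (fun i => (dvd_mul_left _ 2).trans (hf i))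
  rcases lt_or_gt_of_ne (fun h => hij (Fin.ext h) : (i : ℕ) ≠ j) with h | h
  · exact hpair _ _ h n hi hj
  · exact hpair _ _ h n hj hi

end Gaps

/-- For every `ε > 0` and all sufficiently large `x`, the interval `[x, x + x^ε]`
contains an even number which is a difference of two primes. -/
theorem interval_contains_even_maillet (ε : ℝ) (hε : 0 < ε) :
    ∃ x₀ : ℝ, ∀ x : ℝ, x₀ < x →
      ∃ m : ℕ, x ≤ (m : ℝ) ∧ (m : ℝ) ≤ x + x ^ ε ∧ Even m ∧ IsMaillet m := by
  exact exists_even_maillet_of_prime_pair (exists_prime_pair_of_weights (by positivity)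
    fun _ hW _ hκ _ hδ N₀ => exists_primeWeightsFor hW hκ hδ N₀) ε hε
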